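/- Let p > 5 be a prime with p ≡ 3 (mod 4), F = ℚ(√p), and H the totally definite quaternion F-algebra unramified at all finite places of F. Then t(H, C₄) = (3 − (2/p))·h(−p)/2 − 1, where (2/p) is the Legendre symbol and h(−p) is the class number of the imaginary quadratic field ℚ(√−p). -/

import Mathlib

open NumberField Quaternion

noncomputable section

namespace QuatPaper

variable (F : Type) [Field F] [NumberField F]

def scalarSet (H : Type) [Ring H] [Algebra F H] : Set H :=
  Set.range fun r : 𝓞 F => algebraMap F H (algebraMap (𝓞 F) F r)

def IsOrder {H : Type} [Ring H] [Algebra F H] (O : Subring H) : Prop :=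
  scalarSet F H ⊆ ↑O ∧ O.toAddSubgroup.FG ∧ Submodule.span F (O : Set H) = ⊤

def IsMaximalOrder {H : Type} [Ring H] [Algebra F H] (O : Subring H) : Prop :=
  IsOrder F O ∧ ∀ O' : Subring H, IsOrder F O' → O ≤ O' → O' = O

def IsScalarUnit {H : Type} [Ring H] [Algebra F H] {O : Subring H} (u : (↥O)ˣ) : Prop :=
  ∃ r : (𝓞 F)ˣ, ((u : ↥O) : H) = algebraMap F H (algebraMap (𝓞 F) F ↑r)

def RedUnitIso {H : Type} [Ring H] [Algebra F H] (O : Subring H) (G : Type*) [Group G] : Prop :=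
  ∃ φ : (↥O)ˣ →* G, Function.Surjective φ ∧ ∀ u, φ u = 1 ↔ IsScalarUnit F u

def IsConjugate {H : Type} [Ring H] (x : Hˣ) (O O' : Subring H) : Prop :=
  ∀ y : H, y ∈ O ↔ (x : H) * y * ((x⁻¹ : Hˣ) : H) ∈ O'

def ConjRel {H : Type} [Ring H] (O O' : Subring H) : Prop :=
  ∃ x : Hˣ, IsConjugate x O O'

def typeNum (H : Type) [Ring H] [Algebra F H] (G : Type*) [Group G] : ℕ :=
  Nat.card (Quot fun O O' : {O : Subring H // IsMaximalOrder F O ∧ RedUnitIso F O G} =>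
    ConjRel O.1 O'.1)

def IsQuatAlg (H : Type) [Ring H] [Algebra F H] : Prop :=
  ∃ a b : F, a ≠ 0 ∧ b ≠ 0 ∧ Nonempty (H ≃ₐ[F] ℍ[F, a, b])

def TotallyDefinite (H : Type) [Ring H] [Algebra F H] : Prop :=
  ∀ σ : F →+* ℝ,
    letI : Algebra F ℝ := σ.toAlgebra
    ∀ x : TensorProduct F ℝ H, x ≠ 0 → IsUnit x

end QuatPaper

namespace QuatPaper

/-- The value of the quadratic form with Gram matrix `G`. -/
def gramVal {R ι : Type*} [CommRing R] [Fintype ι] (G : Matrix ι ι R) (x : ι → R) : R :=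
  ∑ i, ∑ j, x i * G i j * x j

def Anisotropic {ι : Type*} [Fintype ι] (G : Matrix ι ι ℚ) : Prop :=
  ∀ x : ι → ℚ, x ≠ 0 → gramVal G x ≠ 0

lemma gramVal_eq {R ι : Type*} [CommRing R] [Fintype ι] (G : Matrix ι ι R) (x : ι → R) :
    gramVal G x = dotProduct x (G.mulVec x) := by
  simp [gramVal, dotProduct, Matrix.mulVec, Finset.mul_sum, mul_assoc]

lemma gramVal_congr {R ι κ : Type*} [CommRing R] [Fintype ι] [Fintype κ] (G : Matrix ι ι R)
    (h : Matrix ι κ R) (x : κ → R) :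
    gramVal (h.transpose * G * h) x = gramVal G (h.mulVec x) := by
  rw [gramVal_eq, gramVal_eq, ← Matrix.mulVec_mulVec, ← Matrix.mulVec_mulVec,
    Matrix.dotProduct_mulVec, Matrix.vecMul_transpose]

lemma congr_diag_entry {R ι : Type*} [CommRing R] [Fintype ι] [DecidableEq ι]
    (G h : Matrix ι ι R) (i : ι) :
    (h.transpose * G * h) i i = gramVal G (fun j => h j i) := by
  simp only [gramVal, Matrix.mul_apply, Matrix.transpose_apply, Finset.sum_mul]
  exact Finset.sum_comm

lemma gramVal_reindex {R ι κ : Type*} [CommRing R] [Fintype ι] [Fintype κ] (e : κ ≃ ι)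
    (G : Matrix ι ι R) (x : ι → R) :
    gramVal (G.submatrix e e) (x ∘ e) = gramVal G x := by
  simp only [gramVal, Matrix.submatrix_apply, Function.comp]
  rw [Fintype.sum_equiv e _ (fun i => ∑ j, x i * G i j * x j)]
  intro i
  exact Fintype.sum_equiv e _ (fun j => x (e i) * G (e i) j * x j) (fun j => rfl)

/-- The Schur complement of the corner entry. -/
def schur {κ : Type*} (G : Matrix (Unit ⊕ κ) (Unit ⊕ κ) ℚ) : Matrix κ κ ℚ :=
  fun i j => G (.inr i) (.inr j) - G (.inr i) (.inl ()) * G (.inl ()) (.inr j) / G (.inl ()) (.inl ())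

lemma det_schur {κ : Type*} [Fintype κ] [DecidableEq κ] (G : Matrix (Unit ⊕ κ) (Unit ⊕ κ) ℚ)
    (h0 : G (.inl ()) (.inl ()) ≠ 0) :
    G.det = G (.inl ()) (.inl ()) * (schur G).det := by
  have hA : Invertible G.toBlocks₁₁ := by
    apply Matrix.invertibleOfIsUnitDet
    simpa [Matrix.det_unique, Matrix.toBlocks₁₁] using h0
  conv_lhs => rw [← Matrix.fromBlocks_toBlocks G, Matrix.det_fromBlocks₁₁]
  rw [Matrix.det_unique]
  congr 2
  ext i j
  simp [schur, Matrix.mul_apply, Matrix.toBlocks₁₂, Matrix.toBlocks₂₁, Matrix.toBlocks₂₂]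
  change G (.inr i) (.inl ()) * (G (.inl ()) (.inl ()))⁻¹ * G (.inl ()) (.inr j) = _
  ring

lemma gramVal_schur {κ : Type*} [Fintype κ] (G : Matrix (Unit ⊕ κ) (Unit ⊕ κ) ℚ)
    (hG : G.IsSymm) (h0 : G (.inl ()) (.inl ()) ≠ 0) (k : ℚ) (w : κ → ℚ) :
    gramVal G (Sum.elim (fun _ => k) w) =
      G (.inl ()) (.inl ()) * (k + (∑ j, G (.inl ()) (.inr j) * w j) / G (.inl ()) (.inl ())) ^ 2
        + gramVal (schur G) w := by
  set g := G (.inl ()) (.inl ())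
  set s := ∑ j, G (.inl ()) (.inr j) * w j with hs
  have h1 : gramVal (schur G) w =
      (∑ i, ∑ j, w i * G (.inr i) (.inr j) * w j) - s * s / g := by
    simp only [gramVal, schur]
    rw [hs, Finset.sum_mul_sum, Finset.sum_div, ← Finset.sum_sub_distrib]
    refine Finset.sum_congr rfl fun i _ => ?_
    rw [Finset.sum_div, ← Finset.sum_sub_distrib]
    refine Finset.sum_congr rfl fun j _ => ?_
    rw [hG.apply (.inl ()) (.inr i)]
    ring
  have h2 : gramVal G (Sum.elim (fun _ => k) w) = k * g * k + 2 * k * s +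
      ∑ i, ∑ j, w i * G (.inr i) (.inr j) * w j := by
    simp only [gramVal, Fintype.sum_sum_type, Finset.univ_unique, Finset.sum_singleton,
      Sum.elim_inl, Sum.elim_inr, Finset.sum_add_distrib]
    have e1 : ∑ x, k * G (.inl ()) (.inr x) * w x = k * s := by
      rw [hs, Finset.mul_sum]; exact Finset.sum_congr rfl fun _ _ => by ring
    have e2 : ∑ x, w x * G (.inr x) (.inl ()) * k = k * s := by
      rw [hs, Finset.mul_sum]
      exact Finset.sum_congr rfl fun x _ => by rw [hG.apply (.inl ()) (.inr x)]; ring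
    change k * g * k + ∑ x, w x * G (.inr x) (.inl ()) * k + (∑ x, k * G (.inl ()) (.inr x) * w x + _) = _
    rw [e1, e2]; ring
  rw [h1, h2]; field_simp; ring

lemma schur_isSymm {κ : Type*} (G : Matrix (Unit ⊕ κ) (Unit ⊕ κ) ℚ) (hG : G.IsSymm) :
    (schur G).IsSymm := by
  ext i j
  simp only [Matrix.transpose_apply, schur]
  rw [hG.apply (.inr i) (.inr j), hG.apply (.inl ()) (.inr j), ← hG.apply (.inl ()) (.inr i)]
  ring

lemma schur_anisotropic {κ : Type*} [Fintype κ] (G : Matrix (Unit ⊕ κ) (Unit ⊕ κ) ℚ)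
    (hG : G.IsSymm) (h0 : G (.inl ()) (.inl ()) ≠ 0) (ha : Anisotropic G) :
    Anisotropic (schur G) := by
  intro w hw h
  have := gramVal_schur G hG h0 (-(∑ j, G (.inl ()) (.inr j) * w j) / G (.inl ()) (.inl ())) w
  refine ha _ ?_ (this.trans ?_)
  · intro h'
    apply hw
    funext i
    exact congrFun h' (.inr i)
  · rw [h]; ring

lemma Anisotropic.corner_ne_zero {ι : Type*} [Fintype ι] [DecidableEq ι] {G : Matrix ι ι ℚ}
    (ha : Anisotropic G) (i : ι) : G i i ≠ 0 := by
  have := ha (Pi.single i 1) (by simp)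
  simpa [gramVal, Pi.single_apply, Finset.sum_ite_eq] using this

/-- Integral congruence of Gram matrices. -/
def intMat {ι : Type*} (h : Matrix ι ι ℤ) : Matrix ι ι ℚ := h.map (Int.castRingHom ℚ)

lemma intMat_apply {ι : Type*} (h : Matrix ι ι ℤ) (i j : ι) : intMat h i j = (h i j : ℚ) := rfl

lemma det_intMat {ι : Type*} [Fintype ι] [DecidableEq ι] (h : Matrix ι ι ℤ) :
    (intMat h).det = (h.det : ℚ) := by
  exact ((Int.castRingHom ℚ).map_det h).symm

def HermiteBound {ι : Type*} [Fintype ι] [DecidableEq ι] (i0 : ι) (n m : ℕ) : Prop :=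
  ∀ G : Matrix ι ι ℚ, G.IsSymm → Anisotropic G → ∃ h : Matrix ι ι ℤ, IsUnit h.det ∧
    |gramVal G fun j => (h j i0 : ℚ)| ^ n * (3 / 4) ^ m ≤ |G.det| ∧
    (0 < G.det * (gramVal G fun j => (h j i0 : ℚ)) ^ n ∨
      |gramVal G fun j => (h j i0 : ℚ)| ^ n * (3 / 4) ^ m ≤ 3 / 4 * |G.det|)

lemma HermiteBound.reindex {ι κ : Type*} [Fintype ι] [DecidableEq ι] [Fintype κ] [DecidableEq κ]
    (e : ι ≃ κ) {i0 : ι} {n m : ℕ} (H : HermiteBound i0 n m) : HermiteBound (e i0) n m := by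
  intro G hG ha
  obtain ⟨h, hu, h1⟩ := H (G.submatrix e e) (hG.submatrix e) (by
    intro x hx
    have := gramVal_reindex e G (x ∘ e.symm)
    rw [show (x ∘ e.symm) ∘ e = x by ext; simp] at this
    rw [this]
    apply ha
    intro h; apply hx; ext i
    simpa using congrFun h (e i))
  refine ⟨h.submatrix e.symm e.symm, by rwa [Matrix.det_submatrix_equiv_self], ?_⟩
  have : gramVal G (fun j => (((h.submatrix e.symm e.symm) j (e i0) : ℤ) : ℚ)) =
      gramVal (G.submatrix e e) fun j => (h j i0 : ℚ) := by
    rw [← gramVal_reindex e]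
    congr 1
    ext i; simp
  rw [this]
  rwa [Matrix.det_submatrix_equiv_self] at h1

lemma exists_min {ι : Type*} [Fintype ι] [DecidableEq ι] (i0 : ι) (G : Matrix ι ι ℚ) :
    ∃ h : Matrix ι ι ℤ, IsUnit h.det ∧ ∀ h' : Matrix ι ι ℤ, IsUnit h'.det →
      |gramVal G fun j => (h j i0 : ℚ)| ≤ |gramVal G fun j => (h' j i0 : ℚ)| := by
  obtain ⟨N, hN⟩ := IsLocalization.exist_integer_multiples (nonZeroDivisors ℤ)
    (Finset.univ : Finset (ι × ι)) (fun ij => G ij.1 ij.2)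
  have hN0 : (N : ℤ) ≠ 0 := nonZeroDivisors.coe_ne_zero N
  have hint : ∀ h : Matrix ι ι ℤ, ∃ z : ℤ, (N : ℤ) * (gramVal G fun j => (h j i0 : ℚ)) = z := by
    intro h
    have hc : ∀ i j, ∃ z : ℤ, (N : ℤ) * G i j = (z : ℚ) := by
      intro i j
      obtain ⟨z, hz⟩ := hN (i, j) (Finset.mem_univ _)
      exact ⟨z, by rw [← eq_intCast (algebraMap ℤ ℚ) z, hz]; simp [Algebra.smul_def]⟩
    choose c hc using hc
    refine ⟨∑ i, ∑ j, h i i0 * c i j * h j i0, ?_⟩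
    push_cast
    simp only [gramVal, Finset.mul_sum, ← hc]
    refine Finset.sum_congr rfl fun i _ => Finset.sum_congr rfl fun j _ => by ring
  choose f hf using hint
  let S : Set (Matrix ι ι ℤ) := {h | IsUnit h.det}
  have hS : S.Nonempty := ⟨1, by simp [S]⟩
  refine ⟨Function.argminOn (fun h => (f h).natAbs) S hS, Function.argminOn_mem _ S hS, ?_⟩
  intro h' hh'
  have := Function.argminOn_le (fun h => (f h).natAbs) S (a := h') hh'
  have h3 : ((f (Function.argminOn (fun h => (f h).natAbs) S hS)).natAbs : ℚ) ≤ (f h').natAbs := by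
    exact_mod_cast this
  rw [Nat.cast_natAbs, Nat.cast_natAbs, Int.cast_abs, Int.cast_abs, ← hf, ← hf, abs_mul, abs_mul] at h3
  have : 0 < |(((N : ℤ)) : ℚ)| := abs_pos.mpr (by exact_mod_cast hN0)
  exact le_of_mul_le_mul_left h3 this

lemma hermite_sign {g d : ℚ} {t : ℚ} (hg : g ≠ 0) (ht : |t| ≤ 1 / 2) (h : |g| ≤ |g * t ^ 2 + d|) :
    3 / 4 * |g| ≤ |d| ∧ (g * d < 0 → |g| ≤ |d|) := by
  have ht2 : t ^ 2 ≤ 1 / 4 := by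
    rw [← sq_abs]; nlinarith [abs_nonneg t]
  have h0 := sq_nonneg t
  constructor
  · have h1 : |g * t ^ 2 + d| ≤ |g| * t ^ 2 + |d| := by
      refine (abs_add_le _ _).trans ?_
      rw [abs_mul, abs_of_nonneg h0]
    nlinarith [abs_nonneg g]
  · intro hgd
    rcases lt_or_gt_of_ne hg with h1 | h1
    · have hd : 0 < d := by nlinarith
      rw [abs_of_neg h1, abs_of_pos hd]
      rw [abs_of_neg h1] at h
      rcases abs_cases (g * t ^ 2 + d) with h2 | h2 <;> nlinarith
    · have hd : d < 0 := by nlinarith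
      rw [abs_of_pos h1, abs_of_neg hd]
      rw [abs_of_pos h1] at h
      rcases abs_cases (g * t ^ 2 + d) with h2 | h2 <;> nlinarith

lemma hermite_arith {n m : ℕ} (hn : 1 ≤ n) {g d D : ℚ} (hg : g ≠ 0) (hd : d ≠ 0)
    (h1 : 3 / 4 * |g| ≤ |d|) (h2 : g * d < 0 → |g| ≤ |d|)
    (h3 : |d| ^ n * (3 / 4) ^ m ≤ |D|)
    (h4 : 0 < D * d ^ n ∨ |d| ^ n * (3 / 4) ^ m ≤ 3 / 4 * |D|) :
    |g| ^ (n + 1) * (3 / 4) ^ (m + n) ≤ |g * D| ∧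
    (0 < g * D * g ^ (n + 1) ∨ |g| ^ (n + 1) * (3 / 4) ^ (m + n) ≤ 3 / 4 * |g * D|) := by
  have e : |g| ^ (n + 1) * (3 / 4) ^ (m + n) = |g| * ((3 / 4 * |g|) ^ n * (3 / 4) ^ m) := by
    rw [mul_pow]; ring
  have hg' := abs_nonneg g
  have k1 : (3 / 4 * |g|) ^ n * (3 / 4) ^ m ≤ |d| ^ n * (3 / 4) ^ m := by gcongr
  rw [e, abs_mul]
  refine ⟨by gcongr; exact k1.trans h3, ?_⟩
  rcases lt_or_ge (g * d) 0 with hs | hs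
  · right
    have k2 : (3 / 4 * |g|) ^ n ≤ 3 / 4 * |d| ^ n := by
      rw [mul_pow]
      have := h2 hs
      gcongr
      calc (3 / 4 : ℚ) ^ n ≤ (3 / 4) ^ 1 := pow_le_pow_of_le_one (by norm_num) (by norm_num) hn
        _ = 3 / 4 := by norm_num
    calc _ ≤ |g| * (3 / 4 * |d| ^ n * (3 / 4) ^ m) := by gcongr
      _ = 3 / 4 * |g| * (|d| ^ n * (3 / 4) ^ m) := by ring
      _ ≤ 3 / 4 * |g| * |D| := by gcongr
      _ = _ := by ring
  · rcases h4 with h4 | h4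
    · left
      have hgd : 0 < g * d := lt_of_le_of_ne hs (mul_ne_zero hg hd).symm
      have : 0 < (g * d) ^ n := by positivity
      have hd2 : 0 < (d ^ n) ^ 2 := by positivity
      have hg2 : 0 < g ^ 2 := by positivity
      have : 0 < (g * D * g ^ (n + 1)) * (d ^ n) ^ 2 := by
        have : (g * D * g ^ (n + 1)) * (d ^ n) ^ 2 = g ^ 2 * (D * d ^ n) * (g * d) ^ n := by
          rw [mul_pow]; ring
        rw [this]; positivity
      exact pos_of_mul_pos_left this hd2.le
    · right
      calc _ ≤ |g| * (3 / 4 * |D|) := mul_le_mul_of_nonneg_left (k1.trans h4) hg'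
        _ = _ := by ring

lemma hermite_step {κ : Type*} [Fintype κ] [DecidableEq κ] (k0 : κ) {n m : ℕ} (hn : 1 ≤ n)
    (H : HermiteBound k0 n m) : HermiteBound (Sum.inl () : Unit ⊕ κ) (n + 1) (m + n) := by
  intro G hG ha
  obtain ⟨h, hu, hmin⟩ := exists_min (Sum.inl () : Unit ⊕ κ) G
  set G1 := (intMat h).transpose * G * intMat h with hG1
  have hdet : (intMat h).det * (intMat h).det = 1 := by
    rw [det_intMat]
    rcases Int.isUnit_iff.mp hu with h | h <;> simp [h]
  have hdet0 : (intMat h).det ≠ 0 := fun h => by simp [h] at hdet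
  have hG1s : G1.IsSymm := by
    rw [Matrix.IsSymm, hG1, Matrix.transpose_mul, Matrix.transpose_mul, Matrix.transpose_transpose,
      hG.eq, Matrix.mul_assoc]
  have hG1a : Anisotropic G1 := by
    intro x hx
    rw [hG1, gramVal_congr]
    apply ha
    intro h
    exact hx (Matrix.eq_zero_of_mulVec_eq_zero hdet0 h)
  have hG1d : G1.det = G.det := by
    rw [hG1, Matrix.det_mul, Matrix.det_mul, Matrix.det_transpose]
    linear_combination G.det * hdet
  have hg0 := hG1a.corner_ne_zero (.inl ())
  have hcol : ∀ h' : Matrix (Unit ⊕ κ) (Unit ⊕ κ) ℤ, gramVal G1 (fun j => (h' j (.inl ()) : ℚ)) =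
      gramVal G fun j => ((h * h') j (.inl ()) : ℚ) := by
    intro h'
    rw [hG1, gramVal_congr]
    congr 1
    ext j
    simp [intMat, Matrix.mulVec, dotProduct, Matrix.mul_apply]
  have hg : G1 (.inl ()) (.inl ()) = gramVal G fun j => (h j (.inl ()) : ℚ) := by
    rw [hG1, congr_diag_entry]; rfl
  have hsa := schur_anisotropic G1 hG1s hg0 hG1a
  obtain ⟨h2, hu2, hb, hb'⟩ := H (schur G1) (schur_isSymm G1 hG1s) hsa
  set w : κ → ℚ := fun j => (h2 j k0 : ℚ) with hw
  have hw0 : w ≠ 0 := by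
    intro h
    have : h2.det = 0 := Matrix.det_eq_zero_of_column_eq_zero k0 fun i => by
      simpa [hw] using congrFun h i
    rw [this] at hu2; simp at hu2
  set g := G1 (.inl ()) (.inl ())
  set s := (∑ j, G1 (.inl ()) (.inr j) * w j) / g with hs
  set E := (Matrix.fromBlocks 1 0 0 h2 *
    Matrix.transvection (Sum.inl ()) (Sum.inr k0) (-round s)).submatrix id
      (Equiv.swap (Sum.inl ()) (Sum.inr k0)) with hE
  have hEu : IsUnit E.det := by
    rw [hE, Matrix.det_permute', Matrix.det_mul, Matrix.det_transvection_of_ne _ _ (by simp),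
      Matrix.det_fromBlocks_zero₂₁]
    simp only [Matrix.det_one, one_mul, mul_one]
    exact IsUnit.mul (Units.isUnit _) hu2
  have hEcol : (fun j => (E j (.inl ()) : ℚ)) = Sum.elim (fun _ => ((-round s : ℤ) : ℚ)) w := by
    ext j
    rcases j with j | j <;>
    simp [hE, Matrix.mul_apply, Matrix.transvection, Matrix.one_apply, Matrix.single_apply, hw]
  have hmn := hmin (h * E) (by rw [Matrix.det_mul]; exact hu.mul hEu)
  rw [← hcol, hEcol, gramVal_schur G1 hG1s hg0, ← hg] at hmn
  have hsg := hermite_sign (t := ((-round s : ℤ) : ℚ) + s) hg0 (by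
    have := abs_sub_round s
    rw [show ((-round s : ℤ) : ℚ) + s = s - round s by push_cast; ring]; exact this) hmn
  have := hermite_arith hn hg0 (hsa w hw0) hsg.1 hsg.2 hb hb'
  refine ⟨h, hu, ?_⟩
  rw [← hg, ← hG1d, det_schur G1 hg0]
  exact this

lemma hermite (n : ℕ) : HermiteBound (0 : Fin (n + 1)) (n + 1) (∑ i ∈ Finset.range (n + 1), i) := by
  induction n with
  | zero =>
    intro G _ ha
    have hG : G.det = gramVal G fun j => ((1 : Matrix (Fin 1) (Fin 1) ℤ) j 0 : ℚ) := by
      simp [gramVal]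
    refine ⟨1, by simp, ?_⟩
    rw [hG]
    have := ha (fun j => ((1 : Matrix (Fin 1) (Fin 1) ℤ) j 0 : ℚ)) (by
      intro h; simpa using congrFun h 0)
    refine ⟨by simp, Or.inl ?_⟩
    simp only [zero_add, pow_one]
    exact mul_self_pos.mpr this
  | succ n ih =>
    have := (hermite_step _ (by omega) ih).reindex
      ((Equiv.sumComm _ _).trans ((Equiv.optionEquivSumPUnit _).symm.trans (finSuccEquiv (n + 1)).symm))
    rw [Finset.sum_range_succ]
    simpa using this

lemma exists_finEquiv (n : ℕ) : ∃ e : Unit ⊕ Fin n ≃ Fin (n + 1), e (.inl ()) = 0 :=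
  ⟨(Equiv.sumComm _ _).trans ((Equiv.optionEquivSumPUnit _).symm.trans (finSuccEquiv n).symm),
    by simp⟩

/-- An integral anisotropic form of determinant `±1` represents `±1` as soon as its Hermite
minimum is less than `2`; splitting it off leaves a form of the same kind. -/
lemma split_unit {n : ℕ} (G : Matrix (Fin (n + 1)) (Fin (n + 1)) ℤ) (hG : G.IsSymm)
    (ha : Anisotropic (intMat G)) (hd : IsUnit G.det)
    (hlt : ∀ g : ℚ, |g| ^ (n + 1) * (3 / 4) ^ (∑ i ∈ Finset.range (n + 1), i) ≤ 1 →
      (0 < (G.det : ℚ) * g ^ (n + 1) ∨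
        |g| ^ (n + 1) * (3 / 4) ^ (∑ i ∈ Finset.range (n + 1), i) ≤ 3 / 4) → |g| < 2) :
    ∃ (ε : ℤ) (G2 : Matrix (Fin n) (Fin n) ℤ), IsUnit ε ∧ G2.IsSymm ∧ Anisotropic (intMat G2) ∧
      G.det = ε * G2.det ∧ (∀ w : Fin n → ℚ, ∀ c : ℚ, ∃ x : Fin (n + 1) → ℚ,
        gramVal (intMat G) x = ε * c ^ 2 + gramVal (intMat G2) w ∧ (c ≠ 0 ∨ w ≠ 0 → x ≠ 0)) := by
  obtain ⟨h, hu, h1, h2⟩ := hermite n (intMat G) (hG.map _) ha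
  rw [det_intMat] at h1 h2
  have hdu : |(G.det : ℚ)| = 1 := by
    rcases Int.isUnit_iff.mp hd with h | h <;> simp [h]
  rw [hdu] at h1 h2
  rw [mul_one] at h2
  have hlt := hlt _ h1 h2
  obtain ⟨e, he⟩ := exists_finEquiv n
  set M : Matrix (Unit ⊕ Fin n) (Unit ⊕ Fin n) ℤ := (h.transpose * G * h).submatrix e e with hM
  have hMs : M.IsSymm := by
    apply Matrix.IsSymm.submatrix
    rw [Matrix.IsSymm, Matrix.transpose_mul, Matrix.transpose_mul, Matrix.transpose_transpose,
      hG.eq, Matrix.mul_assoc]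
  have hMv : ∀ x : Unit ⊕ Fin n → ℚ, gramVal (intMat M) x =
      gramVal (intMat G) ((intMat h).mulVec (x ∘ e.symm)) := by
    intro x
    rw [← gramVal_congr, ← gramVal_reindex e]
    congr 1
    · rw [hM]
      ext i j
      simp [intMat, Matrix.mul_apply]
    · ext; simp
  have hdet0 : (intMat h).det ≠ 0 := by
    rw [det_intMat]; exact_mod_cast hu.ne_zero
  have hinj : ∀ x : Unit ⊕ Fin n → ℚ, x ≠ 0 → (intMat h).mulVec (x ∘ e.symm) ≠ 0 := by
    intro x hx h
    have := Matrix.eq_zero_of_mulVec_eq_zero hdet0 h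
    apply hx
    ext i
    simpa using congrFun this (e i)
  have hMa : Anisotropic (intMat M) := fun x hx => by
    rw [hMv]; exact ha _ (hinj x hx)
  have hc0 := hMa.corner_ne_zero (.inl ())
  have hMd : M.det = G.det := by
    rw [hM, Matrix.det_submatrix_equiv_self, Matrix.det_mul, Matrix.det_mul, Matrix.det_transpose]
    rcases Int.isUnit_iff.mp hu with h | h <;> simp [h]
  set ε := M (.inl ()) (.inl ()) with hε
  have hεq : intMat M (.inl ()) (.inl ()) = (ε : ℚ) := rfl
  have hεv : (ε : ℚ) = gramVal (intMat G) fun j => (h j 0 : ℚ) := by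
    rw [← hεq]
    have := hMv (Pi.single (.inl ()) 1)
    rw [show gramVal (intMat M) (Pi.single (.inl ()) 1) = intMat M (.inl ()) (.inl ()) by
      simp [gramVal, Pi.single_apply]] at this
    rw [this]
    congr 1
    ext j
    have : (Pi.single (.inl ()) 1 : Unit ⊕ Fin n → ℚ) ∘ e.symm = Pi.single 0 1 := by
      ext k
      simp [Pi.single_apply, Equiv.symm_apply_eq, he]
    rw [this]
    simp [intMat, Matrix.mulVec_single]
  rw [← hεv] at hlt
  have hεu : IsUnit ε := by
    rw [Int.isUnit_iff_abs_eq]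
    have h1 : |ε| < 2 := by exact_mod_cast hlt
    have h2 : 0 < |ε| := abs_pos.mpr (by rw [hεq] at hc0; exact_mod_cast hc0)
    omega
  have hεε : (ε : ℚ) * ε = 1 := by
    rcases Int.isUnit_iff.mp hεu with h | h <;> simp [h]
  have hεinv : ∀ x : ℚ, x / (ε : ℚ) = ε * x := fun x => by
    have : (ε : ℚ) ≠ 0 := by exact_mod_cast hεu.ne_zero
    field_simp
    linear_combination (-x) * hεε
  obtain ⟨G2, hG2⟩ : ∃ G2 : Matrix (Fin n) (Fin n) ℤ, ∀ i j, G2 i j =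
    M (.inr i) (.inr j) - ε * (M (.inr i) (.inl ()) * M (.inl ()) (.inr j)) := ⟨fun i j => _, fun _ _ => rfl⟩
  have hG2q : intMat G2 = schur (intMat M) := by
    ext i j
    simp only [schur, hεq, hεinv]
    simp only [intMat, Matrix.map_apply, hG2]
    simp
  refine ⟨ε, G2, hεu, ?_, ?_, ?_, ?_⟩
  · ext i j
    rw [Matrix.transpose_apply, hG2, hG2]
    rw [hMs.apply (.inr i) (.inr j), hMs.apply (.inl ()) (.inr j), ← hMs.apply (.inl ()) (.inr i)]
    ring
  · rw [hG2q]; exact schur_anisotropic _ (hMs.map _) hc0 hMa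
  · have := det_schur (intMat M) hc0
    rw [← hG2q, det_intMat, det_intMat, hεq, hMd] at this
    exact_mod_cast this
  · intro w c
    have := gramVal_schur (intMat M) (hMs.map _) hc0
      (c - (∑ j, intMat M (.inl ()) (.inr j) * w j) / intMat M (.inl ()) (.inl ())) w
    refine ⟨_, (hMv _).symm.trans (this.trans ?_), fun hcw => hinj _ fun h => ?_⟩
    · rw [hG2q, hεq]; ring
    · have hw : w = 0 := by
        ext i; exact congrFun h (.inr i)
      have := congrFun h (.inl ())
      simp [hw] at this
      simp [hw, this] at hcw

/-- Definiteness of small unimodular anisotropic forms. -/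
lemma unimodular_le_five : ∀ n : ℕ, n ≤ 5 → ∀ G : Matrix (Fin n) (Fin n) ℤ, G.IsSymm →
    Anisotropic (intMat G) → IsUnit G.det → ∃ ε : ℤ, IsUnit ε ∧ G.det = ε ^ n ∧
      (n ≠ 0 → ∃ x, x ≠ 0 ∧ gramVal (intMat G) x = ε) := by
  intro n
  induction n with
  | zero => intro _ G _ _ _; exact ⟨1, by simp⟩
  | succ n ih =>
    intro hn G hG ha hd
    obtain ⟨ε, G2, hε, hG2, ha2, hdet, hv⟩ := split_unit G hG ha hd (by
      intro g h _
      by_contra! hg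
      have : (2 : ℚ) ^ (n + 1) * (3 / 4) ^ (∑ i ∈ Finset.range (n + 1), i) ≤ 1 :=
        le_trans (by gcongr) h
      have hn : n < 5 := by omega
      interval_cases n <;> norm_num [Finset.sum_range_succ] at this)
    obtain ⟨ε2, hε2, hdet2, hx⟩ := ih (by omega) G2 hG2 ha2 (by
      rw [hdet] at hd; exact isUnit_of_mul_isUnit_right hd)
    have key : n ≠ 0 → ε2 = ε := by
      intro hn0
      obtain ⟨w, hw, hwv⟩ := hx hn0
      obtain ⟨x, hx, hx0⟩ := hv w 1
      have := ha x (hx0 (Or.inl one_ne_zero))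
      rw [hx, hwv] at this
      rcases Int.isUnit_iff.mp hε with h | h <;> rcases Int.isUnit_iff.mp hε2 with h' | h' <;>
        simp [h, h'] at this ⊢
    refine ⟨ε, hε, ?_, fun _ => ?_⟩
    · rw [hdet, hdet2]
      rcases Nat.eq_zero_or_pos n with h | h
      · simp [h]
      · rw [key h.ne', pow_succ']
    · obtain ⟨x, hx, hx0⟩ := hv 0 1
      exact ⟨x, hx0 (Or.inl one_ne_zero), by rw [hx]; simp [gramVal]⟩

theorem isotropic_of_det_neg_one (G : Matrix (Fin 6) (Fin 6) ℤ) (hG : G.IsSymm)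
    (hd : G.det = -1) : ∃ x : Fin 6 → ℚ, x ≠ 0 ∧ gramVal (intMat G) x = 0 := by
  by_contra! ha
  obtain ⟨ε, G2, hε, hG2, ha2, hdet, hv⟩ := split_unit G hG ha (by simp [hd]) (by
    intro g _ h
    by_contra! hg
    have : (2 : ℚ) ^ 6 * (3 / 4) ^ (∑ i ∈ Finset.range 6, i) ≤ 3 / 4 := by
      rcases h with h | h
      · exfalso
        have : 0 ≤ g ^ (5 + 1) := Even.pow_nonneg (by decide) g
        rw [hd] at h
        push_cast at h
        norm_num at h this
        linarith
      · exact le_trans (by gcongr) h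
    norm_num [Finset.sum_range_succ] at this)
  obtain ⟨ε2, hε2, hdet2, hx⟩ := unimodular_le_five 5 le_rfl G2 hG2 ha2 (by
    have : IsUnit G.det := by simp [hd]
    rw [hdet] at this; exact isUnit_of_mul_isUnit_right this)
  obtain ⟨w, hw, hwv⟩ := hx (by norm_num)
  obtain ⟨x, hx, hx0⟩ := hv w 1
  have := ha x (hx0 (Or.inl one_ne_zero))
  rw [hx, hwv] at this
  rcases Int.isUnit_iff.mp hε with h | h <;> rcases Int.isUnit_iff.mp hε2 with h' | h' <;>
    simp [h, h'] at this <;> rw [hd, hdet2, h, h'] at hdet <;> norm_num at hdet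

open Matrix in
/-- A matrix over `k` with independent columns, normalised by its largest minor. -/
lemma exists_normalized_columns {k : Type*} [NormedField k] {m n : ℕ}
    (P : Matrix (Fin m) (Fin n) k) (hP : ∀ c, P.mulVec c = 0 → c = 0) :
    ∃ (N : Matrix (Fin n) (Fin n) k) (ρ : Fin n → Fin m), (P * N).submatrix ρ id = 1 ∧
      ∀ i j, ‖(P * N) i j‖ ≤ 1 := by
  have hrank : P.rank = n := by
    have h : LinearIndependent k P.transpose.row := by
      rw [Fintype.linearIndependent_iff]
      intro c hc
      have := hP c (by
        rw [← hc]
        ext j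
        simp [Matrix.mulVec, dotProduct, Finset.sum_apply, mul_comm])
      exact fun i => congrFun this i
    have := h.rank_matrix
    rwa [Matrix.rank_transpose, Fintype.card_fin] at this
  have hex : ∃ ρ : Fin n → Fin m, (P.submatrix ρ id).det ≠ 0 := by
    have hs := Submodule.exists_fun_fin_finrank_span_eq k (Set.range P.row)
    rw [← Matrix.rank_eq_finrank_span_row, hrank] at hs
    obtain ⟨f, hf, -, hli⟩ := hs
    choose ρ hρ using hf
    refine ⟨ρ, ?_⟩
    have : (P.submatrix ρ id).row = f := funext hρ
    rw [← this] at hli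
    exact ((Matrix.isUnit_iff_isUnit_det _).mp (Matrix.linearIndependent_rows_iff_isUnit.mp hli)).ne_zero
  have : Nonempty (Fin n → Fin m) := ⟨hex.choose⟩
  obtain ⟨ρ, hρ⟩ := Finite.exists_max fun ρ : Fin n → Fin m => ‖(P.submatrix ρ id).det‖
  obtain ⟨ρ', hρ'⟩ := hex
  have h0 : (P.submatrix ρ id).det ≠ 0 := by
    have := hρ ρ'
    intro h
    rw [h, norm_zero] at this
    exact hρ' (norm_le_zero_iff.mp this)
  have hu : IsUnit (P.submatrix ρ id).det := h0.isUnit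
  refine ⟨(P.submatrix ρ id)⁻¹, ρ, ?_, fun i j => ?_⟩
  · rw [show (P * (P.submatrix ρ id)⁻¹).submatrix ρ id = P.submatrix ρ id * (P.submatrix ρ id)⁻¹ from rfl,
      Matrix.mul_nonsing_inv _ hu]
  · have h1 : P * (P.submatrix ρ id)⁻¹ * P.submatrix ρ id = P := Matrix.nonsing_inv_mul_cancel_right _ _ hu
    have h2 := Matrix.det_updateRow_sum (P.submatrix ρ id) j (fun l => (P * (P.submatrix ρ id)⁻¹) i l)
    have h3 : (P.submatrix ρ id).updateRow j (∑ l, (P * (P.submatrix ρ id)⁻¹) i l • (P.submatrix ρ id) l) =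
        P.submatrix (Function.update ρ j i) id := by
      ext a b
      rw [Matrix.submatrix_apply]
      by_cases hab : a = j
      · subst hab
        rw [Matrix.updateRow_self, Function.update_self]
        conv_rhs => rw [← h1]
        simp [Matrix.mul_apply]
      · rw [Matrix.updateRow_ne hab, Function.update_of_ne hab]; rfl
    rw [h3] at h2
    have h4 := hρ (Function.update ρ j i)
    simp only [h2, norm_smul] at h4
    exact le_of_mul_le_mul_right (by rwa [one_mul]) (norm_pos_iff.mpr h0)

/-- A totally isotropic subspace of half the dimension meets the radical of a degenerate form. -/
lemma exists_radical_of_lagrangian {k : Type*} [Field k] (G : Matrix (Fin 6) (Fin 6) k)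
    (hG : G.IsSymm) (hd : G.det = 0) (P : Matrix (Fin 6) (Fin 3) k)
    (hP : ∀ c, P.mulVec c = 0 → c = 0) (hPG : P.transpose * G * P = 0) :
    ∃ c, c ≠ 0 ∧ G.mulVec (P.mulVec c) = 0 := by
  by_contra! hcon
  have hrank : ∀ M : Matrix (Fin 6) (Fin 3) k, (∀ c, M.mulVec c = 0 → c = 0) → M.rank = 3 := by
    intro M hM
    have : LinearMap.ker M.mulVecLin = ⊥ := by
      rw [LinearMap.ker_eq_bot']; exact hM
    have := LinearMap.finrank_range_of_inj (LinearMap.ker_eq_bot.mp this)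
    rw [Matrix.rank, this]; simp
  have h1 : (P.transpose * G).rank = 3 := by
    rw [← Matrix.rank_transpose, Matrix.transpose_mul, Matrix.transpose_transpose, hG.eq]
    apply hrank
    intro c hc
    by_contra hc0
    exact hcon c hc0 (by rwa [Matrix.mulVec_mulVec])
  have h2 : Module.finrank k (LinearMap.ker (P.transpose * G).mulVecLin) = 3 := by
    have := LinearMap.finrank_range_add_finrank_ker (P.transpose * G).mulVecLin
    rw [← Matrix.rank, h1] at this
    simp at this
    omega
  have h3 : LinearMap.range P.mulVecLin = LinearMap.ker (P.transpose * G).mulVecLin := by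
    apply Submodule.eq_of_le_of_finrank_eq
    · rintro _ ⟨c, rfl⟩
      change (P.transpose * G).mulVec (P.mulVec c) = 0
      rw [Matrix.mulVec_mulVec, hPG, Matrix.zero_mulVec]
    · rw [h2, ← Matrix.rank, hrank P hP]
  obtain ⟨z, hz, hz0⟩ := Matrix.exists_mulVec_eq_zero_iff.mpr hd
  have : z ∈ LinearMap.range P.mulVecLin := by
    rw [h3]
    simp [hz0]
  obtain ⟨c, hc⟩ := this
  change P.mulVec c = z at hc
  refine hcon c ?_ (by rw [hc, hz0])
  rintro rfl
  rw [Matrix.mulVec_zero] at hc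
  exact hz hc.symm

lemma gramVal_map {R S ι : Type*} [CommRing R] [CommRing S] [Fintype ι] (f : R →+* S)
    (G : Matrix ι ι R) (x : ι → R) : gramVal (G.map f) (f ∘ x) = f (gramVal G x) := by
  simp [gramVal]

/-- The vectors along which a lattice can be enlarged at `q`. -/
def EnlargeVec (q : ℕ) (G : Matrix (Fin 6) (Fin 6) ℤ) (y : Fin 6 → ℤ) : Prop :=
  (∃ i, ¬ (q : ℤ) ∣ y i) ∧ (∀ i, (q : ℤ) ∣ G.mulVec y i) ∧ (q ^ 2 : ℤ) ∣ gramVal G y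

def LocalLagrangian (q : ℕ) [Fact q.Prime] (G : Matrix (Fin 6) (Fin 6) ℚ) : Prop :=
  ∃ P : Matrix (Fin 6) (Fin 3) ℚ_[q], (∀ c, P.mulVec c = 0 → c = 0) ∧
    P.transpose * G.map (algebraMap ℚ ℚ_[q]) * P = 0

lemma exists_enlargeVec_of_lagrangian (q : ℕ) [Fact q.Prime] (G : Matrix (Fin 6) (Fin 6) ℤ)
    (hG : G.IsSymm) (hd : (q : ℤ) ∣ G.det) (hl : LocalLagrangian q (intMat G)) :
    ∃ y, EnlargeVec q G y := by
  obtain ⟨P, hP, hPG⟩ := hl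
  obtain ⟨N, ρ, hρ, hint⟩ := exists_normalized_columns P hP
  let Q : Matrix (Fin 6) (Fin 3) ℤ_[q] := fun i j => ⟨(P * N) i j, hint i j⟩
  have hQ : Q.map PadicInt.Coe.ringHom = P * N := rfl
  have hQG : Q.transpose * G.map (Int.castRingHom ℤ_[q]) * Q = 0 := by
    have hinj : Function.Injective (PadicInt.Coe.ringHom (p := q)) := Subtype.val_injective
    apply Matrix.map_injective hinj
    dsimp only
    rw [Matrix.map_mul, Matrix.map_mul, Matrix.map_zero _ (map_zero _), Matrix.transpose_map, hQ,
      Matrix.map_map]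
    have : G.map (PadicInt.Coe.ringHom ∘ Int.castRingHom ℤ_[q]) =
        (intMat G).map (algebraMap ℚ ℚ_[q]) := by
      ext i j; simp [intMat]
    rw [this, Matrix.transpose_mul]
    calc _ = N.transpose * (P.transpose * (intMat G).map (algebraMap ℚ ℚ_[q]) * P) * N := by
          simp only [Matrix.mul_assoc]
      _ = 0 := by rw [hPG]; simp
  have hQρ : Q.submatrix ρ id = 1 := by
    ext i j
    have := congrFun (congrFun hρ i) j
    apply Subtype.val_injective
    change (P * N) (ρ i) j = _
    rw [Matrix.submatrix_apply] at this
    rw [id] at this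
    rw [this]
    simp [Matrix.one_apply]
    split_ifs <;> simp
  set φ2 : ℤ_[q] →+* ZMod (q ^ 2) := PadicInt.toZModPow 2
  set ψ : ZMod (q ^ 2) →+* ZMod q := ZMod.castHom (dvd_pow_self q two_ne_zero) (ZMod q)
  set φ : ℤ_[q] →+* ZMod q := ψ.comp φ2
  obtain ⟨c, hc, hc0⟩ := exists_radical_of_lagrangian (G.map (Int.castRingHom (ZMod q)))
    (hG.map _) (by
      have := (Int.castRingHom (ZMod q)).map_det G
      rw [RingHom.mapMatrix_apply] at this
      rw [← this, eq_intCast, ZMod.intCast_zmod_eq_zero_iff_dvd]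
      exact_mod_cast hd) (Q.map φ) (by
      intro c hc
      have h1 : (Q.map φ).submatrix ρ id = 1 := by
        have := congrArg (fun M => Matrix.map M φ) hQρ
        rwa [Matrix.map_one _ (map_zero φ) (map_one φ)] at this
      have : ((Q.map φ).submatrix ρ id).mulVec c = 0 := by
        ext i; exact congrFun hc (ρ i)
      rwa [h1, Matrix.one_mulVec] at this) (by
      have := congrArg (fun M => Matrix.map M φ) hQG
      simp only [Matrix.map_mul, Matrix.map_zero _ (map_zero _), Matrix.transpose_map, Matrix.map_map] at this
      rwa [show G.map (φ ∘ Int.castRingHom ℤ_[q]) = G.map (Int.castRingHom (ZMod q)) by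
        ext; simp] at this)
  choose c' hc' using fun i => ZMod.intCast_surjective (c i)
  set y : Fin 6 → ℤ_[q] := Q.mulVec (fun i => (c' i : ℤ_[q])) with hy
  choose z hz using fun i => ZMod.intCast_surjective (φ2 (y i))
  have hz1 : ∀ i, (z i : ZMod q) = φ (y i) := by
    intro i
    change _ = ψ (φ2 (y i))
    rw [← hz, map_intCast]
  have hyφ : ∀ i, φ (y i) = (Q.map φ).mulVec c i := by
    intro i
    simp [hy, Matrix.mulVec, dotProduct, hc']
  refine ⟨z, ?_, ?_, ?_⟩
  · by_contra! h
    apply hc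
    ext i
    have h1 := (ZMod.intCast_zmod_eq_zero_iff_dvd (z (ρ i)) q).mpr (by exact_mod_cast h (ρ i))
    rw [hz1] at h1
    have h2 : y (ρ i) = c' i := by
      have : (Q.submatrix ρ id).mulVec (fun i => (c' i : ℤ_[q])) i = y (ρ i) := rfl
      rw [← this, hQρ, Matrix.one_mulVec]
    rw [h2, map_intCast, hc'] at h1
    exact h1
  · intro i
    rw [← ZMod.intCast_zmod_eq_zero_iff_dvd]
    rw [← show _ = (0 : ZMod q) from congrFun hc0 i]
    simp only [Matrix.mulVec, dotProduct, Int.cast_sum, Int.cast_mul, hz1, hyφ, Matrix.map_apply,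
      eq_intCast]
  · have h1 : gramVal (G.map (Int.castRingHom ℤ_[q])) y = 0 := by
      rw [hy, ← gramVal_congr, hQG]
      simp [gramVal]
    have h2 := gramVal_map φ2 (G.map (Int.castRingHom ℤ_[q])) y
    rw [h1, map_zero] at h2
    have h3 := gramVal_map (Int.castRingHom (ZMod (q ^ 2))) G z
    have h4 : φ2 ∘ y = Int.castRingHom (ZMod (q ^ 2)) ∘ z := by
      ext i; simp [hz]
    have h5 : (G.map (Int.castRingHom ℤ_[q])).map φ2 = G.map (Int.castRingHom (ZMod (q ^ 2))) := by
      ext; simp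
    rw [h4, h5, h3, eq_intCast, ZMod.intCast_zmod_eq_zero_iff_dvd] at h2
    exact_mod_cast h2

lemma gramVal_add {R ι : Type*} [CommRing R] [Fintype ι] (G : Matrix ι ι R) (hG : G.IsSymm)
    (x y : ι → R) :
    gramVal G (x + y) = gramVal G x + gramVal G y + 2 * dotProduct x (G.mulVec y) := by
  rw [gramVal_eq, gramVal_eq, gramVal_eq, Matrix.mulVec_add, add_dotProduct, dotProduct_add,
    dotProduct_add]
  have : dotProduct y (G.mulVec x) = dotProduct x (G.mulVec y) := by
    rw [Matrix.dotProduct_mulVec, ← Matrix.mulVec_transpose, hG.eq, dotProduct_comm]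
  rw [this]; ring

lemma two_dvd_mulVec_iff (G : Matrix (Fin 6) (Fin 6) ℤ) (y : Fin 6 → ℤ) :
    (∀ i, (2 : ℤ) ∣ G.mulVec y i) ↔
      (G.map (Int.castRingHom (ZMod 2))).mulVec (fun i => (y i : ZMod 2)) = 0 := by
  rw [funext_iff]
  refine forall_congr' fun i => ?_
  have : (2 : ℤ) = ((2 : ℕ) : ℤ) := rfl
  rw [this, ← ZMod.intCast_zmod_eq_zero_iff_dvd]
  simp [Matrix.mulVec, dotProduct]

lemma exists_enlargeVec_two (G : Matrix (Fin 6) (Fin 6) ℤ) (hG : G.IsSymm) (hd : (4 : ℤ) ∣ G.det) :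
    ∃ y, EnlargeVec 2 G y := by
  by_cases hadj : ∃ i j, ¬ (2 : ℤ) ∣ G.adjugate i j
  · obtain ⟨i, j, hij⟩ := hadj
    have h1 : ∀ l, G.mulVec (fun l => G.adjugate l j) l = G.det * (1 : Matrix _ _ ℤ) l j := by
      intro l
      have := congrFun (congrFun (Matrix.mul_adjugate G) l) j
      rwa [Matrix.smul_apply, smul_eq_mul] at this
    refine ⟨fun l => G.adjugate l j, ⟨i, hij⟩, fun l => ?_, ?_⟩
    · rw [h1]
      exact (Dvd.dvd.trans (by norm_num) hd).mul_right _
    · rw [gramVal_eq]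
      apply Finset.dvd_sum
      intro l _
      dsimp only
      rw [h1]
      exact ((Dvd.dvd.trans (by norm_num) hd).mul_right _).mul_left _
  push Not at hadj
  set H := G.map (Int.castRingHom (ZMod 2)) with hH
  have hHs : H.IsSymm := hG.map _
  have hHd : H.det = 0 := by
    have := (Int.castRingHom (ZMod 2)).map_det G
    rw [RingHom.mapMatrix_apply] at this
    rw [hH, ← this, eq_intCast, ZMod.intCast_zmod_eq_zero_iff_dvd]
    exact Dvd.dvd.trans (by norm_num) hd
  obtain ⟨y, hy0, hy⟩ := Matrix.exists_mulVec_eq_zero_iff.mpr hHd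
  obtain ⟨i, hi⟩ := Function.ne_iff.mp hy0
  have hsub : (H.submatrix i.succAbove i.succAbove).det = 0 := by
    have h1 := Matrix.adjugate_fin_succ_eq_det_submatrix H i i
    have h2 : H.adjugate i i = 0 := by
      have := (Int.castRingHom (ZMod 2)).map_adjugate G
      have h3 := congrFun (congrFun this i) i
      rw [RingHom.mapMatrix_apply, RingHom.mapMatrix_apply, Matrix.map_apply] at h3
      rw [hH, ← h3, eq_intCast, ZMod.intCast_zmod_eq_zero_iff_dvd]
      exact hadj i i
    rw [h2] at h1
    simpa using h1.symm
  obtain ⟨z', hz0', hz'⟩ := Matrix.exists_mulVec_eq_zero_iff.mpr hsub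
  set z : Fin 6 → ZMod 2 := Fin.insertNth (α := fun _ => ZMod 2) i 0 z' with hzdef
  have hz1 : ∀ l, H.mulVec z l = ∑ m, H l (i.succAbove m) * z' m := by
    intro l
    rw [Matrix.mulVec, dotProduct, Fin.sum_univ_succAbove _ i]
    simp [hzdef]
  have hz2 : ∀ m, H.mulVec z (i.succAbove m) = 0 := fun m => by
    rw [hz1]; exact congrFun hz' m
  have hz3 : H.mulVec z i = 0 := by
    have h1 : dotProduct y (H.mulVec z) = 0 := by
      rw [Matrix.dotProduct_mulVec, ← Matrix.mulVec_transpose, hHs.eq, hy, zero_dotProduct]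
    rw [dotProduct, Fin.sum_univ_succAbove _ i] at h1
    simp only [hz2, mul_zero, Finset.sum_const_zero, add_zero] at h1
    exact (mul_eq_zero.mp h1).resolve_left hi
  have hz : H.mulVec z = 0 := by
    ext l
    rcases eq_or_ne l i with h | h
    · rw [h, hz3]; rfl
    · obtain ⟨m, rfl⟩ := Fin.exists_succAbove_eq h
      rw [hz2]; rfl
  obtain ⟨m, hm⟩ := Function.ne_iff.mp hz0'
  have hzm : z (i.succAbove m) ≠ 0 := by simpa [hzdef] using hm
  have hzi : z i = 0 := by simp [hzdef]
  choose a ha using fun l => ZMod.intCast_surjective (y l)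
  choose b hb using fun l => ZMod.intCast_surjective (z l)
  have hndvd : ∀ (c : ℤ), (c : ZMod 2) ≠ 0 → ¬ ((2 : ℕ) : ℤ) ∣ c := fun c hc h =>
    hc ((ZMod.intCast_zmod_eq_zero_iff_dvd c 2).mpr h)
  have ha2 : ∀ l, (2 : ℤ) ∣ G.mulVec a l := (two_dvd_mulVec_iff G a).mpr (by simp only [ha]; exact hy)
  have hb2 : ∀ l, (2 : ℤ) ∣ G.mulVec b l := (two_dvd_mulVec_iff G b).mpr (by simp only [hb]; exact hz)
  have hev : ∀ x c : Fin 6 → ℤ, (∀ l, (2 : ℤ) ∣ G.mulVec c l) → (2 : ℤ) ∣ dotProduct x (G.mulVec c) :=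
    fun x c hc => Finset.dvd_sum fun l _ => (hc l).mul_left _
  have e1 : (2 : ℤ) ∣ gramVal G a := by rw [gramVal_eq]; exact hev _ _ ha2
  have e2 : (2 : ℤ) ∣ gramVal G b := by rw [gramVal_eq]; exact hev _ _ hb2
  have e3 := hev a b hb2
  have e4 := gramVal_add G hG a b
  have key : (4 : ℤ) ∣ gramVal G a ∨ (4 : ℤ) ∣ gramVal G b ∨ (4 : ℤ) ∣ gramVal G (a + b) := by
    omega
  rcases key with h | h | h
  · exact ⟨a, ⟨i, hndvd _ (by rw [ha]; exact hi)⟩, ha2, h⟩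
  · exact ⟨b, ⟨_, hndvd _ (by rw [hb]; exact hzm)⟩, hb2, h⟩
  · refine ⟨a + b, ⟨i, hndvd _ ?_⟩, fun l => ?_, h⟩
    · rw [Pi.add_apply, Int.cast_add, ha, hb, hzi, add_zero]; exact hi
    · rw [Matrix.mulVec_add]
      exact dvd_add (ha2 l) (hb2 l)

lemma EnlargeVec.exists_one {q : ℕ} (hq : q.Prime) {G : Matrix (Fin 6) (Fin 6) ℤ} (hG : G.IsSymm)
    {y : Fin 6 → ℤ} (h : EnlargeVec q G y) : ∃ y i, y i = 1 ∧ EnlargeVec q G y := by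
  obtain ⟨⟨i, hi⟩, h1, h2⟩ := h
  have hco : IsCoprime (y i) ((q : ℤ) ^ 2) := by
    apply IsCoprime.pow_right
    exact ((Nat.prime_iff_prime_int.mp hq).coprime_iff_not_dvd.mpr hi).symm
  obtain ⟨e, f, hef⟩ := hco
  refine ⟨e • y + (q : ℤ) ^ 2 • Pi.single i f, i, ?_, ⟨i, ?_⟩, fun l => ?_, ?_⟩
  · simp; linarith
  · simp only [Pi.add_apply, Pi.smul_apply, smul_eq_mul, Pi.single_eq_same]
    rw [show e * y i + (q : ℤ) ^ 2 * f = 1 by linarith]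
    intro h
    have := Int.eq_one_of_dvd_one (by positivity) h
    exact hq.one_lt.ne' (by exact_mod_cast this)
  · rw [Matrix.mulVec_add, Matrix.mulVec_smul, Matrix.mulVec_smul]
    exact dvd_add ((h1 l).mul_left _) ((dvd_pow_self _ two_ne_zero).mul_right _)
  · rw [gramVal_add _ hG]
    have hs : ∀ (c : ℤ) x, gramVal G (c • x) = c ^ 2 * gramVal G x := by
      intro c x
      rw [gramVal_eq, gramVal_eq, Matrix.mulVec_smul, smul_dotProduct, dotProduct_smul]
      simp only [smul_eq_mul]; ring
    rw [hs, hs, Matrix.mulVec_smul, dotProduct_smul]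
    refine dvd_add (dvd_add (h2.mul_left _) ?_) ?_
    · rw [sq ((q : ℤ) ^ 2), mul_assoc]; exact dvd_mul_right _ _
    · rw [smul_eq_mul, mul_left_comm]; exact dvd_mul_right _ _

lemma EnlargeVec.descend {q : ℕ} (hq : q.Prime) {G : Matrix (Fin 6) (Fin 6) ℤ} (hG : G.IsSymm)
    {y : Fin 6 → ℤ} (h : EnlargeVec q G y) : ∃ (G' : Matrix (Fin 6) (Fin 6) ℤ)
      (T : Matrix (Fin 6) (Fin 6) ℚ), G'.IsSymm ∧ IsUnit T.det ∧
      intMat G' = T.transpose * intMat G * T ∧ G.det = q ^ 2 * G'.det := by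
  obtain ⟨y, i, hy, -, h1, h2⟩ := h.exists_one hq hG
  choose v hv using h1
  obtain ⟨w, hw⟩ := h2
  have hq0 : (q : ℚ) ≠ 0 := by exact_mod_cast hq.ne_zero
  let T : Matrix (Fin 6) (Fin 6) ℚ := (1 : Matrix _ _ ℚ).updateCol i fun l => (y l : ℚ) / q
  have hTd : T.det = (q : ℚ)⁻¹ := by
    have : (fun l => (y l : ℚ) / q) = (q : ℚ)⁻¹ • ((1 : Matrix (Fin 6) (Fin 6) ℚ).mulVec fun l => (y l : ℚ)) := by
      ext l; simp; ring
    change Matrix.det (Matrix.updateCol _ _ _) = _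
    rw [this, Matrix.det_updateCol_smul, ← Matrix.cramer_apply, Matrix.cramer_eq_adjugate_mulVec]
    simp [hy]
  have hTu : IsUnit T.det := by rw [hTd]; exact (inv_ne_zero hq0).isUnit
  have hGT : ∀ l j, (intMat G * T) l j = if j = i then (v l : ℚ) else (G l j : ℚ) := by
    intro l j
    by_cases hj : j = i
    · subst hj
      have : (∑ m, (G l m : ℚ) * y m) = q * v l := by
        have := hv l
        simp only [Matrix.mulVec, dotProduct] at this
        exact_mod_cast this
      simp only [Matrix.mul_apply, T, Matrix.updateCol_self, intMat, Matrix.map_apply, if_true, eq_intCast]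
      rw [← mul_left_cancel_iff_of_pos (show (0 : ℚ) < q by exact_mod_cast hq.pos), ← this, Finset.mul_sum]
      exact Finset.sum_congr rfl fun _ _ => by field_simp
    · simp [Matrix.mul_apply, T, hj, Matrix.one_apply, intMat]
  obtain ⟨G', hG'e⟩ : ∃ G' : Matrix (Fin 6) (Fin 6) ℤ, ∀ l j, G' l j =
    if l = i then (if j = i then w else v j) else (if j = i then v l else G l j) :=
    ⟨fun l j => _, fun _ _ => rfl⟩
  have hG' : intMat G' = T.transpose * intMat G * T := by
    ext l j
    rw [Matrix.mul_assoc]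
    by_cases hl : l = i
    · subst hl
      simp only [Matrix.mul_apply (M := T.transpose), hGT, Matrix.transpose_apply, T, Matrix.updateCol_self]
      by_cases hj : j = l
      · subst hj
        have : (∑ m, (y m : ℚ) * v m) * q = q ^ 2 * w := by
          rw [gramVal_eq, dotProduct] at hw
          simp only [hv] at hw
          have : (∑ m, (y m : ℤ) * v m) * q = q ^ 2 * w := by
            rw [← hw, Finset.sum_mul]
            exact Finset.sum_congr rfl fun _ _ => by ring
          exact_mod_cast this
        simp only [if_true, intMat_apply, hG'e]
        have h3 : (w : ℚ) = (∑ m, (y m : ℚ) * v m) / q := by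
          rw [eq_div_iff hq0, ← mul_left_cancel_iff_of_pos (show (0 : ℚ) < q by exact_mod_cast hq.pos)]
          linarith
        rw [h3, Finset.sum_div]
        exact Finset.sum_congr rfl fun _ _ => by ring
      · have : (∑ m, (y m : ℚ) * G m j) = q * v j := by
          have := hv j
          simp only [Matrix.mulVec, dotProduct] at this
          rw [Finset.sum_congr rfl fun m _ => by rw [← hG.apply, mul_comm]] at this
          exact_mod_cast this
        simp only [hj, if_false, if_true, intMat_apply, hG'e]
        have h3 : (v j : ℚ) = (∑ m, (y m : ℚ) * G m j) / q := by
          rw [this]; field_simp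
        rw [h3, Finset.sum_div]
        exact Finset.sum_congr rfl fun _ _ => by ring
    · simp only [Matrix.mul_apply (M := T.transpose), hGT, Matrix.transpose_apply, T,
        Matrix.updateCol_ne hl, Matrix.one_apply]
      rw [intMat_apply, hG'e]
      simp [hl]
  refine ⟨G', T, ?_, hTu, hG', ?_⟩
  · ext l j
    rw [Matrix.transpose_apply, hG'e, hG'e]
    have := hG.apply l j
    split_ifs <;> simp_all
  · have := congrArg Matrix.det hG'
    rw [Matrix.det_mul, Matrix.det_mul, Matrix.det_transpose, hTd, det_intMat, det_intMat] at this
    have h3 : (G.det : ℚ) = q ^ 2 * G'.det := by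
      rw [this]; field_simp
    exact_mod_cast h3

lemma LocalLagrangian.congr {q : ℕ} [Fact q.Prime] {G : Matrix (Fin 6) (Fin 6) ℚ}
    (h : LocalLagrangian q G) (T : Matrix (Fin 6) (Fin 6) ℚ) (hT : IsUnit T.det) :
    LocalLagrangian q (T.transpose * G * T) := by
  obtain ⟨P, hP, hPG⟩ := h
  set f := algebraMap ℚ ℚ_[q]
  have h1 : T.map f * (T⁻¹).map f = 1 := by
    rw [← Matrix.map_mul, Matrix.mul_nonsing_inv _ hT, Matrix.map_one _ (map_zero f) (map_one f)]
  refine ⟨(T⁻¹).map f * P, fun c hc => hP c ?_, ?_⟩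
  · have := congrArg (T.map f).mulVec hc
    rwa [Matrix.mulVec_mulVec, ← Matrix.mul_assoc, h1, Matrix.one_mul, Matrix.mulVec_zero] at this
  · have h2 : ((T⁻¹).map f).transpose * T.transpose.map f = 1 := by
      rw [Matrix.transpose_map, ← Matrix.transpose_mul, h1, Matrix.transpose_one]
    rw [Matrix.transpose_mul, Matrix.map_mul, Matrix.map_mul]
    calc _ = P.transpose * (((T⁻¹).map f).transpose * T.transpose.map f) * G.map f *
          (T.map f * (T⁻¹).map f) * P := by simp only [Matrix.mul_assoc, f]
      _ = 0 := by rw [h1, h2, Matrix.mul_one, Matrix.mul_one, hPG]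

lemma isotropic_congr {G : Matrix (Fin 6) (Fin 6) ℚ} (T : Matrix (Fin 6) (Fin 6) ℚ)
    (hT : IsUnit T.det) (h : ∃ x, x ≠ 0 ∧ gramVal (T.transpose * G * T) x = 0) :
    ∃ x, x ≠ 0 ∧ gramVal G x = 0 := by
  obtain ⟨x, hx, h⟩ := h
  rw [gramVal_congr] at h
  exact ⟨_, fun h0 => hx (Matrix.eq_zero_of_mulVec_eq_zero hT.ne_zero h0), h⟩

lemma senary_isotropic_int (n : ℕ) : ∀ (G : Matrix (Fin 6) (Fin 6) ℤ), G.IsSymm →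
    n ≠ 0 → G.det = -(n : ℤ) ^ 2 →
    (∀ (q : ℕ) [Fact q.Prime], q ≠ 2 → LocalLagrangian q (intMat G)) →
    ∃ x, x ≠ 0 ∧ gramVal (intMat G) x = 0 := by
  induction n using Nat.strong_induction_on with
  | _ n ih =>
  intro G hG hn hd hl
  rcases eq_or_ne n 1 with h1 | h1
  · exact isotropic_of_det_neg_one G hG (by rw [hd, h1]; norm_num)
  obtain ⟨q, hq, m, hm⟩ := Nat.exists_prime_and_dvd h1
  have : Fact q.Prime := ⟨hq⟩
  have hv : ∃ y, EnlargeVec q G y := by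
    rcases eq_or_ne q 2 with h2 | h2
    · subst h2
      refine exists_enlargeVec_two G hG ?_
      rw [hd, hm]
      exact ⟨-(m : ℤ) ^ 2, by push_cast; ring⟩
    · refine exists_enlargeVec_of_lagrangian q G hG ?_ (hl q h2)
      rw [hd, hm]
      exact ⟨-(q : ℤ) * m ^ 2, by push_cast; ring⟩
  obtain ⟨y, hy⟩ := hv
  obtain ⟨G', T, hG', hT, hGT, hdet⟩ := hy.descend hq hG
  refine isotropic_congr T hT ?_
  rw [← hGT]
  have hm0 : m ≠ 0 := by rintro rfl; simp at hm; exact hn hm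
  refine ih m ?_ G' hG' hm0 ?_ fun q' _ h2 => ?_
  · rw [hm]; nlinarith [hq.two_le, Nat.pos_of_ne_zero hm0]
  · have hq0 : (q : ℤ) ^ 2 ≠ 0 := by have := hq.ne_zero; positivity
    apply mul_left_cancel₀ hq0
    rw [← hdet, hd, hm]; push_cast; ring
  · rw [hGT]; exact (hl q' h2).congr T hT

/-- Hasse–Minkowski for senary forms of discriminant `-1` up to squares. -/
theorem senary_isotropic (G : Matrix (Fin 6) (Fin 6) ℚ) (hG : G.IsSymm) (d : ℚ) (hd0 : d ≠ 0)
    (hd : G.det = -d ^ 2)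
    (hl : ∀ (q : ℕ) [Fact q.Prime], q ≠ 2 → LocalLagrangian q G) :
    ∃ x, x ≠ 0 ∧ gramVal G x = 0 := by
  obtain ⟨N, hN⟩ := IsLocalization.exist_integer_multiples (nonZeroDivisors ℤ)
    (Finset.univ : Finset (Fin 6 × Fin 6)) (fun ij => G ij.1 ij.2)
  have hN0 : ((N : ℤ) : ℚ) ≠ 0 := by exact_mod_cast nonZeroDivisors.coe_ne_zero N
  have hc : ∀ i j, ∃ z : ℤ, (z : ℚ) = (N : ℤ) * G i j * (N : ℤ) := by
    intro i j
    obtain ⟨z, hz⟩ := hN (i, j) (Finset.mem_univ _)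
    refine ⟨z * N, ?_⟩
    push_cast
    rw [← eq_intCast (algebraMap ℤ ℚ) z, hz]; simp [Algebra.smul_def]
  choose c hc using hc
  let T : Matrix (Fin 6) (Fin 6) ℚ := Matrix.diagonal fun _ => ((N : ℤ) : ℚ)
  have hTd : T.det = (((N : ℤ) : ℚ)) ^ 6 := by simp [T]
  have hT : IsUnit T.det := by rw [hTd]; exact (pow_ne_zero _ hN0).isUnit
  have hGT : intMat (Matrix.of c) = T.transpose * G * T := by
    ext i j
    simp [intMat, T, hc]
  refine isotropic_congr T hT ?_
  rw [← hGT]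
  have hdet : ((Matrix.of c).det : ℚ) = -(d * ((N : ℤ) : ℚ) ^ 6) ^ 2 := by
    rw [← det_intMat, hGT, Matrix.det_mul, Matrix.det_mul, Matrix.det_transpose, hTd, hd]; ring
  have hsq : IsSquare ((-(Matrix.of c).det : ℤ) : ℚ) :=
    ⟨d * ((N : ℤ) : ℚ) ^ 6, by rw [Int.cast_neg, hdet]; ring⟩
  obtain ⟨r, hr⟩ := Rat.isSquare_intCast_iff.mp hsq
  refine senary_isotropic_int r.natAbs _ ?_ ?_ ?_ fun q _ h2 => ?_
  · ext i j
    have : (c j i : ℚ) = c i j := by rw [hc, hc, hG.apply]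
    exact_mod_cast this
  · rw [Int.natAbs_ne_zero]
    rintro rfl
    have h0 : (Matrix.of c).det = 0 := by linarith
    rw [h0] at hdet
    have : (d * ((N : ℤ) : ℚ) ^ 6) ^ 2 ≠ 0 := by positivity
    apply this
    rw [Int.cast_zero] at hdet; linarith
  · rw [Int.natCast_natAbs, sq_abs]; linarith
  · rw [hGT]; exact (hl q h2).congr T hT

section Pairs
variable {k : Type*} [Field k]

/-- A standard generating pair `x² = c`, `y² = d`, `xy = -yx`. -/
def IsPair {A : Type*} [Ring A] [Algebra k A] (c d : k) (x y : A) : Prop :=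
  x * x = algebraMap k A c ∧ y * y = algebraMap k A d ∧ x * y = -(y * x)

/-- Isomorphism of quaternion algebras. -/
def Sim (k : Type*) [Field k] (a b c d : k) : Prop := Nonempty (ℍ[k,c,d] ≃ₐ[k] ℍ[k,a,b])

def Split (k : Type*) [Field k] (a b : k) : Prop :=
  ∃ x y z : k, (x ≠ 0 ∨ y ≠ 0 ∨ z ≠ 0) ∧ a * x ^ 2 + b * y ^ 2 = z ^ 2

def HasZeroDiv (A : Type*) [Ring A] : Prop := ∃ u v : A, u ≠ 0 ∧ v ≠ 0 ∧ u * v = 0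

lemma Sim.refl (a b : k) : Sim k a b a b := ⟨AlgEquiv.refl⟩
lemma Sim.symm {a b c d : k} (h : Sim k a b c d) : Sim k c d a b := h.map AlgEquiv.symm
lemma Sim.trans {a b c d e f : k} (h : Sim k a b c d) (h' : Sim k c d e f) : Sim k a b e f :=
  ⟨h'.some.trans h.some⟩

lemma isPair_ij (a b : k) : IsPair (A := ℍ[k,a,b]) a b ⟨0, 1, 0, 0⟩ ⟨0, 0, 1, 0⟩ := by
  refine ⟨?_, ?_, ?_⟩ <;> ext <;> simp [QuaternionAlgebra.algebraMap_eq]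

lemma IsPair.map {A B : Type*} [Ring A] [Algebra k A] [Ring B] [Algebra k B] {c d : k} {x y : A}
    (h : IsPair c d x y) (f : A →ₐ[k] B) : IsPair c d (f x) (f y) := by
  obtain ⟨h1, h2, h3⟩ := h
  exact ⟨by rw [← map_mul, h1, AlgHom.commutes], by rw [← map_mul, h2, AlgHom.commutes],
    by rw [← map_mul, h3, map_neg, map_mul]⟩

lemma Sim.exists_pair {a b c d : k} (h : Sim k a b c d) : ∃ x y : ℍ[k,a,b], IsPair c d x y := by
  obtain ⟨e⟩ := h
  exact ⟨_, _, (isPair_ij c d).map e.toAlgHom⟩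

lemma IsPair.sim (h2 : (2 : k) ≠ 0) {a b c d : k} (hc : c ≠ 0) (hd : d ≠ 0) {x y : ℍ[k,a,b]}
    (h : IsPair c d x y) : Sim k a b c d := by
  obtain ⟨hx, hy, hxy⟩ := h
  let B : QuaternionAlgebra.Basis ℍ[k,a,b] c 0 d :=
    { i := x, j := y, k := x * y
      i_mul_i := by rw [hx, zero_smul, add_zero, Algebra.algebraMap_eq_smul_one]
      j_mul_j := by rw [hy, Algebra.algebraMap_eq_smul_one]
      i_mul_j := rfl
      j_mul_i := by rw [hxy]; simp }
  have hlift : ∀ q : ℍ[k,c,d], B.liftHom q = algebraMap k _ q.re + q.imI • x + q.imJ • y + q.imK • (x * y) :=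
    fun q => rfl
  have hinj : Function.Injective B.liftHom := by
    rw [injective_iff_map_eq_zero]
    intro q hq
    have hxi : B.liftHom ⟨0, 1, 0, 0⟩ = x := by rw [hlift]; simp
    have hyi : B.liftHom ⟨0, 0, 1, 0⟩ = y := by rw [hlift]; simp
    have step : ∀ q : ℍ[k,c,d], B.liftHom q = 0 → q.re ≠ 0 → False := by
      intro q hq h0
      have e1 : B.liftHom (⟨0, 1, 0, 0⟩ * q * ⟨0, 1, 0, 0⟩ + algebraMap k _ c * q) = 0 := by
        rw [map_add, map_mul, map_mul, map_mul, hq]; simp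
      set q1 : ℍ[k,c,d] := ⟨0, 1, 0, 0⟩ * q * ⟨0, 1, 0, 0⟩ + algebraMap k _ c * q with hq1
      have e2 : B.liftHom (⟨0, 0, 1, 0⟩ * q1 * ⟨0, 0, 1, 0⟩ + algebraMap k _ d * q1) = 0 := by
        rw [map_add, map_mul, map_mul, map_mul, e1]; simp
      have e3 : (⟨0, 0, 1, 0⟩ * q1 * ⟨0, 0, 1, 0⟩ + algebraMap k _ d * q1 : ℍ[k,c,d]) =
          algebraMap k _ (2 * 2 * c * d * q.re) := by
        rw [hq1]
        ext <;> simp [QuaternionAlgebra.algebraMap_eq] <;> ring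
      rw [e3, AlgHom.commutes] at e2
      have := (algebraMap k ℍ[k,a,b]).injective (e2.trans (map_zero _).symm)
      simp [h2, hc, hd, h0] at this
    have hm : ∀ r : ℍ[k,c,d], (r * q).re = 0 := fun r => by
      by_contra h
      exact step (r * q) (by rw [map_mul, hq, mul_zero]) h
    have e0 := hm 1
    have e1 := hm ⟨0, 1, 0, 0⟩
    have e2 := hm ⟨0, 0, 1, 0⟩
    have e3 := hm ⟨0, 0, 0, 1⟩
    simp [hc, hd] at e0 e1 e2 e3
    ext <;> simp [e0, e1, e2, e3]
  have hbij : Function.Bijective B.liftHom := by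
    refine ⟨hinj, ?_⟩
    have := LinearMap.injective_iff_surjective_of_finrank_eq_finrank (f := B.liftHom.toLinearMap) (by
      rw [QuaternionAlgebra.finrank_eq_four, QuaternionAlgebra.finrank_eq_four])
    exact this.mp hinj
  exact ⟨AlgEquiv.ofBijective _ hbij⟩

lemma Sim.swap (a b : k) : Sim k a b b a := ⟨QuaternionAlgebra.swapEquiv b a⟩

lemma Sim.norm_mul (h2 : (2 : k) ≠ 0) {a b : k} (ha : a ≠ 0) (hb : b ≠ 0) (r s : k)
    (h : r ^ 2 - a * s ^ 2 ≠ 0) : Sim k a b a (b * (r ^ 2 - a * s ^ 2)) := by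
  refine IsPair.sim h2 ha (mul_ne_zero hb h) (x := ⟨0, 1, 0, 0⟩) (y := ⟨0, 0, r, s⟩) ⟨?_, ?_, ?_⟩ <;>
    ext <;> simp [QuaternionAlgebra.algebraMap_eq] <;> ring

lemma Sim.of_norm_eq (h2 : (2 : k) ≠ 0) {a b b' : k} (ha : a ≠ 0) (hb : b ≠ 0) (r s : k)
    (h : b' = b * (r ^ 2 - a * s ^ 2)) (hb' : b' ≠ 0) : Sim k a b a b' := by
  subst h
  exact Sim.norm_mul h2 ha hb r s (right_ne_zero_of_mul hb')

/-- The reduced norm. -/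
def nrm {R : Type*} [CommRing R] {a b : R} (q : ℍ[R,a,b]) : R :=
  q.re ^ 2 - a * q.imI ^ 2 - b * q.imJ ^ 2 + a * b * q.imK ^ 2

lemma mul_star_eq_nrm {R : Type*} [CommRing R] {a b : R} (q : ℍ[R,a,b]) :
    q * star q = algebraMap R _ (nrm q) := by
  ext <;> simp [QuaternionAlgebra.algebraMap_eq, nrm] <;> ring

lemma star_mul_eq_nrm {R : Type*} [CommRing R] {a b : R} (q : ℍ[R,a,b]) :
    star q * q = algebraMap R _ (nrm q) := by
  ext <;> simp [QuaternionAlgebra.algebraMap_eq, nrm] <;> ring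

lemma hasZeroDiv_iff {a b : k} : HasZeroDiv ℍ[k,a,b] ↔ ∃ q : ℍ[k,a,b], q ≠ 0 ∧ nrm q = 0 := by
  constructor
  · rintro ⟨u, v, hu, hv, huv⟩
    by_contra! h
    apply hv
    have : algebraMap k _ (nrm u) * v = 0 := by rw [← star_mul_eq_nrm, mul_assoc, huv, mul_zero]
    rw [← Algebra.smul_def] at this
    exact (smul_eq_zero.mp this).resolve_left (h u hu)
  · rintro ⟨q, hq, h⟩
    exact ⟨q, star q, hq, by simpa using hq, by rw [mul_star_eq_nrm, h, map_zero]⟩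

lemma split_of_sq {a b c : k} (h : a = c ^ 2) : Split k a b := ⟨1, 0, c, by simp, by simp [h]⟩

lemma split_iff_hasZeroDiv {a b : k} : Split k a b ↔ HasZeroDiv ℍ[k,a,b] := by
  rw [hasZeroDiv_iff]
  constructor
  · rintro ⟨x, y, z, h0, h⟩
    refine ⟨⟨z, x, y, 0⟩, ?_, by simp only [nrm]; linear_combination -h⟩
    intro h
    have := QuaternionAlgebra.ext_iff.mp h
    simp at this
    tauto
  · rintro ⟨q, hq, h⟩
    simp only [nrm] at h
    by_cases h1 : q.imJ ^ 2 - a * q.imK ^ 2 = 0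
    · by_cases h3 : q.imK = 0
      · have h4 : q.imJ = 0 := by simpa [h3] using h1
        refine ⟨q.imI, 0, q.re, ?_, by rw [h3, h4] at h; linear_combination -h⟩
        by_contra! h5
        apply hq
        ext <;> simp [h3, h4, h5]
      · refine ⟨q.imK, 0, q.imJ, Or.inl h3, by linear_combination -h1⟩
    · refine ⟨q.re * q.imK + q.imI * q.imJ, q.imJ ^ 2 - a * q.imK ^ 2, q.re * q.imJ + a * q.imI * q.imK,
        Or.inr (Or.inl h1), ?_⟩
      linear_combination (-(q.imJ ^ 2 - a * q.imK ^ 2)) * h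

lemma HasZeroDiv.equiv {A B : Type*} [Ring A] [Ring B] (h : HasZeroDiv A) (e : A ≃+* B) :
    HasZeroDiv B := by
  obtain ⟨u, v, hu, hv, huv⟩ := h
  exact ⟨e u, e v, by simpa using hu, by simpa using hv, by rw [← map_mul, huv, map_zero]⟩

lemma Sim.split {a b c d : k} (h : Sim k a b c d) (hs : Split k a b) : Split k c d :=
  split_iff_hasZeroDiv.mpr ((split_iff_hasZeroDiv.mp hs).equiv h.some.symm.toRingEquiv)

lemma Split.swap {a b : k} (h : Split k a b) : Split k b a := (Sim.swap a b).split h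

lemma Split.norm_or_sq {a b : k} (h : Split k a b) : (∃ c, a = c ^ 2) ∨ ∃ r s, b = r ^ 2 - a * s ^ 2 := by
  obtain ⟨x, y, z, h0, h⟩ := h
  by_cases hy : y = 0
  · left
    have hx : x ≠ 0 := by
      rintro rfl
      simp [hy] at h h0
      exact h0 (by simpa using h.symm)
    exact ⟨z / x, by rw [hy] at h; field_simp; linear_combination h⟩
  · right
    exact ⟨z / y, x / y, by field_simp; linear_combination h⟩

lemma Split.of_norm {a b r s : k} (h : b = r ^ 2 - a * s ^ 2) : Split k a b :=
  ⟨s, 1, r, by simp, by rw [h]; ring⟩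

lemma Split.mul {a b c : k} (h : Split k a b) (h' : Split k a c) : Split k a (b * c) := by
  rcases h.norm_or_sq with ⟨e, he⟩ | ⟨r, s, hb⟩
  · exact split_of_sq he
  rcases h'.norm_or_sq with ⟨e, he⟩ | ⟨r', s', hc⟩
  · exact split_of_sq he
  exact Split.of_norm (r := r * r' + a * s * s') (s := r * s' + r' * s) (by rw [hb, hc]; ring)

lemma Split.sim_one (h2 : (2 : k) ≠ 0) {a b : k} (ha : a ≠ 0) (hb : b ≠ 0) (h : Split k a b) :
    Sim k a b 1 1 := by
  have key : ∀ {c : k}, c ≠ 0 → Sim k 1 c 1 1 := fun {c} hc =>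
    Sim.of_norm_eq h2 one_ne_zero hc ((1 + 1 / c) / 2) ((1 / c - 1) / 2) (by field_simp; ring)
      one_ne_zero
  rcases h.norm_or_sq with ⟨c, hc⟩ | ⟨r, s, hr⟩
  · have hc0 : c ≠ 0 := by rintro rfl; simp [hc] at ha
    refine (Sim.swap a b).trans (((Sim.of_norm_eq h2 hb ha (1 / c) 0 (b' := 1) ?_ one_ne_zero)).trans
      ((Sim.swap _ _).trans (key hb)))
    rw [hc]; field_simp; ring
  · refine (Sim.of_norm_eq h2 ha hb (r / b) (s / b) (b' := 1) ?_ one_ne_zero).trans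
      ((Sim.swap _ _).trans (key ha))
    field_simp; exact hr

lemma Split.sim (h2 : (2 : k) ≠ 0) {a b c d : k} (ha : a ≠ 0) (hb : b ≠ 0) (hc : c ≠ 0) (hd : d ≠ 0)
    (h : Split k a b) (h' : Split k c d) : Sim k a b c d :=
  (h.sim_one h2 ha hb).trans (h'.sim_one h2 hc hd).symm

lemma IsPair.re_eq_zero (h2 : (2 : k) ≠ 0) {a b c d : k} (hd : d ≠ 0) {x y : ℍ[k,a,b]}
    (h : IsPair c d x y) : x.re = 0 := by
  obtain ⟨hx, hy, hxy⟩ := h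
  by_contra h0
  have e := QuaternionAlgebra.ext_iff.mp hx
  simp [QuaternionAlgebra.algebraMap_eq] at e
  obtain ⟨e0, e1, e2, e3⟩ := e
  have f1 : x.imI = 0 := by
    have : 2 * x.re * x.imI = 0 := by linear_combination e1
    simpa [h2, h0] using this
  have f2 : x.imJ = 0 := by
    have : 2 * x.re * x.imJ = 0 := by linear_combination e2
    simpa [h2, h0] using this
  have f3 : x.imK = 0 := by
    have : 2 * x.re * x.imK = 0 := by linear_combination e3
    simpa [h2, h0] using this
  have hxe : x = algebraMap k _ x.re := by
    ext <;> simp [QuaternionAlgebra.algebraMap_eq, f1, f2, f3]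
  rw [hxe, ← Algebra.commutes, ← Algebra.smul_def] at hxy
  have h4 : (2 * x.re) • y = 0 := by
    rw [mul_smul, two_smul]; nth_rewrite 1 [hxy]; simp
  have : y = 0 := (smul_eq_zero.mp h4).resolve_left (mul_ne_zero h2 h0)
  rw [this, mul_zero] at hy
  exact hd ((algebraMap k ℍ[k,a,b]).injective (by rw [← hy, map_zero]))

lemma IsPair.swap {A : Type*} [Ring A] [Algebra k A] {c d : k} {x y : A} (h : IsPair c d x y) :
    IsPair d c y x := ⟨h.2.1, h.1, by rw [h.2.2, neg_neg]⟩

/-- If one algebra has presentations `(u, v)` and `(u, w)`, then `(u, vw)` is split. -/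
lemma Sim.split_mul (h2 : (2 : k) ≠ 0) {u v w : k} (hu : u ≠ 0)
    (h : Sim k u v u w) : Split k u (v * w) := by
  by_cases hs : Split k u v
  · exact hs.mul (h.split hs)
  obtain ⟨x, y, hp⟩ := h.exists_pair
  have hyre := hp.swap.re_eq_zero h2 hu
  obtain ⟨hx, hy, hxy⟩ := hp
  have main : ∀ z : ℍ[k,u,v], ∀ N : k, N ≠ 0 → z * z = algebraMap k _ (N ^ 2 * w) →
      (⟨0, 1, 0, 0⟩ : ℍ[k,u,v]) * z = -(z * ⟨0, 1, 0, 0⟩) → Split k u (v * w) := by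
    intro z N hN hz1 hz2
    have e := QuaternionAlgebra.ext_iff.mp hz2
    simp at e
    have f1 : z.re = 0 := by
      have : 2 * z.re = 0 := by linear_combination e.2
      simpa [h2] using this
    have f2 : z.imI = 0 := by
      have : 2 * (u * z.imI) = 0 := by linear_combination e.1
      simpa [h2, hu] using this
    have e' := (QuaternionAlgebra.ext_iff.mp hz1).1
    simp [QuaternionAlgebra.algebraMap_eq, f1, f2] at e'
    refine ⟨v * z.imK, N, v * z.imJ, Or.inr (Or.inl hN), ?_⟩
    linear_combination (-v) * e'
  set g : ℍ[k,u,v] := x * ⟨0, 1, 0, 0⟩ + algebraMap k _ u with hg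
  have hii : (⟨0, 1, 0, 0⟩ : ℍ[k,u,v]) * ⟨0, 1, 0, 0⟩ = algebraMap k _ u := (isPair_ij u v).1
  have hxg : x * g = g * ⟨0, 1, 0, 0⟩ := by
    rw [hg, mul_add, add_mul, ← mul_assoc, hx, mul_assoc x, hii, ← Algebra.commutes u x, add_comm]
  by_cases hg0 : g = 0
  · have hxi : x = -⟨0, 1, 0, 0⟩ := by
      have h1 : x * ⟨0, 1, 0, 0⟩ = -algebraMap k _ u := eq_neg_of_add_eq_zero_left hg0
      have h3 : u • x = u • (-⟨0, 1, 0, 0⟩ : ℍ[k,u,v]) := by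
        rw [Algebra.smul_def, Algebra.commutes, ← hii, ← mul_assoc, h1, smul_neg, Algebra.smul_def,
          neg_mul]
      exact smul_right_injective _ hu h3
    refine main y 1 one_ne_zero (by rw [hy]; simp) ?_
    rw [hxi] at hxy
    rwa [neg_mul, mul_neg, neg_inj] at hxy
  have hN : nrm g ≠ 0 := fun h => hs (split_iff_hasZeroDiv.mpr (hasZeroDiv_iff.mpr ⟨g, hg0, h⟩))
  have hsg : (⟨0, 1, 0, 0⟩ : ℍ[k,u,v]) * star g = star g * x := by
    have h1 : star g * (x * g) * star g = star g * (g * ⟨0, 1, 0, 0⟩) * star g := by rw [hxg]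
    have h3 : star g * (x * g) * star g = algebraMap k _ (nrm g) * (star g * x) := by
      rw [← mul_assoc, mul_assoc, mul_star_eq_nrm, Algebra.commutes]
    have h4 : star g * (g * ⟨0, 1, 0, 0⟩) * star g =
        algebraMap k _ (nrm g) * (⟨0, 1, 0, 0⟩ * star g) := by
      rw [← mul_assoc, star_mul_eq_nrm, mul_assoc]
    rw [h3, h4, ← Algebra.smul_def, ← Algebra.smul_def] at h1
    exact (smul_right_injective _ hN h1).symm
  refine main (star g * y * g) (nrm g) hN ?_ ?_
  · calc star g * y * g * (star g * y * g) = star g * y * (g * star g) * y * g := by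
          simp only [mul_assoc]
      _ = star g * (y * y) * g * algebraMap k _ (nrm g) := by
          rw [mul_star_eq_nrm, ← Algebra.commutes (nrm g) (star g * (y * y) * g),
            ← Algebra.commutes (nrm g) (star g * y)]
          simp only [mul_assoc]
      _ = algebraMap k _ (nrm g ^ 2 * w) := by
          rw [hy, ← Algebra.commutes _ (star g), mul_assoc (algebraMap k _ _), star_mul_eq_nrm,
            ← map_mul, ← map_mul]
          congr 1; ring
  · calc ⟨0, 1, 0, 0⟩ * (star g * y * g) = (⟨0, 1, 0, 0⟩ * star g) * y * g := by simp only [mul_assoc]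
      _ = star g * (x * y) * g := by rw [hsg]; simp only [mul_assoc]
      _ = -(star g * y * (x * g)) := by rw [hxy]; simp only [mul_neg, neg_mul, mul_assoc]
      _ = -(star g * y * g * ⟨0, 1, 0, 0⟩) := by rw [hxg]; simp only [mul_assoc]

section BaseChange
variable {k' : Type*} [Field k']

/-- Coordinatewise base change. -/
def quatMap (f : k →+* k') (a b : k) : ℍ[k,a,b] →+* ℍ[k',f a,f b] where
  toFun q := ⟨f q.re, f q.imI, f q.imJ, f q.imK⟩
  map_one' := by ext <;> simp
  map_zero' := by ext <;> simp
  map_add' _ _ := by ext <;> simp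
  map_mul' _ _ := by ext <;> simp

lemma IsPair.quatMap (f : k →+* k') {a b c d : k} {x y : ℍ[k,a,b]} (h : IsPair c d x y) :
    IsPair (f c) (f d) (quatMap f a b x) (quatMap f a b y) := by
  obtain ⟨h1, h2, h3⟩ := h
  refine ⟨?_, ?_, ?_⟩
  · rw [← map_mul, h1]; ext <;> simp [QuatPaper.quatMap, QuaternionAlgebra.algebraMap_eq]
  · rw [← map_mul, h2]; ext <;> simp [QuatPaper.quatMap, QuaternionAlgebra.algebraMap_eq]
  · rw [← map_mul, h3, map_neg, map_mul]

lemma Sim.map (f : k →+* k') (h2 : (2 : k') ≠ 0) {a b c d : k} (hc : c ≠ 0) (hd : d ≠ 0)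
    (h : Sim k a b c d) : Sim k' (f a) (f b) (f c) (f d) := by
  obtain ⟨x, y, hp⟩ := h.exists_pair
  exact (hp.quatMap f).sim h2 (by simpa using hc) (by simpa using hd)

lemma Split.map (f : k →+* k') {a b : k} (h : Split k a b) : Split k' (f a) (f b) := by
  obtain ⟨x, y, z, h0, h⟩ := h
  refine ⟨f x, f y, f z, by simpa using h0, ?_⟩
  simp only [← map_pow, ← map_mul, ← map_add, h]

end BaseChange
end Pairs

section LocalHom
open IsDedekindDomain

lemma norm_le_one_of_isIntegral {k : Type*} [NormedField k] [IsUltrametricDist k] {x : k}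
    (hx : IsIntegral ℤ x) : ‖x‖ ≤ 1 := by
  have h := (Valuation.integer.integers (NormedField.valuation (K := k))).mem_of_integral
    (hx.tower_top (A := (NormedField.valuation (K := k)).integer))
  exact h

variable {F : Type*} [Field F] [NumberField F] {k : Type*} [NormedField k] [IsUltrametricDist k]

lemma norm_map_integer_le_one (σ : F →+* k) (x : 𝓞 F) : ‖σ x‖ ≤ 1 :=
  norm_le_one_of_isIntegral ((NumberField.RingOfIntegers.isIntegral_coe x).map σ.toIntAlgHom)

/-- The prime of `F` induced by an embedding into a nonarchimedean field. -/
def inducedPrime (σ : F →+* k) {q : ℕ} (hq : q ≠ 0) (h : ‖(q : k)‖ < 1) :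
    HeightOneSpectrum (𝓞 F) where
  asIdeal :=
    { carrier := {x | ‖σ x‖ < 1}
      zero_mem' := by simp
      add_mem' := fun {x y} hx hy => by
        simp only [Set.mem_ofPred_eq, map_add] at *
        exact (IsUltrametricDist.norm_add_le_max _ _).trans_lt (max_lt hx hy)
      smul_mem' := fun c x hx => by
        simp only [Set.mem_ofPred_eq, smul_eq_mul, map_mul, norm_mul] at *
        exact mul_lt_one_of_nonneg_of_lt_one_right (norm_map_integer_le_one σ c) (norm_nonneg _) hx }
  isPrime := by
    refine ⟨?_, ?_⟩
    · rw [Ideal.ne_top_iff_one]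
      show ¬ ‖σ _‖ < 1
      simp
    · intro x y hxy
      by_contra! hh
      simp only [Submodule.mem_mk, AddSubmonoid.mem_mk, AddSubsemigroup.mem_mk, Set.mem_ofPred_eq,
        not_lt] at hh hxy
      have e : ‖σ (x * y : 𝓞 F)‖ = ‖σ x‖ * ‖σ y‖ := by simp
      have : (1 : ℝ) ≤ ‖σ x‖ * ‖σ y‖ := one_le_mul_of_one_le_of_one_le hh.1 hh.2
      exact absurd hxy (not_lt.mpr (this.trans e.ge))
  ne_bot := by
    intro hb
    have : (q : 𝓞 F) ∈ (⊥ : Ideal (𝓞 F)) := by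
      rw [← hb]
      show ‖σ ((q : 𝓞 F) : F)‖ < 1
      simpa using h
    simp [hq] at this

lemma norm_le_one_of_valuation_le_one (σ : F →+* k) {q : ℕ} (hq : q ≠ 0) (h : ‖(q : k)‖ < 1) (x : F)
    (hx : (inducedPrime σ hq h).valuation F x ≤ 1) : ‖σ x‖ ≤ 1 := by
  obtain ⟨a, s, e⟩ := HeightOneSpectrum.exists_primeCompl_mul_eq_of_integer _ x hx
  have hs : ‖σ ((s : 𝓞 F) : F)‖ = 1 := by
    refine le_antisymm (norm_map_integer_le_one σ _) ?_
    have : ¬ (s : 𝓞 F) ∈ (inducedPrime σ hq h).asIdeal := s.2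
    exact not_lt.mp this
  have := norm_map_integer_le_one σ a
  rwa [show ((a : 𝓞 F) : F) = _ from e.symm, map_mul, norm_mul, hs, mul_one] at this

lemma exists_hom_adicCompletion [CompleteSpace k] (σ : F →+* k) {q : ℕ} (hq : q ≠ 0)
    (h : ‖(q : k)‖ < 1) : ∃ v : HeightOneSpectrum (𝓞 F), ∃ φ : v.adicCompletion F →+* k,
      ∀ x, φ (algebraMap F _ x) = σ x := by
  set v := inducedPrime σ hq h with hv
  refine ⟨v, ?_⟩
  let f : WithVal (v.valuation F) →+* k := σ.comp (WithVal.equiv (v.valuation F)).toRingHom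
  have hf : Continuous f := by
    refine continuous_of_continuousAt_zero f ?_
    rw [ContinuousAt, map_zero, Metric.tendsto_nhds]
    intro ε hε
    obtain ⟨n, hn⟩ := exists_pow_lt_of_lt_one hε h

    have hq1 : (Valued.v (R := WithVal (v.valuation F))).restrict
        (WithVal.toVal (v.valuation F) ((q : F) ^ n)) ≠ 0 := by
      simp [hq]
    filter_upwards [Valued.mem_nhds_zero.mpr ⟨Units.mk0 _ hq1, subset_rfl⟩] with x hx
    rw [Units.val_mk0, Valuation.restrict_lt_iff] at hx
    have hx' : v.valuation F x.ofVal < v.valuation F ((q : F) ^ n) := hx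
    have h1 := norm_le_one_of_valuation_le_one σ hq h (x.ofVal / (q : F) ^ n) (by
      rw [map_div₀]
      exact div_le_one_of_le₀ hx'.le zero_le)
    rw [map_div₀, norm_div, map_pow, map_natCast, norm_pow] at h1
    rw [dist_zero_right]
    refine lt_of_le_of_lt ?_ hn
    by_cases hz : ‖(q : k)‖ = 0
    · have : (q : k) = 0 := norm_eq_zero.mp hz
      rw [← map_natCast σ, map_eq_zero] at this
      simp [hq] at this
    · have hz' : 0 < ‖(q : k)‖ ^ n := by positivity
      rw [div_le_one hz'] at h1
      exact h1
  refine ⟨(UniformSpace.Completion.extensionHom f hf).comp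
    (HeightOneSpectrum.adicCompletion.equiv F v).toRingHom, fun x => ?_⟩
  have : HeightOneSpectrum.adicCompletion.equiv F v (algebraMap F _ x) =
     ((WithVal.toVal (v.valuation F) x : WithVal (v.valuation F)) : (v.valuation F).Completion) := rfl
  simp only [RingEquiv.toRingHom_eq_coe, RingHom.comp_apply, RingHom.coe_coe, this]
  rw [UniformSpace.Completion.extensionHom_coe]
  rfl

end LocalHom

lemma hasZeroDiv_matrix {k : Type*} [Field k] : HasZeroDiv (Matrix (Fin 2) (Fin 2) k) := by
  refine ⟨!![1, 0; 0, 0], !![0, 0; 0, 1], fun h => ?_, fun h => ?_, ?_⟩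
  · simpa using congrFun (congrFun h 0) 0
  · simpa using congrFun (congrFun h 1) 1
  · ext i j; fin_cases i <;> fin_cases j <;> simp

lemma split_of_unram {F : Type} [Field F] [NumberField F] {A B : F}
    (hunram : ∀ v : IsDedekindDomain.HeightOneSpectrum (𝓞 F),
      Nonempty
        (ℍ[v.adicCompletion F, algebraMap F (v.adicCompletion F) A,
            algebraMap F (v.adicCompletion F) B] ≃ₐ[v.adicCompletion F]
          Matrix (Fin 2) (Fin 2) (v.adicCompletion F)))
    {k : Type*} [NormedField k] [IsUltrametricDist k] [CompleteSpace k] (σ : F →+* k) {q : ℕ}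
    (hq : q ≠ 0) (h : ‖(q : k)‖ < 1) : Split k (σ A) (σ B) := by
  obtain ⟨v, φ, hφ⟩ := exists_hom_adicCompletion σ hq h
  rw [← hφ, ← hφ]
  exact (split_iff_hasZeroDiv.mpr
    (hasZeroDiv_matrix.equiv (hunram v).some.symm.toRingEquiv)).map φ

section QuadraticField

lemma quad_coords {E : Type*} [Field E] [CharZero E] {n : ℚ} {s : E} (hs : s ^ 2 = (n : E))
    (hgen : Algebra.adjoin ℚ {s} = ⊤) (x : E) : ∃ a b : ℚ, x = a + b * s := by
  have hx : x ∈ Algebra.adjoin ℚ {s} := hgen ▸ Algebra.mem_top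
  induction hx using Algebra.adjoin_induction with
  | mem x hx => exact ⟨0, 1, by rw [Set.mem_singleton_iff.mp hx]; simp⟩
  | algebraMap r => exact ⟨r, 0, by simp⟩
  | add x y _ _ hx hy =>
    obtain ⟨a, b, rfl⟩ := hx
    obtain ⟨c, d, rfl⟩ := hy
    exact ⟨a + c, b + d, by push_cast; ring⟩
  | mul x y _ _ hx hy =>
    obtain ⟨a, b, rfl⟩ := hx
    obtain ⟨c, d, rfl⟩ := hy
    exact ⟨a * c + b * d * n, a * d + b * c, by push_cast; linear_combination (b * d : E) * hs⟩

lemma quad_indep {E : Type*} [Field E] [CharZero E] {n : ℚ} {s : E} (hs : s ^ 2 = (n : E))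
    (hn : ¬ IsSquare n) {a b : ℚ} (h : (a + b * s : E) = 0) : a = 0 ∧ b = 0 := by
  have hb : b = 0 := by
    by_contra hb
    apply hn
    refine ⟨-a / b, ?_⟩
    have h1 : (b : E) ≠ 0 := by exact_mod_cast hb
    have : s = -(a : E) / b := by field_simp; linear_combination h
    rw [this] at hs
    have : (-(a / b) : ℚ) ^ 2 = n := by
      rw [← neg_div]; exact_mod_cast hs
    rw [← this]; ring
  subst hb
  exact ⟨by simpa using h, rfl⟩

lemma quad_indep' {E : Type*} [Field E] [CharZero E] {n : ℚ} {s : E} (hs : s ^ 2 = (n : E))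
    (hn : ¬ IsSquare n) {a b c d : ℚ} (h : (a + b * s : E) = c + d * s) : a = c ∧ b = d := by
  have := quad_indep hs hn (a := a - c) (b := b - d) (by push_cast; linear_combination h)
  exact ⟨sub_eq_zero.mp this.1, sub_eq_zero.mp this.2⟩

lemma quad_hom {E : Type*} [Field E] [CharZero E] {n : ℚ} {s : E} (hs : s ^ 2 = (n : E))
    (hn : ¬ IsSquare n) (hgen : Algebra.adjoin ℚ {s} = ⊤) {M : Type*} [Field M] [CharZero M] {t : M}
    (ht : t ^ 2 = (n : M)) : ∃ σ : E →+* M, ∀ a b : ℚ, σ (a + b * s) = a + b * t := by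
  choose re im h using quad_coords hs hgen
  have huniq : ∀ {a b : ℚ} {x : E}, x = a + b * s → re x = a ∧ im x = b := fun {a b x} hx =>
    quad_indep' hs hn ((h x).symm.trans hx)
  have hadd : ∀ x y, re (x + y) = re x + re y ∧ im (x + y) = im x + im y := fun x y =>
    huniq (by nth_rewrite 1 [h x, h y]; push_cast; ring)
  have hmul : ∀ x y, re (x * y) = re x * re y + im x * im y * n ∧
      im (x * y) = re x * im y + im x * re y := fun x y =>
    huniq (by
      nth_rewrite 1 [h x, h y]; push_cast
      linear_combination (im x * im y : E) * hs)
  refine ⟨{ toFun := fun x => re x + im x * t, map_one' := ?_, map_zero' := ?_, map_add' := ?_,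
            map_mul' := ?_ }, ?_⟩
  · obtain ⟨h1, h2⟩ := huniq (a := 1) (b := 0) (x := 1) (by simp)
    simp [h1, h2]
  · intro x y
    simp only [(hmul x y).1, (hmul x y).2]
    push_cast
    linear_combination (-(im x * im y) : M) * ht
  · obtain ⟨h1, h2⟩ := huniq (a := 0) (b := 0) (x := 0) (by simp)
    simp [h1, h2]
  · intro x y
    simp only [(hadd x y).1, (hadd x y).2]
    push_cast
    ring
  · intro a b
    obtain ⟨h1, h2⟩ := huniq (a := a) (b := b) rfl
    simp [h1, h2]

end QuadraticField

/-- `a + b√p` over a field containing `ℚ`, as an element of the quadratic algebra. -/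
def LocSplit (p : ℕ) (A0 A1 B0 B1 : ℚ) (q : ℕ) [Fact q.Prime] : Prop :=
  (∀ t : ℚ_[q], t ^ 2 = p → Split ℚ_[q] (A0 + A1 * t) (B0 + B1 * t)) ∧
  (∀ _ : Fact (∀ r : ℚ_[q], r ^ 2 ≠ p + 0 * r),
    Split (QuadraticAlgebra ℚ_[q] p 0) ⟨A0, A1⟩ ⟨B0, B1⟩)

lemma not_isSquare_prime {p : ℕ} (hp : p.Prime) : ¬ IsSquare (p : ℚ) := by
  rw [Rat.isSquare_natCast_iff]
  exact fun h => hp.prime.not_isSquare h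

lemma locSplit_of_unram {F : Type} [Field F] [NumberField F] {p : ℕ} (hp : p.Prime) {s : F}
    (hs : s ^ 2 = (p : F)) (hgen : Algebra.adjoin ℚ {s} = ⊤) {A0 A1 B0 B1 : ℚ} {A B : F}
    (hA : A = A0 + A1 * s) (hB : B = B0 + B1 * s)
    (hunram : ∀ v : IsDedekindDomain.HeightOneSpectrum (𝓞 F),
      Nonempty
        (ℍ[v.adicCompletion F, algebraMap F (v.adicCompletion F) A,
            algebraMap F (v.adicCompletion F) B] ≃ₐ[v.adicCompletion F]
          Matrix (Fin 2) (Fin 2) (v.adicCompletion F)))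
    (q : ℕ) [hq : Fact q.Prime] : LocSplit p A0 A1 B0 B1 q := by
  have hs' : s ^ 2 = ((p : ℚ) : F) := by simpa using hs
  have hq0 : q ≠ 0 := hq.out.ne_zero
  have hn := not_isSquare_prime hp
  constructor
  · intro t ht
    obtain ⟨σ, hσ⟩ := quad_hom hs' hn hgen (M := ℚ_[q]) (t := t) (by simpa using ht)
    have := split_of_unram hunram σ hq0 (by simpa using Padic.norm_p_lt_one (p := q))
    rwa [hA, hB, hσ, hσ] at this
  · intro hf
    have hc : CharZero (QuadraticAlgebra ℚ_[q] (p : ℚ_[q]) 0) := inferInstance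
    have hcast : ∀ a : ℚ, (a : QuadraticAlgebra ℚ_[q] (p : ℚ_[q]) 0) = ⟨a, 0⟩ := fun a => by
      rw [← QuadraticAlgebra.algebraMap_eq, map_ratCast]
    obtain ⟨σ, hσ⟩ := quad_hom hs' hn hgen (M := QuadraticAlgebra ℚ_[q] (p : ℚ_[q]) 0)
      (t := ⟨0, 1⟩) (by rw [hcast]; ext <;> simp [pow_two])
    let := spectralNorm.normedField ℚ_[q] (QuadraticAlgebra ℚ_[q] (p : ℚ_[q]) 0)
    have : IsUltrametricDist (QuadraticAlgebra ℚ_[q] (p : ℚ_[q]) 0) :=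
      IsUltrametricDist.isUltrametricDist_of_isNonarchimedean_norm isNonarchimedean_spectralNorm
    have : CompleteSpace (QuadraticAlgebra ℚ_[q] (p : ℚ_[q]) 0) :=
      spectralNorm.completeSpace ℚ_[q] _
    have hlt : ‖((q : ℕ) : QuadraticAlgebra ℚ_[q] (p : ℚ_[q]) 0)‖ < 1 := by
      rw [← map_natCast (algebraMap ℚ_[q] (QuadraticAlgebra ℚ_[q] (p : ℚ_[q]) 0))]
      refine (spectralNorm_extends (K := ℚ_[q]) _).trans_lt ?_
      simpa using Padic.norm_p_lt_one (p := q)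
    have := split_of_unram hunram σ hq0 hlt
    rw [hA, hB, hσ, hσ, hcast, hcast, hcast, hcast] at this
    convert! this using 1 <;> ext <;> simp

section Legendre

lemma isSquare_zmod_of_padic {q : ℕ} [Fact q.Prime] {a : ℤ} {c : ℚ_[q]} (h : ‖c ^ 2 - a‖ < 1) :
    IsSquare (a : ZMod q) := by
  have hc : ‖c‖ ≤ 1 := by
    have h1 : ‖c ^ 2‖ ≤ 1 := by
      have : c ^ 2 = (c ^ 2 - a) + a := by ring
      rw [this]
      exact (Padic.nonarchimedean _ _).trans (max_le h.le (Padic.norm_int_le_one a))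
    rw [norm_pow] at h1
    exact (sq_le_one_iff₀ (norm_nonneg _)).mp h1
  obtain ⟨c', rfl⟩ : ∃ c' : ℤ_[q], (c' : ℚ_[q]) = c := ⟨⟨c, hc⟩, rfl⟩
  have h2 : (c' ^ 2 - (a : ℤ_[q])) ∈ RingHom.ker (PadicInt.toZMod (p := q)) := by
    rw [PadicInt.ker_toZMod, IsLocalRing.mem_maximalIdeal, mem_nonunits_iff, PadicInt.isUnit_iff,
      PadicInt.norm_def]
    push_cast
    exact h.ne
  rw [RingHom.mem_ker, map_sub, map_pow, map_intCast, sub_eq_zero] at h2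
  exact ⟨_, by rw [← h2, pow_two]⟩

lemma norm_sq_ne_inv {q : ℕ} [hq : Fact q.Prime] (r : ℚ_[q]) : ‖r‖ ^ 2 ≠ (q : ℝ)⁻¹ := by
  intro h
  have hr : r ≠ 0 := by
    rintro rfl
    have := hq.out.ne_zero
    simp at h
    exact this (by exact_mod_cast h.symm)
  rw [Padic.norm_eq_zpow_neg_valuation hr, ← zpow_natCast, ← zpow_mul, ← zpow_neg_one] at h
  have := zpow_right_injective₀ (by exact_mod_cast hq.out.pos) (by exact_mod_cast hq.out.one_lt.ne') h
  simp at this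
  omega

lemma isSquare_zmod_of_split {q : ℕ} [hq : Fact q.Prime] {a b : ℤ} (hb : ‖(b : ℚ_[q])‖ = (q : ℝ)⁻¹)
    (h : Split ℚ_[q] a b) : IsSquare (a : ZMod q) := by
  have hq1 : (1 : ℝ) < q := by exact_mod_cast hq.out.one_lt
  rcases h.norm_or_sq with ⟨c, hc⟩ | ⟨r, s, hrs⟩
  · exact isSquare_zmod_of_padic (c := c) (by simp [hc])
  · by_cases hs : 1 ≤ ‖s‖
    · have hs0 : s ≠ 0 := by rintro rfl; simp at hs; linarith
      refine isSquare_zmod_of_padic (c := r / s) ?_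
      have : (r / s) ^ 2 - a = b / s ^ 2 := by rw [hrs]; field_simp
      rw [this, norm_div, hb, norm_pow, div_lt_one (by positivity)]
      exact (inv_lt_one_of_one_lt₀ hq1).trans_le (one_le_pow₀ hs)
    · exfalso
      push Not at hs
      have hsq : ‖s‖ ≤ (q : ℝ)⁻¹ := by
        have := (Padic.norm_le_pow_iff_norm_lt_pow_add_one s (-1)).mpr (by simpa using hs)
        simpa using this
      have h1 : ‖(a : ℚ_[q]) * s ^ 2‖ < (q : ℝ)⁻¹ := by
        rw [norm_mul, norm_pow]
        have h3 : ‖s‖ ^ 2 < (q : ℝ)⁻¹ := by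
          have : ‖s‖ ^ 2 ≤ (q : ℝ)⁻¹ * ‖s‖ := by nlinarith [norm_nonneg s]
          have : (q : ℝ)⁻¹ * ‖s‖ < (q : ℝ)⁻¹ := by nlinarith [inv_pos.mpr (zero_lt_one.trans hq1)]
          linarith
        have := Padic.norm_int_le_one (p := q) a
        nlinarith [sq_nonneg ‖s‖]
      have h2 : ‖r ^ 2‖ = (q : ℝ)⁻¹ := by
        have : r ^ 2 = b + a * s ^ 2 := by rw [hrs]; ring
        rw [this, Padic.add_eq_max_of_ne (by rw [hb]; exact h1.ne'), hb, max_eq_left h1.le]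
      rw [norm_pow] at h2
      exact norm_sq_ne_inv r h2

lemma isSquare_zmod_of_squarefree (a : ℤ) (n : ℕ) (hn : Squarefree n)
    (h : ∀ q : ℕ, q.Prime → q ∣ n → IsSquare (a : ZMod q)) : IsSquare (a : ZMod n) := by
  induction n using induction_on_primes with
  | zero => simp at hn
  | one => exact ⟨0, Subsingleton.elim _ _⟩
  | prime_mul q m hq ih =>
    have hc : Nat.Coprime q m := Nat.coprime_of_squarefree_mul hn
    obtain ⟨x, hx⟩ := h q hq (Dvd.intro _ rfl)
    obtain ⟨y, hy⟩ := ih (hn.squarefree_of_dvd (Dvd.intro_left _ rfl))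
      fun r hr hrm => h r hr (hrm.mul_left _)
    refine ⟨(ZMod.chineseRemainder hc).symm (x, y), ?_⟩
    apply (ZMod.chineseRemainder hc).injective
    rw [map_mul, RingEquiv.apply_symm_apply, map_intCast]
    ext
    · simpa using hx
    · simpa using hy

lemma Sim.mul_sq {k : Type*} [Field k] (h2 : (2 : k) ≠ 0) {a b : k} (ha : a ≠ 0) (hb : b ≠ 0)
    {d : k} (hd : d ≠ 0) : Sim k a b a (b * d ^ 2) :=
  Sim.of_norm_eq h2 ha hb d 0 (by ring) (by positivity)

lemma norm_intCast_eq_inv {q : ℕ} [hq : Fact q.Prime] {b : ℤ} (h : Squarefree b) (hqb : (q : ℤ) ∣ b) :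
    ‖(b : ℚ_[q])‖ = (q : ℝ)⁻¹ := by
  obtain ⟨c, rfl⟩ := hqb
  have hc : ¬ (q : ℤ) ∣ c := by
    rintro ⟨d, rfl⟩
    have := h q ⟨d, by ring⟩
    exact (Nat.prime_iff_prime_int.mp hq.out).not_isUnit this
  push_cast
  rw [norm_mul, Padic.norm_p]
  have : ‖(c : ℚ_[q])‖ = 1 := by
    refine le_antisymm (Padic.norm_int_le_one c) (not_lt.mp fun h => hc ?_)
    exact Padic.norm_intCast_lt_one_iff.mp h
  rw [this, mul_one]

lemma legendre_int (N : ℕ) : ∀ a b : ℤ, a ≠ 0 → b ≠ 0 → a.natAbs + b.natAbs ≤ N →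
    (∀ (q : ℕ) [Fact q.Prime], q ≠ 2 → Split ℚ_[q] (a : ℚ) (b : ℚ)) →
    Split ℚ (a : ℚ) b ∨ Sim ℚ (a : ℚ) b (-1) (-1) := by
  induction N with
  | zero => intro a b ha hb h; simp at h; exact absurd h.1 ha
  | succ N ih =>
    have key : ∀ a b : ℤ, a ≠ 0 → b ≠ 0 → a.natAbs ≤ b.natAbs → a.natAbs + b.natAbs ≤ N + 1 →
        (∀ (q : ℕ) [Fact q.Prime], q ≠ 2 → Split ℚ_[q] (a : ℚ) (b : ℚ)) →
        Split ℚ (a : ℚ) b ∨ Sim ℚ (a : ℚ) b (-1) (-1) := by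
      intro a b ha hb hab hN hl
      have ha' : (a : ℚ) ≠ 0 := by exact_mod_cast ha
      have hb' : (b : ℚ) ≠ 0 := by exact_mod_cast hb
      have reduce : ∀ b' : ℤ, b' ≠ 0 → b'.natAbs < b.natAbs → Sim ℚ (a : ℚ) b a b' →
          Split ℚ (a : ℚ) b ∨ Sim ℚ (a : ℚ) b (-1) (-1) := by
        intro b' hb0 hlt hsim
        have hb0' : (b' : ℚ) ≠ 0 := by exact_mod_cast hb0
        rcases ih a b' ha hb0 (by omega) (fun q _ hq =>
          (hsim.map (algebraMap ℚ ℚ_[q]) two_ne_zero ha' hb0').split (hl q hq)) with h | h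
        · exact Or.inl (hsim.symm.split h)
        · exact Or.inr (hsim.trans h)
      by_cases hsf : Squarefree b
      · by_cases hb1 : b.natAbs = 1
        · have ha1 : a.natAbs = 1 := by have := Int.natAbs_pos.mpr ha; omega
          rcases Int.natAbs_eq_iff.mp ha1 with rfl | rfl
          · exact Or.inl (split_of_sq (c := 1) (by simp))
          · rcases Int.natAbs_eq_iff.mp hb1 with rfl | rfl
            · exact Or.inl (split_of_sq (c := 1) (by simp)).swap
            · exact Or.inr (by simpa using Sim.refl _ _)
        · have hbpos := Int.natAbs_pos.mpr hb
          have hsq : IsSquare (a : ZMod b.natAbs) := by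
            refine isSquare_zmod_of_squarefree a _ (Int.squarefree_natAbs.mpr hsf) ?_
            intro q hq hqb
            by_cases hq2 : q = 2
            · subst hq2
              have : ∀ x : ZMod 2, IsSquare x := by decide
              exact this _
            · have := Fact.mk hq
              have := hl q hq2
              push_cast at this
              exact isSquare_zmod_of_split (norm_intCast_eq_inv hsf (Int.natCast_dvd.mpr hqb)) this
          obtain ⟨x, hx⟩ := hsq
          have : NeZero b.natAbs := ⟨hbpos.ne'⟩
          set t := x.valMinAbs with ht
          have hdvd : b ∣ t ^ 2 - a := by
            rw [← Int.natAbs_dvd, ← ZMod.intCast_zmod_eq_zero_iff_dvd]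
            push_cast
            rw [ht, ZMod.coe_valMinAbs, hx]
            ring
          obtain ⟨b', hb'e⟩ := hdvd
          have htle : t.natAbs ≤ b.natAbs / 2 := ZMod.natAbs_valMinAbs_le x
          by_cases hb0 : b' = 0
          · left
            refine split_of_sq (c := (t : ℚ)) ?_
            have : t ^ 2 = a := by rw [hb0] at hb'e; linarith
            exact_mod_cast this.symm
          · have hb0' : (b' : ℚ) ≠ 0 := by exact_mod_cast hb0
            refine reduce b' hb0 ?_ ?_
            · have h1 : (b.natAbs * b'.natAbs : ℤ) ≤ t.natAbs ^ 2 + a.natAbs := by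
                have : |b * b'| ≤ |t ^ 2| + |a| := by rw [← hb'e]; exact abs_sub _ _
                rw [abs_mul, abs_pow] at this
                simpa [Int.natCast_natAbs] using this
              have h3 : 2 * t.natAbs ≤ b.natAbs := by omega
              have h4 : b.natAbs * b'.natAbs ≤ t.natAbs ^ 2 + a.natAbs := by exact_mod_cast h1
              have h5 : 2 ≤ b.natAbs := by omega
              by_contra! hge
              have h6 := Nat.mul_le_mul_right t.natAbs h3
              have h7 := Nat.mul_le_mul_left b.natAbs h3
              have h8 : b.natAbs * b.natAbs ≤ b.natAbs * b'.natAbs := Nat.mul_le_mul le_rfl hge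
              have h9 : 2 * b.natAbs ≤ b.natAbs * b.natAbs := Nat.mul_le_mul h5 le_rfl
              nlinarith
            · have hq : (b : ℚ) * b' = t ^ 2 - a := by exact_mod_cast hb'e.symm
              refine Sim.symm (Sim.of_norm_eq two_ne_zero ha' hb0' (t / b') (1 / b') ?_ hb')
              field_simp
              linear_combination hq
      · rw [Squarefree] at hsf
        push Not at hsf
        obtain ⟨d, ⟨c, rfl⟩, hd⟩ := hsf
        have hd0 : d ≠ 0 := by rintro rfl; simp at hb
        have hc0 : c ≠ 0 := by rintro rfl; simp at hb
        have hd0' : (d : ℚ) ≠ 0 := by exact_mod_cast hd0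
        have hc0' : (c : ℚ) ≠ 0 := by exact_mod_cast hc0
        refine reduce c hc0 ?_ ?_
        · rw [Int.natAbs_mul, Int.natAbs_mul]
          have h1 : d.natAbs ≠ 1 := fun h => hd (Int.isUnit_iff_natAbs_eq.mpr h)
          have h2 := Int.natAbs_pos.mpr hd0
          have h3 := Int.natAbs_pos.mpr hc0
          have : 2 ≤ d.natAbs := by omega
          nlinarith [Nat.mul_le_mul this this]
        · have := Sim.mul_sq two_ne_zero ha' hc0' hd0'
          push_cast
          rw [show (d * d * c : ℚ) = c * d ^ 2 by ring]
          exact this.symm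
    intro a b ha hb hN hl
    rcases le_total a.natAbs b.natAbs with h | h
    · exact key a b ha hb h hN hl
    · rcases key b a hb ha h (by omega) (fun q _ hq => (hl q hq).swap) with h | h
      · exact Or.inl h.swap
      · exact Or.inr ((Sim.swap _ _).trans h)

lemma exists_int_mul_sq (a : ℚ) (ha : a ≠ 0) : ∃ (m : ℤ) (d : ℚ), m ≠ 0 ∧ d ≠ 0 ∧ (m : ℚ) = a * d ^ 2 := by
  refine ⟨a.num * a.den, a.den, mul_ne_zero (Rat.num_ne_zero.mpr ha) (by simp), by simp, ?_⟩
  have := Rat.mul_den_eq_num a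
  push_cast
  rw [← this]
  ring

/-- A rational quaternion algebra split at all odd primes is split or Hamiltonian. -/
lemma legendre (a b : ℚ) (ha : a ≠ 0) (hb : b ≠ 0)
    (hl : ∀ (q : ℕ) [Fact q.Prime], q ≠ 2 → Split ℚ_[q] a b) :
    Split ℚ a b ∨ Sim ℚ a b (-1) (-1) := by
  obtain ⟨m, d, hm, hd, hmd⟩ := exists_int_mul_sq a ha
  obtain ⟨n, e, hn, he, hne⟩ := exists_int_mul_sq b hb
  have hm' : (m : ℚ) ≠ 0 := by exact_mod_cast hm
  have hn' : (n : ℚ) ≠ 0 := by exact_mod_cast hn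
  have hsim : Sim ℚ a b m n := by
    rw [hmd, hne]
    exact (Sim.mul_sq two_ne_zero ha hb he).trans ((Sim.swap _ _).trans
      ((Sim.mul_sq two_ne_zero (hne ▸ hn') ha hd).trans (Sim.swap _ _)))
  rcases legendre_int _ m n hm hn le_rfl (fun q _ hq =>
    (hsim.map (algebraMap ℚ ℚ_[q]) two_ne_zero hm' hn').split (hl q hq)) with h | h
  · exact Or.inl (hsim.symm.split h)
  · exact Or.inr (hsim.trans h)

lemma Split.not_neg {a b : ℚ} (ha : a < 0) (hb : b < 0) : ¬ Split ℚ a b := by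
  rintro ⟨x, y, z, h0, h⟩
  have hx : x = 0 := by
    by_contra hx; have := sq_pos_of_ne_zero hx; nlinarith [sq_nonneg y, sq_nonneg z]
  have hy : y = 0 := by
    by_contra hy; have := sq_pos_of_ne_zero hy; nlinarith [sq_nonneg x, sq_nonneg z]
  subst hx; subst hy
  have hz : z = 0 := by simpa using h.symm
  simp [hz] at h0

lemma legendre_neg {a b : ℚ} (ha : a < 0) (hb : b < 0)
    (hl : ∀ (q : ℕ) [Fact q.Prime], q ≠ 2 → Split ℚ_[q] a b) : Sim ℚ a b (-1) (-1) :=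
  (legendre a b ha.ne hb.ne hl).resolve_left (Split.not_neg ha hb)

lemma legendre_pos {a b : ℚ} (ha : a ≠ 0) (hb : 0 < b)
    (hl : ∀ (q : ℕ) [Fact q.Prime], q ≠ 2 → Split ℚ_[q] a b) : Split ℚ a b := by
  refine (legendre a b ha hb.ne' hl).resolve_right fun h => ?_
  have h1 : Split ℝ (a : ℝ) b :=
    (split_of_sq (c := √(b : ℝ)) (by rw [Real.sq_sqrt]; exact_mod_cast hb.le)).swap
  have h2 := (h.map (algebraMap ℚ ℝ) two_ne_zero (by simp) (by simp)).split h1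
  obtain ⟨x, y, z, h0, h⟩ := h2
  simp only [map_neg, map_one] at h
  have hx : x = 0 := by nlinarith [sq_nonneg x, sq_nonneg y, sq_nonneg z]
  have hy : y = 0 := by nlinarith [sq_nonneg x, sq_nonneg y, sq_nonneg z]
  have hz : z = 0 := by nlinarith [sq_nonneg x, sq_nonneg y, sq_nonneg z]
  simp [hx, hy, hz] at h0

end Legendre

section Frames

lemma senary_isotropic_equiv {ι : Type*} [Fintype ι] [DecidableEq ι] (e : ι ≃ Fin 6)
    (G : Matrix ι ι ℚ) (hG : G.IsSymm) (d : ℚ) (hd0 : d ≠ 0) (hd : G.det = -d ^ 2)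
    (hl : ∀ (q : ℕ) [Fact q.Prime], q ≠ 2 → ∃ P : Matrix ι (Fin 3) ℚ_[q],
      (∀ c, P.mulVec c = 0 → c = 0) ∧ P.transpose * G.map (algebraMap ℚ ℚ_[q]) * P = 0) :
    ∃ x : ι → ℚ, x ≠ 0 ∧ ∑ i, ∑ j, x i * G i j * x j = 0 := by
  obtain ⟨x, hx, h⟩ := senary_isotropic (G.submatrix e.symm e.symm) (hG.submatrix _) d hd0
    (by rw [Matrix.det_submatrix_equiv_self, hd]) (fun q _ hq => by
      obtain ⟨P, h1, h2⟩ := hl q hq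
      refine ⟨P.submatrix e.symm id, fun c hc => h1 c ?_, ?_⟩
      · ext i
        have := congrFun hc (e i)
        simpa [Matrix.mulVec, dotProduct] using this
      · rw [Matrix.transpose_submatrix, ← Matrix.submatrix_map, Matrix.submatrix_mul_equiv,
          Matrix.submatrix_mul_equiv, h2]
        rfl)
  refine ⟨x ∘ e, fun h0 => hx ?_, ?_⟩
  · ext i
    simpa using congrFun h0 (e.symm i)
  · rw [← h, gramVal, ← e.sum_comp]
    refine Finset.sum_congr rfl fun i _ => ?_
    rw [← e.sum_comp]
    simp

variable {k : Type*} [Field k]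

/-- A presentation `(c, d)` of `(a, b)` yields an isometry of the pure quaternion forms. -/
lemma Sim.exists_frame (h2 : (2 : k) ≠ 0) {a b c d : k} (hc : c ≠ 0) (hd : d ≠ 0)
    (h : Sim k a b c d) : ∃ V : Matrix (Fin 3) (Fin 3) k,
      V.transpose * Matrix.diagonal ![a, b, -(a * b)] * V = Matrix.diagonal ![c, d, -(c * d)] := by
  obtain ⟨x, y, hp⟩ := h.exists_pair
  have hx := hp.re_eq_zero h2 hd
  have hy := hp.swap.re_eq_zero h2 hc
  obtain ⟨h1, h3, h4⟩ := hp
  have hz : (x * y).re = 0 := by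
    have e := congrArg QuaternionAlgebra.re h4
    simp only [QuaternionAlgebra.re_neg] at e
    have e' : (x * y).re = (y * x).re := by
      simp [hx, hy]; ring
    have : 2 * (x * y).re = 0 := by
      linear_combination e + e'
    exact (mul_eq_zero.mp this).resolve_left h2
  obtain ⟨W, hW⟩ : ∃ W : Fin 3 → ℍ[k,a,b], W = ![x, y, x * y] := ⟨_, rfl⟩
  have hWre : ∀ j, (W j).re = 0 := by
    intro j; fin_cases j <;> simp [hW, hx, hy] ; simpa [hx, hy] using hz
  obtain ⟨V, hV⟩ : ∃ V : Matrix (Fin 3) (Fin 3) k,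
    ∀ i j, V i j = ![(W j).imI, (W j).imJ, (W j).imK] i := ⟨fun i j => _, fun _ _ => rfl⟩
  have key : ∀ j j', (V.transpose * Matrix.diagonal ![a, b, -(a * b)] * V) j j' = (W j * W j').re := by
    intro j j'
    simp [Matrix.mul_apply, Matrix.diagonal_apply, Fin.sum_univ_three, hV, hWre]
    ring
  have m : ∀ r : k, (algebraMap k ℍ[k,a,b] r).re = r := fun r => by
    simp [QuaternionAlgebra.algebraMap_eq]
  have e01 : x * (x * y) = algebraMap k _ c * y := by rw [← mul_assoc, h1]
  have e10 : x * y * x = -(algebraMap k _ c * y) := by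
    rw [h4, neg_mul, mul_assoc, h1, Algebra.commutes]
  have e12 : y * (x * y) = -(algebraMap k _ d * x) := by
    rw [h4, mul_neg, ← mul_assoc, h3]
  have e21 : x * y * y = algebraMap k _ d * x := by rw [mul_assoc, h3, Algebra.commutes]
  have e22 : x * y * (x * y) = algebraMap k _ (-(c * d)) := by
    rw [mul_assoc, e12, mul_neg, ← mul_assoc, ← Algebra.commutes, mul_assoc, h1, ← map_mul, map_neg,
      mul_comm d]
  have hyx : (y * x).re = 0 := by
    have : y * x = -(x * y) := by rw [h4, neg_neg]
    rw [this, QuaternionAlgebra.re_neg, hz, neg_zero]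
  have hsm : ∀ (r : k) (w : ℍ[k,a,b]), w.re = 0 → (algebraMap k _ r * w).re = 0 := fun r w hw => by
    rw [← Algebra.smul_def]; simp [hw]
  refine ⟨V, ?_⟩
  ext j j'
  rw [key, hW]
  fin_cases j <;> fin_cases j' <;>
    simp only [Fin.zero_eta, Fin.mk_one, Fin.reduceFinMk, Matrix.cons_val_zero, Matrix.cons_val_one,
      Matrix.cons_val, h1, h3, hz, hyx, e01, e10, e12, e21, e22, m, hsm _ _ hx, hsm _ _ hy,
      QuaternionAlgebra.re_neg, neg_zero, Matrix.diagonal_apply] <;> simp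

end Frames

section TraceForm

variable {p : ℕ} {A0 A1 B0 B1 : ℚ}

/-- The evaluation `x + yω ↦ x + yt` at a square root `t` of `a`. -/
def evalAt {k : Type*} [Field k] {a t : k} (h : t ^ 2 = a) :
    QuadraticAlgebra k a 0 →+* k where
  toFun x := x.re + x.im * t
  map_one' := by simp [QuadraticAlgebra.re_one, QuadraticAlgebra.im_one]
  map_zero' := by simp
  map_add' x y := by simp; ring
  map_mul' x y := by simp; linear_combination (-x.im * y.im) * h

lemma exists_local_frame (hp : p ≠ 0) (hA : A0 ^ 2 - p * A1 ^ 2 ≠ 0) (hB : B0 ^ 2 - p * B1 ^ 2 ≠ 0)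
    {q : ℕ} [Fact q.Prime] (h : LocSplit p A0 A1 B0 B1 q) :
    ∃ V : Matrix (Fin 3) (Fin 3) (QuadraticAlgebra ℚ_[q] p 0),
      V.transpose * Matrix.diagonal (![⟨A0, A1⟩, ⟨B0, B1⟩, -(⟨A0, A1⟩ * ⟨B0, B1⟩)] :
          Fin 3 → QuadraticAlgebra ℚ_[q] p 0) * V =
        Matrix.diagonal ![1, 1, -(1 * 1)] := by
  by_cases ht : ∃ t : ℚ_[q], t ^ 2 = p
  · obtain ⟨t, ht⟩ := ht
    have ht0 : t ≠ 0 := by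
      rintro rfl
      have : (p : ℚ_[q]) = 0 := by rw [← ht]; ring
      exact hp (by exact_mod_cast this)
    have ht' : (-t) ^ 2 = (p : ℚ_[q]) := by rw [neg_sq, ht]
    have hne : ∀ (u : ℚ_[q]) (c d : ℚ), u ^ 2 = p → c ^ 2 - p * d ^ 2 ≠ 0 → (c + d * u : ℚ_[q]) ≠ 0 := by
      intro u c d hu hcd h0
      have : ((c ^ 2 - p * d ^ 2 : ℚ) : ℚ_[q]) = 0 := by
        push_cast; linear_combination (c - d * u) * h0 + d ^ 2 * hu
      exact hcd (by exact_mod_cast this)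
    have fr := fun u (hu : u ^ 2 = (p : ℚ_[q])) => Sim.exists_frame (k := ℚ_[q]) two_ne_zero one_ne_zero
      one_ne_zero ((h.1 u hu).sim_one two_ne_zero (hne u _ _ hu hA) (hne u _ _ hu hB))
    obtain ⟨V, hV⟩ := fr t ht
    obtain ⟨V', hV'⟩ := fr (-t) ht'
    obtain ⟨W, hW⟩ : ∃ W : Matrix (Fin 3) (Fin 3) (QuadraticAlgebra ℚ_[q] p 0),
      ∀ i j, W i j = ⟨(V i j + V' i j) / 2, (V i j - V' i j) / (2 * t)⟩ :=
      ⟨fun i j => _, fun _ _ => rfl⟩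
    have e1 : W.map (evalAt ht) = V := by
      ext i j; simp [hW, evalAt]; field_simp; ring
    have e2 : W.map (evalAt ht') = V' := by
      ext i j; simp [hW, evalAt]; field_simp; ring
    have inj : ∀ x y : QuadraticAlgebra ℚ_[q] (p : ℚ_[q]) 0, evalAt ht x = evalAt ht y →
        evalAt ht' x = evalAt ht' y → x = y := by
      intro x y h1 h2
      simp only [evalAt, RingHom.coe_mk, MonoidHom.coe_mk, OneHom.coe_mk] at h1 h2
      have h3 : x.re = y.re := mul_left_cancel₀ (two_ne_zero (α := ℚ_[q])) (by linear_combination h1 + h2)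
      have h4 : x.im = y.im := mul_left_cancel₀ (mul_ne_zero two_ne_zero ht0)
        (by linear_combination h1 - h2)
      exact QuadraticAlgebra.ext h3 h4
    refine ⟨W, ?_⟩
    have key : ∀ (u : ℚ_[q]) (hu : u ^ 2 = (p : ℚ_[q])) (U : Matrix (Fin 3) (Fin 3) ℚ_[q]),
        U.transpose * Matrix.diagonal ![A0 + A1 * u, B0 + B1 * u, -((A0 + A1 * u) * (B0 + B1 * u))] * U =
          Matrix.diagonal ![1, 1, -(1 * 1)] → W.map (evalAt hu) = U →
        (W.transpose * Matrix.diagonal (![⟨A0, A1⟩, ⟨B0, B1⟩, -(⟨A0, A1⟩ * ⟨B0, B1⟩)] :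
          Fin 3 → QuadraticAlgebra ℚ_[q] p 0) * W).map
          (evalAt hu) = (Matrix.diagonal (![1, 1, -(1 * 1)] : Fin 3 → QuadraticAlgebra ℚ_[q] p 0)).map (evalAt hu) := by
      intro u hu U h1 h2
      rw [Matrix.map_mul, Matrix.map_mul, h2, Matrix.transpose_map, h2, Matrix.diagonal_map (map_zero _),
        Matrix.diagonal_map (map_zero _)]
      convert! h1 using 2
      · congr 2
        ext i; fin_cases i <;> simp <;> simp [evalAt]
        linear_combination (A1 * B1 : ℚ_[q]) * hu
      · ext i; fin_cases i <;> simp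
    have k1 := key t ht V hV e1
    have k2 := key (-t) ht' V' hV' e2
    ext1 i j
    exact inj _ _ (congrFun (congrFun k1 i) j) (congrFun (congrFun k2 i) j)
  · have hf : Fact (∀ r : ℚ_[q], r ^ 2 ≠ p + 0 * r) := ⟨fun r hr => ht ⟨r, by simpa using hr⟩⟩
    have hne : ∀ c d : ℚ, c ^ 2 - p * d ^ 2 ≠ 0 → (⟨c, d⟩ : QuadraticAlgebra ℚ_[q] p 0) ≠ 0 := by
      intro c d hcd h0
      have h1 : (c : ℚ_[q]) = 0 := congrArg QuadraticAlgebra.re h0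
      have h2 : (d : ℚ_[q]) = 0 := congrArg QuadraticAlgebra.im h0
      norm_cast at h1 h2
      simp [h1, h2] at hcd
    exact Sim.exists_frame two_ne_zero one_ne_zero one_ne_zero
      ((h.2 hf).sim_one two_ne_zero (hne _ _ hA) (hne _ _ hB))

lemma exists_pure_rational (hp : p ≠ 0) (hA : A0 ^ 2 - p * A1 ^ 2 ≠ 0) (hB : B0 ^ 2 - p * B1 ^ 2 ≠ 0)
    (h : ∀ (q : ℕ) [Fact q.Prime], q ≠ 2 → LocSplit p A0 A1 B0 B1 q) :
    ∃ (x : Fin 3 → QuadraticAlgebra ℚ p 0), x ≠ 0 ∧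
      ((⟨A0, A1⟩ : QuadraticAlgebra ℚ p 0) * x 0 ^ 2 + (⟨B0, B1⟩ : QuadraticAlgebra ℚ p 0) * x 1 ^ 2 -
        (⟨A0, A1⟩ : QuadraticAlgebra ℚ p 0) * (⟨B0, B1⟩ : QuadraticAlgebra ℚ p 0) * x 2 ^ 2).im = 0 := by
  obtain ⟨α, hα⟩ : ∃ α : Fin 3 → QuadraticAlgebra ℚ p 0,
    α = ![⟨A0, A1⟩, ⟨B0, B1⟩, -(⟨A0, A1⟩ * ⟨B0, B1⟩)] := ⟨_, rfl⟩
  obtain ⟨M, hM⟩ : ∃ M : Fin 3 → Matrix (Fin 2) (Fin 2) ℚ,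
    ∀ i, M i = !![(α i).im, (α i).re; (α i).re, p * (α i).im] := ⟨fun i => _, fun i => rfl⟩
  obtain ⟨x, hx, hx0⟩ := senary_isotropic_equiv (ι := Fin 2 × Fin 3) finProdFinEquiv
    (Matrix.blockDiagonal M) (by
      rw [Matrix.IsSymm, Matrix.blockDiagonal_transpose]
      congr 1; ext k i j; rw [hM]; fin_cases i <;> fin_cases j <;> simp)
    ((A0 ^ 2 - p * A1 ^ 2) * (B0 ^ 2 - p * B1 ^ 2)) (mul_ne_zero hA hB) (by
      rw [Matrix.det_blockDiagonal]
      simp [Fin.prod_univ_three, hM, hα, Matrix.det_fin_two]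
      ring) (by
      intro q _ hq
      obtain ⟨V, hV⟩ := exists_local_frame hp hA hB (h q hq)
      have hV' : ∀ j j', ∑ i, V i j * (⟨(α i).re, (α i).im⟩ : QuadraticAlgebra ℚ_[q] p 0) * V i j' =
          Matrix.diagonal ![1, 1, -(1 * 1)] j j' := by
        intro j j'
        rw [← hV]
        have e : ![(⟨A0, A1⟩ : QuadraticAlgebra ℚ_[q] p 0), ⟨B0, B1⟩, -(⟨A0, A1⟩ * ⟨B0, B1⟩)] =
            fun i => ⟨(α i).re, (α i).im⟩ := by
          ext i <;> fin_cases i <;> simp [hα]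
        rw [e, Matrix.mul_apply]
        simp [Matrix.mul_diagonal]
      obtain ⟨P, hP⟩ : ∃ P : Matrix (Fin 2 × Fin 3) (Fin 3) ℚ_[q],
        ∀ ei j, P ei j = ![(V ei.2 j).re, (V ei.2 j).im] ei.1 := ⟨fun ei j => _, fun _ _ => rfl⟩
      refine ⟨P, fun c hc => ?_, ?_⟩
      · obtain ⟨C, hC⟩ : ∃ C : Fin 3 → QuadraticAlgebra ℚ_[q] p 0, ∀ j, C j = ⟨c j, 0⟩ :=
          ⟨fun j => _, fun _ => rfl⟩
        have h1 : V.mulVec C = 0 := by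
          ext i
          · have := congrFun hc (0, i)
            simpa [Matrix.mulVec, dotProduct, hC, hP, Fin.sum_univ_three] using this
          · have := congrFun hc (1, i)
            simpa [Matrix.mulVec, dotProduct, hC, hP, Fin.sum_univ_three] using this
        have h2 : (Matrix.diagonal ![1, 1, -(1 * 1)] : Matrix (Fin 3) (Fin 3) (QuadraticAlgebra ℚ_[q] p 0)).mulVec C = 0 := by
          rw [← hV, ← Matrix.mulVec_mulVec, h1, Matrix.mulVec_zero]
        ext j
        have := congrArg QuadraticAlgebra.re (congrFun h2 j)
        rw [Matrix.mulVec_diagonal] at this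
        fin_cases j <;> simpa [hC] using this
      · ext j j'
        have := congrArg QuadraticAlgebra.im (hV' j j')
        have hd : ((Matrix.diagonal ![1, 1, -(1 * 1)] : Matrix (Fin 3) (Fin 3) (QuadraticAlgebra ℚ_[q] p 0)) j j').im = 0 := by
          fin_cases j <;> fin_cases j' <;> simp [QuadraticAlgebra.im_one]
        rw [hd] at this
        simp only [Fin.sum_univ_three] at this
        simp [Matrix.mul_apply, Fintype.sum_prod_type, Fin.sum_univ_three, Matrix.blockDiagonal_apply, hM, hP]
        simp at this
        linear_combination this)
  refine ⟨fun i => ⟨x (0, i), x (1, i)⟩, fun h0 => hx ?_, ?_⟩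
  · ext ⟨e, i⟩
    have := congrFun h0 i
    fin_cases e
    · exact congrArg QuadraticAlgebra.re this
    · exact congrArg QuadraticAlgebra.im this
  · simp [Fintype.sum_prod_type, Fin.sum_univ_three, Matrix.blockDiagonal_apply, hM, hα] at hx0
    simp [pow_two]
    linear_combination hx0

end TraceForm

section RationalSlots

/-- Every local algebra of `(A, B)` at a finite place is a matrix algebra. -/
def Unram {F : Type} [Field F] [NumberField F] (A B : F) : Prop :=
  ∀ v : IsDedekindDomain.HeightOneSpectrum (𝓞 F),
      Nonempty
        (ℍ[v.adicCompletion F, algebraMap F (v.adicCompletion F) A,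
            algebraMap F (v.adicCompletion F) B] ≃ₐ[v.adicCompletion F]
          Matrix (Fin 2) (Fin 2) (v.adicCompletion F))

lemma Unram.sim {F : Type} [Field F] [NumberField F] {A B C D : F} (h : Unram A B) (hC : C ≠ 0)
    (hD : D ≠ 0) (hs : Sim F A B C D) : Unram C D := fun v => by
  have : CharZero (v.adicCompletion F) := charZero_of_injective_algebraMap
    (algebraMap F (v.adicCompletion F)).injective
  obtain ⟨e⟩ := h v
  obtain ⟨e'⟩ := hs.map (algebraMap F (v.adicCompletion F)) two_ne_zero hC hD
  exact ⟨e'.trans e⟩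

variable {F : Type} [Field F] [NumberField F] {p : ℕ} {s : F}

lemma exists_real_hom (hp : p.Prime) (hs : s ^ 2 = (p : F)) (hgen : Algebra.adjoin ℚ {s} = ⊤)
    {t : ℝ} (ht : t ^ 2 = p) : ∃ σ : F →+* ℝ, ∀ a b : ℚ, σ (a + b * s) = a + b * t :=
  quad_hom (by simpa using hs) (not_isSquare_prime hp) hgen (by simpa using ht)

lemma norm_pos_of_neg (hp : p.Prime) (hs : s ^ 2 = (p : F)) (hgen : Algebra.adjoin ℚ {s} = ⊤)
    {β0 β1 : ℚ} (h : ∀ σ : F →+* ℝ, σ (β0 + β1 * s) < 0) : 0 < β0 ^ 2 - p * β1 ^ 2 ∧ β0 < 0 := by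
  have ht : √(p : ℝ) ^ 2 = p := Real.sq_sqrt (by positivity)
  obtain ⟨σ, hσ⟩ := exists_real_hom hp hs hgen ht
  obtain ⟨σ', hσ'⟩ := exists_real_hom hp hs hgen (t := -√(p : ℝ)) (by rw [neg_sq, ht])
  have h1 := h σ
  have h2 := h σ'
  rw [hσ] at h1
  rw [hσ'] at h2
  constructor
  · have := mul_pos_of_neg_of_neg h1 h2
    have e : ((β0 ^ 2 - p * β1 ^ 2 : ℚ) : ℝ) = (β0 + β1 * √p) * (β0 + β1 * -√p) := by
      push_cast; linear_combination β1 ^ 2 * ht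
    rw [← e] at this
    exact_mod_cast this
  · have : (β0 : ℝ) < 0 := by linarith
    exact_mod_cast this

lemma exists_first_slot (hp : p.Prime) (hs : s ^ 2 = (p : F)) (hgen : Algebra.adjoin ℚ {s} = ⊤)
    {A B : F} (hdef : ∀ σ : F →+* ℝ, σ A < 0 ∧ σ B < 0) (hu : Unram A B) :
    ∃ (a : ℚ) (β : F), a < 0 ∧ (∀ σ : F →+* ℝ, σ β < 0) ∧ Sim F A B a β := by
  have hs' : s ^ 2 = ((p : ℚ) : F) := by simpa using hs
  obtain ⟨A0, A1, hA⟩ := quad_coords hs' hgen A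
  obtain ⟨B0, B1, hB⟩ := quad_coords hs' hgen B
  have hNA := norm_pos_of_neg hp hs hgen (β0 := A0) (β1 := A1) (fun σ => hA ▸ (hdef σ).1)
  have hNB := norm_pos_of_neg hp hs hgen (β0 := B0) (β1 := B1) (fun σ => hB ▸ (hdef σ).2)
  obtain ⟨x, hx, hx0⟩ := exists_pure_rational hp.ne_zero hNA.1.ne' hNB.1.ne'
    (fun q _ _ => locSplit_of_unram hp hs hgen hA hB hu q)
  obtain ⟨X, hX⟩ : ∃ X : Fin 3 → F, ∀ i, X i = (x i).re + (x i).im * s := ⟨fun i => _, fun _ => rfl⟩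
  have hXne : X ≠ 0 := by
    intro h0
    apply hx
    ext i
    · exact (quad_indep hs' (not_isSquare_prime hp) (((hX i).symm).trans (congrFun h0 i))).1
    · exact (quad_indep hs' (not_isSquare_prime hp) (((hX i).symm).trans (congrFun h0 i))).2
  obtain ⟨a, ha⟩ : ∃ a : ℚ, A * X 0 ^ 2 + B * X 1 ^ 2 - A * B * X 2 ^ 2 = a := by
    refine ⟨((⟨A0, A1⟩ : QuadraticAlgebra ℚ p 0) * x 0 ^ 2 + (⟨B0, B1⟩ : QuadraticAlgebra ℚ p 0) * x 1 ^ 2 -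
        (⟨A0, A1⟩ : QuadraticAlgebra ℚ p 0) * (⟨B0, B1⟩ : QuadraticAlgebra ℚ p 0) * x 2 ^ 2).re, ?_⟩
    have hhom : ∃ τ : QuadraticAlgebra ℚ p 0 →+* F, ∀ z, τ z = z.re + z.im * s :=
      ⟨{ toFun := fun z => z.re + z.im * s
         map_one' := by simp [QuadraticAlgebra.re_one, QuadraticAlgebra.im_one]
         map_zero' := by simp
         map_add' := fun x y => by simp; ring
         map_mul' := fun x y => by simp; linear_combination (-x.im * y.im : F) * hs }, fun _ => rfl⟩
    obtain ⟨τ, hτ⟩ := hhom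
    have h1 := hτ ((⟨A0, A1⟩ : QuadraticAlgebra ℚ p 0) * x 0 ^ 2 + (⟨B0, B1⟩ : QuadraticAlgebra ℚ p 0) * x 1 ^ 2 -
        (⟨A0, A1⟩ : QuadraticAlgebra ℚ p 0) * (⟨B0, B1⟩ : QuadraticAlgebra ℚ p 0) * x 2 ^ 2)
    rw [hx0] at h1
    rw [map_sub, map_add, map_mul, map_mul, map_mul, map_mul, map_pow, map_pow, map_pow] at h1
    rw [hτ, hτ, hτ, hτ, hτ, ← hX, ← hX, ← hX, ← hA, ← hB] at h1
    simpa using h1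
  have hA0 : A ≠ 0 := by
    rintro rfl
    obtain ⟨σ, -⟩ := exists_real_hom hp hs hgen (t := √(p : ℝ)) (Real.sq_sqrt (by positivity))
    simpa using (hdef σ).1
  have hσX : ∀ σ : F →+* ℝ, (a : ℝ) = σ A * σ (X 0) ^ 2 + σ B * σ (X 1) ^ 2 - σ A * σ B * σ (X 2) ^ 2 := by
    intro σ
    have := congrArg σ ha
    simpa using this.symm
  have ha0 : a < 0 := by
    obtain ⟨σ, -⟩ := exists_real_hom hp hs hgen (t := √(p : ℝ)) (Real.sq_sqrt (by positivity))
    have h1 := hσX σ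
    obtain ⟨hA', hB'⟩ := hdef σ
    have e0 : σ A * σ (X 0) ^ 2 ≤ 0 := mul_nonpos_of_nonpos_of_nonneg hA'.le (sq_nonneg _)
    have e1 : σ B * σ (X 1) ^ 2 ≤ 0 := mul_nonpos_of_nonpos_of_nonneg hB'.le (sq_nonneg _)
    have e2 : 0 ≤ σ A * σ B * σ (X 2) ^ 2 := mul_nonneg (mul_pos_of_neg_of_neg hA' hB').le (sq_nonneg _)
    have hlt : (a : ℝ) < 0 := by
      refine lt_of_le_of_ne (by linarith) fun h0 => hXne ?_
      have z0 : σ A * σ (X 0) ^ 2 = 0 := by linarith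
      have z1 : σ B * σ (X 1) ^ 2 = 0 := by linarith
      have z2 : σ A * σ B * σ (X 2) ^ 2 = 0 := by linarith
      have f : ∀ {c : ℝ} {y : F}, c ≠ 0 → c * σ y ^ 2 = 0 → y = 0 := fun hc h => by simpa [hc] using h
      ext i
      fin_cases i
      · exact f hA'.ne z0
      · exact f hB'.ne z1
      · exact f (mul_pos_of_neg_of_neg hA' hB').ne' z2
    exact_mod_cast hlt
  have hF2 : (2 : F) ≠ 0 := two_ne_zero
  have haF : (a : F) ≠ 0 := by exact_mod_cast ha0.ne
  have hpos : ∀ β : F, (∀ σ : F →+* ℝ, σ β < 0) → β ≠ 0 := by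
    rintro β hβ rfl
    obtain ⟨σ, -⟩ := exists_real_hom hp hs hgen (t := √(p : ℝ)) (Real.sq_sqrt (by positivity))
    simpa using hβ σ
  by_cases h12 : X 1 = 0 ∧ X 2 = 0
  · refine ⟨a, B, ha0, fun σ => (hdef σ).2, IsPair.sim hF2 haF (hpos B fun σ => (hdef σ).2)
      (x := ⟨0, X 0, 0, 0⟩) (y := ⟨0, 0, 1, 0⟩) ⟨?_, ?_, ?_⟩⟩ <;>
      ext <;> simp [QuaternionAlgebra.algebraMap_eq, ← ha, h12] ; ring
  · have hβ : ∀ σ : F →+* ℝ, σ (B * A ^ 2 * X 2 ^ 2 - A * B * X 1 ^ 2) < 0 := by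
      intro σ
      obtain ⟨hA', hB'⟩ := hdef σ
      simp only [map_sub, map_mul, map_pow]
      have e1 : σ B * σ A ^ 2 < 0 := mul_neg_of_neg_of_pos hB' (by have := hA'.ne; positivity)
      have e2 := mul_pos_of_neg_of_neg hA' hB'
      by_cases h2 : X 2 = 0
      · have h1 : X 1 ≠ 0 := fun h1 => h12 ⟨h1, h2⟩
        have : 0 < σ (X 1) ^ 2 := by have : σ (X 1) ≠ 0 := by simpa using h1
                                     positivity
        rw [h2]
        have := mul_pos e2 this
        simp only [map_zero]
        linarith
      · have : 0 < σ (X 2) ^ 2 := by have : σ (X 2) ≠ 0 := by simpa using h2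
                                     positivity
        have := mul_neg_of_neg_of_pos e1 this
        have := mul_nonneg e2.le (sq_nonneg (σ (X 1)))
        linarith
    refine ⟨a, _, ha0, hβ, IsPair.sim hF2 haF (hpos _ hβ)
      (x := ⟨0, X 0, X 1, X 2⟩) (y := ⟨0, 0, A * X 2, X 1⟩) ⟨?_, ?_, ?_⟩⟩
    · rw [← ha]; ext <;> simp [QuaternionAlgebra.algebraMap_eq] <;> ring
    · ext <;> simp [QuaternionAlgebra.algebraMap_eq] <;> ring
    · ext <;> simp <;> ring

lemma LocSplit.split_norm {a β0 β1 : ℚ} {q : ℕ} [Fact q.Prime] (h : LocSplit p a 0 β0 β1 q) :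
    Split ℚ_[q] (a : ℚ) ((β0 ^ 2 - p * β1 ^ 2 : ℚ) : ℚ_[q]) := by
  by_cases ht : ∃ t : ℚ_[q], t ^ 2 = p
  · obtain ⟨t, ht⟩ := ht
    have h1 := h.1 t ht
    have h2 := h.1 (-t) (by rw [neg_sq, ht])
    simp only [Rat.cast_zero, zero_mul, add_zero] at h1 h2
    have := h1.mul h2
    convert! this using 1
    push_cast
    linear_combination (-β1 ^ 2 : ℚ_[q]) * (-ht)
  · have hf : Fact (∀ r : ℚ_[q], r ^ 2 ≠ p + 0 * r) := ⟨fun r hr => ht ⟨r, by simpa using hr⟩⟩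
    rcases (h.2 hf).norm_or_sq with ⟨c, hc⟩ | ⟨x, y, hxy⟩
    · have h1 := congrArg QuadraticAlgebra.re hc
      have h2 := congrArg QuadraticAlgebra.im hc
      simp [pow_two] at h1 h2
      by_cases hc1 : c.im = 0
      · exact split_of_sq (c := c.re) (by rw [h1, hc1]; ring)
      · have hc0 : c.re = 0 := by
          have : 2 * c.im * c.re = 0 := by linear_combination -h2
          simpa [hc1] using this
        rw [hc0] at h1
        refine Split.of_norm (r := β0) (s := β1 / c.im) ?_
        push_cast
        rw [h1]
        field_simp
        ring
    · have h1 := congrArg QuadraticAlgebra.re hxy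
      have h2 := congrArg QuadraticAlgebra.im hxy
      simp [pow_two] at h1 h2
      refine Split.of_norm (r := x.re ^ 2 - p * x.im ^ 2 + a * (y.re ^ 2 - p * y.im ^ 2))
        (s := 2 * (x.re * y.re - p * x.im * y.im)) ?_
      push_cast
      rw [h1, h2]
      ring

lemma exists_rational_pair (hp : p.Prime) (hs : s ^ 2 = (p : F)) (hgen : Algebra.adjoin ℚ {s} = ⊤)
    {A B : F} (hdef : ∀ σ : F →+* ℝ, σ A < 0 ∧ σ B < 0) (hu : Unram A B) :
    ∃ (a c : ℚ), a < 0 ∧ c < 0 ∧ Sim F A B a c := by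
  have hs' : s ^ 2 = ((p : ℚ) : F) := by simpa using hs
  obtain ⟨a, β, ha, hβ, hsim⟩ := exists_first_slot hp hs hgen hdef hu
  obtain ⟨β0, β1, rfl⟩ := quad_coords hs' hgen β
  obtain ⟨hN, hβ0⟩ := norm_pos_of_neg hp hs hgen hβ
  have haF : (a : F) ≠ 0 := by exact_mod_cast ha.ne
  have hβF : (β0 + β1 * s : F) ≠ 0 := by
    intro h0
    have := quad_indep hs' (not_isSquare_prime hp) h0
    simp [this.1] at hβ0
  have hspl := legendre_pos ha.ne hN (fun q _ _ => (locSplit_of_unram hp hs hgen (A0 := a) (A1 := 0)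
    (by simp) rfl (hu.sim haF hβF hsim) q).split_norm)
  rcases hspl.norm_or_sq with ⟨e, he⟩ | ⟨u, v, huv⟩
  · nlinarith [sq_nonneg e]
  · have hc : 2 * (β0 - |u|) < 0 := by linarith [abs_nonneg u]
    refine ⟨a, 2 * (β0 - |u|), ha, hc, hsim.trans ?_⟩
    refine Sim.of_norm_eq two_ne_zero haF hβF ((β0 + β1 * s - (|u| : ℚ)) / (β0 + β1 * s)) (v / (β0 + β1 * s)) ?_
      (by exact_mod_cast hc.ne)
    field_simp
    have e : (β0 ^ 2 - p * β1 ^ 2 : F) = ((|u| : ℚ) : F) ^ 2 - a * v ^ 2 := by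
      rw [← sq_abs u] at huv; exact_mod_cast huv
    push_cast at e ⊢
    linear_combination e - (β1 : F) ^ 2 * hs

end RationalSlots

section LocalNorms

variable {q : ℕ} [hq : Fact q.Prime]

lemma padicInt_norm_lt_one_iff (z : ℤ_[q]) : ‖z‖ < 1 ↔ PadicInt.toZMod z = 0 := by
  rw [← PadicInt.mem_nonunits, ← RingHom.mem_ker, PadicInt.ker_toZMod, IsLocalRing.mem_maximalIdeal]

lemma padicInt_norm_eq_one_iff (z : ℤ_[q]) : ‖z‖ = 1 ↔ PadicInt.toZMod z ≠ 0 := by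
  rw [Ne, ← padicInt_norm_lt_one_iff, not_lt]
  exact ⟨fun h => h.ge, fun h => le_antisymm (PadicInt.norm_le_one z) h⟩

lemma padicInt_exists_sq (hq2 : q ≠ 2) (u : ℤ_[q]) {x : ZMod q} (hx : x ≠ 0)
    (hu : PadicInt.toZMod u = x ^ 2) : ∃ y : ℤ_[q], y ^ 2 = u := by
  obtain ⟨a, rfl⟩ := ZMod.ringHom_surjective (PadicInt.toZMod (p := q)) x
  have h2 : (2 : ZMod q) ≠ 0 := by
    intro h
    have : q ∣ 2 := (ZMod.natCast_eq_zero_iff 2 q).mp (by exact_mod_cast h)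
    exact hq2 ((Nat.prime_dvd_prime_iff_eq hq.out Nat.prime_two).mp this)
  obtain ⟨z, hz, -⟩ := hensels_lemma (p := q) (R := ℤ_[q]) (F := Polynomial.X ^ 2 - Polynomial.C u) (a := a) (by
    have h1 : ‖a ^ 2 - u‖ < 1 := by
      rw [padicInt_norm_lt_one_iff]; simp [hu]
    have h3 : ‖2 * a‖ = 1 := by
      rw [padicInt_norm_eq_one_iff, map_mul, map_ofNat]; exact mul_ne_zero h2 hx
    simpa [h3, one_add_one_eq_two] using h1)
  exact ⟨z, by simpa [sub_eq_zero] using hz⟩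

lemma padicInt_exists_norm (hq2 : q ≠ 2) (d u : ℤ_[q]) (hd : ‖d‖ = 1) (hu : ‖u‖ = 1) :
    ∃ r s : ℤ_[q], u = r ^ 2 - d * s ^ 2 := by
  have hd0 := (padicInt_norm_eq_one_iff d).mp hd
  have hu0 := (padicInt_norm_eq_one_iff u).mp hu
  obtain ⟨a, b, hab⟩ := FiniteField.exists_root_sum_quadratic (R := ZMod q)
    (f := Polynomial.X ^ 2 - Polynomial.C (PadicInt.toZMod u))
    (g := Polynomial.C (-PadicInt.toZMod d) * Polynomial.X ^ 2)
    (Polynomial.degree_X_pow_sub_C two_pos _) (Polynomial.degree_C_mul_X_pow 2 (neg_ne_zero.mpr hd0))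
    (by rw [ZMod.card]; exact hq.out.eq_two_or_odd.resolve_left hq2)
  simp at hab
  by_cases ha : a = 0
  · have hb : b ≠ 0 := by
      rintro rfl
      simp [ha] at hab
      exact hu0 hab
    obtain ⟨e, he⟩ := (PadicInt.isUnit_iff.mpr hd).exists_right_inv
    have he' : PadicInt.toZMod d * PadicInt.toZMod e = 1 := by rw [← map_mul, he, map_one]
    obtain ⟨y, hy⟩ := padicInt_exists_sq hq2 (-u * e) hb (by
      rw [map_mul, map_neg]
      rw [ha] at hab
      linear_combination PadicInt.toZMod e * hab + b ^ 2 * he')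
    exact ⟨0, y, by rw [hy]; linear_combination -u * he⟩
  · obtain ⟨B, rfl⟩ := ZMod.ringHom_surjective (PadicInt.toZMod (p := q)) b
    obtain ⟨y, hy⟩ := padicInt_exists_sq hq2 (u + d * B ^ 2) ha (by
      simp only [map_add, map_mul, map_pow]
      linear_combination -hab)
    exact ⟨y, B, by rw [hy]; ring⟩

lemma padic_norm_zpow_mul {z : ℚ_[q]} (hz : z ≠ 0) : ‖z * (q : ℚ_[q]) ^ (-z.valuation)‖ = 1 := by
  have : (q : ℝ) ≠ 0 := by exact_mod_cast hq.out.ne_zero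
  rw [norm_mul, Padic.norm_eq_zpow_neg_valuation hz, norm_zpow, Padic.norm_p, inv_zpow', neg_neg,
    ← zpow_add₀ this, neg_add_cancel, zpow_zero]

lemma padic_exists_norm (hq2 : q ≠ 2) {d z : ℚ_[q]} (hd : ‖d‖ = 1) (hz : z ≠ 0)
    (hv : Even z.valuation) : ∃ r s : ℚ_[q], z = r ^ 2 - d * s ^ 2 := by
  obtain ⟨n, hn⟩ := hv
  have h0 : (q : ℚ_[q]) ≠ 0 := by exact_mod_cast hq.out.ne_zero
  have hu := padic_norm_zpow_mul hz
  obtain ⟨d, rfl⟩ : ∃ d' : ℤ_[q], (d' : ℚ_[q]) = d := ⟨⟨d, hd.le⟩, rfl⟩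
  obtain ⟨r, s, hrs⟩ := padicInt_exists_norm hq2 d ⟨_, hu.le⟩ hd hu
  have hrs' := congrArg (fun x : ℤ_[q] => (x : ℚ_[q])) hrs
  simp only [PadicInt.coe_sub, PadicInt.coe_pow, PadicInt.coe_mul] at hrs'
  refine ⟨r * (q : ℚ_[q]) ^ n, s * (q : ℚ_[q]) ^ n, ?_⟩
  rw [hn, neg_add, zpow_add₀ h0, zpow_neg] at hrs'
  have h1 : (q : ℚ_[q]) ^ n ≠ 0 := zpow_ne_zero _ h0
  have h2 : z = (z * (((q : ℚ_[q]) ^ n)⁻¹ * ((q : ℚ_[q]) ^ n)⁻¹)) * ((q : ℚ_[q]) ^ n) ^ 2 := by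
    field_simp
  rw [h2, hrs']
  ring

lemma padic_exists_norm_self (hq4 : q % 4 = 3) {z : ℚ_[q]} (hz : z ≠ 0) :
    (∃ r s : ℚ_[q], z = r ^ 2 - q * s ^ 2) ∨ ∃ r s : ℚ_[q], -z = r ^ 2 - q * s ^ 2 := by
  have h0 : (q : ℚ_[q]) ≠ 0 := by exact_mod_cast hq.out.ne_zero
  have hq2 : q ≠ 2 := by rintro rfl; simp at hq4
  have hu := padic_norm_zpow_mul hz
  obtain ⟨u, hu'⟩ : ∃ u : ℤ_[q], (u : ℚ_[q]) = z * (q : ℚ_[q]) ^ (-z.valuation) := ⟨⟨_, hu.le⟩, rfl⟩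
  have hu1 : ‖u‖ = 1 := by rw [PadicInt.norm_def, hu', hu]
  have hx := (padicInt_norm_eq_one_iff u).mp hu1
  have hns : ¬ IsSquare (-1 : ZMod q) := fun h => (ZMod.exists_sq_eq_neg_one_iff.mp h) hq4
  have hz' : z = u * (q : ℚ_[q]) ^ z.valuation := by
    rw [hu', mul_assoc, ← zpow_add₀ h0, neg_add_cancel, zpow_zero, mul_one]
  have key : ∃ y : ℤ_[q], y ^ 2 = u ∨ y ^ 2 = -u := by
    have hF : ringChar (ZMod q) ≠ 2 := by rwa [ZMod.ringChar_zmod_n]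
    by_cases hs : IsSquare (PadicInt.toZMod u)
    · obtain ⟨x, h⟩ := hs
      obtain ⟨y, hy⟩ := padicInt_exists_sq hq2 u (x := x) (by rintro rfl; simp at h; exact hx h)
        (by rw [h]; ring)
      exact ⟨y, Or.inl hy⟩
    · have h1 := quadraticChar_neg_one_iff_not_isSquare.mpr hs
      have h2 := quadraticChar_neg_one_iff_not_isSquare.mpr hns
      have h3 : quadraticChar (ZMod q) (-PadicInt.toZMod u) = 1 := by
        rw [← neg_one_mul, map_mul, h1, h2]; rfl
      obtain ⟨x, h⟩ := (quadraticChar_one_iff_isSquare (by simpa using hx)).mp h3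
      obtain ⟨y, hy⟩ := padicInt_exists_sq hq2 (-u) (x := x)
        (by rintro rfl; simp at h; exact hx h) (by rw [map_neg, h]; ring)
      exact ⟨y, Or.inr hy⟩
  obtain ⟨y, hy⟩ := key
  have hy' : (y : ℚ_[q]) ^ 2 = u ∨ (y : ℚ_[q]) ^ 2 = -u := by
    rcases hy with h | h
    · left; rw [← h]; simp
    · right; rw [← PadicInt.coe_pow, h]; simp
  rcases Int.even_or_odd' z.valuation with ⟨n, hn | hn⟩
  · have e : z = u * ((q : ℚ_[q]) ^ n) ^ 2 := by
      rw [← zpow_natCast, ← zpow_mul, Nat.cast_two, mul_comm n, ← hn]; exact hz'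
    rcases hy' with h | h
    · left; exact ⟨y * (q : ℚ_[q]) ^ n, 0, by rw [mul_pow, h, e]; ring⟩
    · right; exact ⟨y * (q : ℚ_[q]) ^ n, 0, by rw [mul_pow, h, e]; ring⟩
  · have e : z = q * (u * ((q : ℚ_[q]) ^ n) ^ 2) := by
      rw [hn, zpow_add₀ h0, zpow_one] at hz'
      rw [← zpow_natCast, ← zpow_mul, Nat.cast_two, mul_comm n]
      rw [hz']; ring
    rcases hy' with h | h
    · right; exact ⟨0, y * (q : ℚ_[q]) ^ n, by rw [mul_pow, h, e]; ring⟩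
    · left; exact ⟨0, y * (q : ℚ_[q]) ^ n, by rw [mul_pow, h, e]; ring⟩

end LocalNorms

section GlobalSlot

variable {p : ℕ} {a c : ℚ}

lemma exists_local_slot (hp : p ≠ 0) (ha : a ≠ 0) (hc : c ≠ 0) {q : ℕ} [Fact q.Prime]
    (h : LocSplit p a 0 c 0 q) :
    ∃ w : ℚ_[q], w ≠ 0 ∧ Sim ℚ_[q] (a : ℚ) (c : ℚ) p w ∧ (Split ℚ_[q] (a : ℚ) (c : ℚ) → w = 1) := by
  have ha' : (a : ℚ_[q]) ≠ 0 := by exact_mod_cast ha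
  have hc' : (c : ℚ_[q]) ≠ 0 := by exact_mod_cast hc
  have hp' : (p : ℚ_[q]) ≠ 0 := by exact_mod_cast hp
  by_cases hs : Split ℚ_[q] (a : ℚ) (c : ℚ)
  · exact ⟨1, one_ne_zero, hs.sim two_ne_zero ha' hc' hp' one_ne_zero
      (split_of_sq (c := 1) (by simp)).swap, fun _ => rfl⟩
  have ht : ¬ ∃ t : ℚ_[q], t ^ 2 = p := by
    rintro ⟨t, ht⟩
    exact hs (by simpa using h.1 t ht)
  have hf : Fact (∀ r : ℚ_[q], r ^ 2 ≠ p + 0 * r) := ⟨fun r hr => ht ⟨r, by simpa using hr⟩⟩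
  have hne : ∀ d : ℚ, d ≠ 0 → (⟨d, (0 : ℚ)⟩ : QuadraticAlgebra ℚ_[q] p 0) ≠ 0 := by
    intro d hd h0
    have h1 : (d : ℚ_[q]) = 0 := congrArg QuadraticAlgebra.re h0
    exact hd (by exact_mod_cast h1)
  obtain ⟨V, hV⟩ := Sim.exists_frame two_ne_zero one_ne_zero one_ne_zero
      ((h.2 hf).sim_one two_ne_zero (hne _ ha) (hne _ hc))
  obtain ⟨a', hae⟩ : ∃ x : QuadraticAlgebra ℚ_[q] p 0, x = ⟨a, (0 : ℚ)⟩ := ⟨_, rfl⟩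
  obtain ⟨c', hce⟩ : ∃ x : QuadraticAlgebra ℚ_[q] p 0, x = ⟨c, (0 : ℚ)⟩ := ⟨_, rfl⟩
  rw [← hae, ← hce] at hV
  obtain ⟨n, hn⟩ : ∃ n : Fin 3 → QuadraticAlgebra ℚ_[q] p 0, ∀ i, n i = V i 0 + V i 2 :=
    ⟨fun i => _, fun _ => rfl⟩
  have hiso : a' * n 0 ^ 2 + c' * n 1 ^ 2 - a' * c' * n 2 ^ 2 = 0 := by
    have e := fun i j => congrFun (congrFun hV i) j
    have e00 := e 0 0
    have e02 := e 0 2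
    have e22 := e 2 2
    simp only [Matrix.mul_apply, Matrix.transpose_apply, Fin.sum_univ_three, Matrix.diagonal_apply] at e00 e02 e22
    simp at e00 e02 e22
    rw [hn, hn, hn]
    linear_combination e00 + 2 * e02 + e22
  have hn0 : n ≠ 0 := by
    intro h0
    have e := fun i => congrFun (congrFun hV 0) i
    have e0 := e 0
    have e2 := e 2
    have z := fun i => (hn i).symm.trans (congrFun h0 i)
    have z0 := z 0
    have z1 := z 1
    have z2 := z 2
    simp only [Matrix.mul_apply, Matrix.transpose_apply, Fin.sum_univ_three, Matrix.diagonal_apply] at e0 e2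
    simp at e0 e2 z0 z1 z2
    have : (1 : QuadraticAlgebra ℚ_[q] p 0) = 0 := by
      linear_combination -e0 - e2 + V 0 0 * a' * z0 + V 1 0 * c' * z1 -
        V 2 0 * a' * c' * z2
    exact one_ne_zero this
  rw [hae, hce] at hiso
  have h1 := congrArg QuadraticAlgebra.re hiso
  have h2 := congrArg QuadraticAlgebra.im hiso
  simp [pow_two] at h1 h2
  obtain ⟨e, he⟩ : ∃ e, e = (a : ℚ_[q]) * (n 0).im ^ 2 + c * (n 1).im ^ 2 - a * c * (n 2).im ^ 2 := ⟨_, rfl⟩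
  have h1' : (a : ℚ_[q]) * (n 0).re ^ 2 + c * (n 1).re ^ 2 - a * c * (n 2).re ^ 2 = - p * e := by
    rw [he]; linear_combination h1
  have h2' : (a : ℚ_[q]) * (n 0).re * (n 0).im + c * (n 1).re * (n 1).im - a * c * (n 2).re * (n 2).im = 0 := by
    apply mul_left_cancel₀ (two_ne_zero (α := ℚ_[q]))
    linear_combination h2
  have aniso : ∀ x y z : ℚ_[q], (a : ℚ_[q]) * x ^ 2 + c * y ^ 2 - a * c * z ^ 2 = 0 → x = 0 ∧ y = 0 ∧ z = 0 := by
    intro x y z hxyz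
    by_contra! h0
    refine hs (split_iff_hasZeroDiv.mpr (hasZeroDiv_iff.mpr ⟨⟨0, x, y, z⟩, fun h => ?_, ?_⟩))
    · have ex := congrArg QuaternionAlgebra.imI h
      have ey := congrArg QuaternionAlgebra.imJ h
      have ez := congrArg QuaternionAlgebra.imK h
      exact h0 ex ey ez
    · simp only [nrm]; linear_combination -hxyz
  have he0 : e ≠ 0 := by
    intro h0
    rw [h0] at he h1'
    obtain ⟨i0, i1, i2⟩ := aniso _ _ _ he.symm
    obtain ⟨r0, r1, r2⟩ := aniso _ _ _ (h1'.trans (by simp))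
    apply hn0
    ext i <;> fin_cases i <;> assumption
  have hw : -(p : ℚ_[q]) * e ≠ 0 := mul_ne_zero (neg_ne_zero.mpr hp') he0
  have q1 : ∀ x y z : ℚ_[q], ((⟨0, x, y, z⟩ : ℍ[ℚ_[q],(a : ℚ),(c : ℚ)]) * ⟨0, x, y, z⟩) =
      algebraMap ℚ_[q] _ ((a : ℚ_[q]) * x ^ 2 + c * y ^ 2 - a * c * z ^ 2) := by
    intro x y z
    ext <;> simp [QuaternionAlgebra.algebraMap_eq] <;> ring
  obtain ⟨n1, hn1⟩ : ∃ n1 : ℍ[ℚ_[q],(a : ℚ),(c : ℚ)], n1 = ⟨0, (n 0).re, (n 1).re, (n 2).re⟩ := ⟨_, rfl⟩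
  obtain ⟨n2, hn2⟩ : ∃ n2 : ℍ[ℚ_[q],(a : ℚ),(c : ℚ)], n2 = ⟨0, (n 0).im, (n 1).im, (n 2).im⟩ := ⟨_, rfl⟩
  have s1 : n1 * n1 = algebraMap ℚ_[q] _ (-p * e) := by rw [hn1, q1, h1']
  have s2 : n2 * n2 = algebraMap ℚ_[q] _ e := by rw [hn2, q1, he]
  have s12 : n1 * n2 = -(n2 * n1) := by
    rw [hn1, hn2]
    ext <;> simp
    · linear_combination 2 * h2'
    · ring
    · ring
    · ring
  have hpair : IsPair (p : ℚ_[q]) (-p * e) (algebraMap ℚ_[q] _ e⁻¹ * (n1 * n2)) n1 := by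
    refine ⟨?_, s1, ?_⟩
    · have : n1 * n2 * (n1 * n2) = algebraMap ℚ_[q] _ (p * e ^ 2) := by
        calc n1 * n2 * (n1 * n2) = n1 * (n2 * n1) * n2 := by noncomm_ring
          _ = -((n1 * n1) * (n2 * n2)) := by
            have : n2 * n1 = -(n1 * n2) := by rw [s12, neg_neg]
            rw [this]; noncomm_ring
          _ = _ := by rw [s1, s2, ← map_mul, ← map_neg]; congr 1; ring
      rw [← Algebra.smul_def, smul_mul_smul_comm, this, Algebra.smul_def, ← map_mul]
      congr 1; field_simp
    · rw [← Algebra.smul_def, smul_mul_assoc, mul_smul_comm, ← smul_neg, mul_assoc n1, ← mul_neg,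
        s12, neg_neg]
  exact ⟨_, hw, hpair.sim two_ne_zero hp' hw, fun h => absurd h hs⟩

end GlobalSlot

section GlobalSlot

variable {p : ℕ}

lemma split_of_units {q : ℕ} [Fact q.Prime] (hq2 : q ≠ 2) {a c : ℤ} (h : ¬ (q : ℤ) ∣ a * c) :
    Split ℚ_[q] (a : ℚ_[q]) c := by
  have h1 : ∀ d : ℤ, ¬ (q : ℤ) ∣ d → ‖(d : ℚ_[q])‖ = 1 := fun d hd =>
    le_antisymm (Padic.norm_int_le_one d) (not_lt.mp fun h => hd ((Padic.norm_intCast_lt_one_iff).mp h))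
  have ha := h1 a fun h' => h (h'.mul_right _)
  have hc := h1 c fun h' => h (h'.mul_left _)
  have hc0 : (c : ℚ_[q]) ≠ 0 := by rw [← norm_ne_zero_iff, hc]; exact one_ne_zero
  obtain ⟨r, s, hrs⟩ := padicInt_exists_norm hq2 (a : ℤ_[q]) (c : ℤ_[q]) (by simpa using ha)
    (by simpa using hc)
  exact Split.of_norm (r := (r : ℚ_[q])) (s := (s : ℚ_[q])) (by exact_mod_cast congrArg (fun x : ℤ_[q] => (x : ℚ_[q])) hrs)

lemma exists_global_slot_int (hp : p.Prime) (hp4 : p % 4 = 3) {a c : ℤ} (ha : a ≠ 0) (hc : c ≠ 0)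
    (h : ∀ (q : ℕ) [Fact q.Prime], q ≠ 2 → LocSplit p a 0 c 0 q) :
    ∃ m : ℚ, m ≠ 0 ∧ ∀ (q : ℕ) [Fact q.Prime], q ≠ 2 →
      Sim ℚ_[q] ((a : ℚ) : ℚ_[q]) ((c : ℚ) : ℚ_[q]) p (m : ℚ) := by
  have hloc : ∀ (q : ℕ) (hq : Fact q.Prime), ∃ w : ℚ_[q], q ≠ 2 → w ≠ 0 ∧ Sim ℚ_[q] ((a : ℚ) : ℚ_[q]) ((c : ℚ) : ℚ_[q]) p w ∧
      (Split ℚ_[q] ((a : ℚ) : ℚ_[q]) ((c : ℚ) : ℚ_[q]) → w = 1) := by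
    intro q hq
    by_cases hq2 : q = 2
    · exact ⟨1, fun h => absurd hq2 h⟩
    · obtain ⟨w, hw⟩ := exists_local_slot hp.ne_zero (by exact_mod_cast ha) (by exact_mod_cast hc) (h q hq2)
      exact ⟨w, fun _ => hw⟩
  choose w hw using hloc
  classical
  obtain ⟨T, hT⟩ : ∃ T : Finset ℕ, T = (a * c).natAbs.primeFactors.filter
    (fun q => q ≠ p ∧ q ≠ 2 ∧ ∃ hq : q.Prime, ¬ Even (@Padic.valuation q ⟨hq⟩ (w q ⟨hq⟩))) := ⟨_, rfl⟩
  have hTp : ∀ q ∈ T, q.Prime := fun q hq => by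
    rw [hT, Finset.mem_filter] at hq; exact Nat.prime_of_mem_primeFactors hq.1
  obtain ⟨M, hM⟩ : ∃ M : ℕ, M = ∏ q ∈ T, q := ⟨_, rfl⟩
  have hMsq : Squarefree M := by
    rw [hM]
    exact Finset.squarefree_prod_of_pairwise_isCoprime (fun q hq r hr hqr =>
      Nat.coprime_iff_isRelPrime.mp ((Nat.coprime_primes (hTp q hq) (hTp r hr)).mpr hqr))
      fun q hq => (hTp q hq).squarefree
  have hM0 : M ≠ 0 := hMsq.ne_zero
  have hMdvd : ∀ q : ℕ, q.Prime → (q ∣ M ↔ q ∈ T) := by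
    intro q hq
    rw [hM, hq.prime.dvd_finsetProd_iff]
    refine ⟨fun ⟨r, hr, hqr⟩ => ?_, fun hqT => ⟨q, hqT, dvd_rfl⟩⟩
    rwa [(Nat.prime_dvd_prime_iff_eq hq (hTp r hr)).mp hqr]
  have hp2 : p ≠ 2 := by rintro rfl; simp at hp4
  have hpf : Fact p.Prime := ⟨hp⟩
  obtain ⟨m, hmM, hmp⟩ : ∃ m : ℤ, m.natAbs = M ∧ ∃ r s : ℚ_[p], (m : ℚ_[p]) / w p hpf = r ^ 2 - p * s ^ 2 := by
    have hM0' : (M : ℚ_[p]) ≠ 0 := by exact_mod_cast hM0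
    rcases padic_exists_norm_self hp4 (div_ne_zero hM0' (hw p hpf hp2).1) with ⟨r, s, hrs⟩ | ⟨r, s, hrs⟩
    · exact ⟨M, by simp, r, s, by simpa using hrs⟩
    · exact ⟨-M, by simp, r, s, by rw [← hrs]; push_cast; ring⟩
  have hm0 : m ≠ 0 := by rintro rfl; simp at hmM; exact hM0 hmM.symm
  refine ⟨m, by exact_mod_cast hm0, fun q hq hq2 => ?_⟩
  obtain ⟨hw0, hsim, hone⟩ := hw q hq hq2
  have hmq : (m : ℚ_[q]) ≠ 0 := by exact_mod_cast hm0
  have hpq : (p : ℚ_[q]) ≠ 0 := by exact_mod_cast hp.ne_zero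
  suffices hsuff : ∃ r s : ℚ_[q], (m : ℚ_[q]) / w q hq = r ^ 2 - p * s ^ 2 by
    obtain ⟨r, s, hrs⟩ := hsuff
    refine hsim.trans (Sim.of_norm_eq two_ne_zero hpq hw0 r s ?_ (by exact_mod_cast hmq))
    rw [← hrs, Rat.cast_intCast, mul_div_cancel₀ _ hw0]
  by_cases hqp : q = p
  · subst hqp; exact hmp
  have hpn : ‖(p : ℚ_[q])‖ = 1 := by
    refine le_antisymm (by exact_mod_cast Padic.norm_int_le_one (p := q) (p : ℤ)) (not_lt.mp fun h => hqp ?_)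
    have : ((p : ℤ) : ℚ_[q]) = p := by simp
    rw [← this, Padic.norm_intCast_lt_one_iff] at h
    exact (Nat.prime_dvd_prime_iff_eq hq.out hp).mp (by exact_mod_cast h)
  refine padic_exists_norm hq2 hpn (div_ne_zero hmq hw0) ?_
  rw [div_eq_mul_inv, Padic.valuation_mul hmq (inv_ne_zero hw0), Padic.valuation_inv, Padic.valuation_intCast]
  by_cases hqT : q ∈ T
  · have h1 : padicValInt q m = 1 := by
      rw [padicValInt, hmM]
      have := (hMdvd q hq.out).mpr hqT
      have h2 := hMsq.natFactorization_le_one q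
      rw [Nat.factorization_def _ hq.out] at h2
      have := one_le_padicValNat_of_dvd hM0 this
      omega
    rw [h1]
    rw [hT, Finset.mem_filter] at hqT
    obtain ⟨-, -, -, _, hodd⟩ := hqT
    rw [← sub_eq_add_neg]
    exact (odd_one).sub_odd (Int.not_even_iff_odd.mp hodd)
  · have h1 : padicValInt q m = 0 := by
      rw [padicValInt, hmM]
      exact padicValNat.eq_zero_of_not_dvd fun h => hqT ((hMdvd q hq.out).mp h)
    rw [h1, Int.even_add]
    simp only [Nat.cast_zero, even_neg, Even.zero, true_iff]
    by_contra hodd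
    have : ¬ (q : ℤ) ∣ a * c := fun hdvd => hqT (by
      rw [hT, Finset.mem_filter]
      exact ⟨Nat.mem_primeFactors.mpr ⟨hq.out, Int.natCast_dvd.mp hdvd, Int.natAbs_ne_zero.mpr (mul_ne_zero ha hc)⟩,
        hqp, hq2, hq.out, hodd⟩)
    rw [hone (by simpa using split_of_units hq2 this)] at hodd
    simp at hodd

lemma exists_global_slot (hp : p.Prime) (hp4 : p % 4 = 3) {a c : ℚ} (ha : a ≠ 0) (hc : c ≠ 0)
    (h : ∀ (a' c' : ℚ), a' ≠ 0 → c' ≠ 0 → Sim ℚ a c a' c' → ∀ (q : ℕ) [Fact q.Prime], q ≠ 2 → LocSplit p a' 0 c' 0 q) :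
    ∃ m : ℚ, m ≠ 0 ∧ ∀ (q : ℕ) [Fact q.Prime], q ≠ 2 → Sim ℚ_[q] (a : ℚ) (c : ℚ) p (m : ℚ) := by
  obtain ⟨a', d, ha', hd, had⟩ := exists_int_mul_sq a ha
  obtain ⟨c', e, hc', he, hce⟩ := exists_int_mul_sq c hc
  have ha'' : (a' : ℚ) ≠ 0 := by exact_mod_cast ha'
  have hc'' : (c' : ℚ) ≠ 0 := by exact_mod_cast hc'
  have hs : Sim ℚ a c a' c' := by
    rw [had, hce]
    exact (Sim.mul_sq two_ne_zero ha hc he).trans ((Sim.swap _ _).trans ((Sim.mul_sq two_ne_zero (hce ▸ hc'') ha hd).trans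
      (Sim.swap _ _)))
  obtain ⟨m, hm, h'⟩ := exists_global_slot_int hp hp4 ha' hc' (h _ _ ha'' hc'' hs)
  refine ⟨m, hm, fun q _ hq => ?_⟩
  have := hs.map (algebraMap ℚ ℚ_[q]) two_ne_zero ha'' hc''
  exact (by simpa using this : Sim ℚ_[q] (a : ℚ) (c : ℚ) a' c').trans (by simpa using h' q hq)

end GlobalSlot

section CommonSlot

lemma exists_common_value {a c b d : ℚ} (ha : a ≠ 0) (hc : c ≠ 0) (hb : b ≠ 0) (hd : d ≠ 0)
    (h : ∀ (q : ℕ) [Fact q.Prime], q ≠ 2 → Sim ℚ_[q] (a : ℚ) (c : ℚ) (b : ℚ) (d : ℚ)) :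
    ∃ x y : Fin 3 → ℚ, (x ≠ 0 ∨ y ≠ 0) ∧
      a * x 0 ^ 2 + c * x 1 ^ 2 - a * c * x 2 ^ 2 = b * y 0 ^ 2 + d * y 1 ^ 2 - b * d * y 2 ^ 2 := by
  obtain ⟨x, hx, h0⟩ := senary_isotropic_equiv (finSumFinEquiv (m := 3) (n := 3))
    (Matrix.fromBlocks (Matrix.diagonal ![a, c, -(a * c)]) 0 0 (-Matrix.diagonal ![b, d, -(b * d)]))
    (by
      rw [Matrix.IsSymm, Matrix.fromBlocks_transpose]
      simp)
    (a * c * (b * d)) (by positivity) (by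
      rw [Matrix.det_fromBlocks_zero₂₁, Matrix.diagonal_neg, Matrix.det_diagonal, Matrix.det_diagonal]
      simp [Fin.prod_univ_three]
      ring)
    (fun q _ hq => by
      obtain ⟨V, hV⟩ := (h q hq).exists_frame two_ne_zero (by exact_mod_cast hb) (by exact_mod_cast hd)
      refine ⟨Matrix.fromRows V 1, fun e he => ?_, ?_⟩
      · ext i
        have := congrFun he (Sum.inr i)
        simpa using this
      · have e : ∀ a b : ℚ, (Matrix.diagonal ![a, b, -(a * b)]).map (algebraMap ℚ ℚ_[q]) =
            Matrix.diagonal ![(a : ℚ_[q]), b, -(a * b)] := by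
          intro a b
          rw [Matrix.diagonal_map (map_zero _)]
          congr 1; ext i; fin_cases i <;> simp
        rw [Matrix.fromBlocks_map, Matrix.transpose_fromRows, Matrix.fromCols_mul_fromBlocks, Matrix.fromCols_mul_fromRows,
          Matrix.map_neg _ (map_neg _), e, e]
        simp [hV])
  refine ⟨x ∘ Sum.inl, x ∘ Sum.inr, ?_, ?_⟩
  · by_contra! hxy
    apply hx
    ext i
    rcases i with i | i
    · exact congrFun hxy.1 i
    · exact congrFun hxy.2 i
  · simp [Matrix.diagonal_apply, Fin.sum_univ_three] at h0 ⊢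
    linear_combination h0

lemma exists_partner {k : Type*} [Field k] (h2 : (2 : k) ≠ 0) {a b u : k} (ha : ¬ IsSquare a) (hb : b ≠ 0) (hu : u ≠ 0)
    {X : Fin 3 → k} (hX : a * X 0 ^ 2 + b * X 1 ^ 2 - a * b * X 2 ^ 2 = u) :
    ∃ v, v ≠ 0 ∧ Sim k a b u v := by
  by_cases h12 : X 1 = 0 ∧ X 2 = 0
  · refine ⟨b, hb, IsPair.sim h2 hu hb
      (x := ⟨0, X 0, 0, 0⟩) (y := ⟨0, 0, 1, 0⟩) ⟨?_, ?_, ?_⟩⟩ <;>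
      ext <;> simp [QuaternionAlgebra.algebraMap_eq, ← hX, h12] ; ring
  · have ha0 : a ≠ 0 := by rintro rfl; exact ha (IsSquare.zero)
    have hv : b * a ^ 2 * X 2 ^ 2 - a * b * X 1 ^ 2 ≠ 0 := by
      intro h0
      have h1 : X 1 ^ 2 = a * X 2 ^ 2 := mul_left_cancel₀ (mul_ne_zero ha0 hb) (by linear_combination -h0)
      by_cases h2 : X 2 = 0
      · exact h12 ⟨by simpa [h2] using h1, h2⟩
      · exact ha ⟨X 1 / X 2, by field_simp; exact h1.symm⟩
    refine ⟨_, hv, IsPair.sim h2 hu hv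
      (x := ⟨0, X 0, X 1, X 2⟩) (y := ⟨0, 0, a * X 2, X 1⟩) ⟨?_, ?_, ?_⟩⟩
    · rw [← hX]; ext <;> simp [QuaternionAlgebra.algebraMap_eq] <;> ring
    · ext <;> simp [QuaternionAlgebra.algebraMap_eq] <;> ring
    · ext <;> simp <;> ring

lemma Split.pos_of_neg {u v : ℝ} (hu : u < 0) (hv : v ≠ 0) (h : Split ℝ u v) : 0 < v := by
  rcases h.norm_or_sq with ⟨c, hc⟩ | ⟨r, s, hrs⟩
  · nlinarith [sq_nonneg c]
  · refine lt_of_le_of_ne ?_ hv.symm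
    rw [hrs]; nlinarith [sq_nonneg r, sq_nonneg s]

lemma sim_real {a b c d : ℚ} (hc : c ≠ 0) (hd : d ≠ 0) (h : Sim ℚ a b c d) : Sim ℝ (a : ℝ) b c d := by
  simpa using h.map (algebraMap ℚ ℝ) two_ne_zero hc hd

lemma sim_padic {q : ℕ} [Fact q.Prime] {a b c d : ℚ} (hc : c ≠ 0) (hd : d ≠ 0) (h : Sim ℚ a b c d) :
    Sim ℚ_[q] (a : ℚ) (b : ℚ) (c : ℚ) (d : ℚ) := by
  simpa using h.map (algebraMap ℚ ℚ_[q]) two_ne_zero hc hd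

variable {F : Type} [Field F] [NumberField F] {p : ℕ} {s : F}

/-- The totally definite quaternion algebra over `ℚ(√p)` without finite ramification is Hamilton's. -/
theorem sim_hamilton (hp : p.Prime) (hp4 : p % 4 = 3) (hs : s ^ 2 = (p : F))
    (hgen : Algebra.adjoin ℚ {s} = ⊤) {A B : F} (hdef : ∀ σ : F →+* ℝ, σ A < 0 ∧ σ B < 0)
    (hu : Unram A B) : Sim F A B (-1) (-1) := by
  obtain ⟨a, c, ha, hc, hac⟩ := exists_rational_pair hp hs hgen hdef hu
  have hacF := fun {a c b d : ℚ} (hb : b ≠ 0) (hd : d ≠ 0) (h : Sim ℚ a c b d) =>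
    (show Sim F (a : F) c b d by simpa using h.map (algebraMap ℚ F) two_ne_zero hb hd)
  have haF : (a : F) ≠ 0 := by exact_mod_cast ha.ne
  have hcF : (c : F) ≠ 0 := by exact_mod_cast hc.ne
  obtain ⟨m, hm, hsim⟩ := exists_global_slot hp hp4 ha.ne hc.ne (fun a' c' ha' hc' h q _ _ =>
    locSplit_of_unram hp hs hgen (A := a') (B := c') (by simp) (by simp)
      (hu.sim (by exact_mod_cast ha') (by exact_mod_cast hc') (hac.trans (hacF ha' hc' h))) q)
  have hp0 : (p : ℚ) ≠ 0 := by exact_mod_cast hp.ne_zero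
  obtain ⟨x, y, hxy, he⟩ := exists_common_value (b := p) ha.ne hc.ne hp0 hm
    (fun q _ hq => by simpa using hsim q hq)
  have m1 : (-1 : ℚ) ≠ 0 := by norm_num
  obtain ⟨u, hxu⟩ : ∃ u, a * x 0 ^ 2 + c * x 1 ^ 2 - a * c * x 2 ^ 2 = u := ⟨_, rfl⟩
  have hneg : ∀ {d : ℚ}, d < 0 → ¬ IsSquare d := fun hd ⟨e, h⟩ => by nlinarith [sq_nonneg e]
  by_cases hx : x = 0
  · have hspl : Split ℚ (p : ℚ) m := by
      refine split_iff_hasZeroDiv.mpr (hasZeroDiv_iff.mpr ⟨⟨0, y 0, y 1, y 2⟩, fun h => ?_, ?_⟩)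
      · refine hxy.elim (fun h => h hx) fun hy => hy ?_
        ext i
        fin_cases i
        · exact congrArg QuaternionAlgebra.imI h
        · exact congrArg QuaternionAlgebra.imJ h
        · exact congrArg QuaternionAlgebra.imK h
      · rw [hx] at he
        simp at he
        simp only [nrm]
        linear_combination he
    have := legendre_neg ha hc fun q _ hq => (hsim q hq).symm.split
      (by simpa using hspl.map (algebraMap ℚ ℚ_[q]))
    exact hac.trans (by simpa using hacF m1 m1 this)
  have hu0 : u < 0 := by
    have e0 : a * x 0 ^ 2 ≤ 0 := mul_nonpos_of_nonpos_of_nonneg ha.le (sq_nonneg _)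
    have e1 : c * x 1 ^ 2 ≤ 0 := mul_nonpos_of_nonpos_of_nonneg hc.le (sq_nonneg _)
    have e2 : 0 ≤ a * c * x 2 ^ 2 := mul_nonneg (mul_pos_of_neg_of_neg ha hc).le (sq_nonneg _)
    refine lt_of_le_of_ne (by linarith) fun h0 => hx ?_
    have z0 : a * x 0 ^ 2 = 0 := by linarith
    have z1 : c * x 1 ^ 2 = 0 := by linarith
    have z2 : a * c * x 2 ^ 2 = 0 := by linarith
    ext i
    fin_cases i
    · simpa [ha.ne] using z0
    · simpa [hc.ne] using z1
    · simpa [ha.ne, hc.ne] using z2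
  obtain ⟨v, hv, hsv⟩ := exists_partner two_ne_zero (hneg ha) hc.ne hu0.ne hxu
  obtain ⟨v', hv', hsv'⟩ := exists_partner two_ne_zero (not_isSquare_prime hp) hm hu0.ne (he.symm.trans hxu)
  have huR : (u : ℝ) < 0 := by exact_mod_cast hu0
  have hv'pos : 0 < v' := by
    have h1 : Split ℝ ((p : ℚ) : ℝ) m := split_of_sq (c := √(p : ℝ)) (by rw [Real.sq_sqrt] <;> simp)
    have := Split.pos_of_neg huR (by exact_mod_cast hv') ((sim_real hu0.ne hv' hsv').split h1)
    exact_mod_cast this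
  have hvneg : v < 0 := by
    by_contra! h
    have h1 : Split ℝ (u : ℝ) v := (split_of_sq (c := √(v : ℝ)) (by rw [Real.sq_sqrt]; exact_mod_cast h)).swap
    have := Split.pos_of_neg (by exact_mod_cast ha) (by exact_mod_cast hc.ne) ((sim_real hu0.ne hv hsv).symm.split h1)
    have : 0 < c := by exact_mod_cast this
    linarith
  have hvv : v * v' < 0 := mul_neg_of_neg_of_pos hvneg hv'pos
  have hleg := legendre_neg hu0 hvv fun q _ hq => by
    have h1 := (sim_padic (q := q) hu0.ne hv hsv).symm.trans ((hsim q hq).trans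
      (by simpa using sim_padic (q := q) hu0.ne hv' hsv'))
    have := Sim.split_mul two_ne_zero (by exact_mod_cast hu0.ne) h1
    simpa using this
  have hsplF : Split F (u : F) v' := (hacF hu0.ne hv' hsv').split (split_of_sq (c := s) (by simpa using hs.symm))
  have hlegF := hacF m1 m1 hleg
  refine hac.trans ((hacF hu0.ne hv hsv).trans (Sim.trans ?_ (by simpa using hlegF)))
  rcases hsplF.norm_or_sq with ⟨e, he⟩ | ⟨r, t, hrt⟩
  · obtain ⟨σ, -⟩ := exists_real_hom hp hs hgen (t := √(p : ℝ)) (Real.sq_sqrt (by positivity))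
    have := congrArg σ he
    simp at this
    nlinarith [sq_nonneg (σ e)]
  · refine Sim.of_norm_eq two_ne_zero (by exact_mod_cast hu0.ne) (by exact_mod_cast hv) r t ?_ (by exact_mod_cast hvv.ne)
    rw [← hrt]

end CommonSlot

section QuadInt

variable {k : Type*} [Field k] [CharZero k] {d : ℤ} {ρ : k}

lemma isIntegral_ratCast_iff {q : ℚ} : IsIntegral ℤ (q : k) ↔ ∃ n : ℤ, q = n := by
  have : (q : k) = algebraMap ℚ k q := by simp
  rw [this, isIntegral_algebraMap_iff (algebraMap ℚ k).injective, IsIntegrallyClosed.isIntegral_iff]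
  simp [eq_comm]

lemma isIntegral_of_trace_norm {x t n : k} (h : x ^ 2 - t * x + n = 0) (ht : IsIntegral ℤ t)
    (hn : IsIntegral ℤ n) : IsIntegral ℤ x := by
  refine isIntegral_trans (R := ℤ) (A := integralClosure ℤ k) x ?_
  refine ⟨Polynomial.X ^ 2 - Polynomial.C ⟨t, ht⟩ * Polynomial.X + Polynomial.C ⟨n, hn⟩, by monicity!, ?_⟩
  simpa [Subalgebra.algebraMap_eq] using h

lemma quad_conj (hρ : ρ ^ 2 = (d : k)) (hd : ¬ IsSquare (d : ℚ)) (hgen : Algebra.adjoin ℚ {ρ} = ⊤) :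
    ∃ σ : k →+* k, ∀ a b : ℚ, σ (a + b * ρ) = a - b * ρ := by
  obtain ⟨σ, h⟩ := quad_hom (n := (d : ℚ)) (by simpa using hρ) hd hgen (M := k) (t := -ρ) (by simpa using hρ)
  exact ⟨σ, fun a b => by rw [h]; ring⟩

lemma quad_isIntegral_iff (hρ : ρ ^ 2 = (d : k)) (hd : Prime d) (hgen : Algebra.adjoin ℚ {ρ} = ⊤) {x : k} :
    IsIntegral ℤ x ↔ ∃ m t : ℤ, 2 * x = m + t * ρ ∧ (4 : ℤ) ∣ m ^ 2 - d * t ^ 2 := by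
  have hd0 : (d : ℚ) ≠ 0 := by exact_mod_cast hd.ne_zero
  have hsq : ¬ IsSquare (d : ℚ) := by
    rw [Rat.isSquare_intCast_iff]
    exact fun h => hd.irreducible.not_isSquare h
  constructor
  · intro hx
    obtain ⟨σ, hσ⟩ := quad_conj hρ hsq hgen
    obtain ⟨a, b, rfl⟩ := quad_coords (n := (d : ℚ)) (by simpa using hρ) hgen x
    have hx' := map_isIntegral_int σ hx
    rw [hσ] at hx'
    obtain ⟨m, hm⟩ := isIntegral_ratCast_iff (k := k) (q := 2 * a) |>.mp (by
      convert! hx.add hx' using 1; push_cast; ring)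
    obtain ⟨n, hn⟩ := isIntegral_ratCast_iff (k := k) (q := a ^ 2 - d * b ^ 2) |>.mp (by
      convert! hx.mul hx' using 1; push_cast; rw [← hρ]; ring)
    have h1 : (d * (2 * b)) ^ 2 = ((d * (m ^ 2 - 4 * n) : ℤ) : ℚ) := by
      push_cast; rw [← hm, ← hn]; ring
    obtain ⟨u, hu⟩ := isIntegral_ratCast_iff (k := ℚ) (q := d * (2 * b)) |>.mp (by
      refine IsIntegral.of_pow (n := 2) two_pos ?_
      rw [Rat.cast_id, h1]
      exact isIntegral_algebraMap (R := ℤ) (x := d * (m ^ 2 - 4 * n)))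
    have h2 : u ^ 2 = d * (m ^ 2 - 4 * n) := by
      rw [hu] at h1; exact_mod_cast h1
    obtain ⟨t, rfl⟩ := hd.dvd_of_dvd_pow (Dvd.intro _ h2.symm)
    have h3 : 2 * b = t := by
      have : (d : ℚ) * (2 * b - t) = 0 := by push_cast at hu; linear_combination hu
      rcases mul_eq_zero.mp this with h | h
      · exact absurd h hd0
      · linarith
    refine ⟨m, t, ?_, n, ?_⟩
    · have e1 : (2 * a : k) = m := by exact_mod_cast congrArg (Rat.cast : ℚ → k) hm
      have e2 : (2 * b : k) = t := by exact_mod_cast congrArg (Rat.cast : ℚ → k) h3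
      linear_combination e1 + ρ * e2
    · have : (m : ℚ) ^ 2 - d * t ^ 2 = 4 * n := by rw [← hm, ← h3, ← hn]; ring
      exact_mod_cast this
  · rintro ⟨m, t, h, n, hn⟩
    refine isIntegral_of_trace_norm (t := m) (n := n) ?_ (isIntegral_algebraMap (R := ℤ)) (isIntegral_algebraMap (R := ℤ))
    have hn' : (m : k) ^ 2 - d * t ^ 2 = 4 * n := by exact_mod_cast congrArg (Int.cast : ℤ → k) hn
    have : (4 : k) * (x ^ 2 - m * x + n) = 0 := by
      rw [← hρ] at hn'
      linear_combination (2 * x - m + t * ρ) * h - hn'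
    simpa using this

end QuadInt

/-- If `x² - p y² = 1` with `p ≡ 3 mod 4` prime, then `x + y √p` or its double is a square. -/
lemma pell_sqrt {p : ℕ} (hp : p.Prime) (hp4 : p % 4 = 3) {x y : ℤ} (hx : 0 < x) (h : x ^ 2 - p * y ^ 2 = 1) :
    ∃ a b : ℤ, (a ^ 2 - p * b ^ 2 = 1 ∧ x = a ^ 2 + p * b ^ 2 ∧ y = 2 * (a * b)) ∨
      (|a ^ 2 - p * b ^ 2| = 2 ∧ 2 * x = a ^ 2 + p * b ^ 2 ∧ y = a * b) := by
  have hpp : Prime (p : ℤ) := Nat.prime_iff_prime_int.mp hp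
  have hp0 : (0 : ℤ) < p := by exact_mod_cast hp.pos
  have hp4' : (p : ℤ) % 4 = 3 := by omega
  have key : ∀ u v w : ℤ, 0 ≤ u → 0 ≤ v → IsCoprime u v → u * v = p * w ^ 2 →
      ∃ a b : ℤ, (u = a ^ 2 ∧ v = p * b ^ 2 ∧ w = a * b) ∨ (v = a ^ 2 ∧ u = p * b ^ 2 ∧ w = a * b) := by
    have main : ∀ u v w : ℤ, 0 ≤ u → 0 ≤ v → IsCoprime u v → u * (p * v) = p * w ^ 2 →
        ∃ a b : ℤ, u = a ^ 2 ∧ p * v = p * b ^ 2 ∧ w = a * b := by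
      intro u v w hu hv hc huv
      have huv' : u * v = w ^ 2 := mul_left_cancel₀ hp0.ne' (by linear_combination huv)
      obtain ⟨a, ha⟩ := Int.sq_of_isCoprime hc huv'
      obtain ⟨b, hb⟩ := Int.sq_of_isCoprime hc.symm (by rw [mul_comm]; exact huv')
      have ha : u = a ^ 2 := ha.elim id fun h => by nlinarith [sq_nonneg a]
      have hb : v = b ^ 2 := hb.elim id fun h => by nlinarith [sq_nonneg b]
      have : w ^ 2 = (a * b) ^ 2 := by rw [← huv', ha, hb]; ring
      rcases sq_eq_sq_iff_eq_or_eq_neg.mp this with h | h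
      · exact ⟨a, b, ha, by rw [hb], h⟩
      · exact ⟨a, -b, ha, by rw [hb]; ring, by rw [h]; ring⟩
    intro u v w hu hv hc huv
    rcases hpp.dvd_or_dvd (Dvd.intro _ huv.symm) with ⟨u', rfl⟩ | ⟨v', rfl⟩
    · have hu' : 0 ≤ u' := nonneg_of_mul_nonneg_right hu hp0
      obtain ⟨a, b, h1, h2, h3⟩ := main v u' w hv hu' (hc.symm.of_mul_right_right) (by linear_combination huv)
      exact ⟨a, b, Or.inr ⟨h1, h2, h3⟩⟩
    · have hv' : 0 ≤ v' := nonneg_of_mul_nonneg_right hv hp0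
      obtain ⟨a, b, h1, h2, h3⟩ := main u v' w hu hv' (hc.of_mul_right_right) (by linear_combination huv)
      exact ⟨a, b, Or.inl ⟨h1, h2, h3⟩⟩
  rcases Int.even_or_odd' y with ⟨w, rfl | rfl⟩
  · rcases Int.even_or_odd' x with ⟨v, rfl | rfl⟩
    · have : (2 * v) ^ 2 - p * (2 * w) ^ 2 = 2 * (2 * (v ^ 2 - p * w ^ 2)) := by ring
      omega
    · obtain ⟨a, b, ⟨h1, h2, h3⟩ | ⟨h1, h2, h3⟩⟩ := key v (v + 1) w (by omega) (by omega)
        ⟨-1, 1, by ring⟩ (by nlinarith)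
      · exfalso
        have h4 : a ^ 2 + 1 = p * b ^ 2 := by rw [← h1, ← h2]
        have := congrArg (· % 4) h4
        rcases Int.even_or_odd' a with ⟨a, rfl | rfl⟩ <;> rcases Int.even_or_odd' b with ⟨b, rfl | rfl⟩ <;>
        · ring_nf at this
          simp [Int.add_emod, hp4'] at this
      · refine ⟨a, b, Or.inl ⟨?_, ?_, ?_⟩⟩ <;> linarith
  · rcases Int.even_or_odd' x with ⟨v, rfl | rfl⟩
    · obtain ⟨a, b, ⟨h1, h2, h3⟩ | ⟨h1, h2, h3⟩⟩ := key (2 * v - 1) (2 * v + 1) (2 * w + 1) (by omega) (by omega)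
        ⟨-v - 1, v, by ring⟩ (by linarith)
      · exact ⟨a, b, Or.inr ⟨by rw [← h1, ← h2]; ring_nf; norm_num, by linarith, h3⟩⟩
      · exact ⟨a, b, Or.inr ⟨by rw [← h1, ← h2]; ring_nf; norm_num, by linarith, h3⟩⟩
    · exfalso
      obtain ⟨q, hq⟩ : ∃ q : ℤ, (p : ℤ) = 4 * q + 3 := ⟨p / 4, by omega⟩
      rw [hq] at h
      ring_nf at h
      omega

lemma exists_pell_two {p : ℕ} (hp : p.Prime) (hp4 : p % 4 = 3) : ∃ a b : ℤ, |a ^ 2 - p * b ^ 2| = 2 := by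
  have hsq : ¬ IsSquare (p : ℤ) := (Nat.prime_iff_prime_int.mp hp).irreducible.not_isSquare
  obtain ⟨f, hf⟩ := Pell.IsFundamental.exists_of_not_isSquare (by exact_mod_cast hp.pos) hsq
  obtain ⟨a, b, ⟨h1, h2, h3⟩ | h⟩ := pell_sqrt hp hp4 hf.x_pos f.prop
  · exfalso
    have hy := hf.2.1
    have hp0 : (0 : ℤ) < p := by exact_mod_cast hp.pos
    have ha : a ≠ 0 := by rintro rfl; simp [h3] at hy
    have hb : b ≠ 0 := by rintro rfl; simp [h3] at hy
    have hb2 : 0 < p * b ^ 2 := by positivity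
    have ha1 : 1 ≤ |a| := Int.one_le_abs ha
    have h5 : 1 < (Pell.Solution₁.mk (|a|) b (by rw [sq_abs, h1])).x := by
      rw [Pell.Solution₁.x_mk]
      by_contra! hle
      nlinarith [sq_abs a]
    have h4 := hf.2.2 h5
    rw [Pell.Solution₁.x_mk, h2] at h4
    nlinarith [sq_abs a]
  · exact ⟨a, b, h.1⟩

/-- The standing data: `F = ℚ(√p)` with `r = √p`, and `s` a generator of the prime above `2`. -/
structure RealQuad (F : Type) [Field F] [NumberField F] (p : ℕ) (r s : F) : Prop where
  prime : p.Prime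
  mod_four : p % 4 = 3
  five_lt : 5 < p
  sq : r ^ 2 = (p : F)
  gen : Algebra.adjoin ℚ {r} = ⊤
  pell : ∃ a b : ℤ, s = a + b * r ∧ |a ^ 2 - p * b ^ 2| = 2

namespace RealQuad

variable {F : Type} [Field F] [NumberField F] {p : ℕ} {r s : F} (H : RealQuad F p r s)
include H

lemma prime_int : Prime (p : ℤ) := Nat.prime_iff_prime_int.mp H.prime

lemma isIntegral_iff {x : F} : IsIntegral ℤ x ↔ ∃ a b : ℤ, x = a + b * r := by
  rw [quad_isIntegral_iff (d := p) (by simpa using H.sq) H.prime_int H.gen]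
  constructor
  · rintro ⟨m, t, h, n, hn⟩
    obtain ⟨q, hq⟩ : ∃ q : ℤ, (p : ℤ) = 4 * q + 3 := ⟨p / 4, by have := H.mod_four; omega⟩
    rw [hq] at hn
    rcases Int.even_or_odd' m with ⟨m, rfl | rfl⟩ <;> rcases Int.even_or_odd' t with ⟨t, rfl | rfl⟩
    · refine ⟨m, t, ?_⟩
      have : (2 : F) * (x - (m + t * r)) = 0 := by push_cast at h; linear_combination h
      exact sub_eq_zero.mp (by simpa using this)
    all_goals (exfalso; ring_nf at hn; omega)
  · rintro ⟨a, b, rfl⟩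
    exact ⟨2 * a, 2 * b, by push_cast; ring, a ^ 2 - p * b ^ 2, by ring⟩

lemma isIntegral_mk (a b : ℤ) : IsIntegral ℤ (a + b * r) := H.isIntegral_iff.mpr ⟨a, b, rfl⟩

lemma isIntegral_r : IsIntegral ℤ r := by simpa using H.isIntegral_mk 0 1

lemma isIntegral_s : IsIntegral ℤ s := by
  obtain ⟨a, b, h, -⟩ := H.pell
  exact h ▸ H.isIntegral_mk a b

lemma indep {a b c d : ℚ} (h : (a + b * r : F) = c + d * r) : a = c ∧ b = d :=
  quad_indep' (n := p) (by simpa using H.sq) (not_isSquare_prime H.prime) h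

lemma indep_int {a b c d : ℤ} (h : (a + b * r : F) = c + d * r) : a = c ∧ b = d := by
  have := H.indep (a := a) (b := b) (c := c) (d := d) (by simpa using h)
  exact_mod_cast this

/-- `s = a + b√p` with `a, b` odd and `s² = 2ε`. -/
lemma s_spec : ∃ a b e f : ℤ, s = 2 * a + 1 + (2 * b + 1) * r ∧ s ^ 2 = 2 * (e + f * r) ∧ e ^ 2 - p * f ^ 2 = 1 ∧ 0 < e := by
  obtain ⟨a, b, h, hab⟩ := H.pell
  obtain ⟨q, hq⟩ : ∃ q : ℤ, (p : ℤ) = 4 * q + 3 := ⟨p / 4, by have := H.mod_four; omega⟩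
  have hq0 : 0 ≤ q := by omega
  rcases Int.even_or_odd' a with ⟨a, rfl | rfl⟩ <;> rcases Int.even_or_odd' b with ⟨b, rfl | rfl⟩
  · exfalso; rcases abs_eq two_pos.le |>.mp hab with h | h <;> (rw [hq] at h; ring_nf at h; omega)
  · exfalso; rcases abs_eq two_pos.le |>.mp hab with h | h <;> (rw [hq] at h; ring_nf at h; omega)
  · exfalso; rcases abs_eq two_pos.le |>.mp hab with h | h <;> (rw [hq] at h; ring_nf at h; omega)
  · refine ⟨a, b, 2 * a ^ 2 + 2 * a + 2 + 2 * q + p * (2 * b ^ 2 + 2 * b), (2 * a + 1) * (2 * b + 1), by push_cast at h; exact h, ?_, ?_, ?_⟩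
    · have hsq := H.sq
      have hq' : (p : F) = 4 * q + 3 := by exact_mod_cast congrArg (Int.cast : ℤ → F) hq
      rw [h]; push_cast
      linear_combination (2 * b + 1 : F) ^ 2 * hsq + hq'
    · have : ((2 * a + 1) ^ 2 - p * (2 * b + 1) ^ 2) ^ 2 = 4 := by
        rw [← sq_abs, hab]; norm_num
      have h4 : (4 : ℤ) * ((2 * a ^ 2 + 2 * a + 2 + 2 * q + p * (2 * b ^ 2 + 2 * b)) ^ 2 - p * ((2 * a + 1) * (2 * b + 1)) ^ 2) = 4 * 1 := by
        rw [hq] at this ⊢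
        linear_combination this
      exact mul_left_cancel₀ four_ne_zero h4
    · have h1 : 0 ≤ 2 * a ^ 2 + 2 * a := by nlinarith [Int.lt_or_le a 0, sq_nonneg (2 * a + 1)]
      have h2 : 0 ≤ 2 * b ^ 2 + 2 * b := by nlinarith [sq_nonneg (2 * b + 1)]
      have : 0 ≤ p * (2 * b ^ 2 + 2 * b) := by positivity
      omega

lemma s_ne : s ≠ 0 := by
  obtain ⟨a, b, e, f, h, -⟩ := H.s_spec
  intro h0
  have := (H.indep_int (a := 2 * a + 1) (b := 2 * b + 1) (c := 0) (d := 0) (by push_cast; rw [← h, h0]; simp)).1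
  omega

lemma isIntegral_eps : IsIntegral ℤ (s ^ 2 / 2) := by
  obtain ⟨a, b, e, f, -, h, -⟩ := H.s_spec
  rw [h, mul_div_cancel_left₀ _ two_ne_zero]
  exact H.isIntegral_mk e f

lemma isIntegral_eps_inv : IsIntegral ℤ (2 / s ^ 2) := by
  obtain ⟨a, b, e, f, -, h, h1, -⟩ := H.s_spec
  have h2 : (e + f * r) * (e + (-f : ℤ) * r) = (1 : F) := by
    have h1' : (e : F) ^ 2 - p * f ^ 2 = 1 := by exact_mod_cast congrArg (Int.cast : ℤ → F) h1
    push_cast; linear_combination h1' - f ^ 2 * H.sq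
  have : (2 / s ^ 2 : F) = e + (-f : ℤ) * r := by
    rw [div_eq_iff (pow_ne_zero 2 H.s_ne), h]; linear_combination -2 * h2
  rw [this]
  exact H.isIntegral_mk _ _

/-- Integers of `F` are `0` or `1` modulo `s`. -/
lemma mod_s {a : F} (ha : IsIntegral ℤ a) : IsIntegral ℤ (a / s) ∨ IsIntegral ℤ ((a - 1) / s) := by
  have hs := H.s_ne
  have two : IsIntegral ℤ (2 / s) := by
    convert! H.isIntegral_eps_inv.mul H.isIntegral_s using 1; field_simp
  have hr : IsIntegral ℤ ((r - 1) / s) := by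
    obtain ⟨a, b, e, f, h, -⟩ := H.s_spec
    have : (r - 1) / s = 1 - (a + 1 + b * r) * (2 / s) := by
      field_simp; rw [h]; ring
    rw [this]
    refine isIntegral_one.sub (IsIntegral.mul ?_ two)
    simpa using H.isIntegral_mk (a + 1) b
  obtain ⟨m, n, rfl⟩ := H.isIntegral_iff.mp ha
  rcases Int.even_or_odd' (m + n) with ⟨c, hc | hc⟩
  · left
    have : (m : F) = 2 * c - n := by rw [eq_sub_iff_add_eq]; exact_mod_cast hc
    have : (m + n * r) / s = c * (2 / s) + n * ((r - 1) / s) := by rw [this]; ring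
    rw [this]
    exact ((isIntegral_algebraMap (R := ℤ) (x := c)).mul two).add ((isIntegral_algebraMap (R := ℤ) (x := n)).mul hr)
  · right
    have : (m : F) = 2 * c + 1 - n := by rw [eq_sub_iff_add_eq]; exact_mod_cast hc
    have : (m + n * r - 1) / s = c * (2 / s) + n * ((r - 1) / s) := by rw [this]; ring
    rw [this]
    exact ((isIntegral_algebraMap (R := ℤ) (x := c)).mul two).add ((isIntegral_algebraMap (R := ℤ) (x := n)).mul hr)

lemma not_isIntegral_inv_s : ¬ IsIntegral ℤ (1 / s) := by
  intro h
  have h2 : IsIntegral ℤ (((1 / 2 : ℚ) : F)) := by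
    convert! (h.pow 2).mul H.isIntegral_eps using 1
    have := H.s_ne
    field_simp; push_cast; norm_num
  obtain ⟨n, hn⟩ := isIntegral_ratCast_iff.mp h2
  have : (1 : ℚ) = 2 * n := by rw [← hn]; norm_num
  have : (1 : ℤ) = 2 * n := by exact_mod_cast this
  omega

lemma real_homs : ∃ σ τ : F →+* ℝ, ∀ a b : ℚ, σ (a + b * r) = a + b * √p ∧ τ (a + b * r) = a - b * √p := by
  obtain ⟨σ, hσ⟩ := exists_real_hom H.prime H.sq H.gen (t := √(p : ℝ)) (Real.sq_sqrt (by positivity))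
  obtain ⟨τ, hτ⟩ := exists_real_hom H.prime H.sq H.gen (t := -√(p : ℝ)) (by rw [neg_sq, Real.sq_sqrt (by positivity)])
  exact ⟨σ, τ, fun a b => ⟨hσ a b, by rw [hτ]; ring⟩⟩

lemma bounds {a b : ℤ} {B : ℝ} (h : ∀ σ : F →+* ℝ, 0 ≤ σ (a + b * r) ∧ σ (a + b * r) < B) :
    (a : ℝ) + b * √p < B ∧ (a : ℝ) - b * √p < B ∧ 0 ≤ (a : ℝ) + b * √p ∧ 0 ≤ (a : ℝ) - b * √p := by
  obtain ⟨σ, τ, hst⟩ := H.real_homs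
  have h1 := h σ
  have h2 := h τ
  have h3 := hst a b
  simp only [Rat.cast_intCast] at h3
  rw [h3.1] at h1; rw [h3.2] at h2
  exact ⟨h1.2, h2.2, h1.1, h2.1⟩

/-- A small totally nonnegative integer is `0` or `1`. -/
lemma eq_zero_or_one {a : F} (ha : IsIntegral ℤ a) (h : ∀ σ : F →+* ℝ, 0 ≤ σ a ∧ σ a < 2) : a = 0 ∨ a = 1 := by
  obtain ⟨m, n, rfl⟩ := H.isIntegral_iff.mp ha
  obtain ⟨h1, h2, h3, h4⟩ := H.bounds h
  have hm1 : m < 2 := by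
    have : (m : ℝ) < 2 := by linarith
    exact_mod_cast this
  have hm0 : 0 ≤ m := by
    have : 0 ≤ (m : ℝ) := by linarith
    exact_mod_cast this
  have hn : n = 0 := by
    have h5 : (p : ℝ) * n ^ 2 ≤ m ^ 2 := by
      have := mul_nonneg h3 h4
      have h6 : √(p : ℝ) ^ 2 = p := Real.sq_sqrt (by positivity)
      rw [← h6]; linarith
    have h6 : (p : ℤ) * n ^ 2 ≤ m ^ 2 := by exact_mod_cast h5
    have h7 : (5 : ℤ) < p := by exact_mod_cast H.five_lt
    by_contra hn
    have : 0 < n ^ 2 := by positivity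
    nlinarith
  subst hn
  interval_cases m <;> simp

lemma eq_of_sq_add_sq {c d : F} (hc : IsIntegral ℤ (2 * c)) (hd : IsIntegral ℤ (2 * d)) (h : c ^ 2 + d ^ 2 = 1) :
    (d = 0 ∧ (c = 1 ∨ c = -1)) ∨ (c = 0 ∧ (d = 1 ∨ d = -1)) := by
  obtain ⟨m, n, hm⟩ := H.isIntegral_iff.mp hc
  obtain ⟨m', n', hm'⟩ := H.isIntegral_iff.mp hd
  have h1 := (H.indep_int (a := m ^ 2 + p * n ^ 2 + m' ^ 2 + p * n' ^ 2) (b := 2 * m * n + 2 * m' * n') (c := 4) (d := 0) (by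
    push_cast
    rw [← H.sq]
    linear_combination 4 * h - (2 * c + m + n * r) * hm - (2 * d + m' + n' * r) * hm')).1
  have h7 : (5 : ℤ) < p := by exact_mod_cast H.five_lt
  have hn : n = 0 := by
    by_contra hn
    have : 0 < n ^ 2 := by positivity
    nlinarith [sq_nonneg m, sq_nonneg m', sq_nonneg n']
  have hn' : n' = 0 := by
    by_contra hn
    have : 0 < n' ^ 2 := by positivity
    nlinarith [sq_nonneg m, sq_nonneg m', sq_nonneg n]
  subst hn hn'
  have hm2 : |m| ≤ 2 := abs_le_of_sq_le_sq (by nlinarith [sq_nonneg m']) (by norm_num)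
  obtain ⟨hl, hr⟩ := abs_le.mp hm2
  have hm2 : |m'| ≤ 2 := abs_le_of_sq_le_sq (by nlinarith [sq_nonneg m]) (by norm_num)
  obtain ⟨hl', hr'⟩ := abs_le.mp hm2
  have two : (2 : F) ≠ 0 := two_ne_zero
  have hc' : c = m / 2 := by field_simp; linear_combination hm
  have hd' : d = m' / 2 := by field_simp; linear_combination hm'
  rw [hc', hd']
  clear hc hd hc' hd' hm hm' h
  interval_cases m <;> interval_cases m' <;> simp at h1 ⊢

/-- A totally positive unit is a square or `s²/2` times a square. -/
lemma unit_eq {u : F} (hu : IsIntegral ℤ u) (hu' : IsIntegral ℤ u⁻¹) (hpos : ∀ σ : F →+* ℝ, 0 < σ u) :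
    ∃ v : F, IsIntegral ℤ v ∧ IsIntegral ℤ v⁻¹ ∧ (u = v ^ 2 ∨ u = v ^ 2 * (s ^ 2 / 2)) := by
  have hs := H.s_ne
  obtain ⟨x, y, hxy⟩ := H.isIntegral_iff.mp hu
  obtain ⟨x', y', hxy'⟩ := H.isIntegral_iff.mp hu'
  have hsq : √(p : ℝ) ^ 2 = p := Real.sq_sqrt (by positivity)
  have hu0 : u ≠ 0 := fun h => by
    obtain ⟨σ, -, -⟩ := H.real_homs
    simpa [h] using hpos σ
  have h1 : x * x' + p * (y * y') = 1 ∧ x * y' + y * x' = 0 := by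
    refine H.indep_int (c := 1) (d := 0) ?_
    have := mul_inv_cancel₀ hu0
    rw [hxy', hxy] at this
    push_cast
    rw [← H.sq]
    linear_combination this
  have h2 : (x ^ 2 - p * y ^ 2) * (x' ^ 2 - p * y' ^ 2) = 1 := by
    linear_combination (x * x' + p * (y * y') + 1) * h1.1 - p * (x * y' + y * x') * h1.2
  obtain ⟨σ, τ, hst⟩ := H.real_homs
  have h3 := hst x y
  simp only [Rat.cast_intCast] at h3
  rw [← hxy] at h3
  have hσ := hpos σ
  have hτ := hpos τ
  have h4 : 0 < x ^ 2 - p * y ^ 2 := by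
    have : (0 : ℝ) < x ^ 2 - p * y ^ 2 := by
      have := mul_pos hσ hτ
      rw [h3.1, h3.2] at this
      rw [← hsq]; linarith
    exact_mod_cast this
  have hx0 : 0 < x := by
    have : (0 : ℝ) < x := by rw [h3.1] at hσ; rw [h3.2] at hτ; linarith
    exact_mod_cast this
  have h5 : x ^ 2 - p * y ^ 2 = 1 := (Int.eq_one_or_neg_one_of_mul_eq_one h2).resolve_right (by omega)
  obtain ⟨a, b, ⟨-, ha, hb⟩ | ⟨-, ha, hb⟩⟩ := pell_sqrt H.prime H.mod_four hx0 h5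
  · have huv : u = (a + b * r) ^ 2 := by
      rw [hxy, ha, hb]; push_cast; linear_combination -b ^ 2 * H.sq
    refine ⟨a + b * r, H.isIntegral_mk a b, IsIntegral.of_pow (n := 2) two_pos ?_, Or.inl huv⟩
    rwa [inv_pow, ← huv]
  · have huv : 2 * u = (a + b * r) ^ 2 := by
      have ha' : (2 * x : F) = a ^ 2 + p * b ^ 2 := by exact_mod_cast congrArg (Int.cast : ℤ → F) ha
      rw [hxy, hb]; push_cast; linear_combination -b ^ 2 * H.sq + ha'
    have hv2 : ((a + b * r) / s) ^ 2 = u * (2 / s ^ 2) := by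
      rw [div_pow, ← huv]; ring
    refine ⟨(a + b * r) / s, IsIntegral.of_pow (n := 2) two_pos ?_, IsIntegral.of_pow (n := 2) two_pos ?_, Or.inr ?_⟩
    · rw [hv2]; exact hu.mul H.isIntegral_eps_inv
    · rw [inv_pow, hv2, mul_inv, inv_div]; exact hu'.mul H.isIntegral_eps
    · rw [hv2]; field_simp

lemma exists_real : Nonempty (F →+* ℝ) := let ⟨σ, _⟩ := H.real_homs; ⟨σ⟩

end RealQuad

/-- The quadratic extension `F(i)`. -/
abbrev Gau (F : Type) [Field F] := QuadraticAlgebra F (-1) 0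

section Gau

attribute [local simp] QuadraticAlgebra.re_one QuadraticAlgebra.im_one

variable {F : Type} [Field F] [NumberField F]

lemma isIntegral_nat {A : Type*} [Ring A] (q : ℕ) : IsIntegral ℤ (q : A) := by
  simpa using isIntegral_algebraMap (R := ℤ) (A := A) (x := (q : ℤ))

lemma RealQuad.fact {p : ℕ} {r s : F} (H : RealQuad F p r s) : Fact (∀ x : F, x ^ 2 ≠ -1 + 0 * x) := by
  obtain ⟨σ⟩ := H.exists_real
  refine ⟨fun x h => ?_⟩
  have := congrArg σ h
  simp at this
  nlinarith [sq_nonneg (σ x)]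

variable [Fact (∀ x : F, x ^ 2 ≠ -1 + 0 * x)]

instance : NumberField (Gau F) where
  to_charZero := inferInstance
  to_finiteDimensional := Module.Finite.trans F (Gau F)

lemma gau_norm (x : Gau F) : x.norm = x.re ^ 2 + x.im ^ 2 := by
  rw [QuadraticAlgebra.norm_def]; ring

lemma gau_mul_star (x : Gau F) : x * star x = algebraMap F (Gau F) x.norm :=
  (QuadraticAlgebra.algebraMap_norm_eq_mul_star x).symm

lemma gau_add_star (x : Gau F) : x + star x = algebraMap F (Gau F) (2 * x.re) := by
  ext <;> simp [QuadraticAlgebra.algebraMap_eq]; ring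

lemma isIntegral_gau_algebraMap {a : F} : IsIntegral ℤ (algebraMap F (Gau F) a) ↔ IsIntegral ℤ a :=
  isIntegral_algebraMap_iff (algebraMap F (Gau F)).injective

lemma _root_.IsIntegral.gau {a : F} (ha : IsIntegral ℤ a) : IsIntegral ℤ (algebraMap F (Gau F) a) :=
  isIntegral_gau_algebraMap.mpr ha

lemma isIntegral_gau_star {x : Gau F} (hx : IsIntegral ℤ x) : IsIntegral ℤ (star x) :=
  map_isIntegral_int (starRingEnd (Gau F)) hx

lemma isIntegral_gau_trace {x : Gau F} (hx : IsIntegral ℤ x) : IsIntegral ℤ (2 * x.re) := by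
  rw [← isIntegral_gau_algebraMap, ← gau_add_star]
  exact hx.add (isIntegral_gau_star hx)

lemma isIntegral_gau_norm {x : Gau F} (hx : IsIntegral ℤ x) : IsIntegral ℤ x.norm := by
  rw [← isIntegral_gau_algebraMap, ← gau_mul_star]
  exact hx.mul (isIntegral_gau_star hx)

lemma isIntegral_gau {x : Gau F} (ht : IsIntegral ℤ (2 * x.re)) (hn : IsIntegral ℤ x.norm) : IsIntegral ℤ x := by
  refine isIntegral_of_trace_norm (t := x + star x) (n := x * star x) (by ring) ?_ ?_
  · rw [gau_add_star]; exact IsIntegral.gau ht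
  · rw [gau_mul_star]; exact IsIntegral.gau hn

/-- The square root of `-1`. -/
def gI (F : Type) [Field F] : Gau F := ⟨0, 1⟩

lemma gI_mul_gI : gI F * gI F = -1 := by
  ext <;> simp [gI, QuadraticAlgebra.re_one, QuadraticAlgebra.im_one]

lemma algebraMap_gau (a : F) : algebraMap F (Gau F) a = ⟨a, 0⟩ := rfl

@[simp] lemma gau_coe_re (a : F) : (algebraMap F (Gau F) a).re = a := rfl

@[simp] lemma gau_coe_im (a : F) : (algebraMap F (Gau F) a).im = 0 := rfl

lemma star_gI : star (gI F) = -gI F := by ext <;> simp [gI]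

lemma isIntegral_gI : IsIntegral ℤ (gI F) :=
  isIntegral_gau (by simp [gI, isIntegral_zero]) (by simp [gI, gau_norm, isIntegral_one])

namespace RealQuad

variable {p : ℕ} {r s : F} (H : RealQuad F p r s)
include H

/-- The generator of the ring of integers of `F(i)` over that of `F`. -/
def om (_ : RealQuad F p r s) : Gau F := ⟨r / 2, 1 / 2⟩

/-- A unit of `F(i)` with `η² = i s²/2`. -/
def eta (_ : RealQuad F p r s) : Gau F := ⟨s / 2, s / 2⟩

lemma norm_om : H.om.norm = (p + 1) / 4 := by
  rw [gau_norm, om, ← H.sq]; field_simp; ring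

lemma isIntegral_om : IsIntegral ℤ H.om := by
  refine isIntegral_gau ?_ ?_
  · rw [om]; convert! H.isIntegral_r using 1; ring
  · rw [norm_om]
    obtain ⟨q, hq⟩ : ∃ q : ℕ, p + 1 = 4 * q := ⟨(p + 1) / 4, by have := H.mod_four; omega⟩
    have : ((p : F) + 1) / 4 = (q : F) := by
      have h4 : (p : F) + 1 = 4 * q := by exact_mod_cast congrArg (Nat.cast : ℕ → F) hq
      rw [h4]; field_simp
    rw [this]; exact isIntegral_nat q

lemma om_sub_star : H.om - star H.om = gI F := by ext <;> simp [om, gI]; norm_num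

lemma norm_eta : H.eta.norm = s ^ 2 / 2 := by
  rw [gau_norm, eta]; ring

lemma isIntegral_eta : IsIntegral ℤ H.eta := by
  refine isIntegral_gau ?_ ?_
  · rw [eta]; convert! H.isIntegral_s using 1; ring
  · rw [norm_eta]; exact H.isIntegral_eps

lemma eta_sub_star : H.eta - star H.eta = algebraMap F _ s * gI F := by
  ext <;> simp [eta, gI, QuadraticAlgebra.algebraMap_eq]

lemma eta_sq : H.eta * H.eta = algebraMap F _ (s ^ 2 / 2) * gI F := by
  rw [algebraMap_gau]
  ext <;> simp [eta, gI]; ring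

lemma algebraMap_s_ne : algebraMap F (Gau F) s ≠ 0 := by
  simpa using H.s_ne

lemma isIntegral_two_div : IsIntegral ℤ (2 / s) := by
  have := H.s_ne
  convert! H.isIntegral_eps_inv.mul H.isIntegral_s using 1; field_simp

lemma isIntegral_gI_sub_one : IsIntegral ℤ ((gI F - 1) / algebraMap F _ s) := by
  have hs := H.s_ne
  have : (gI F - 1) / algebraMap F _ s = ⟨-(1 / s), 1 / s⟩ := by
    rw [div_eq_iff H.algebraMap_s_ne]
    ext <;> simp [gI, QuadraticAlgebra.algebraMap_eq, hs]
  rw [this]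
  refine isIntegral_gau ?_ ?_
  · convert! H.isIntegral_two_div.neg using 1; ring
  · rw [gau_norm]; convert! H.isIntegral_eps_inv using 1; field_simp; ring

/-- The trace form of the ring of integers of `F(i)` over that of `F` is unimodular. -/
lemma isIntegral_of_traces {x : Gau F} (h0 : IsIntegral ℤ (2 * x.re)) (h1 : IsIntegral ℤ (2 * (H.om * x).re)) :
    IsIntegral ℤ x := by
  have : x = -gI F * (algebraMap F _ (2 * (H.om * x).re) - algebraMap F _ (2 * x.re) * star H.om) := by
    rw [← gau_add_star, ← gau_add_star, star_mul']
    linear_combination x * gI F * H.om_sub_star + x * gI_mul_gI (F := F)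
  rw [this]
  exact isIntegral_gI.neg.mul ((IsIntegral.gau h1).sub ((IsIntegral.gau h0).mul (isIntegral_gau_star H.isIntegral_om)))

lemma exists_coords {x : Gau F} (hx : IsIntegral ℤ x) : ∃ u v : F, IsIntegral ℤ u ∧ IsIntegral ℤ v ∧
    x = algebraMap F _ u + algebraMap F _ v * H.om := by
  have hv : IsIntegral ℤ (2 * x.im) := by
    convert! isIntegral_gau_trace (isIntegral_gI.neg.mul hx) using 1; simp [gI]
  have hx' : x = algebraMap F _ (x.re - x.im * r) + algebraMap F _ (2 * x.im) * H.om := by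
    rw [algebraMap_gau, algebraMap_gau]
    ext <;> simp [om] <;> ring
  refine ⟨x.re - x.im * r, 2 * x.im, ?_, hv, hx'⟩
  rw [← isIntegral_gau_algebraMap]
  convert! hx.sub ((IsIntegral.gau hv).mul H.isIntegral_om) using 1
  linear_combination -hx'

/-- Membership in the order `O_F + s O_L`. -/
def MemB (_ : RealQuad F p r s) (x : Gau F) : Prop :=
  IsIntegral ℤ (x / algebraMap F _ s) ∨ IsIntegral ℤ ((x - 1) / algebraMap F _ s)

lemma MemB.isIntegral {x : Gau F} (hx : H.MemB x) : IsIntegral ℤ x := by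
  have hs := H.algebraMap_s_ne
  have hsi := IsIntegral.gau H.isIntegral_s
  rcases hx with h | h
  · convert! h.mul hsi using 1; field_simp
  · convert! (h.mul hsi).add isIntegral_one using 1; field_simp; ring

lemma memB_of {x : Gau F} {a : F} (ha : IsIntegral ℤ a) (h : IsIntegral ℤ ((x - algebraMap F _ a) / algebraMap F _ s)) :
    H.MemB x := by
  rcases H.mod_s ha with h1 | h1
  · left
    convert! h.add (IsIntegral.gau h1) using 1; rw [map_div₀]; ring
  · right
    convert! h.add (IsIntegral.gau h1) using 1; rw [map_div₀, map_sub, map_one]; ring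

/-- The dual of `O_F + s O_L` for the trace form. -/
lemma memB_of_traces {x : Gau F} (h0 : IsIntegral ℤ (2 * x.re)) (h1 : IsIntegral ℤ (2 * (algebraMap F _ s * H.om * x).re)) :
    H.MemB (algebraMap F _ s * x) := by
  have hs := H.s_ne
  have hx : IsIntegral ℤ (algebraMap F _ s * x) := by
    refine H.isIntegral_of_traces ?_ ?_
    · convert! H.isIntegral_s.mul h0 using 1; simp [QuadraticAlgebra.algebraMap_eq]; ring
    · convert! h1 using 3; ring
  obtain ⟨u, v, hu, hv, huv⟩ := H.exists_coords hx
  have hvs : IsIntegral ℤ (v / s) := by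
    have e1 : s * (2 * x.re) = 2 * u + v * r := by
      have := congrArg QuadraticAlgebra.re huv
      simp [QuadraticAlgebra.algebraMap_eq, om] at this
      linear_combination 2 * this
    obtain ⟨q, hq⟩ : ∃ q : ℕ, p = 2 * q + 1 := ⟨p / 2, by have := H.mod_four; omega⟩
    have hq' : (p : F) = 2 * q + 1 := by exact_mod_cast congrArg (Nat.cast : ℕ → F) hq
    have : v / s = (2 * x.re - 2 / s * u) * r - q * v * (2 / s) := by
      field_simp
      linear_combination -r * e1 - v * H.sq - v * hq'
    rw [this]
    exact ((h0.sub (H.isIntegral_two_div.mul hu)).mul H.isIntegral_r).sub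
      (((isIntegral_nat q).mul hv).mul H.isIntegral_two_div)
  refine H.memB_of hu ?_
  convert! (IsIntegral.gau hvs).mul H.isIntegral_om using 1
  rw [huv, map_div₀]; ring

lemma s_mul_om : algebraMap F _ s * H.om = H.eta + algebraMap F _ ((r - 1) * s / 2) := by
  rw [algebraMap_gau, algebraMap_gau]
  ext <;> simp [om, eta] <;> ring

lemma isIntegral_r_sub_one_mul : IsIntegral ℤ ((r - 1) * s / 2) := by
  have hs := H.s_ne
  rcases H.mod_s H.isIntegral_r with h | h
  · exfalso
    apply H.not_isIntegral_inv_s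
    obtain ⟨q, hq⟩ : ∃ q : ℕ, p = 2 * q + 1 := ⟨p / 2, by have := H.mod_four; omega⟩
    have hq' : (p : F) = 2 * q + 1 := by exact_mod_cast congrArg (Nat.cast : ℕ → F) hq
    convert! (h.mul H.isIntegral_r).sub ((isIntegral_algebraMap (R := ℤ) (x := q)).mul H.isIntegral_two_div) using 1
    simp; field_simp; linear_combination -H.sq - hq'
  · convert! h.mul H.isIntegral_eps using 1; field_simp

/-- Integral elements of relative norm one are fourth roots of unity. -/
lemma eq_of_norm_one {x : Gau F} (hx : IsIntegral ℤ x) (h : x.norm = 1) :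
    x = 1 ∨ x = -1 ∨ x = gI F ∨ x = -gI F := by
  have hv : IsIntegral ℤ (2 * x.im) := by
    convert! isIntegral_gau_trace (isIntegral_gI.neg.mul hx) using 1; simp [gI]
  rcases H.eq_of_sq_add_sq (isIntegral_gau_trace hx) hv (by rw [← gau_norm, h]) with ⟨h1, h2 | h2⟩ | ⟨h1, h2 | h2⟩
  · exact Or.inl (by ext <;> simp [h1, h2])
  · exact Or.inr (Or.inl (by ext <;> simp [h1, h2]))
  · exact Or.inr (Or.inr (Or.inl (by ext <;> simp [h1, h2, gI])))
  · exact Or.inr (Or.inr (Or.inr (by ext <;> simp [h1, h2, gI])))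

omit H in
lemma norm_pos {x : Gau F} (hx : x ≠ 0) (σ : F →+* ℝ) : 0 < σ x.norm := by
  have h0 : x.norm ≠ 0 := fun h => hx (QuadraticAlgebra.norm_eq_zero_iff_eq_zero.mp h)
  have h1 : 0 ≤ σ x.norm := by rw [gau_norm]; simp; positivity
  exact lt_of_le_of_ne h1 ((map_ne_zero σ).mpr h0).symm

/-- Every totally positive unit is the norm of a unit `v` or `v η` with `v` a unit of `F`. -/
lemma exists_norm_eq {u : F} (hu : IsIntegral ℤ u) (hu' : IsIntegral ℤ u⁻¹) (hpos : ∀ σ : F →+* ℝ, 0 < σ u) :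
    ∃ v : F, IsIntegral ℤ v ∧ IsIntegral ℤ v⁻¹ ∧
      ((algebraMap F (Gau F) v).norm = u ∨ (algebraMap F (Gau F) v * H.eta).norm = u) := by
  obtain ⟨v, h1, h2, h3⟩ := H.unit_eq hu hu' hpos
  refine ⟨v, h1, h2, h3.imp (fun h => ?_) fun h => ?_⟩
  · rw [QuadraticAlgebra.norm_algebraMap, h]
  · rw [map_mul, QuadraticAlgebra.norm_algebraMap, norm_eta, h]

end RealQuad

end Gau

/-- Fractional ideals of a number field. -/
abbrev FId (E : Type*) [Field E] [NumberField E] := FractionalIdeal (nonZeroDivisors (𝓞 E)) E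

namespace FId

section Basic

variable {E : Type*} [Field E] [NumberField E] {I J : FId E}

lemma mem_one {x : E} : x ∈ (1 : FId E) ↔ IsIntegral ℤ x := by
  rw [FractionalIdeal.mem_one_iff]
  exact ⟨fun ⟨a, ha⟩ => ha ▸ RingOfIntegers.isIntegral_coe a, fun h => ⟨⟨x, h⟩, rfl⟩⟩

lemma mul_mem {a x : E} (ha : IsIntegral ℤ a) (hx : x ∈ I) : a * x ∈ I := by
  have : (⟨a, ha⟩ : 𝓞 E) • x ∈ I := I.val.smul_mem _ hx
  rwa [Algebra.smul_def] at this

lemma add_mem {x y : E} (hx : x ∈ I) (hy : y ∈ I) : x + y ∈ I := I.val.add_mem hx hy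

lemma sub_mem {x y : E} (hx : x ∈ I) (hy : y ∈ I) : x - y ∈ I := I.val.sub_mem hx hy

lemma neg_mem {x : E} (hx : x ∈ I) : -x ∈ I := I.val.neg_mem hx

lemma zero_mem : (0 : E) ∈ I := I.val.zero_mem

lemma mem_inv (hI : I ≠ 0) {x : E} : x ∈ I⁻¹ ↔ ∀ y ∈ I, IsIntegral ℤ (x * y) := by
  rw [FractionalIdeal.mem_inv_iff hI]
  simp only [mem_one]

lemma exists_mem_ne_zero (hI : I ≠ 0) : ∃ x ∈ I, x ≠ 0 := by
  by_contra! h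
  exact hI (FractionalIdeal.eq_zero_iff.mpr h)

lemma ne_zero_of_mem {x : E} (hx : x ∈ I) (h : x ≠ 0) : I ≠ 0 := fun h0 => by
  rw [h0] at hx
  exact h ((FractionalIdeal.mem_zero_iff _).mp hx)

/-- The principal fractional ideal generated by an element. -/
abbrev pr (x : E) : FId E := FractionalIdeal.spanSingleton _ x

lemma mem_pr {x y : E} : x ∈ pr y ↔ ∃ a, IsIntegral ℤ a ∧ x = a * y := by
  rw [FractionalIdeal.mem_spanSingleton]
  constructor
  · rintro ⟨z, rfl⟩
    exact ⟨z, RingOfIntegers.isIntegral_coe z, Algebra.smul_def _ _⟩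
  · rintro ⟨a, ha, rfl⟩
    exact ⟨⟨a, ha⟩, Algebra.smul_def _ _⟩

lemma mem_pr_mul {x y : E} : x ∈ pr y * I ↔ ∃ z ∈ I, x = y * z := FractionalIdeal.mem_singleton_mul

lemma pr_mul (x y : E) : pr (x * y) = pr x * pr y := (FractionalIdeal.spanSingleton_mul_spanSingleton x y).symm

lemma pr_one : pr (1 : E) = 1 := FractionalIdeal.spanSingleton_one

lemma pr_ne_zero {x : E} (hx : x ≠ 0) : pr x ≠ 0 := FractionalIdeal.spanSingleton_ne_zero_iff.mpr hx

lemma pr_inv {x : E} (hx : x ≠ 0) : pr x⁻¹ = (pr x)⁻¹ := by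
  apply eq_inv_of_mul_eq_one_left
  rw [← pr_mul, inv_mul_cancel₀ hx, pr_one]

lemma pr_div {x y : E} (hy : y ≠ 0) : pr (x / y) = pr x / pr y := by
  rw [div_eq_mul_inv, div_eq_mul_inv, pr_mul, pr_inv hy]

lemma pr_eq_one {x : E} (hx : x ≠ 0) : pr x = 1 ↔ IsIntegral ℤ x ∧ IsIntegral ℤ x⁻¹ := by
  constructor
  · intro h
    refine ⟨mem_one.mp (h ▸ mem_pr.mpr ⟨1, isIntegral_one, by simp⟩), mem_one.mp ?_⟩
    rw [← inv_one, ← h, ← pr_inv hx]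
    exact mem_pr.mpr ⟨1, isIntegral_one, by simp⟩
  · rintro ⟨h, h'⟩
    refine le_antisymm (fun y hy => ?_) fun y hy => ?_
    · obtain ⟨a, ha, rfl⟩ := mem_pr.mp hy
      exact mem_one.mpr (ha.mul h)
    · exact mem_pr.mpr ⟨y * x⁻¹, (mem_one.mp hy).mul h', by field_simp⟩

/-- A fractional ideal given by a predicate. -/
def mk' (P : E → Prop) (h0 : P 0) (hadd : ∀ x y, P x → P y → P (x + y))
    (hmul : ∀ a x, IsIntegral ℤ a → P x → P (a * x)) (d : E) (hd : d ≠ 0) (hP : ∀ x, P x → IsIntegral ℤ (d * x)) :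
    FId E :=
  ⟨{ carrier := {x | P x}
     zero_mem' := h0
     add_mem' := fun hx hy => hadd _ _ hx hy
     smul_mem' := fun c x hx => by
      rw [Algebra.smul_def]
      exact hmul _ _ (RingOfIntegers.isIntegral_coe c) hx }, by
    obtain ⟨m, n, hn, hd'⟩ := IsFractionRing.div_surjective (A := 𝓞 E) d
    have hn0 : algebraMap (𝓞 E) E n ≠ 0 := by simpa using nonZeroDivisors.ne_zero hn
    refine ⟨m, mem_nonZeroDivisors_of_ne_zero ?_, fun x hx => ?_⟩
    · rintro rfl
      exact hd (by rw [← hd']; simp)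
    · refine ⟨⟨algebraMap _ E n * (d * x), (RingOfIntegers.isIntegral_coe n).mul (hP x hx)⟩, ?_⟩
      rw [Algebra.smul_def]
      change algebraMap _ E n * (d * x) = _
      rw [← hd']
      field_simp⟩

lemma mem_mk' {P : E → Prop} {h0 hadd hmul d hd hP} {x : E} : x ∈ mk' P h0 hadd hmul d hd hP ↔ P x := Iff.rfl

lemma exists_bound (I : FId E) : ∃ d : E, d ≠ 0 ∧ IsIntegral ℤ d ∧ ∀ x ∈ I, IsIntegral ℤ (d * x) := by
  obtain ⟨a, ha, h⟩ := I.2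
  refine ⟨a, by simpa using nonZeroDivisors.ne_zero ha, RingOfIntegers.isIntegral_coe a, fun x hx => ?_⟩
  obtain ⟨b, hb⟩ := h x hx
  rw [Algebra.smul_def] at hb
  exact hb ▸ RingOfIntegers.isIntegral_coe b

lemma le_one_of_sq (h : I * I ≤ 1) : I ≤ 1 := fun x hx => by
  have := mem_one.mp (h (FractionalIdeal.mul_mem_mul hx hx))
  rw [← sq] at this
  exact mem_one.mpr (IsIntegral.of_pow two_pos this)

lemma eq_one_of_sq (h : I * I = 1) : I = 1 := by
  have h1 := le_one_of_sq h.le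
  have h0 : I ≠ 0 := by rintro rfl; simp at h
  refine le_antisymm h1 ?_
  calc (1 : FId E) = I * I := h.symm
    _ ≤ I * 1 := by gcongr
    _ = I := mul_one I

lemma eq_of_sq (hJ : J ≠ 0) (h : I * I = J * J) : I = J := by
  have : (I / J) * (I / J) = 1 := by rw [div_mul_div_comm, h, div_self (mul_ne_zero hJ hJ)]
  exact (div_eq_one_iff_eq hJ).mp (eq_one_of_sq this)

lemma exists_maximal_pairing (c : FId E →+* FId E) (hc : ∀ I, c (c I) = I) {X : FId E} (hX : X ≠ 0)
    (h : X * c X ≤ 1) : ∃ X', X ≤ X' ∧ X' * c X' = 1 := by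
  set Y := c X with hY
  have hY0 : Y ≠ 0 := fun h0 => hX (by rw [← hc X, ← hY, h0, map_zero])
  have idem : ∀ a : FId E, a + a = a := fun a => by rw [← FractionalIdeal.sup_eq_add, sup_idem]
  have one_add : ∀ a : FId E, a ≤ 1 → a + 1 = 1 := fun a ha => by
    rw [← FractionalIdeal.sup_eq_add, sup_eq_right.mpr ha]
  have le_add : ∀ a b : FId E, a ≤ a + b := fun a b => by
    rw [← FractionalIdeal.sup_eq_add]; exact le_sup_left
  have nz : ∀ a : FId E, 1 + a ≠ 0 := fun a h0 => by
    have := le_add 1 a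
    rw [h0] at this
    exact one_ne_zero (le_antisymm this zero_le)
  set C := (1 + X)⁻¹
  set C' := (1 + Y)⁻¹
  have hC : C + X * C = 1 := by
    rw [show C + X * C = (1 + X) * C by ring]; exact mul_inv_cancel₀ (nz X)
  have hC' : C' + Y * C' = 1 := by
    rw [show C' + Y * C' = (1 + Y) * C' by ring]; exact mul_inv_cancel₀ (nz Y)
  have hcC : c C = C' := by simp only [C, C', map_inv₀, map_add, map_one, hY]
  set D := X * C
  set D' := Y * C'
  have hD : D + 1 = 1 := by
    rw [← hC, add_left_comm, idem]
  have key : C * C' + D + D' = 1 := by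
    have e1 : D = D * C' + D * D' := by rw [← mul_add, hC', mul_one]
    have e2 : D' = C * D' + D * D' := by rw [← add_mul, hC, one_mul]
    calc C * C' + D + D' = C * C' + (D * C' + D * D') + (C * D' + D * D') := by rw [← e1, ← e2]
      _ = C * C' + D * C' + C * D' + (D * D' + D * D') := by ring
      _ = (C + D) * (C' + D') := by rw [idem]; ring
      _ = 1 := by rw [hC, hC', one_mul]
  set e := D + X * Y
  have he0 : e ≠ 0 := fun h0 => by
    have : X * Y ≤ e := (le_add (X * Y) D).trans_eq (add_comm _ _)
    rw [h0] at this
    exact mul_ne_zero hX hY0 (le_antisymm this zero_le)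
  have he1 : e + 1 = 1 := by rw [add_assoc, one_add _ h, hD]
  have he : e ≤ 1 := by rw [← he1]; exact le_add _ _
  have hce : c e = D' + X * Y := by
    simp only [e, D, D', map_add, map_mul, hcC, ← hY]
    rw [hY, hc, mul_comm (c X) X]
  have hmul : e * c e = X * Y := by
    rw [hce]
    calc (D + X * Y) * (D' + X * Y) = X * Y * (C * C' + D + D' + X * Y) := by simp only [D, D']; ring
      _ = X * Y := by rw [key, add_comm, one_add _ h, mul_one]
  have hce0 : c e ≠ 0 := fun h0 => by
    rw [h0, mul_zero] at hmul
    exact mul_ne_zero hX hY0 hmul.symm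
  refine ⟨X / e, ?_, ?_⟩
  · have : X * e ≤ X * 1 := by gcongr
    rw [le_div_iff₀ (pos_iff_ne_zero.mpr he0)]
    simpa using this
  · rw [map_div₀, ← hY, div_mul_div_comm, hmul, div_self (mul_ne_zero hX hY0)]

end Basic

section Map

variable {E E' : Type*} [Field E] [NumberField E] [Field E'] [NumberField E']

lemma le_comap (f : E →+* E') : nonZeroDivisors (𝓞 E) ≤
    Submonoid.comap (RingOfIntegers.mapRingHom f) (nonZeroDivisors (𝓞 E')) :=
  nonZeroDivisors_le_comap_nonZeroDivisors_of_injective _ fun x y h => by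
    have := congrArg (algebraMap (𝓞 E') E') h
    exact RingOfIntegers.ext (f.injective (by simpa [RingOfIntegers.mapRingHom_apply] using this))

/-- Extension of fractional ideals along a ring homomorphism. -/
def map (f : E →+* E') : FId E →+* FId E' := FractionalIdeal.extendedHom' E' (le_comap f)

lemma localization_map (f : E →+* E') : IsLocalization.map (S := E) E' _ (le_comap f) = f :=
  IsLocalization.map_unique _ _ fun _ => rfl

lemma map_pr (f : E →+* E') (x : E) : map f (pr x) = pr (f x) := by
  simp only [map, pr, FractionalIdeal.extendedHom'_apply, FractionalIdeal.extended_spanSingleton, localization_map]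

lemma mem_map_of_mem (f : E →+* E') {I : FId E} {x : E} (hx : x ∈ I) : f x ∈ map f I := by
  simp only [map, FractionalIdeal.extendedHom'_apply, FractionalIdeal.mem_extended_iff, localization_map]
  exact Submodule.subset_span ⟨x, hx, rfl⟩

lemma map_le (f : E →+* E') {I : FId E} {J : FId E'} (h : ∀ x ∈ I, f x ∈ J) : map f I ≤ J := by
  intro y hy
  simp only [map, FractionalIdeal.extendedHom'_apply, FractionalIdeal.mem_extended_iff, localization_map] at hy
  refine (Submodule.span_le (p := J.val)).mpr ?_ hy
  rintro _ ⟨x, hx, rfl⟩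
  exact h x hx

lemma map_map {E'' : Type*} [Field E''] [NumberField E''] (f : E →+* E') (g : E' →+* E'') (I : FId E) :
    map g (map f I) = map (g.comp f) I :=
  FractionalIdeal.extended_extended E' (le_comap f) I (le_comap g)

lemma map_id (I : FId E) : map (RingHom.id E) I = I :=
  le_antisymm (map_le _ fun _ hx => hx) fun _ hx => mem_map_of_mem (RingHom.id E) hx

lemma mem_map_iff (σ : E →+* E) (hσ : ∀ x, σ (σ x) = x) {I : FId E} {x : E} : x ∈ map σ I ↔ σ x ∈ I := by
  have hid : σ.comp σ = RingHom.id E := RingHom.ext hσ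
  constructor
  · intro h
    have := mem_map_of_mem σ h
    rwa [map_map, hid, map_id] at this
  · intro h
    rw [← hσ x]
    exact mem_map_of_mem σ h

lemma le_one_of_map_le_one (f : E →+* E') {I : FId E} (h : map f I ≤ 1) : I ≤ 1 := fun _ hx =>
  mem_one.mpr ((isIntegral_algHom_iff (f.toIntAlgHom) f.injective).mp (mem_one.mp (h (mem_map_of_mem f hx))))

lemma map_ne_zero (f : E →+* E') {I : FId E} (hI : I ≠ 0) : map f I ≠ 0 := (_root_.map_ne_zero (map f)).mpr hI

lemma map_injective (f : E →+* E') : Function.Injective (map f) := by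
  have key : ∀ I J : FId E, J ≠ 0 → map f I = map f J → I ≤ J := fun I J hJ h => by
    have : map f (I / J) ≤ 1 := by rw [map_div₀, h, div_self (map_ne_zero f hJ)]
    simpa using (div_le_iff₀ (pos_iff_ne_zero.mpr hJ)).mp (le_one_of_map_le_one f this)
  intro I J h
  by_cases hJ : J = 0
  · rw [hJ, map_zero, _root_.map_eq_zero] at h
    rw [h, hJ]
  by_cases hI : I = 0
  · rw [hI, map_zero, eq_comm, _root_.map_eq_zero] at h
    exact absurd h hJ
  exact le_antisymm (key I J hJ h) (key J I hI h.symm)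

/-- Fractional ideals of the form `I * σ I` come from the fixed field of the involution `σ`. -/
lemma exists_norm (ι : E →+* E') (σ : E' →+* E') (hσ : ∀ x, σ (σ x) = x)
    (hfix : ∀ x, σ x = x → ∃ m, ι m = x) {I : FId E'} (hI : I ≠ 0) :
    ∃ N : FId E, N ≠ 0 ∧ I * map σ I = map ι N := by
  obtain ⟨d, hd, -, hdI⟩ := exists_bound I
  obtain ⟨e, he⟩ := hfix (d * σ d) (by rw [map_mul, hσ, mul_comm])
  have int_iff : ∀ m : E, IsIntegral ℤ (ι m) ↔ IsIntegral ℤ m := fun m =>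
    isIntegral_algHom_iff ι.toIntAlgHom ι.injective
  have he0 : e ≠ 0 := by
    rintro rfl
    rw [map_zero] at he
    exact (mul_ne_zero hd ((_root_.map_ne_zero σ).mpr hd)) he.symm
  let N : FId E := mk' (fun m => ι m ∈ I * map σ I) (by simpa using zero_mem)
    (fun x y hx hy => by simpa using add_mem hx hy)
    (fun a x ha hx => by simpa using mul_mem (map_isIntegral_int ι ha) hx) e he0 fun m hm => by
      rw [← int_iff, map_mul, he]
      refine FractionalIdeal.mul_induction_on hm (fun i hi j hj => ?_) fun x y hx hy => ?_
      · have := map_isIntegral_int σ (hdI _ ((mem_map_iff σ hσ).mp hj))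
        rw [map_mul, hσ] at this
        convert! (hdI i hi).mul this using 1; ring
      · rw [mul_add]; exact hx.add hy
  have hN : ∀ m, m ∈ N ↔ ι m ∈ I * map σ I := fun m => mem_mk'
  obtain ⟨x, hx, hx0⟩ := exists_mem_ne_zero hI
  have mem_norm : ∀ x ∈ I, ∃ m ∈ N, ι m = x * σ x := fun x hx => by
    obtain ⟨m, hm⟩ := hfix (x * σ x) (by rw [map_mul, hσ, mul_comm])
    exact ⟨m, (hN m).mpr (hm ▸ FractionalIdeal.mul_mem_mul hx (mem_map_of_mem σ hx)), hm⟩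
  have hN0 : N ≠ 0 := by
    obtain ⟨m, hm, h⟩ := mem_norm x hx
    refine ne_zero_of_mem hm fun h0 => ?_
    rw [h0, map_zero] at h
    exact (mul_ne_zero hx0 ((_root_.map_ne_zero σ).mpr hx0)) h.symm
  refine ⟨N, hN0, le_antisymm ?_ (map_le ι fun m hm => (hN m).mp hm)⟩
  rw [FractionalIdeal.mul_le]
  intro x hx z hz
  have hy := (mem_map_iff σ hσ).mp hz
  set y := σ z with hyz
  have hzy : z = σ y := by rw [hyz, hσ]
  rw [hzy]
  by_cases ht : x * σ y = 0
  · rw [ht]; exact zero_mem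
  have key : ∀ u ∈ N⁻¹, IsIntegral ℤ (ι u * (x * σ y)) := fun u hu => by
    rw [mem_inv hN0] at hu
    obtain ⟨a, ha, ha'⟩ := mem_norm x hx
    obtain ⟨b, hb, hb'⟩ := mem_norm y hy
    obtain ⟨c, hc, hc'⟩ := mem_norm (x + y) (add_mem hx hy)
    rw [map_add] at hc'
    refine isIntegral_of_trace_norm (t := ι (u * c) - ι (u * a) - ι (u * b)) (n := ι (u * a) * ι (u * b)) ?_
      ((((int_iff _).mpr (hu c hc)).sub ((int_iff _).mpr (hu a ha))).sub ((int_iff _).mpr (hu b hb)))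
      (((int_iff _).mpr (hu a ha)).mul ((int_iff _).mpr (hu b hb)))
    simp only [map_mul, ha', hb', hc']
    ring
  have h : map ι N⁻¹ ≤ (pr (x * σ y))⁻¹ := by
    refine map_le ι fun u hu => (mem_inv (pr_ne_zero ht)).mpr fun w hw => ?_
    obtain ⟨a, ha, rfl⟩ := mem_pr.mp hw
    convert! ha.mul (key u hu) using 1; ring
  have h' := FractionalIdeal.inv_anti_mono (map_ne_zero ι (inv_ne_zero hN0)) (inv_ne_zero (pr_ne_zero ht)) h
  rw [← map_inv₀, inv_inv, inv_inv] at h'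
  exact h' (mem_pr.mpr ⟨1, isIntegral_one, by ring⟩)

end Map

end FId

/-- Hamilton quaternions over `F`. -/
abbrev Ham (F : Type) [Field F] := ℍ[F, -1, -1]

namespace Ham

attribute [local simp] QuadraticAlgebra.re_one QuadraticAlgebra.im_one

section
variable {F : Type} [Field F] [NumberField F] [Fact (∀ x : F, x ^ 2 ≠ -1 + 0 * x)]

/-- The quaternion `x + w j`, with `x`, `w` in `F(i)`. -/
def qm (x w : Gau F) : Ham F := ⟨x.re, x.im, w.re, w.im⟩

/-- The coordinate `x` of `x + w j`. -/
def fst (h : Ham F) : Gau F := ⟨h.re, h.imI⟩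

/-- The coordinate `w` of `x + w j`. -/
def snd (h : Ham F) : Gau F := ⟨h.imJ, h.imK⟩

@[simp] lemma fst_mk (x w : Gau F) : fst (qm x w) = x := rfl
@[simp] lemma snd_mk (x w : Gau F) : snd (qm x w) = w := rfl
@[simp] lemma mk_eta (h : Ham F) : qm (fst h) (snd h) = h := rfl

lemma ext' {h k : Ham F} (h1 : fst h = fst k) (h2 : snd h = snd k) : h = k := by
  rw [← mk_eta h, ← mk_eta k, h1, h2]

@[simp] lemma fst_add (h k : Ham F) : fst (h + k) = fst h + fst k := rfl
@[simp] lemma snd_add (h k : Ham F) : snd (h + k) = snd h + snd k := rfl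
@[simp] lemma fst_neg (h : Ham F) : fst (-h) = -fst h := rfl
@[simp] lemma snd_neg (h : Ham F) : snd (-h) = -snd h := rfl
@[simp] lemma snd_zero : snd (0 : Ham F) = 0 := rfl
@[simp] lemma fst_zero : fst (0 : Ham F) = 0 := rfl
@[simp] lemma fst_one : fst (1 : Ham F) = 1 := rfl
@[simp] lemma snd_one : snd (1 : Ham F) = 0 := rfl
@[simp] lemma fst_sub (h k : Ham F) : fst (h - k) = fst h - fst k := rfl
@[simp] lemma snd_sub (h k : Ham F) : snd (h - k) = snd h - snd k := rfl
@[simp] lemma fst_algebraMap (a : F) :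
    fst (algebraMap F (Ham F) a) = algebraMap F _ a := rfl
@[simp] lemma snd_algebraMap (a : F) : snd (algebraMap F (Ham F) a) = 0 := rfl

lemma fst_mul (h k : Ham F) : fst (h * k) = fst h * fst k - snd h * star (snd k) := by
  ext <;> simp [fst, snd] <;> ring

lemma snd_mul (h k : Ham F) : snd (h * k) = fst h * snd k + snd h * star (fst k) := by
  ext <;> simp [fst, snd] <;> ring

lemma fst_smul (a : F) (h : Ham F) : fst (a • h) = algebraMap F _ a * fst h := by
  rw [algebraMap_gau]; ext <;> simp [fst]

lemma snd_smul (a : F) (h : Ham F) : snd (a • h) = algebraMap F _ a * snd h := by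
  rw [algebraMap_gau]; ext <;> simp [snd]

/-- Reduced trace. -/
def tr (h : Ham F) : F := 2 * (fst h).re

/-- Reduced norm. -/
def nr (h : Ham F) : F := (fst h).norm + (snd h).norm

lemma nr_eq (h : Ham F) : nr h = h.re ^ 2 + h.imI ^ 2 + h.imJ ^ 2 + h.imK ^ 2 := by
  rw [nr, gau_norm, gau_norm]; simp only [fst, snd]; ring

lemma nr_mul (h k : Ham F) : nr (h * k) = nr h * nr k := by
  simp only [nr_eq]; simp; ring

/-- The conjugate quaternion. -/
def conj (h : Ham F) : Ham F := algebraMap F _ (tr h) - h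

lemma fst_conj (h : Ham F) : fst (conj h) = star (fst h) := by
  rw [conj, fst_sub, fst_algebraMap, tr, ← gau_add_star]; ring

lemma snd_conj (h : Ham F) : snd (conj h) = -snd h := by
  rw [conj, snd_sub, snd_algebraMap, zero_sub]

lemma mul_conj (h : Ham F) : h * conj h = algebraMap F _ (nr h) := by
  apply ext'
  · rw [fst_mul, fst_conj, snd_conj, fst_algebraMap, nr, map_add, ← gau_mul_star, ← gau_mul_star,
      star_neg]
    ring
  · rw [snd_mul, fst_conj, snd_conj, snd_algebraMap, star_star]
    ring

lemma conj_mul (h : Ham F) : conj h * h = algebraMap F _ (nr h) := by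
  apply ext'
  · rw [fst_mul, fst_conj, snd_conj, fst_algebraMap, nr, map_add, ← gau_mul_star, ← gau_mul_star]
    ring
  · rw [snd_mul, fst_conj, snd_conj, snd_algebraMap]
    ring

lemma mul_self (h : Ham F) : h * h = (-nr h) • 1 + tr h • h := by
  rw [nr_eq, tr, fst]
  ext <;> simp <;> ring

lemma nr_ne_zero (hF : ∃ _ : F →+* ℝ, True) {h : Ham F} (hh : h ≠ 0) : nr h ≠ 0 := by
  obtain ⟨σ, -⟩ := hF
  intro h0
  apply hh
  have h1 := congrArg σ h0
  rw [nr_eq] at h1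
  simp only [map_add, map_pow, map_zero] at h1
  have hz : ∀ x : F, σ x ^ 2 = 0 → x = 0 := fun x hx => by simpa using hx
  ext
  · exact hz _ (by nlinarith [sq_nonneg (σ h.re), sq_nonneg (σ h.imI), sq_nonneg (σ h.imJ), sq_nonneg (σ h.imK)])
  · exact hz _ (by nlinarith [sq_nonneg (σ h.re), sq_nonneg (σ h.imI), sq_nonneg (σ h.imJ), sq_nonneg (σ h.imK)])
  · exact hz _ (by nlinarith [sq_nonneg (σ h.re), sq_nonneg (σ h.imI), sq_nonneg (σ h.imJ), sq_nonneg (σ h.imK)])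
  · exact hz _ (by nlinarith [sq_nonneg (σ h.re), sq_nonneg (σ h.imI), sq_nonneg (σ h.imJ), sq_nonneg (σ h.imK)])

/-- A quaternion of nonzero norm, as a unit. -/
def unit (h : Ham F) (hh : nr h ≠ 0) : (Ham F)ˣ where
  val := h
  inv := (nr h)⁻¹ • conj h
  val_inv := by
    rw [mul_smul_comm, mul_conj, Algebra.smul_def, ← map_mul, inv_mul_cancel₀ hh, map_one]
  inv_val := by
    rw [smul_mul_assoc, conj_mul, Algebra.smul_def, ← map_mul, inv_mul_cancel₀ hh, map_one]

/-- A non-scalar quaternion generates a quadratic algebra. -/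
lemma lift_injective {h : Ham F} (hh : ∀ a : F, h ≠ algebraMap F _ a) :
    Function.Injective (QuadraticAlgebra.lift (R := F) (a := -nr h) (b := tr h) ⟨h, mul_self h⟩) := by
  rw [injective_iff_map_eq_zero]
  intro x hx
  rw [QuadraticAlgebra.lift_apply_apply] at hx
  have h1 : x.im = 0 := by
    by_contra h0
    apply hh (-x.im⁻¹ * x.re)
    have : x.im⁻¹ • (x.re • 1 + x.im • h) = 0 := by rw [hx, smul_zero]
    rw [smul_add, smul_smul, smul_smul, inv_mul_cancel₀ h0, one_smul, ← Algebra.algebraMap_eq_smul_one] at this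
    rw [neg_mul, map_neg]
    exact eq_neg_of_add_eq_zero_right this
  rw [h1, zero_smul, add_zero] at hx
  have h2 : x.re = 0 := by simpa using congrArg QuaternionAlgebra.re hx
  ext <;> assumption

end

section
variable {F : Type} [Field F] [NumberField F] [Fact (∀ x : F, x ^ 2 ≠ -1 + 0 * x)]

lemma isIntegral_tr_nr {h : Ham F} (hh : IsIntegral ℤ h) :
    IsIntegral ℤ (tr h) ∧ IsIntegral ℤ (nr h) := by
  by_cases hs : ∀ a : F, h ≠ algebraMap F _ a
  · set f := QuadraticAlgebra.lift (R := F) (a := -nr h) (b := tr h) ⟨h, mul_self h⟩ with hf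
    have hfi : Function.Injective f := lift_injective hs
    set w : QuadraticAlgebra F (-nr h) (tr h) := ⟨0, 1⟩ with hw
    have hfw : f w = h := by
      rw [hf, QuadraticAlgebra.lift_apply_apply]; simp [hw]
    have hwi : IsIntegral ℤ w := by
      rw [← hfw] at hh
      exact (isIntegral_algHom_iff (f.restrictScalars ℤ) hfi).mp hh
    have hwi' : IsIntegral ℤ (star w) := hwi.map (starRingEnd (QuadraticAlgebra F (-nr h) (tr h))).toIntAlgHom
    have hinj : Function.Injective (algebraMap F (QuadraticAlgebra F (-nr h) (tr h))) := fun x y hxy => by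
      simpa using congrArg QuadraticAlgebra.re hxy
    have hd : ∀ a : F, IsIntegral ℤ (algebraMap F (QuadraticAlgebra F (-nr h) (tr h)) a) → IsIntegral ℤ a :=
      fun a ha => (isIntegral_algHom_iff (algebraMap F (QuadraticAlgebra F (-nr h) (tr h))).toIntAlgHom hinj).mp ha
    constructor
    · apply hd
      convert! hwi.add hwi' using 1
      ext <;> simp [hw]
    · apply hd
      convert! hwi.mul hwi' using 1
      ext <;> simp [hw]
  · push Not at hs
    obtain ⟨a, rfl⟩ := hs
    have ha : IsIntegral ℤ a := by
      refine (isIntegral_algHom_iff (algebraMap F (Ham F)).toIntAlgHom ?_).mp hh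
      intro x y hxy
      simpa using congrArg QuaternionAlgebra.re hxy
    constructor
    · rw [tr, fst_algebraMap, gau_coe_re]
      exact (by simpa using isIntegral_nat (A := F) 2 : IsIntegral ℤ (2 : F)).mul ha
    · rw [nr, fst_algebraMap, snd_algebraMap, gau_norm, gau_norm]
      simpa using ha.pow 2

lemma isIntegral_of_mem {O : Subring (Ham F)} (hO : IsOrder F O) {h : Ham F} (hh : h ∈ O) :
    IsIntegral ℤ h := by
  refine IsIntegral.of_mem_of_fg (subalgebraOfSubring O) ?_ h hh
  have := hO.2.1
  rw [Submodule.fg_iff_addSubgroup_fg]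
  exact this

end
end Ham

section
variable {F : Type} [Field F] [NumberField F] [Fact (∀ x : F, x ^ 2 ≠ -1 + 0 * x)]

lemma star_gau (a : F) : star (algebraMap F (Gau F) a) = algebraMap F _ a := by
  rw [algebraMap_gau]; ext <;> simp

/-- The action of complex conjugation on fractional ideals of `F(i)`. -/
def bar : FId (Gau F) →+* FId (Gau F) := FId.map (starRingEnd (Gau F))

lemma mem_bar {I : FId (Gau F)} {x : Gau F} : x ∈ bar I ↔ star x ∈ I :=
  FId.mem_map_iff _ star_star

lemma bar_bar (I : FId (Gau F)) : bar (bar I) = I := by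
  ext x; rw [mem_bar, mem_bar, star_star]

lemma bar_pr (x : Gau F) : bar (FId.pr x) = FId.pr (star x) := FId.map_pr _ x

lemma mul_bar_le_one_iff {I : FId (Gau F)} :
    I * bar I ≤ 1 ↔ ∀ x ∈ I, ∀ y ∈ I, IsIntegral ℤ (x * star y) := by
  rw [FractionalIdeal.mul_le]
  constructor
  · intro h x hx y hy
    exact FId.mem_one.mp (h x hx _ (mem_bar.mpr (by rwa [star_star])))
  · intro h x hx y hy
    simpa using FId.mem_one.mpr (h x hx _ (mem_bar.mp hy))

/-- The right order of an additive subgroup of a ring. -/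
def rightOrder {A : Type*} [Ring A] (J : AddSubgroup A) : Subring A where
  carrier := {h | ∀ k ∈ J, k * h ∈ J}
  mul_mem' := fun {a b} ha hb k hk => by
    rw [← mul_assoc]; exact hb _ (ha _ hk)
  one_mem' := fun k hk => by rwa [mul_one]
  add_mem' := fun {a b} ha hb k hk => by
    rw [mul_add]; exact J.add_mem (ha _ hk) (hb _ hk)
  zero_mem' := fun k _ => by rw [mul_zero]; exact J.zero_mem
  neg_mem' := fun {a} ha k hk => by rw [mul_neg]; exact J.neg_mem (ha _ hk)

namespace Ham

lemma fg_of_bounded {O : AddSubgroup (Ham F)} {d : Gau F} (hd : d ≠ 0)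
    (h : ∀ h ∈ O, IsIntegral ℤ (d * fst h) ∧ IsIntegral ℤ (d * snd h)) : O.FG := by
  let f : (𝓞 (Gau F) × 𝓞 (Gau F)) →+ Ham F :=
    { toFun := fun z => qm (d⁻¹ * z.1) (d⁻¹ * z.2)
      map_zero' := by apply ext' <;> simp
      map_add' := fun x y => by apply ext' <;> simp [mul_add] }
  have hle : O.toIntSubmodule ≤ LinearMap.range f.toIntLinearMap := by
    intro x hx
    obtain ⟨h1, h2⟩ := h x hx
    refine ⟨(⟨_, h1⟩, ⟨_, h2⟩), ?_⟩
    apply ext'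
    · change d⁻¹ * (d * fst x) = _
      field_simp
    · change d⁻¹ * (d * snd x) = _
      field_simp
  have := isNoetherian_submodule.mp (inferInstanceAs (IsNoetherian ℤ (LinearMap.range f.toIntLinearMap))) _ hle
  rwa [Submodule.fg_iff_addSubgroup_fg] at this

/-- Any subring containing `O_F`, the element `η`, and some nonzero `w j` spans. -/
lemma span_eq_top {O : Subring (Ham F)} {e w : Gau F} (he : e.im ≠ 0)
    (heO : qm e 0 ∈ O) (hw : w ≠ 0) (hwO : qm 0 w ∈ O) :
    Submodule.span F (O : Set (Ham F)) = ⊤ := by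
  have hmul : ∀ a ∈ Submodule.span F (O : Set (Ham F)), ∀ b ∈ Submodule.span F (O : Set (Ham F)),
      a * b ∈ Submodule.span F (O : Set (Ham F)) := by
    intro a ha b hb
    have := Submodule.mul_mem_mul ha hb
    rw [Submodule.span_mul_span] at this
    refine Submodule.span_mono ?_ this
    rintro _ ⟨x, hx, y, hy, rfl⟩
    exact O.mul_mem hx hy
  have hL : ∀ x : Gau F, qm x 0 ∈ Submodule.span F (O : Set (Ham F)) := by
    intro x
    have h1 : (1 : Ham F) ∈ Submodule.span F (O : Set (Ham F)) := Submodule.subset_span O.one_mem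
    have h2 := Submodule.subset_span (R := F) heO
    convert! Submodule.add_mem _ (Submodule.smul_mem _ (x.re - x.im / e.im * e.re) h1)
      (Submodule.smul_mem _ (x.im / e.im) h2) using 1
    apply ext'
    · rw [fst_add, fst_smul, fst_smul, fst_one, fst_mk, fst_mk, algebraMap_gau, algebraMap_gau]
      ext
      · simp
      · simp; field_simp
    · rw [snd_add, snd_smul, snd_smul]; simp
  rw [eq_top_iff]
  intro h _
  have := Submodule.add_mem _ (hL (fst h)) (hmul _ (hL (snd h * w⁻¹)) _ (Submodule.subset_span hwO))
  convert! this using 1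
  apply ext'
  · rw [fst_add, fst_mul]; simp
  · rw [snd_add, snd_mul]; simp [hw]

/-- The order `O_L + 𝔟 j`. -/
def ord1 (𝔟 : FId (Gau F)) (h𝔟 : 𝔟 * bar 𝔟 ≤ 1) : Subring (Ham F) where
  carrier := {h | IsIntegral ℤ (fst h) ∧ snd h ∈ 𝔟}
  mul_mem' := fun {a b} ha hb => by
    constructor
    · rw [fst_mul]
      exact (ha.1.mul hb.1).sub (mul_bar_le_one_iff.mp h𝔟 _ ha.2 _ hb.2)
    · rw [snd_mul, mul_comm (snd a)]
      exact FId.add_mem (FId.mul_mem ha.1 hb.2) (FId.mul_mem (isIntegral_gau_star hb.1) ha.2)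
  one_mem' := ⟨by simpa using isIntegral_one, by simpa using FId.zero_mem⟩
  add_mem' := fun {a b} ha hb => ⟨ha.1.add hb.1, FId.add_mem ha.2 hb.2⟩
  zero_mem' := ⟨by simpa using isIntegral_zero, by simpa using FId.zero_mem⟩
  neg_mem' := fun {a} ha => ⟨ha.1.neg, FId.neg_mem ha.2⟩

lemma mem_ord1 {𝔟 : FId (Gau F)} {h𝔟 : 𝔟 * bar 𝔟 ≤ 1} {h : Ham F} :
    h ∈ ord1 𝔟 h𝔟 ↔ IsIntegral ℤ (fst h) ∧ snd h ∈ 𝔟 := Iff.rfl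

/-- The left `O_L`-lattice generated by `(1 + y j) / s` and `𝔟 j`. -/
def lat (s : F) (𝔟 : FId (Gau F)) (y : Gau F) : AddSubgroup (Ham F) where
  carrier := {h | IsIntegral ℤ (algebraMap F _ s * fst h) ∧ snd h - fst h * y ∈ 𝔟}
  add_mem' := fun {a b} ha hb => by
    constructor
    · rw [fst_add, mul_add]; exact ha.1.add hb.1
    · convert! FId.add_mem ha.2 hb.2 using 1
      rw [fst_add, snd_add]; ring
  zero_mem' := ⟨by simpa using isIntegral_zero, by simpa using FId.zero_mem⟩
  neg_mem' := fun {a} ha => by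
    constructor
    · rw [fst_neg, mul_neg]; exact ha.1.neg
    · convert! FId.neg_mem ha.2 using 1
      rw [fst_neg, snd_neg]; ring

lemma mem_lat {s : F} {𝔟 : FId (Gau F)} {y : Gau F} {h : Ham F} :
    h ∈ lat s 𝔟 y ↔ IsIntegral ℤ (algebraMap F _ s * fst h) ∧ snd h - fst h * y ∈ 𝔟 := Iff.rfl

/-- The right order of `lat s 𝔟 y`. -/
def ord2 (s : F) (𝔟 : FId (Gau F)) (y : Gau F) : Subring (Ham F) := rightOrder (lat s 𝔟 y)

/-- The element `(1 + y j) / s`. -/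
def al (s : F) (y : Gau F) : Ham F := qm (1 / algebraMap F _ s) (y / algebraMap F _ s)

/-- Compatibility of `y` and `𝔟` making `ord2 s 𝔟 y` a ring with good properties. -/
structure Good (s : F) (𝔟 : FId (Gau F)) (y : Gau F) : Prop where
  mem : y ∈ 𝔟
  int : IsIntegral ℤ ((1 + y.norm) / s)

end Ham
open Ham
namespace RealQuad
variable {p : ℕ} {r s : F} (H : RealQuad F p r s) {𝔟 : FId (Gau F)} {y : Gau F}
include H

lemma isIntegral_sL : IsIntegral ℤ (algebraMap F (Gau F) s) := H.isIntegral_s.gau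

lemma one_mem_lat (hy : y ∈ 𝔟) : (1 : Ham F) ∈ lat s 𝔟 y := by
  refine ⟨by simpa using H.isIntegral_sL, ?_⟩
  simpa using FId.neg_mem hy

lemma al_mem_lat : al s y ∈ lat s 𝔟 y := by
  have := H.algebraMap_s_ne
  refine ⟨?_, ?_⟩
  · rw [al, fst_mk, mul_one_div_cancel this]; exact isIntegral_one
  · rw [al, fst_mk, snd_mk]
    convert! FId.zero_mem (I := 𝔟) using 1
    ring

omit H in
lemma exists_good (hy : Good s 𝔟 y) (H : RealQuad F p r s) : ∃ t : F, IsIntegral ℤ t ∧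
    algebraMap F (Gau F) s * algebraMap F _ t = 1 + y * star y := by
  refine ⟨_, hy.int, ?_⟩
  rw [← map_mul, mul_div_cancel₀ _ H.s_ne, gau_mul_star, map_add, map_one]

lemma mem_ord2 (h𝔟 : 𝔟 * bar 𝔟 ≤ 1) (hy : Good s 𝔟 y) {h : Ham F} :
    h ∈ ord2 s 𝔟 y ↔ h ∈ lat s 𝔟 y ∧ al s y * h ∈ lat s 𝔟 y := by
  rw [mul_bar_le_one_iff] at h𝔟
  constructor
  · intro hh
    refine ⟨?_, hh _ H.al_mem_lat⟩
    have := hh 1 (H.one_mem_lat hy.mem)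
    rwa [one_mul] at this
  · rintro ⟨⟨h1, h2⟩, h3, h4⟩ k ⟨k1, k2⟩
    obtain ⟨t, ht, htt⟩ := exists_good hy H
    have ht' := ht.gau
    have hy0 := hy.mem
    simp only [al, fst_mul, snd_mul, fst_mk, snd_mk] at h3 h4
    have hS := H.algebraMap_s_ne
    have hSs := star_gau s
    set S := algebraMap F (Gau F) s
    set T := algebraMap F (Gau F) t
    obtain ⟨a, hka⟩ : ∃ a, a = S * fst k := ⟨_, rfl⟩
    obtain ⟨b, hkb⟩ : ∃ b, b = snd k - fst k * y := ⟨_, rfl⟩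
    rw [← hka] at k1
    rw [← hkb] at k2
    have e1 : fst k = a / S := by rw [hka]; field_simp
    have e2 : snd k = b + a / S * y := by rw [hkb, e1]; ring
    obtain ⟨c, hc⟩ : ∃ c, c = snd h - fst h * y := ⟨_, rfl⟩
    rw [← hc] at h2
    have e3 : snd h = c + fst h * y := by rw [hc]; ring
    rw [mem_lat, fst_mul, snd_mul, e1, e2]
    have hsf : IsIntegral ℤ (S * star (fst h)) := by
      have := isIntegral_gau_star h1
      rwa [star_mul', hSs] at this
    have hbc := h𝔟 _ k2 _ h2
    have hby := h𝔟 _ k2 _ hy0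
    have hcy := h𝔟 _ hy0 _ h2
    constructor
    · have : S * (a / S * fst h - (b + a / S * y) * star (snd h)) =
        a * (S * (1 / S * fst h - y / S * star (snd h))) - S * (b * star c)
          - (S * star (fst h)) * (b * star y) := by
        rw [e3, star_add, star_mul']
        field_simp; ring
      rw [this]
      exact ((k1.mul h3).sub (H.isIntegral_sL.mul hbc)).sub (hsf.mul hby)
    · have : a / S * snd h + (b + a / S * y) * star (fst h) -
          (a / S * fst h - (b + a / S * y) * star (snd h)) * y =
          a * (1 / S * snd h + y / S * star (fst h) - (1 / S * fst h - y / S * star (snd h)) * y)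
          + (S * star (fst h) * T + star (c * star y)) * b := by
        rw [mul_right_comm S, htt, e3, star_add, star_mul', star_mul', star_star]
        field_simp; ring
      rw [this]
      refine FId.add_mem (FId.mul_mem k1 h4) (FId.mul_mem ((hsf.mul ht').add ?_) k2)
      exact isIntegral_gau_star (h𝔟 _ h2 _ hy0)

lemma ord2_mono (h𝔟 : 𝔟 * bar 𝔟 ≤ 1) {𝔟' : FId (Gau F)} (h𝔟' : 𝔟' * bar 𝔟' ≤ 1) (hle : 𝔟 ≤ 𝔟')
    (hy : Good s 𝔟 y) : ord2 s 𝔟 y ≤ ord2 s 𝔟' y := by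
  intro h hh
  rw [H.mem_ord2 h𝔟 hy] at hh
  rw [H.mem_ord2 h𝔟' ⟨hle hy.mem, hy.int⟩]
  exact ⟨⟨hh.1.1, hle hh.1.2⟩, ⟨hh.2.1, hle hh.2.2⟩⟩

lemma eta_mem_ord1 (h𝔟 : 𝔟 * bar 𝔟 ≤ 1) : qm H.eta 0 ∈ ord1 𝔟 h𝔟 :=
  ⟨H.isIntegral_eta, FId.zero_mem⟩

lemma eta_mem_ord2 (h𝔟 : 𝔟 * bar 𝔟 ≤ 1) (hy : Good s 𝔟 y) : qm H.eta 0 ∈ ord2 s 𝔟 y := by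
  rw [H.mem_ord2 h𝔟 hy, mem_lat, mem_lat, fst_mul, snd_mul, al]
  have hS := H.algebraMap_s_ne
  have he := H.eta_sub_star
  simp only [fst_mk, snd_mk, mul_zero, zero_sub, zero_add, star_zero, sub_zero]
  refine ⟨⟨H.isIntegral_sL.mul H.isIntegral_eta, FId.neg_mem (FId.mul_mem H.isIntegral_eta hy.mem)⟩, ?_, ?_⟩
  · convert! H.isIntegral_eta using 1
    field_simp
  · convert! FId.neg_mem (FId.mul_mem isIntegral_gI hy.mem) using 1
    generalize star H.eta = e' at *
    rw [sub_eq_iff_eq_add.mp he]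
    field_simp; ring

lemma s_mul_mem_ord2 (h𝔟 : 𝔟 * bar 𝔟 ≤ 1) (hy : Good s 𝔟 y) {b : Gau F} (hb : b ∈ 𝔟) :
    qm 0 (algebraMap F _ s * b) ∈ ord2 s 𝔟 y := by
  rw [H.mem_ord2 h𝔟 hy, mem_lat, mem_lat, fst_mul, snd_mul, al]
  have hS := H.algebraMap_s_ne
  rw [mul_bar_le_one_iff] at h𝔟
  have hi := h𝔟 _ hy.mem _ hb
  simp only [fst_mk, snd_mk, mul_zero, zero_sub, zero_mul, star_zero, sub_zero, add_zero, star_mul',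
    star_gau]
  refine ⟨⟨isIntegral_zero, FId.mul_mem H.isIntegral_sL hb⟩, ?_, ?_⟩
  · convert! (H.isIntegral_sL.mul hi).neg using 1
    field_simp
  · convert! FId.add_mem hb (FId.mul_mem hi hy.mem) using 1
    field_simp; ring

/-- The element `(1 + y j) / s + t ω`. -/
def oy (H : RealQuad F p r s) (y : Gau F) : Ham F :=
  qm (1 / algebraMap F _ s + algebraMap F _ ((1 + y.norm) / s) * H.om) (y / algebraMap F _ s)

lemma oy_mem_ord2 (h𝔟 : 𝔟 * bar 𝔟 ≤ 1) (hy : Good s 𝔟 y) : H.oy y ∈ ord2 s 𝔟 y := by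
  rw [H.mem_ord2 h𝔟 hy, mem_lat, mem_lat, fst_mul, snd_mul, al, oy]
  have hS := H.algebraMap_s_ne
  have ht := hy.int
  have htt : algebraMap F (Gau F) s * algebraMap F _ ((1 + y.norm) / s) = 1 + y * star y := by
    rw [← map_mul, mul_div_cancel₀ _ H.s_ne, gau_mul_star, map_add, map_one]
  set t := (1 + y.norm) / s
  have ht' := ht.gau
  have h2s : IsIntegral ℤ (2 / algebraMap F (Gau F) s) := by
    have := H.isIntegral_two_div.gau; rwa [map_div₀, map_ofNat] at this
  have hom := sub_eq_iff_eq_add.mp H.om_sub_star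
  simp only [fst_mk, snd_mk, star_add, star_div₀, star_one, star_mul', star_gau]
  refine ⟨⟨?_, ?_⟩, ?_, ?_⟩
  · rw [mul_add, mul_one_div_cancel hS]
    exact isIntegral_one.add (H.isIntegral_sL.mul (ht'.mul H.isIntegral_om))
  · convert! FId.neg_mem (FId.mul_mem (ht'.mul H.isIntegral_om) hy.mem) using 1
    ring
  · convert! (h2s.sub ht').add (ht'.mul H.isIntegral_om) using 1
    have : algebraMap F (Gau F) t = (1 + y * star y) / algebraMap F (Gau F) s := by
      rw [← htt]; field_simp
    rw [this]; field_simp; ring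
  · convert! FId.neg_mem (FId.mul_mem (ht'.mul H.isIntegral_gI_sub_one) hy.mem) using 1
    have : algebraMap F (Gau F) t = (1 + y * star y) / algebraMap F (Gau F) s := by
      rw [← htt]; field_simp
    generalize star H.om = o' at *
    rw [this, hom]; field_simp; ring

lemma eta_im_ne : H.eta.im ≠ 0 := div_ne_zero H.s_ne two_ne_zero

lemma ord1_isOrder (h𝔟 : 𝔟 * bar 𝔟 ≤ 1) (h0 : 𝔟 ≠ 0) : IsOrder F (ord1 𝔟 h𝔟) := by
  refine ⟨?_, ?_, ?_⟩
  · rintro _ ⟨a, rfl⟩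
    rw [SetLike.mem_coe, mem_ord1, fst_algebraMap, snd_algebraMap]
    exact ⟨a.2.gau, FId.zero_mem⟩
  · obtain ⟨d, hd, hdi, hdm⟩ := FId.exists_bound 𝔟
    exact fg_of_bounded hd fun h hh => ⟨hdi.mul hh.1, hdm _ hh.2⟩
  · obtain ⟨b, hb, hb0⟩ := FId.exists_mem_ne_zero h0
    exact span_eq_top H.eta_im_ne (H.eta_mem_ord1 h𝔟) hb0 ⟨isIntegral_zero, hb⟩

lemma ord2_isOrder (h𝔟 : 𝔟 * bar 𝔟 ≤ 1) (h0 : 𝔟 ≠ 0) (hy : Good s 𝔟 y) : IsOrder F (ord2 s 𝔟 y) := by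
  refine ⟨?_, ?_, ?_⟩
  · rintro _ ⟨a, rfl⟩ k ⟨hk, hk'⟩
    have : ∀ h : Ham F, h * algebraMap F _ (algebraMap (𝓞 F) F a) = (algebraMap (𝓞 F) F a) • h := fun h => by
      rw [Algebra.smul_def, Algebra.commutes]
    have ha : IsIntegral ℤ (algebraMap F (Gau F) (algebraMap (𝓞 F) F a)) := a.2.gau
    rw [this, mem_lat, fst_smul, snd_smul]
    constructor
    · rw [mul_left_comm]; exact ha.mul hk
    · rw [mul_assoc, ← mul_sub]; exact FId.mul_mem ha hk'
  · obtain ⟨d, hd, hdi, hdm⟩ := FId.exists_bound 𝔟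
    have hS := H.algebraMap_s_ne
    refine fg_of_bounded (mul_ne_zero hd hS) fun h hh => ?_
    obtain ⟨h1, h2⟩ := ((H.mem_ord2 h𝔟 hy).mp hh).1
    refine ⟨by rw [mul_assoc]; exact hdi.mul h1, ?_⟩
    have : d * algebraMap F _ s * snd h = algebraMap F _ s * (d * (snd h - fst h * y))
      + algebraMap F _ s * fst h * (d * y) := by ring
    rw [this]
    exact (H.isIntegral_sL.mul (hdm _ h2)).add (h1.mul (hdm _ hy.mem))
  · obtain ⟨b, hb, hb0⟩ := FId.exists_mem_ne_zero h0
    exact span_eq_top H.eta_im_ne (H.eta_mem_ord2 h𝔟 hy) (mul_ne_zero H.algebraMap_s_ne hb0)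
      (H.s_mul_mem_ord2 h𝔟 hy hb)

end RealQuad
end

section
variable {F : Type} [Field F] [NumberField F] [Fact (∀ x : F, x ^ 2 ≠ -1 + 0 * x)]
open Ham

namespace Ham

lemma algebraMap_mem {O : Subring (Ham F)} (hO : IsOrder F O) {a : F} (ha : IsIntegral ℤ a) :
    algebraMap F (Ham F) a ∈ O :=
  hO.1 ⟨⟨a, ha⟩, rfl⟩

lemma conj_mem {O : Subring (Ham F)} (hO : IsOrder F O) {h : Ham F} (hh : h ∈ O) : conj h ∈ O :=
  O.sub_mem (algebraMap_mem hO (isIntegral_tr_nr (isIntegral_of_mem hO hh)).1) hh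

lemma fst_qm_mul (x : Gau F) (h : Ham F) : fst (qm x 0 * h) = x * fst h := by
  rw [fst_mul]; simp

lemma snd_qm_mul (x : Gau F) (h : Ham F) : snd (qm x 0 * h) = x * snd h := by
  rw [snd_mul]; simp

lemma qm_add (x y w v : Gau F) : qm (x + y) (w + v) = qm x w + qm y v := rfl

lemma algebraMap_eq (a : F) : algebraMap F (Ham F) a = qm (algebraMap F _ a) 0 := rfl

lemma exists_snd_ne {O : Subring (Ham F)} (hO : IsOrder F O) : ∃ h ∈ O, snd h ≠ 0 := by
  by_contra! hc
  let V : Submodule F (Ham F) :=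
    { carrier := {h | snd h = 0}
      add_mem' := fun {a b} ha hb => by
        rw [Set.mem_ofPred_eq] at *; rw [snd_add, ha, hb, add_zero]
      zero_mem' := snd_zero
      smul_mem' := fun a x hx => by
        rw [Set.mem_ofPred_eq] at *; rw [snd_smul, hx, mul_zero] }
  have hV : Submodule.span F (O : Set (Ham F)) ≤ V := Submodule.span_le.mpr fun h hh => hc h hh
  rw [hO.2.2] at hV
  have : snd (qm (0 : Gau F) 1) = 0 := hV (Submodule.mem_top)
  simp at this

end Ham

namespace RealQuad
variable {p : ℕ} {r s : F} (H : RealQuad F p r s)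
include H

lemma s_om_mem {O : Subring (Ham F)} (hO : IsOrder F O) (he : qm H.eta 0 ∈ O) :
    qm (algebraMap F _ s * H.om) 0 ∈ O := by
  rw [H.s_mul_om]
  have := O.add_mem he (algebraMap_mem hO H.isIntegral_r_sub_one_mul)
  rw [algebraMap_eq, ← qm_add, zero_add] at this
  exact this

lemma memB_fst {O : Subring (Ham F)} (hO : IsOrder F O) (he : qm H.eta 0 ∈ O) {h : Ham F}
    (hh : h ∈ O) : H.MemB (algebraMap F _ s * fst h) := by
  apply H.memB_of_traces
  · exact (isIntegral_tr_nr (isIntegral_of_mem hO hh)).1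
  · have := (isIntegral_tr_nr (isIntegral_of_mem hO (O.mul_mem (H.s_om_mem hO he) hh))).1
    rwa [tr, fst_qm_mul] at this

lemma exists_le_ord1 {O : Subring (Ham F)} (hO : IsOrder F O)
    (hint : ∀ h ∈ O, IsIntegral ℤ (fst h)) :
    ∃ 𝔟 : FId (Gau F), ∃ h𝔟 : 𝔟 * bar 𝔟 = 1, O ≤ ord1 𝔟 h𝔟.le := by
  have hpair : ∀ h ∈ O, ∀ k ∈ O, IsIntegral ℤ (snd h * star (snd k)) := by
    intro h hh k hk
    have := hint _ (O.mul_mem hh hk)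
    rw [fst_mul] at this
    convert! ((hint h hh).mul (hint k hk)).sub this using 1
    ring
  obtain ⟨k, hk, hk0⟩ := exists_snd_ne hO
  let N : Submodule (𝓞 (Gau F)) (Gau F) := Submodule.span _ (snd '' (O : Set (Ham F)))
  have hN : ∀ x ∈ N, ∀ h ∈ O, IsIntegral ℤ (x * star (snd h)) := by
    intro x hx h hh
    induction hx using Submodule.span_induction with
    | mem x hx => obtain ⟨k, hk, rfl⟩ := hx; exact hpair _ hk _ hh
    | zero => rw [zero_mul]; exact isIntegral_zero
    | add x y _ _ hx hy => rw [add_mul]; exact hx.add hy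
    | smul a x _ hx =>
      rw [Algebra.smul_def, mul_assoc]
      exact a.2.mul hx
  have hN' : ∀ x ∈ N, ∀ y ∈ N, IsIntegral ℤ (x * star y) := by
    intro x hx y hy
    induction hy using Submodule.span_induction with
    | mem y hy => obtain ⟨k, hk, rfl⟩ := hy; exact hN _ hx _ hk
    | zero => rw [star_zero, mul_zero]; exact isIntegral_zero
    | add y z _ _ hy hz => rw [star_add, mul_add]; exact hy.add hz
    | smul a y _ hy =>
      rw [Algebra.smul_def, star_mul', mul_left_comm]
      exact (isIntegral_gau_star a.2).mul hy
  let 𝔟 : FId (Gau F) := FId.mk' (fun x => x ∈ N) N.zero_mem (fun _ _ => N.add_mem)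
    (fun a x ha hx => N.smul_mem (⟨a, ha⟩ : 𝓞 (Gau F)) hx) (star (snd k)) (star_ne_zero.mpr hk0)
    (fun x hx => by rw [mul_comm]; exact hN x hx k hk)
  have hmem : ∀ x, x ∈ 𝔟 ↔ x ∈ N := fun x => FId.mem_mk'
  have hsub : ∀ h ∈ O, snd h ∈ 𝔟 := fun h hh => (hmem _).mpr (Submodule.subset_span ⟨h, hh, rfl⟩)
  obtain ⟨𝔟', hle, h𝔟'⟩ := FId.exists_maximal_pairing bar bar_bar
    (FId.ne_zero_of_mem (hsub k hk) hk0)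
    (mul_bar_le_one_iff.mpr fun x hx y hy => hN' _ ((hmem _).mp hx) _ ((hmem _).mp hy))
  exact ⟨𝔟', h𝔟', fun h hh => ⟨hint h hh, hle (hsub h hh)⟩⟩

lemma exists_al {O : Subring (Ham F)} (hO : IsOrder F O) (he : qm H.eta 0 ∈ O)
    (hint : ¬ ∀ h ∈ O, IsIntegral ℤ (fst h)) :
    ∃ h ∈ O, ∃ l : Gau F, IsIntegral ℤ l ∧ fst h = 1 / algebraMap F _ s + l := by
  push Not at hint
  obtain ⟨h, hh, hi⟩ := hint
  have hS := H.algebraMap_s_ne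
  rcases H.memB_fst hO he hh with h1 | h1
  · rw [mul_div_cancel_left₀ _ hS] at h1
    exact absurd h1 hi
  · exact ⟨h, hh, _, h1, by field_simp; ring⟩

lemma exists_le_ord2 {O : Subring (Ham F)} (hO : IsOrder F O) (he : qm H.eta 0 ∈ O)
    (hint : ¬ ∀ h ∈ O, IsIntegral ℤ (fst h)) :
    ∃ (𝔟 : FId (Gau F)) (y : Gau F), 𝔟 * bar 𝔟 = 1 ∧ Good s 𝔟 y ∧ O ≤ ord2 s 𝔟 y := by
  have hS := H.algebraMap_s_ne
  obtain ⟨h₀, hh₀, l, hl, hl'⟩ := H.exists_al hO he hint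
  -- the left `O_L`-lattice generated by `O`
  let J : AddSubgroup (Ham F) := O.toAddSubgroup ⊔ O.toAddSubgroup.map (AddMonoidHom.mulLeft (qm H.om 0))
  have hJ : ∀ k, k ∈ J ↔ ∃ h₁ ∈ O, ∃ h₂ ∈ O, k = h₁ + qm H.om 0 * h₂ := by
    intro k
    rw [AddSubgroup.mem_sup]
    constructor
    · rintro ⟨a, ha, _, ⟨b, hb, rfl⟩, rfl⟩; exact ⟨a, ha, b, hb, rfl⟩
    · rintro ⟨a, ha, b, hb, rfl⟩; exact ⟨a, ha, _, ⟨b, hb, rfl⟩, rfl⟩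
  have hOJ : ∀ h ∈ O, h ∈ J := fun h hh => (hJ h).mpr ⟨h, hh, 0, O.zero_mem, by simp⟩
  have hJr : ∀ k ∈ J, ∀ h ∈ O, k * h ∈ J := by
    intro k hk h hh
    obtain ⟨a, ha, b, hb, rfl⟩ := (hJ k).mp hk
    exact (hJ _).mpr ⟨_, O.mul_mem ha hh, _, O.mul_mem hb hh, by rw [add_mul, mul_assoc]⟩
  have hJF : ∀ a : F, IsIntegral ℤ a → ∀ k ∈ J, qm (algebraMap F _ a) 0 * k ∈ J := by
    intro a ha k hk
    have := hJr k hk _ (algebraMap_mem hO ha)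
    rwa [← Algebra.commutes, algebraMap_eq] at this
  have hJom : ∀ k ∈ J, qm H.om 0 * k ∈ J := by
    intro k hk
    obtain ⟨a, ha, b, hb, rfl⟩ := (hJ k).mp hk
    obtain ⟨u, v, hu, hv, huv⟩ := H.exists_coords (H.isIntegral_om.mul H.isIntegral_om)
    rw [mul_add, ← mul_assoc]
    have e : qm H.om 0 * qm H.om 0 = qm (H.om * H.om) 0 := by
      apply ext'
      · rw [fst_qm_mul]; rfl
      · rw [snd_qm_mul]; simp
    have e2 : qm (algebraMap F _ v * H.om) 0 = qm (algebraMap F _ v) 0 * qm H.om 0 := by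
      apply ext'
      · rw [fst_qm_mul]; rfl
      · rw [snd_qm_mul]; simp
    have e3 : qm (H.om * H.om) 0 * b = qm (algebraMap F _ u) 0 * b
        + qm (algebraMap F _ v) 0 * (qm H.om 0 * b) := by
      rw [huv]
      have := qm_add (algebraMap F _ u) (algebraMap F _ v * H.om) 0 0
      rw [add_zero] at this
      rw [this, add_mul, e2, mul_assoc]
    rw [e, e3]
    have ho : ∀ h ∈ O, qm H.om 0 * h ∈ J := fun h hh => (hJ _).mpr ⟨0, O.zero_mem, h, hh, by simp⟩
    exact J.add_mem (ho a ha) (J.add_mem (hJF u hu _ (hOJ b hb)) (hJF v hv _ (ho b hb)))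
  have hJL : ∀ a : Gau F, IsIntegral ℤ a → ∀ k ∈ J, qm a 0 * k ∈ J := by
    intro a ha k hk
    obtain ⟨u, v, hu, hv, rfl⟩ := H.exists_coords ha
    have := qm_add (algebraMap F _ u) (algebraMap F _ v * H.om) 0 0
    rw [add_zero] at this
    rw [this, add_mul]
    refine J.add_mem (hJF u hu k hk) ?_
    have e2 : qm (algebraMap F _ v * H.om) 0 = qm (algebraMap F _ v) 0 * qm H.om 0 := by
      apply ext'
      · rw [fst_qm_mul]; rfl
      · rw [snd_qm_mul]; simp
    rw [e2, mul_assoc]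
    exact hJF v hv _ (hJom k hk)
  have hJfst : ∀ k ∈ J, IsIntegral ℤ (algebraMap F _ s * fst k) := by
    intro k hk
    obtain ⟨a, ha, b, hb, rfl⟩ := (hJ k).mp hk
    rw [fst_add, fst_qm_mul, mul_add, mul_left_comm]
    exact (MemB.isIntegral H (H.memB_fst hO he ha)).add
      (H.isIntegral_om.mul (MemB.isIntegral H (H.memB_fst hO he hb)))
  have hJnr : ∀ k ∈ J, IsIntegral ℤ (s * nr k) := by
    intro k hk
    obtain ⟨a, ha, b, hb, rfl⟩ := (hJ k).mp hk
    have hz := H.memB_fst hO he (O.mul_mem hb (conj_mem hO ha))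
    have e : nr (a + qm H.om 0 * b) = nr a + H.om.norm * nr b + 2 * (H.om * fst (b * conj a)).re := by
      apply FaithfulSMul.algebraMap_injective F (Gau F)
      rw [map_add, map_add, map_mul, ← gau_add_star, nr, nr, nr, map_add, map_add, map_add,
        ← gau_mul_star, ← gau_mul_star, ← gau_mul_star, ← gau_mul_star, ← gau_mul_star, ← gau_mul_star,
        ← gau_mul_star,
        fst_add, snd_add, fst_qm_mul, snd_qm_mul, fst_mul, fst_conj, snd_conj]
      simp only [star_add, star_mul', star_neg, star_sub, star_star]
      ring
    rw [e, mul_add, mul_add]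
    refine ((H.isIntegral_s.mul (isIntegral_tr_nr (isIntegral_of_mem hO ha)).2).add
      (H.isIntegral_s.mul ((isIntegral_gau_norm H.isIntegral_om).mul
        (isIntegral_tr_nr (isIntegral_of_mem hO hb)).2))).add ?_
    have := isIntegral_gau_trace (H.isIntegral_om.mul (MemB.isIntegral H hz))
    convert! this using 1
    rw [mul_left_comm H.om, algebraMap_gau]
    simp; ring
  -- the element `α = (1 + y j) / s` of `J`
  obtain ⟨y, hy⟩ : ∃ y, y = algebraMap F _ s * snd h₀ := ⟨_, rfl⟩
  have hal : al s y ∈ J := by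
    convert! J.sub_mem (hOJ _ hh₀) (hJL l hl 1 (hOJ _ O.one_mem)) using 1
    apply ext'
    · rw [fst_sub, fst_qm_mul, hl', al, fst_mk, fst_one]; ring
    · rw [snd_sub, snd_qm_mul, al, snd_mk, hy, snd_one]; field_simp; ring
  have h1J : (1 : Ham F) ∈ J := hOJ _ O.one_mem
  have hsubJ : ∀ k ∈ J, qm 0 (snd k - fst k * y) ∈ J := by
    intro k hk
    convert! J.sub_mem hk (hJL _ (hJfst k hk) _ hal) using 1
    apply ext'
    · rw [fst_sub, fst_qm_mul, al, fst_mk, fst_mk]; field_simp; ring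
    · rw [snd_sub, snd_qm_mul, al, snd_mk, snd_mk]; field_simp
  have hyint : IsIntegral ℤ ((1 + y.norm) / s) := by
    have := hJnr _ hal
    convert! this using 1
    have hs := H.s_ne
    apply FaithfulSMul.algebraMap_injective F (Gau F)
    rw [al, nr, fst_mk, snd_mk, map_mul, map_add, map_div₀, map_add, ← gau_mul_star, ← gau_mul_star,
      ← gau_mul_star, star_div₀, star_div₀, star_gau, star_one, map_one]
    field_simp
  have hcross : ∀ b, qm 0 b ∈ J → IsIntegral ℤ (b * star y) := by
    intro b hb
    have key : ∀ a : Gau F, IsIntegral ℤ a → IsIntegral ℤ (2 * (a * (b * star y)).re) := by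
      intro a ha
      have h1 := hJL a ha _ hb
      have h2 := hJnr _ (J.add_mem hal h1)
      have h3 := (h2.sub (hJnr _ hal)).sub (hJnr _ h1)
      convert! h3 using 1
      apply FaithfulSMul.algebraMap_injective F (Gau F)
      rw [← gau_add_star, map_sub, map_sub, map_mul, map_mul, map_mul, nr, nr, nr, map_add, map_add,
        map_add, ← gau_mul_star, ← gau_mul_star, ← gau_mul_star, ← gau_mul_star, ← gau_mul_star,
        ← gau_mul_star, fst_add, snd_add, fst_qm_mul, snd_qm_mul, al, fst_mk, fst_mk, snd_mk, snd_mk]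
      simp only [star_add, star_mul', star_div₀, star_star, star_gau, star_one, star_zero]
      field_simp; ring
    refine H.isIntegral_of_traces ?_ (key _ H.isIntegral_om)
    simpa using key 1 isIntegral_one
  have hnorm : ∀ b, qm 0 b ∈ J → IsIntegral ℤ b.norm := by
    intro b hb
    have h1 := isIntegral_gau_norm (hcross b hb)
    have h2 : IsIntegral ℤ (s * b.norm) := by
      have := hJnr _ hb
      rwa [nr, fst_mk, snd_mk, QuadraticAlgebra.norm_zero, zero_add] at this
    convert! (h2.mul hyint).sub h1 using 1
    have hs := H.s_ne
    have : (b * star y).norm = b.norm * y.norm := by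
      rw [map_mul, gau_norm, gau_norm, gau_norm]; simp
    rw [this]; field_simp; ring
  have hpair : ∀ b c, qm 0 b ∈ J → qm 0 c ∈ J → IsIntegral ℤ (b * star c) := by
    intro b c hb hc
    have key : ∀ a : Gau F, IsIntegral ℤ a → IsIntegral ℤ (2 * (a * (b * star c)).re) := by
      intro a ha
      have e : qm 0 (a * b) = qm a 0 * qm 0 b := by
        apply ext'
        · rw [fst_qm_mul]; simp
        · rw [snd_qm_mul]; rfl
      have h1 : qm 0 (a * b) ∈ J := e ▸ hJL a ha _ hb
      have h2 : qm 0 (a * b + c) ∈ J := by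
        have := J.add_mem h1 hc
        rwa [← qm_add, add_zero] at this
      have h3 := ((hnorm _ h2).sub (hnorm _ h1)).sub (hnorm _ hc)
      convert! h3 using 1
      apply FaithfulSMul.algebraMap_injective F (Gau F)
      rw [← gau_add_star, map_sub, map_sub, ← gau_mul_star, ← gau_mul_star, ← gau_mul_star]
      simp only [star_add, star_mul', star_star]
      ring
    refine H.isIntegral_of_traces ?_ (key _ H.isIntegral_om)
    simpa using key 1 isIntegral_one
  have hyJ : qm 0 y ∈ J := by
    have := J.neg_mem (hsubJ 1 h1J)
    convert! this using 1
    apply ext' <;> simp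
  have hy0 : y ≠ 0 := by
    rintro rfl
    rw [QuadraticAlgebra.norm_zero, add_zero] at hyint
    exact H.not_isIntegral_inv_s hyint
  let 𝔟 : FId (Gau F) := FId.mk' (fun b => qm 0 b ∈ J) (by exact J.zero_mem)
    (fun a b ha hb => by have := J.add_mem ha hb; rwa [← qm_add, add_zero] at this)
    (fun a b ha hb => by
      have e : qm 0 (a * b) = qm a 0 * qm 0 b := by
        apply ext'
        · rw [fst_qm_mul]; simp
        · rw [snd_qm_mul]; rfl
      exact e ▸ hJL a ha _ hb) (star y) (star_ne_zero.mpr hy0)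
    (fun b hb => by rw [mul_comm]; exact hcross b hb)
  have hmem : ∀ x, x ∈ 𝔟 ↔ qm 0 x ∈ J := fun x => FId.mem_mk'
  have h𝔟 : 𝔟 * bar 𝔟 ≤ 1 := mul_bar_le_one_iff.mpr fun b hb c hc =>
    hpair b c ((hmem b).mp hb) ((hmem c).mp hc)
  have hgood : Good s 𝔟 y := ⟨(hmem y).mpr hyJ, hyint⟩
  have hJlat : ∀ k ∈ J, k ∈ lat s 𝔟 y := fun k hk => ⟨hJfst k hk, (hmem _).mpr (hsubJ k hk)⟩
  have hO2 : O ≤ ord2 s 𝔟 y := fun h hh =>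
    (H.mem_ord2 h𝔟 hgood).mpr ⟨hJlat _ (hOJ h hh), hJlat _ (hJr _ hal h hh)⟩
  obtain ⟨𝔟', hle, h𝔟'⟩ := FId.exists_maximal_pairing bar bar_bar
    (FId.ne_zero_of_mem hgood.mem hy0) h𝔟
  exact ⟨𝔟', y, h𝔟', ⟨hle hgood.mem, hgood.int⟩, hO2.trans (H.ord2_mono h𝔟 h𝔟'.le hle hgood)⟩

end RealQuad
end

section
variable {F : Type} [Field F] [NumberField F] [Fact (∀ x : F, x ^ 2 ≠ -1 + 0 * x)]
open Ham

namespace Ham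

open Classical in
/-- The orders `ord1 𝔟` and `ord2 s 𝔟 y`, indexed uniformly. -/
def ordX (s : F) (𝔟 : FId (Gau F)) : Option (Gau F) → Subring (Ham F)
  | none => if h : 𝔟 * bar 𝔟 ≤ 1 then ord1 𝔟 h else ⊥
  | some y => ord2 s 𝔟 y

lemma ordX_none (s : F) {𝔟 : FId (Gau F)} (h : 𝔟 * bar 𝔟 ≤ 1) : ordX s 𝔟 none = ord1 𝔟 h :=
  dif_pos h

lemma ordX_some (s : F) (𝔟 : FId (Gau F)) (y : Gau F) : ordX s 𝔟 (some y) = ord2 s 𝔟 y := rfl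

/-- The data parametrizing maximal orders containing `η`. -/
structure Dat (s : F) (𝔟 : FId (Gau F)) (o : Option (Gau F)) : Prop where
  unit : 𝔟 * bar 𝔟 = 1
  good : ∀ y, o = some y → Good s 𝔟 y

/-- Two data defining the same order. -/
def Eqv (s : F) (𝔟 : FId (Gau F)) : Option (Gau F) → Option (Gau F) → Prop
  | none, none => True
  | some y, some y' => (y - y') / algebraMap F _ s ∈ 𝔟
  | _, _ => False

lemma eq_of_le_of_unit {𝔟 𝔟' : FId (Gau F)} (h : 𝔟 * bar 𝔟 = 1) (h' : 𝔟' * bar 𝔟' = 1)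
    (hle : 𝔟 ≤ 𝔟') : 𝔟 = 𝔟' := by
  have h1 : 𝔟' * bar 𝔟 ≤ 1 := by
    rw [← h']
    refine mul_le_mul_right ?_ _
    intro x hx
    exact mem_bar.mpr (hle (mem_bar.mp hx))
  have h2 : 1 ≤ 𝔟' * bar 𝔟 := by
    rw [← h]; exact mul_le_mul_left hle _
  exact mul_right_cancel₀ (right_ne_zero_of_mul_eq_one h) (h.trans (le_antisymm h2 h1))

lemma unit_ne_zero {𝔟 : FId (Gau F)} (h : 𝔟 * bar 𝔟 = 1) : 𝔟 ≠ 0 := left_ne_zero_of_mul_eq_one h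

end Ham

namespace RealQuad
variable {p : ℕ} {r s : F} (H : RealQuad F p r s)
include H

lemma lat_congr {𝔟 : FId (Gau F)} {y y' : Gau F} (h : (y - y') / algebraMap F _ s ∈ 𝔟) :
    lat s 𝔟 y = lat s 𝔟 y' := by
  have hS := H.algebraMap_s_ne
  have key : ∀ y y' : Gau F, (y - y') / algebraMap F _ s ∈ 𝔟 → ∀ k ∈ lat s 𝔟 y, k ∈ lat s 𝔟 y' := by
    rintro y y' h k ⟨h1, h2⟩
    refine ⟨h1, ?_⟩
    convert! FId.add_mem h2 (FId.mul_mem h1 h) using 1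
    field_simp; ring
  ext k
  refine ⟨key y y' h k, key y' y ?_ k⟩
  convert! FId.neg_mem h using 1
  ring

lemma ordX_congr {𝔟 : FId (Gau F)} {o o' : Option (Gau F)} (h : Eqv s 𝔟 o o') :
    ordX s 𝔟 o = ordX s 𝔟 o' := by
  rcases o with _ | y <;> rcases o' with _ | y'
  · rfl
  · exact h.elim
  · exact h.elim
  · rw [ordX_some, ordX_some, ord2, ord2, H.lat_congr h]

lemma not_ord1_le_ord2 {𝔟 𝔟' : FId (Gau F)} {y : Gau F} (h𝔟 : 𝔟 * bar 𝔟 = 1)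
    (h𝔟' : 𝔟' * bar 𝔟' = 1) (hy : Good s 𝔟' y) : ¬ ord1 𝔟 h𝔟.le ≤ ord2 s 𝔟' y := by
  intro hle
  have hS := H.algebraMap_s_ne
  have h1 : qm H.om 0 ∈ ord1 𝔟 h𝔟.le := ⟨H.isIntegral_om, FId.zero_mem⟩
  have h2 := ((H.mem_ord2 h𝔟'.le hy).mp (hle h1)).2.2
  rw [fst_mul, snd_mul, al] at h2
  simp only [fst_mk, snd_mk, mul_zero, zero_add, star_zero, sub_zero] at h2
  have h3 : y / algebraMap F _ s ∈ 𝔟' := by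
    convert! FId.mul_mem isIntegral_gI h2 using 1
    have hom := sub_eq_iff_eq_add.mp H.om_sub_star
    have hI := gI_mul_gI (F := F)
    generalize star H.om = o at *
    rw [hom]
    field_simp
    linear_combination y * hI
  have h4 := mul_bar_le_one_iff.mp h𝔟'.le _ h3 _ h3
  have h5 : IsIntegral ℤ (y.norm / s ^ 2) := by
    apply isIntegral_gau_algebraMap.mp
    rw [map_div₀, ← gau_mul_star, map_pow]
    rw [star_div₀, star_gau] at h4
    convert! h4 using 1
    field_simp
  apply H.not_isIntegral_inv_s
  convert! hy.int.sub (H.isIntegral_s.mul h5) using 1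
  have := H.s_ne
  field_simp; ring

lemma not_ord2_le_ord1 {𝔟 𝔟' : FId (Gau F)} {y : Gau F} (h𝔟 : 𝔟 * bar 𝔟 = 1)
    (h𝔟' : 𝔟' * bar 𝔟' = 1) (hy : Good s 𝔟 y) : ¬ ord2 s 𝔟 y ≤ ord1 𝔟' h𝔟'.le := by
  intro hle
  have h1 := (hle (H.oy_mem_ord2 h𝔟.le hy)).1
  rw [oy, fst_mk] at h1
  apply H.not_isIntegral_inv_s
  apply isIntegral_gau_algebraMap.mp
  rw [map_div₀, map_one]
  convert! h1.sub (hy.int.gau.mul H.isIntegral_om) using 1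
  ring

lemma ord2_le {𝔟 𝔟' : FId (Gau F)} {y y' : Gau F} (h𝔟 : 𝔟 * bar 𝔟 = 1)
    (h𝔟' : 𝔟' * bar 𝔟' = 1) (hy : Good s 𝔟 y) (hy' : Good s 𝔟' y')
    (hle : ord2 s 𝔟 y ≤ ord2 s 𝔟' y') : 𝔟 = 𝔟' ∧ (y - y') / algebraMap F _ s ∈ 𝔟 := by
  have hS := H.algebraMap_s_ne
  have h1 := ((H.mem_ord2 h𝔟'.le hy').mp (hle (H.oy_mem_ord2 h𝔟.le hy))).1.2
  rw [oy, fst_mk, snd_mk] at h1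
  have h2 : (y - y') / algebraMap F _ s ∈ 𝔟' := by
    convert! FId.add_mem h1 (FId.mul_mem (hy.int.gau.mul H.isIntegral_om) hy'.mem) using 1
    ring
  have hsub : 𝔟 ≤ 𝔟' := by
    intro b hb
    obtain ⟨h3, h4⟩ := (H.mem_ord2 h𝔟'.le hy').mp (hle (H.s_mul_mem_ord2 h𝔟.le hy hb))
    have h5 := h3.2
    have h6 := h4.2
    rw [fst_mk, snd_mk, zero_mul, sub_zero] at h5
    rw [fst_mul, snd_mul, al] at h6
    simp only [fst_mk, snd_mk, mul_zero, add_zero, star_zero, zero_sub, star_mul',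
      star_gau] at h6
    have h7 := mul_bar_le_one_iff.mp h𝔟.le _ hy.mem _ hb
    have h8 := mul_bar_le_one_iff.mp h𝔟'.le _ h2 _ h5
    rw [star_mul', star_gau] at h8
    have h9 : IsIntegral ℤ (y' * star b) := by
      convert! h7.sub h8 using 1
      field_simp; ring
    convert! FId.sub_mem h6 (FId.mul_mem h9 hy'.mem) using 1
    field_simp; ring
  have := eq_of_le_of_unit h𝔟 h𝔟' hsub
  exact ⟨this, this ▸ h2⟩

lemma ordX_le {𝔟 𝔟' : FId (Gau F)} {o o' : Option (Gau F)} (h : Dat s 𝔟 o) (h' : Dat s 𝔟' o')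
    (hle : ordX s 𝔟 o ≤ ordX s 𝔟' o') : 𝔟 = 𝔟' ∧ Eqv s 𝔟 o o' := by
  rcases o with _ | y <;> rcases o' with _ | y'
  · rw [ordX_none s h.unit.le, ordX_none s h'.unit.le] at hle
    refine ⟨eq_of_le_of_unit h.unit h'.unit fun b hb => ?_, trivial⟩
    exact (hle (show qm 0 b ∈ _ from ⟨isIntegral_zero, hb⟩)).2
  · rw [ordX_none s h.unit.le, ordX_some] at hle
    exact absurd hle (H.not_ord1_le_ord2 h.unit h'.unit (h'.good y' rfl))
  · rw [ordX_none s h'.unit.le, ordX_some] at hle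
    exact absurd hle (H.not_ord2_le_ord1 h.unit h'.unit (h.good y rfl))
  · exact H.ord2_le h.unit h'.unit (h.good y rfl) (h'.good y' rfl) hle

lemma ordX_isOrder {𝔟 : FId (Gau F)} {o : Option (Gau F)} (h : Dat s 𝔟 o) :
    IsOrder F (ordX s 𝔟 o) := by
  rcases o with _ | y
  · rw [ordX_none s h.unit.le]; exact H.ord1_isOrder _ (unit_ne_zero h.unit)
  · exact H.ord2_isOrder h.unit.le (unit_ne_zero h.unit) (h.good y rfl)

lemma eta_mem_ordX {𝔟 : FId (Gau F)} {o : Option (Gau F)} (h : Dat s 𝔟 o) :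
    qm H.eta 0 ∈ ordX s 𝔟 o := by
  rcases o with _ | y
  · rw [ordX_none s h.unit.le]; exact H.eta_mem_ord1 _
  · exact H.eta_mem_ord2 h.unit.le (h.good y rfl)

lemma exists_le_ordX {O : Subring (Ham F)} (hO : IsOrder F O) (he : qm H.eta 0 ∈ O) :
    ∃ 𝔟 o, Dat s 𝔟 o ∧ O ≤ ordX s 𝔟 o := by
  by_cases hint : ∀ h ∈ O, IsIntegral ℤ (fst h)
  · obtain ⟨𝔟, h𝔟, hle⟩ := H.exists_le_ord1 hO hint
    exact ⟨𝔟, none, ⟨h𝔟, by simp⟩, by rwa [ordX_none s h𝔟.le]⟩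
  · obtain ⟨𝔟, y, h𝔟, hy, hle⟩ := H.exists_le_ord2 hO he hint
    exact ⟨𝔟, some y, ⟨h𝔟, by rintro _ ⟨⟩; exact hy⟩, hle⟩

theorem ordX_isMaximalOrder {𝔟 : FId (Gau F)} {o : Option (Gau F)} (h : Dat s 𝔟 o) :
    IsMaximalOrder F (ordX s 𝔟 o) := by
  refine ⟨H.ordX_isOrder h, fun O' hO' hle => ?_⟩
  obtain ⟨𝔟', o', h', hle'⟩ := H.exists_le_ordX hO' (hle (H.eta_mem_ordX h))
  obtain ⟨rfl, he⟩ := H.ordX_le h h' (hle.trans hle')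
  rw [← H.ordX_congr he] at hle'
  exact le_antisymm hle' hle

theorem exists_eq_ordX {O : Subring (Ham F)} (hO : IsMaximalOrder F O) (he : qm H.eta 0 ∈ O) :
    ∃ 𝔟 o, Dat s 𝔟 o ∧ O = ordX s 𝔟 o := by
  obtain ⟨𝔟, o, h, hle⟩ := H.exists_le_ordX hO.1 he
  exact ⟨𝔟, o, h, (hO.2 _ (H.ordX_isOrder h) hle).symm⟩

end RealQuad
end

section
variable {F : Type} [Field F] [NumberField F] [Fact (∀ x : F, x ^ 2 ≠ -1 + 0 * x)]
open Ham

namespace Ham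

lemma qm_mul_qm (x y : Gau F) : qm x 0 * qm y 0 = qm (x * y) 0 := by
  apply ext'
  · rw [fst_qm_mul]; rfl
  · rw [snd_qm_mul]; simp

lemma qm_ne_zero_left {x : Gau F} (w : Gau F) (hx : x ≠ 0) : qm x w ≠ 0 := fun h => hx (congrArg fst h)

lemma isScalarUnit_iff {O : Subring (Ham F)} (hO : IsOrder F O) (u : (O)ˣ) :
    IsScalarUnit F u ↔ ∃ a : F, ((u : O) : Ham F) = algebraMap F _ a := by
  constructor
  · rintro ⟨c, hc⟩; exact ⟨_, hc⟩
  · rintro ⟨a, ha⟩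
    have hinj : Function.Injective (algebraMap F (Ham F)) := FaithfulSMul.algebraMap_injective _ _
    have ha0 : a ≠ 0 := by
      rintro rfl
      have h1 : ((u : O) : Ham F) * ((u⁻¹ : (O)ˣ) : O) = 1 := by
        rw [← Subring.coe_mul, Units.mul_inv]; rfl
      rw [ha, map_zero, zero_mul] at h1
      exact zero_ne_one h1
    have hd : ∀ (b : F), algebraMap F (Ham F) b ∈ O → IsIntegral ℤ b := fun b hb =>
      (isIntegral_algHom_iff (algebraMap F (Ham F)).toIntAlgHom hinj).mp (isIntegral_of_mem hO hb)
    have h1 : IsIntegral ℤ a := hd _ (ha ▸ (u : O).2)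
    have h2 : IsIntegral ℤ a⁻¹ := by
      apply hd
      have h1 : ((u : O) : Ham F) * ((u⁻¹ : (O)ˣ) : O) = 1 := by
        rw [← Subring.coe_mul, Units.mul_inv]; rfl
      have h3 : algebraMap F (Ham F) a⁻¹ = ((u⁻¹ : (O)ˣ) : O) := by
        rw [ha] at h1
        calc algebraMap F (Ham F) a⁻¹ = algebraMap F (Ham F) a⁻¹ * (algebraMap F (Ham F) a * ((u⁻¹ : (O)ˣ) : O)) := by
              rw [h1, mul_one]
          _ = _ := by rw [← mul_assoc, ← map_mul, inv_mul_cancel₀ ha0, map_one, one_mul]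
      rw [h3]
      exact ((u⁻¹ : (O)ˣ) : O).2
    exact ⟨⟨⟨a, h1⟩, ⟨a⁻¹, h2⟩, Subtype.ext (mul_inv_cancel₀ ha0), Subtype.ext (inv_mul_cancel₀ ha0)⟩, ha⟩

/-- A unit of a subring from a two-sided inverse in it. -/
def mkUnit {O : Subring (Ham F)} (a b : Ham F) (ha : a ∈ O) (hb : b ∈ O) (h : a * b = 1) (h' : b * a = 1) :
    (O)ˣ := ⟨⟨a, ha⟩, ⟨b, hb⟩, Subtype.ext h, Subtype.ext h'⟩

@[simp] lemma coe_mkUnit {O : Subring (Ham F)} {a b : Ham F} (ha : a ∈ O) (hb : b ∈ O) (h : a * b = 1)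
    (h' : b * a = 1) : ((mkUnit a b ha hb h h' : (O)ˣ) : O).1 = a := rfl

lemma unit_mul_inv {O : Subring (Ham F)} (u : (O)ˣ) :
    ((u : O) : Ham F) * ((u⁻¹ : (O)ˣ) : O) = 1 := by
  rw [← Subring.coe_mul, Units.mul_inv]; rfl

lemma nr_pos {h : Ham F} (hh : h ≠ 0) (σ : F →+* ℝ) : 0 < σ (nr h) := by
  have h1 := nr_ne_zero ⟨σ, trivial⟩ hh
  have h2 : 0 ≤ σ (nr h) := by
    rw [nr_eq]; simp only [map_add, map_pow]; positivity
  exact lt_of_le_of_ne h2 (Ne.symm (by simpa using h1))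

lemma norm_star (x : Gau F) : (star x).norm = x.norm := by
  rw [gau_norm, gau_norm]; simp

end Ham

namespace RealQuad
variable {p : ℕ} {r s : F} (H : RealQuad F p r s)
include H

lemma eta_ne : H.eta ≠ 0 := fun h => H.eta_im_ne (by rw [h]; rfl)

lemma eta_inv_mem {O : Subring (Ham F)} (hO : IsOrder F O) (he : qm H.eta 0 ∈ O) :
    qm H.eta⁻¹ 0 ∈ O := by
  have h1 := O.mul_mem (algebraMap_mem hO H.isIntegral_eps_inv) (conj_mem hO he)
  convert! h1 using 1
  have e : conj (qm H.eta 0) = qm (star H.eta) 0 := by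
    apply ext'
    · rw [fst_conj]; rfl
    · rw [snd_conj]; simp
  rw [e, algebraMap_eq, qm_mul_qm]
  congr 1
  have h2 := gau_mul_star H.eta
  rw [H.norm_eta] at h2
  have := H.eta_ne
  have h3 : algebraMap F (Gau F) (2 / s ^ 2) * algebraMap F (Gau F) (s ^ 2 / 2) = 1 := by
    rw [← map_mul, ← map_one (algebraMap F (Gau F))]
    congr 1
    have := H.s_ne
    field_simp
  rw [← h2] at h3
  field_simp
  linear_combination -h3

lemma gI_mem {O : Subring (Ham F)} (hO : IsOrder F O) (he : qm H.eta 0 ∈ O) :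
    qm (gI F) 0 ∈ O := by
  have h1 := O.mul_mem (algebraMap_mem hO H.isIntegral_eps_inv) (O.mul_mem he he)
  convert! h1 using 1
  rw [qm_mul_qm, algebraMap_eq, qm_mul_qm, H.eta_sq, ← mul_assoc, ← map_mul]
  have : 2 / s ^ 2 * (s ^ 2 / 2) = 1 := by
    have := H.s_ne
    field_simp
  rw [this, map_one, one_mul]

/-- Every unit is, up to `F^×` and powers of `η`, of reduced norm one. -/
lemma exists_nr_one {O : Subring (Ham F)} (hO : IsOrder F O) (he : qm H.eta 0 ∈ O) (u : (O)ˣ) :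
    ∃ g ∈ O, nr g = 1 ∧ ∃ v : F, v ≠ 0 ∧ (((u : O) : Ham F) = g * qm (algebraMap F _ v) 0 ∨
      ((u : O) : Ham F) = g * qm (algebraMap F _ v * H.eta) 0) := by
  have hu1 := unit_mul_inv u
  have hu := (isIntegral_tr_nr (isIntegral_of_mem hO (u : O).2)).2
  have hu' := (isIntegral_tr_nr (isIntegral_of_mem hO ((u⁻¹ : (O)ˣ) : O).2)).2
  have hn := congrArg nr hu1
  have hone : nr (1 : Ham F) = 1 := by rw [nr_eq]; simp
  rw [nr_mul, hone] at hn
  rw [eq_inv_of_mul_eq_one_right hn] at hu'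
  have hu0 : ((u : O) : Ham F) ≠ 0 := fun h => by rw [h, zero_mul] at hu1; exact zero_ne_one hu1
  obtain ⟨v, hv, hv', hN⟩ := H.exists_norm_eq hu hu' (nr_pos hu0)
  have hv0 : v ≠ 0 := by
    rintro rfl
    rw [map_zero, zero_mul, QuadraticAlgebra.norm_zero] at hN
    have := nr_ne_zero (⟨H.exists_real.some, trivial⟩) hu0
    rcases hN with h | h <;> exact this h.symm
  have hv1 : algebraMap F (Gau F) v ≠ 0 := by simpa using hv0
  have key : ∀ x : Gau F, x ≠ 0 → qm x⁻¹ 0 ∈ O → x.norm = nr ((u : O) : Ham F) →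
      ∃ g ∈ O, nr g = 1 ∧ ((u : O) : Ham F) = g * qm x 0 := by
    intro x hx hxO hxn
    refine ⟨_, O.mul_mem (u : O).2 hxO, ?_, ?_⟩
    · have h1 : nr (qm x⁻¹ 0) * nr (qm x 0) = 1 := by
        rw [← nr_mul, qm_mul_qm, inv_mul_cancel₀ hx]; exact hone
      have h2 : nr (qm x 0) = nr ((u : O) : Ham F) := by rw [← hxn, nr]; simp
      rw [nr_mul, mul_comm, ← h2, h1]
    · rw [mul_assoc, qm_mul_qm, inv_mul_cancel₀ hx]; exact (mul_one _).symm
  have hvO : qm (algebraMap F (Gau F) v)⁻¹ 0 ∈ O := by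
    have := algebraMap_mem hO hv'
    rwa [algebraMap_eq, map_inv₀] at this
  rcases hN with h | h
  · obtain ⟨g, hg, hg1, hg2⟩ := key _ hv1 hvO h
    exact ⟨g, hg, hg1, v, hv0, Or.inl hg2⟩
  · obtain ⟨g, hg, hg1, hg2⟩ := key _ (mul_ne_zero hv1 H.eta_ne) (by
      rw [mul_inv, ← qm_mul_qm]; exact O.mul_mem hvO (H.eta_inv_mem hO he)) h
    exact ⟨g, hg, hg1, v, hv0, Or.inr hg2⟩

/-- Existence of an element `w j` of reduced norm one. -/
def Special (O : Subring (Ham F)) : Prop := ∃ w : Gau F, w.norm = 1 ∧ qm 0 w ∈ O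

omit H in
lemma norm_nonneg (x : Gau F) (σ : F →+* ℝ) : 0 ≤ σ x.norm := by
  rw [gau_norm]; simp only [map_add, map_pow]; positivity

omit H in
lemma eq_zero_of_norm (hF : Nonempty (F →+* ℝ)) {x : Gau F} (hx : x.norm = 0) : x = 0 := by
  by_contra h
  have := norm_pos h hF.some
  rw [hx, map_zero] at this
  exact this.false

lemma special_of_nr_one {O : Subring (Ham F)} (hO : IsOrder F O) (he : qm H.eta 0 ∈ O) {g : Ham F}
    (hg : g ∈ O) (hn : nr g = 1) (h0 : snd g ≠ 0) : Special O := by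
  have hlt : ∀ σ : F →+* ℝ, σ (fst g).norm < 1 := by
    intro σ
    have h1 := norm_pos h0 σ
    have h2 := congrArg σ hn
    rw [nr, map_add, map_one] at h2
    linarith
  have hS := H.algebraMap_s_ne
  rcases H.memB_fst hO he hg with h1 | h1
  · rw [mul_div_cancel_left₀ _ hS] at h1
    rcases H.eq_zero_or_one (isIntegral_gau_norm h1) fun σ => ⟨norm_nonneg _ σ, (hlt σ).trans one_lt_two⟩
      with h2 | h2
    · refine ⟨snd g, ?_, ?_⟩
      · rw [nr, h2, zero_add] at hn; exact hn
      · rwa [← eq_zero_of_norm H.exists_real h2, mk_eta]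
    · have := hlt H.exists_real.some
      rw [h2, map_one] at this
      exact absurd this (lt_irrefl _)
  · obtain ⟨l, hl⟩ : ∃ l, l = (algebraMap F _ s * fst g - 1) / algebraMap F _ s := ⟨_, rfl⟩
    rw [← hl] at h1
    have hx : fst g = algebraMap F _ (1 / s) + l := by
      rw [hl, map_div₀, map_one]; field_simp; ring
    have h2 : IsIntegral ℤ (2 * (fst g).norm) := by
      have e : 2 * (fst g).norm = 2 / s ^ 2 + (2 / s) * (2 * l.re) + 2 * l.norm := by
        rw [hx, gau_norm, gau_norm]
        have := H.s_ne
        simp; field_simp; ring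
      rw [e]
      have h2i : IsIntegral ℤ (2 : F) := by simpa using isIntegral_nat (A := F) 2
      exact (H.isIntegral_eps_inv.add (H.isIntegral_two_div.mul (isIntegral_gau_trace h1))).add
        (h2i.mul (isIntegral_gau_norm h1))
    rcases H.eq_zero_or_one h2 fun σ => by
      rw [map_mul, map_ofNat]
      exact ⟨mul_nonneg zero_le_two (norm_nonneg _ σ), by linarith [hlt σ]⟩ with h3 | h3
    · have h3' : (fst g).norm = 0 := by simpa using h3
      refine ⟨snd g, ?_, ?_⟩
      · rw [nr, h3', zero_add] at hn; exact hn
      · rwa [← eq_zero_of_norm H.exists_real h3', mk_eta]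
    · have h4 : (fst g).norm = 1 / 2 := by rw [eq_div_iff two_ne_zero, mul_comm]; exact h3
      have h5 : (snd g).norm = 1 / 2 := by
        rw [nr, h4] at hn
        linear_combination hn
      refine ⟨-(2 * gI F * fst g * snd g), ?_, ?_⟩
      · have h2n : (2 : Gau F).norm = 4 := by
          rw [show (2 : Gau F) = algebraMap F _ 2 by rw [map_ofNat], gau_norm]; simp; norm_num
        have hIn : (gI F).norm = 1 := by rw [gau_norm]; simp [gI]
        have hm1 : (-1 : Gau F).norm = 1 := by
          rw [gau_norm]; simp [QuadraticAlgebra.re_one, QuadraticAlgebra.im_one]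
        have e : -(2 * gI F * fst g * snd g) = -1 * (2 * gI F * fst g * snd g) := by ring
        rw [e, map_mul, map_mul, map_mul, map_mul, h4, h5, h2n, hIn, hm1]
        norm_num
      · have := O.mul_mem (O.mul_mem hg (H.gI_mem hO he)) (conj_mem hO hg)
        convert! this using 1
        have e1 := gau_mul_star (fst g)
        have e2 := gau_mul_star (snd g)
        rw [h4] at e1
        rw [h5, ← e1] at e2
        apply ext'
        · simp only [fst_mul, snd_mul, fst_mk, snd_mk, fst_conj, snd_conj, star_gI, star_neg]
          simp only [star_zero]
          linear_combination gI F * e2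
        · simp only [fst_mul, snd_mul, fst_mk, snd_mk, fst_conj, snd_conj, star_gI, star_star]
          simp only [star_zero]
          ring

/-- Without special elements, all units lie in `F(i)`, and are explicit. -/
lemma unit_of_not_special {O : Subring (Ham F)} (hO : IsOrder F O) (he : qm H.eta 0 ∈ O)
    (hs : ¬ Special O) (u : (O)ˣ) : ∃ v : F, v ≠ 0 ∧ ∃ k : ℕ,
      ((u : O) : Ham F) = qm (algebraMap F _ v * H.eta ^ k) 0 := by
  obtain ⟨g, hg, hg1, v, hv, h⟩ := H.exists_nr_one hO he u
  have hg2 : snd g = 0 := by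
    by_contra h0; exact hs (H.special_of_nr_one hO he hg hg1 h0)
  have hge : g = qm (fst g) 0 := by conv_lhs => rw [← mk_eta g, hg2]
  have hn : (fst g).norm = 1 := by rw [nr, hg2, QuadraticAlgebra.norm_zero, add_zero] at hg1; exact hg1
  have hint : IsIntegral ℤ (fst g) := by
    apply isIntegral_gau
    · exact (isIntegral_tr_nr (isIntegral_of_mem hO hg)).1
    · rw [hn]; exact isIntegral_one
  have hI : gI F = algebraMap F _ (2 / s ^ 2) * H.eta ^ 2 := by
    rw [pow_two H.eta, H.eta_sq, ← mul_assoc, ← map_mul]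
    have : 2 / s ^ 2 * (s ^ 2 / 2) = 1 := by
      have := H.s_ne
      field_simp
    rw [this, map_one, one_mul]
  have hs2 : (2 / s ^ 2 : F) ≠ 0 := div_ne_zero two_ne_zero (pow_ne_zero _ H.s_ne)
  have hζ : ∃ c : F, c ≠ 0 ∧ ∃ k : ℕ, fst g = algebraMap F _ c * H.eta ^ k := by
    rcases H.eq_of_norm_one hint hn with h | h | h | h
    · exact ⟨1, one_ne_zero, 0, by rw [h]; simp⟩
    · exact ⟨-1, by simp, 0, by rw [h]; simp⟩
    · exact ⟨_, hs2, 2, by rw [h, hI]⟩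
    · exact ⟨_, neg_ne_zero.mpr hs2, 2, by rw [h, hI, map_neg]; ring⟩
  obtain ⟨c, hc, k, hck⟩ := hζ
  rcases h with h | h
  · refine ⟨c * v, mul_ne_zero hc hv, k, ?_⟩
    rw [h, hge, qm_mul_qm, hck, map_mul]; congr 1; ring
  · refine ⟨c * v, mul_ne_zero hc hv, k + 1, ?_⟩
    rw [h, hge, qm_mul_qm, hck, map_mul]; congr 1; ring

lemma eta_pow_im {k : ℕ} {c : F} (hk : k = 1 ∨ k = 2 ∨ k = 3) : H.eta ^ k ≠ algebraMap F _ c := by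
  intro h
  have hs := H.s_ne
  have h1 := congrArg QuadraticAlgebra.im h
  rw [gau_coe_im] at h1
  have h2 : (2 : F) ≠ 0 := two_ne_zero
  rcases hk with rfl | rfl | rfl
  · rw [pow_one] at h1; exact H.eta_im_ne h1
  · rw [pow_two, H.eta_sq, algebraMap_gau] at h1
    simp [gI, hs] at h1
  · rw [pow_succ, pow_two, H.eta_sq, algebraMap_gau] at h1
    simp [gI, eta, hs] at h1

theorem redUnitIso_of_not_special {O : Subring (Ham F)} (hO : IsOrder F O) (he : qm H.eta 0 ∈ O)
    (hs : ¬ Special O) : RedUnitIso F O (Multiplicative (ZMod 4)) := by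
  let N : Subgroup (O)ˣ :=
    { carrier := {u | ∃ a : F, ((u : O) : Ham F) = algebraMap F _ a}
      one_mem' := ⟨1, by simp⟩
      mul_mem' := by
        rintro a b ⟨x, hx⟩ ⟨y, hy⟩
        exact ⟨x * y, by rw [map_mul, ← hx, ← hy]; rfl⟩
      inv_mem' := by
        rintro a ⟨x, hx⟩
        refine ⟨x⁻¹, ?_⟩
        have h1 := unit_mul_inv a
        rw [hx] at h1
        have hx0 : x ≠ 0 := by rintro rfl; rw [map_zero, zero_mul] at h1; exact zero_ne_one h1
        calc (((a⁻¹ : (O)ˣ) : O) : Ham F) = algebraMap F _ x⁻¹ * (algebraMap F _ x * (((a⁻¹ : (O)ˣ) : O) : Ham F)) := by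
              rw [← mul_assoc, ← map_mul, inv_mul_cancel₀ hx0, map_one, one_mul]
          _ = _ := by rw [h1, mul_one] }
  have hN : ∀ u : (O)ˣ, u ∈ N ↔ ∃ a : F, ((u : O) : Ham F) = algebraMap F _ a := fun u => Iff.rfl
  have hcomm : ∀ (a b : (O)ˣ), a ∈ N → a * b = b * a := by
    rintro a b ⟨x, hx⟩
    apply Units.ext; apply Subtype.ext
    change ((a : O) : Ham F) * ((b : O) : Ham F) = ((b : O) : Ham F) * ((a : O) : Ham F)
    rw [hx, Algebra.commutes]
  have : N.Normal := ⟨fun n hn g => by rwa [← hcomm n g hn, mul_inv_cancel_right]⟩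
  let e : (O)ˣ := mkUnit (qm H.eta 0) (qm H.eta⁻¹ 0) he (H.eta_inv_mem hO he)
    (by rw [qm_mul_qm, mul_inv_cancel₀ H.eta_ne]; rfl) (by rw [qm_mul_qm, inv_mul_cancel₀ H.eta_ne]; rfl)
  have hepow : ∀ k : ℕ, (((e ^ k : (O)ˣ) : O) : Ham F) = qm (H.eta ^ k) 0 := by
    intro k
    induction k with
    | zero => simp; rfl
    | succ k ih => rw [pow_succ, Units.val_mul, Subring.coe_mul, ih, pow_succ, ← qm_mul_qm]; rfl
  have hgen : ∀ q : (O)ˣ ⧸ N, q ∈ Subgroup.zpowers (QuotientGroup.mk' N e) := by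
    intro q
    obtain ⟨u, rfl⟩ := QuotientGroup.mk'_surjective N q
    obtain ⟨v, hv, k, hk⟩ := H.unit_of_not_special hO he hs u
    refine ⟨k, ?_⟩
    change (QuotientGroup.mk' N e) ^ (k : ℤ) = _
    rw [zpow_natCast, ← map_pow]
    rw [QuotientGroup.mk'_eq_mk']
    have h0 : ((u : O) : Ham F) = (((e ^ k : (O)ˣ) : O) : Ham F) * algebraMap F _ v := by
      rw [hk, hepow, algebraMap_eq, qm_mul_qm, mul_comm]
    refine ⟨(e ^ k)⁻¹ * u, (hN _).mpr ⟨v, ?_⟩, by rw [mul_inv_cancel_left]⟩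
    rw [Units.val_mul, Subring.coe_mul, h0, ← mul_assoc, ← Subring.coe_mul, Units.inv_mul]
    simp
  have hcyc : IsCyclic ((O)ˣ ⧸ N) := ⟨_, hgen⟩
  have h4 : (H.eta ^ 4 : Gau F) = algebraMap F _ (-(s ^ 2 / 2) ^ 2) := by
    rw [show 4 = 2 + 2 from rfl, pow_add, pow_two, H.eta_sq, map_neg, map_pow]
    linear_combination (algebraMap F (Gau F) (s ^ 2 / 2)) ^ 2 * gI_mul_gI (F := F)
  have hpow : ∀ k : ℕ, (QuotientGroup.mk' N e) ^ k = 1 ↔ ∃ a : F, H.eta ^ k = algebraMap F _ a := by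
    intro k
    rw [← map_pow, QuotientGroup.mk'_apply, QuotientGroup.eq_one_iff, hN, hepow]
    constructor
    · rintro ⟨a, ha⟩; exact ⟨a, congrArg fst ha⟩
    · rintro ⟨a, ha⟩; exact ⟨a, by rw [ha]; rfl⟩
  have hord : orderOf (QuotientGroup.mk' N e) = 4 := by
    refine orderOf_eq_of_pow_and_pow_div_prime (by norm_num) ((hpow 4).mpr ⟨_, h4⟩) ?_
    intro q hq hq4
    have : q = 2 := by
      rw [show 4 = 2 ^ 2 from rfl] at hq4
      exact (Nat.prime_dvd_prime_iff_eq hq Nat.prime_two).mp (hq.dvd_of_dvd_pow hq4)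
    subst this
    rw [Ne, hpow]
    rintro ⟨a, ha⟩
    exact H.eta_pow_im (Or.inr (Or.inl rfl)) ha
  have hcard : Nat.card ((O)ˣ ⧸ N) = 4 := by
    rw [← hord, orderOf_eq_card_of_forall_mem_zpowers hgen]
  have hcyc' : IsCyclic (Multiplicative (ZMod 4)) := inferInstance
  have φ : (O)ˣ ⧸ N ≃* Multiplicative (ZMod 4) := mulEquivOfCyclicCardEq (by rw [hcard]; simp)
  refine ⟨φ.toMonoidHom.comp (QuotientGroup.mk' N), φ.surjective.comp (QuotientGroup.mk'_surjective N), ?_⟩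
  intro u
  rw [isScalarUnit_iff hO, ← hN, ← QuotientGroup.eq_one_iff]
  simp

theorem not_redUnitIso_of_special {O : Subring (Ham F)} (hO : IsOrder F O) (he : qm H.eta 0 ∈ O)
    (hs : Special O) : ¬ RedUnitIso F O (Multiplicative (ZMod 4)) := by
  rintro ⟨φ, -, hφ⟩
  obtain ⟨w, hw, hwO⟩ := hs
  let e : (O)ˣ := mkUnit (qm H.eta 0) (qm H.eta⁻¹ 0) he (H.eta_inv_mem hO he)
    (by rw [qm_mul_qm, mul_inv_cancel₀ H.eta_ne]; rfl) (by rw [qm_mul_qm, inv_mul_cancel₀ H.eta_ne]; rfl)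
  have hnr : nr (qm 0 w) = 1 := by rw [nr]; simpa using hw
  let f : (O)ˣ := mkUnit (qm 0 w) (conj (qm 0 w)) hwO (conj_mem hO hwO)
    (by rw [mul_conj, hnr, map_one]) (by rw [Ham.conj_mul, hnr, map_one])
  have h1 : φ (e * f * (f * e)⁻¹) = 1 := by
    rw [map_mul, map_inv, map_mul, map_mul, mul_comm (φ f), mul_inv_cancel]
  rw [hφ] at h1
  obtain ⟨a, ha⟩ := (isScalarUnit_iff hO _).mp h1
  have h2 : qm H.eta 0 * qm 0 w = algebraMap F _ a * (qm 0 w * qm H.eta 0) := by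
    rw [← ha]
    change ((e : O) : Ham F) * ((f : O) : Ham F) = _ * (((f : O) : Ham F) * ((e : O) : Ham F))
    rw [← Subring.coe_mul, ← Subring.coe_mul, ← Subring.coe_mul, ← Units.val_mul, ← Units.val_mul,
      ← Units.val_mul, inv_mul_cancel_right]
  have h3 := congrArg snd h2
  rw [algebraMap_eq, snd_qm_mul, snd_qm_mul, snd_mul] at h3
  have hw0 : w ≠ 0 := by
    rintro rfl
    rw [QuadraticAlgebra.norm_zero] at hw
    exact zero_ne_one hw
  simp only [fst_mk, snd_mk, zero_mul, zero_add] at h3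
  have h4 : H.eta = algebraMap F _ a * star H.eta := by
    apply mul_right_cancel₀ hw0; rw [h3]; ring
  have hs := H.s_ne
  have h5 := congrArg QuadraticAlgebra.re h4
  have h6 := congrArg QuadraticAlgebra.im h4
  rw [algebraMap_gau] at h5 h6
  simp [eta, hs] at h5 h6
  rw [h5] at h6
  exact hs (by linear_combination h6)

/-- Conjugacies between orders with reduced unit group `C₄` containing `η` normalize `F(i)`. -/
lemma conj_normalizes {O O' : Subring (Ham F)} (hO : IsOrder F O) (he : qm H.eta 0 ∈ O)
    (hO' : IsOrder F O') (he' : qm H.eta 0 ∈ O')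
    (hs' : ¬ Special O') {x : (Ham F)ˣ} (hx : IsConjugate x O O') :
    fst (x : Ham F) = 0 ∨ snd (x : Ham F) = 0 := by
  have h1 := (hx _).mp he
  have h2 := (hx _).mp (H.eta_inv_mem hO he)
  have e1 : ∀ a b : Ham F, a * b = 1 → (x : Ham F) * a * ((x⁻¹ : (Ham F)ˣ) : Ham F) *
      ((x : Ham F) * b * ((x⁻¹ : (Ham F)ˣ) : Ham F)) = 1 := by
    intro a b hab
    have : (x : Ham F) * a * ((x⁻¹ : (Ham F)ˣ) : Ham F) *
      ((x : Ham F) * b * ((x⁻¹ : (Ham F)ˣ) : Ham F)) = (x : Ham F) * (a * (((x⁻¹ : (Ham F)ˣ) : Ham F) * x) * b) * ((x⁻¹ : (Ham F)ˣ) : Ham F) := by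
        simp only [mul_assoc]
    rw [this, Units.inv_mul, mul_one, hab, mul_one, Units.mul_inv]
  obtain ⟨v, -, k, hk⟩ := H.unit_of_not_special hO' he' hs' (mkUnit _ _ h1 h2
    (e1 _ _ (by rw [qm_mul_qm, mul_inv_cancel₀ H.eta_ne]; rfl))
    (e1 _ _ (by rw [qm_mul_qm, inv_mul_cancel₀ H.eta_ne]; rfl)))
  rw [coe_mkUnit] at hk
  set a := algebraMap F (Gau F) v * H.eta ^ k
  have h3 : (x : Ham F) * qm H.eta 0 = qm a 0 * x := by
    rw [← hk, Units.inv_mul_cancel_right]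
  have h4 := congrArg fst h3
  have h5 := congrArg snd h3
  rw [fst_qm_mul, fst_mul] at h4
  rw [snd_qm_mul, snd_mul] at h5
  simp only [fst_mk, snd_mk, star_zero, mul_zero, sub_zero, zero_add] at h4 h5
  by_contra! hc
  have h6 : H.eta = a := mul_left_cancel₀ hc.1 (h4.trans (mul_comm _ _))
  have h7 : star H.eta = a := mul_left_cancel₀ hc.2 (h5.trans (mul_comm _ _))
  have h8 := H.eta_sub_star
  rw [h7, ← h6, sub_self] at h8
  have := congrArg QuadraticAlgebra.im h8
  rw [algebraMap_gau] at this
  simp [gI] at this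
  exact H.s_ne this.symm

end RealQuad
end

section
variable {F : Type} [Field F] [NumberField F] {A A' : Type} [Ring A] [Algebra F A] [Ring A'] [Algebra F A']

/-- Transport of a subring along an algebra isomorphism. -/
def mapO (f : A ≃ₐ[F] A') (O : Subring A) : Subring A' := O.map (f : A →+* A')

lemma mem_mapO {f : A ≃ₐ[F] A'} {O : Subring A} {h : A'} : h ∈ mapO f O ↔ f.symm h ∈ O := by
  constructor
  · rintro ⟨k, hk, rfl⟩
    simpa using hk
  · intro hh
    exact ⟨_, hh, by simp⟩

lemma apply_mem_mapO {f : A ≃ₐ[F] A'} {O : Subring A} {h : A} : f h ∈ mapO f O ↔ h ∈ O := by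
  rw [mem_mapO, AlgEquiv.symm_apply_apply]

lemma mapO_symm (f : A ≃ₐ[F] A') (O : Subring A) : mapO f.symm (mapO f O) = O := by
  ext h; rw [mem_mapO, mem_mapO]; simp

lemma symm_mapO (f : A ≃ₐ[F] A') (O : Subring A') : mapO f (mapO f.symm O) = O := by
  ext h; rw [mem_mapO, mem_mapO]; simp

lemma mapO_mono (f : A ≃ₐ[F] A') {O O' : Subring A} (h : O ≤ O') : mapO f O ≤ mapO f O' :=
  fun _ hx => mem_mapO.mpr (h (mem_mapO.mp hx))

lemma isOrder_mapO (f : A ≃ₐ[F] A') {O : Subring A} (hO : IsOrder F O) : IsOrder F (mapO f O) := by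
  obtain ⟨h1, h2, h3⟩ := hO
  refine ⟨?_, ?_, ?_⟩
  · rintro _ ⟨r, rfl⟩
    refine ⟨_, h1 ⟨r, rfl⟩, by simp⟩
  · have : (mapO f O).toAddSubgroup = O.toAddSubgroup.map (f : A →+ A') := rfl
    rw [this, AddSubgroup.fg_iff_addSubmonoid_fg, AddSubgroup.map_toAddSubmonoid]
    rw [AddSubgroup.fg_iff_addSubmonoid_fg] at h2
    exact h2.map _
  · have : ((mapO f O : Subring A') : Set A') = f.toLinearMap '' (O : Set A) := rfl
    rw [this, ← Submodule.map_span, h3, Submodule.map_top]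
    exact LinearMap.range_eq_top.mpr f.surjective

lemma isMaximalOrder_mapO (f : A ≃ₐ[F] A') {O : Subring A} (hO : IsMaximalOrder F O) :
    IsMaximalOrder F (mapO f O) := by
  refine ⟨isOrder_mapO f hO.1, fun O' hO' hle => ?_⟩
  rw [← hO.2 _ (isOrder_mapO f.symm hO') (by simpa [mapO_symm] using mapO_mono f.symm hle), symm_mapO]

lemma redUnitIso_mapO (f : A ≃ₐ[F] A') {O : Subring A} {G : Type*} [Group G] (hO : RedUnitIso F O G) :
    RedUnitIso F (mapO f O) G := by
  obtain ⟨φ, hφ, hφ'⟩ := hO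
  let e : (mapO f O) ≃+* O :=
    { toFun := fun x => ⟨f.symm x.1, mem_mapO.mp x.2⟩
      invFun := fun x => ⟨f x.1, apply_mem_mapO.mpr x.2⟩
      left_inv := fun x => by simp
      right_inv := fun x => by simp
      map_mul' := fun x y => Subtype.ext (map_mul f.symm _ _)
      map_add' := fun x y => Subtype.ext (map_add f.symm _ _) }
  refine ⟨φ.comp (Units.mapEquiv e.toMulEquiv).toMonoidHom, hφ.comp (Units.mapEquiv e.toMulEquiv).surjective, ?_⟩
  intro u
  rw [MonoidHom.comp_apply, hφ']
  refine exists_congr fun a => ?_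
  change f.symm ((u : mapO f O) : A') = _ ↔ _
  rw [AlgEquiv.symm_apply_eq, AlgEquiv.commutes]

/-- Conjugation by a unit. -/
def conjE (F : Type) [Field F] {A : Type} [Ring A] [Algebra F A] (x : Aˣ) : A ≃ₐ[F] A :=
  AlgEquiv.ofRingEquiv (f :=
    { toFun := fun y => x * y * ((x⁻¹ : Aˣ) : A)
      invFun := fun y => ((x⁻¹ : Aˣ) : A) * y * x
      left_inv := fun y => by simp [mul_assoc]
      right_inv := fun y => by simp [mul_assoc]
      map_mul' := fun y z => by simp [mul_assoc]
      map_add' := fun y z => by simp [mul_add, add_mul] }) (fun r => by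
        change (x : A) * algebraMap F A r * ((x⁻¹ : Aˣ) : A) = _
        rw [← Algebra.commutes, mul_assoc, Units.mul_inv, mul_one])

lemma conjE_apply (x : Aˣ) (y : A) : conjE F x y = x * y * ((x⁻¹ : Aˣ) : A) := rfl

lemma isConjugate_iff {x : Aˣ} {O O' : Subring A} : IsConjugate x O O' ↔ O' = mapO (conjE F x) O := by
  constructor
  · intro h
    ext y
    rw [mem_mapO, h, ← conjE_apply (F := F), AlgEquiv.apply_symm_apply]
  · rintro rfl y
    rw [← conjE_apply (F := F), apply_mem_mapO]

lemma isConjugate_conjE (F : Type) [Field F] [NumberField F] [Algebra F A] (x : Aˣ) (O : Subring A) :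
    IsConjugate x O (mapO (conjE F x) O) := isConjugate_iff.mpr rfl

lemma isConjugate_mapO (f : A ≃ₐ[F] A') {x : Aˣ} {O O' : Subring A} (h : IsConjugate x O O') :
    IsConjugate (Units.map (f : A →* A') x) (mapO f O) (mapO f O') := by
  intro y
  rw [mem_mapO, mem_mapO, h]
  simp

lemma ConjRel.refl (O : Subring A) : ConjRel O O := ⟨1, fun y => by simp⟩

lemma ConjRel.symm {O O' : Subring A} (h : ConjRel O O') : ConjRel O' O := by
  obtain ⟨x, hx⟩ := h
  refine ⟨x⁻¹, fun y => ?_⟩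
  rw [hx]; simp [mul_assoc]

lemma ConjRel.trans {O O' O'' : Subring A} (h : ConjRel O O') (h' : ConjRel O' O'') : ConjRel O O'' := by
  obtain ⟨x, hx⟩ := h
  obtain ⟨z, hz⟩ := h'
  refine ⟨z * x, fun y => ?_⟩
  rw [hx, hz]; simp [mul_assoc]

lemma conjRel_mapO_iff (f : A ≃ₐ[F] A') {O O' : Subring A} :
    ConjRel (mapO f O) (mapO f O') ↔ ConjRel O O' := by
  constructor
  · rintro ⟨x, hx⟩
    have := isConjugate_mapO f.symm hx
    rw [mapO_symm, mapO_symm] at this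
    exact ⟨_, this⟩
  · rintro ⟨x, hx⟩
    exact ⟨_, isConjugate_mapO f hx⟩

lemma typeNum_congr (f : A ≃ₐ[F] A') (G : Type*) [Group G] : typeNum F A G = typeNum F A' G := by
  refine Nat.card_congr (Quot.congr
    { toFun := fun O => ⟨mapO f O.1, isMaximalOrder_mapO f O.2.1, redUnitIso_mapO f O.2.2⟩
      invFun := fun O => ⟨mapO f.symm O.1, isMaximalOrder_mapO f.symm O.2.1, redUnitIso_mapO f.symm O.2.2⟩
      left_inv := fun O => Subtype.ext (mapO_symm f _)
      right_inv := fun O => Subtype.ext (symm_mapO f _) } ?_)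
  intro O O'
  exact (conjRel_mapO_iff f).symm

end

section
variable {F : Type} [Field F] [NumberField F] [Fact (∀ x : F, x ^ 2 ≠ -1 + 0 * x)]
open Ham

namespace Ham
attribute [local simp] QuadraticAlgebra.re_one QuadraticAlgebra.im_one

lemma tr_mul_self (g : Ham F) : tr (g * g) = tr g ^ 2 - 2 * nr g := by
  rw [tr, tr, nr_eq, fst_mul]
  simp [fst, snd]
  ring

end Ham

namespace RealQuad
variable {p : ℕ} {r s : F} (H : RealQuad F p r s)
include H

/-- Every order with reduced unit group `C₄` is conjugate to an order containing `η`. -/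
theorem exists_conj_eta {O : Subring (Ham F)} (hO : IsOrder F O)
    (hr : RedUnitIso F O (Multiplicative (ZMod 4))) :
    ∃ x : (Ham F)ˣ, qm H.eta 0 ∈ mapO (conjE F x) O := by
  obtain ⟨φ, hφ, hφ'⟩ := hr
  obtain ⟨u, hu⟩ := hφ (Multiplicative.ofAdd 1)
  obtain ⟨g, hg⟩ : ∃ g : Ham F, g = (u : O) := ⟨_, rfl⟩
  have h2 : ∀ a : F, g * g ≠ algebraMap F _ a := by
    intro a ha
    have h1 : φ (u * u) = 1 := by
      rw [hφ', isScalarUnit_iff hO]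
      exact ⟨a, by rw [← ha, hg]; rfl⟩
    rw [map_mul, hu] at h1
    revert h1; decide
  have h4 : ∃ a : F, (g * g) * (g * g) = algebraMap F _ a := by
    have h1 : φ ((u * u) * (u * u)) = 1 := by
      rw [map_mul, map_mul, hu]; decide
    rw [hφ', isScalarUnit_iff hO] at h1
    obtain ⟨a, ha⟩ := h1
    exact ⟨a, by rw [← ha, hg]; rfl⟩
  have hn1 : IsIntegral ℤ (nr g) := by
    rw [hg]; exact (isIntegral_tr_nr (isIntegral_of_mem hO (u : O).2)).2
  have hu1 := unit_mul_inv u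
  rw [← hg] at hu1
  have hn2 : IsIntegral ℤ (nr g)⁻¹ := by
    have hu' := (isIntegral_tr_nr (isIntegral_of_mem hO ((u⁻¹ : (O)ˣ) : O).2)).2
    have hn := congrArg nr hu1
    have hone : nr (1 : Ham F) = 1 := by rw [nr_eq]; simp
    rw [nr_mul, hone] at hn
    rwa [eq_inv_of_mul_eq_one_right hn] at hu'
  have hg0 : g ≠ 0 := fun h => by rw [h, zero_mul] at hu1; exact zero_ne_one hu1
  have hn0 := nr_ne_zero ⟨H.exists_real.some, trivial⟩ hg0
  have hgO : g ∈ O := hg ▸ (u : O).2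
  clear hu1 hu hφ' hφ hg
  have ht : tr g ≠ 0 := by
    intro h
    apply h2 (-nr g)
    rw [mul_self, h, zero_smul, add_zero, Algebra.algebraMap_eq_smul_one]
  have htt : tr g ^ 2 = 2 * nr g := by
    obtain ⟨a, ha⟩ := h4
    rw [← sub_eq_zero, ← tr_mul_self]
    by_contra h
    rw [mul_self (g * g)] at ha
    apply h2 ((tr (g * g))⁻¹ * (a + nr (g * g)))
    rw [map_mul, map_add, ← ha, ← Algebra.smul_def, Algebra.algebraMap_eq_smul_one, neg_smul,
      neg_add_cancel_comm, smul_smul, inv_mul_cancel₀ h, one_smul]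
  have hs := H.s_ne
  obtain ⟨t, htg⟩ : ∃ t, t = tr g := ⟨_, rfl⟩
  have hgg := mul_self g
  rw [← htg] at ht htt hgg
  have hk : IsIntegral ℤ (s / t) := by
    refine IsIntegral.of_pow (n := 2) two_pos ?_
    have : (s / t) ^ 2 = (s ^ 2 / 2) * (nr g)⁻¹ := by
      rw [div_pow, htt]; field_simp
    rw [this]
    exact H.isIntegral_eps.mul hn2
  obtain ⟨i', hi'⟩ : ∃ i' : Ham F, i' = (2 / t) • g - 1 := ⟨_, rfl⟩
  have hii : i' * i' = -1 := by
    have h1 : i' * i' = (2 / t * (2 / t)) • (g * g) - (2 * (2 / t)) • g + 1 := by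
      rw [hi']
      simp only [mul_sub, sub_mul, mul_one, one_mul, smul_mul_assoc, mul_smul_comm]
      module
    rw [h1, hgg]
    have e1 : 2 / t * (2 / t) * (-nr g) = -2 := by
      field_simp; rw [htt]
    have e2 : 2 / t * (2 / t) * t = 2 * (2 / t) := by field_simp
    rw [smul_add, smul_smul, smul_smul, e1, e2]
    module
  obtain ⟨I, hI⟩ : ∃ I : Ham F, I = qm (gI F) 0 := ⟨_, rfl⟩
  have hII : I * I = -1 := by
    rw [hI, qm_mul_qm, gI_mul_gI]
    apply ext' <;> simp
  obtain ⟨c, hc0, hc⟩ : ∃ c : Ham F, c ≠ 0 ∧ i' * c = c * I := by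
    by_cases h : 1 - i' * I = 0
    · refine ⟨qm 0 1, fun h0 => one_ne_zero (congrArg snd h0), ?_⟩
      have h1 : i' = -I := by
        have h3 : i' * (I * I) = I := by rw [← mul_assoc, ← sub_eq_zero.mp h, one_mul]
        rw [hII, mul_neg, mul_one] at h3
        rw [← h3, neg_neg]
      rw [h1, hI]
      apply ext'
      · rw [fst_mul, fst_mul]; simp
      · rw [snd_mul, snd_mul]; simp [star_gI]
    · refine ⟨_, h, ?_⟩
      rw [mul_sub, ← mul_assoc, hii, sub_mul, mul_assoc, hII]; simp [add_comm]
  let x := unit c (nr_ne_zero ⟨H.exists_real.some, trivial⟩ hc0)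
  have hxc : (x : Ham F) = c := rfl
  refine ⟨x⁻¹, ?_⟩
  have h5 : conjE F x⁻¹ i' = I := by
    rw [conjE_apply, inv_inv, hxc, mul_assoc, hc, ← hxc, Units.inv_mul_cancel_left]
  have h6 : g = (t / 2) • (1 + i') := by
    rw [hi', add_sub_cancel, smul_smul, show t / 2 * (2 / t) = 1 by field_simp, one_smul]
  have h7 : qm H.eta 0 = conjE F x⁻¹ ((s / t) • g) := by
    rw [h6, map_smul, map_smul, map_add, map_one, h5, smul_smul,
      show s / t * (t / 2) = s / 2 by field_simp, hI]
    apply ext'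
    · rw [fst_smul, fst_add, fst_one, fst_mk, fst_mk, algebraMap_gau, eta, gI]
      ext <;> simp [QuadraticAlgebra.re_one, QuadraticAlgebra.im_one]
    · rw [snd_smul]; simp
  rw [h7, apply_mem_mapO, Algebra.smul_def]
  exact O.mul_mem (algebraMap_mem hO hk) hgO

end RealQuad
end

section
variable {F : Type} [Field F] [NumberField F] [Fact (∀ x : F, x ^ 2 ≠ -1 + 0 * x)]
open Ham

attribute [local simp] QuadraticAlgebra.re_one QuadraticAlgebra.im_one

lemma mul_star_of_norm {v : Gau F} (hv : v.norm = 1) : v * star v = 1 := by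
  rw [gau_mul_star, hv, map_one]

lemma ne_zero_of_norm {v : Gau F} (hv : v.norm = 1) : v ≠ 0 := by
  rintro rfl; rw [QuadraticAlgebra.norm_zero] at hv; exact zero_ne_one hv

lemma norm_inv_of_norm {v : Gau F} (hv : v.norm = 1) : v⁻¹.norm = 1 := by
  have h := mul_inv_cancel₀ (ne_zero_of_norm hv)
  have h2 := congrArg QuadraticAlgebra.norm h
  rwa [map_mul, hv, one_mul, map_one] at h2

lemma mul_mem_pr_mul {v x : Gau F} (hv : v ≠ 0) {I : FId (Gau F)} : v * x ∈ FId.pr v * I ↔ x ∈ I := by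
  rw [FId.mem_pr_mul]
  exact ⟨fun ⟨z, hz, h⟩ => by rwa [mul_left_cancel₀ hv h], fun h => ⟨x, h, rfl⟩⟩

namespace Ham

/-- The automorphism `x + w j ↦ x + v w j`, for `v` of norm one. -/
def rot (v : Gau F) (h : Ham F) : Ham F := qm (fst h) (v * snd h)

/-- Conjugation by `j`. -/
def inv (h : Ham F) : Ham F := qm (star (fst h)) (star (snd h))

lemma rot_mul {v : Gau F} (hv : v.norm = 1) (h k : Ham F) : rot v (h * k) = rot v h * rot v k := by
  have := mul_star_of_norm hv
  apply ext'
  · simp only [rot, fst_mul, fst_mk, snd_mk, star_mul]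
    linear_combination snd h * star (snd k) * this
  · simp only [rot, fst_mul, snd_mul, fst_mk, snd_mk]
    ring

lemma inv_mul (h k : Ham F) : inv (h * k) = inv h * inv k := by
  apply ext'
  · simp only [inv, fst_mul, fst_mk, snd_mk, star_mul, star_sub]; ring
  · simp only [inv, fst_mul, snd_mul, fst_mk, snd_mk, star_mul, star_add]; ring

lemma conjE_of_snd {x : (Ham F)ˣ} (hx : snd (x : Ham F) = 0) (h : Ham F) :
    conjE F x h = rot (fst (x : Ham F) / star (fst (x : Ham F))) h := by
  have h0 : fst (x : Ham F) ≠ 0 := fun h0 => x.ne_zero (ext' h0 hx)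
  have h1 : star (fst (x : Ham F)) ≠ 0 := by simpa using h0
  rw [conjE_apply]
  have : (x : Ham F) * h = rot (fst (x : Ham F) / star (fst (x : Ham F))) h * x := by
    apply ext'
    · simp [rot, fst_mul, hx]; ring
    · simp only [rot, snd_mul, hx, fst_mk, snd_mk]
      field_simp
      ring
  rw [this, Units.mul_inv_cancel_right]

lemma conjE_of_fst {x : (Ham F)ˣ} (hx : fst (x : Ham F) = 0) (h : Ham F) :
    conjE F x h = rot (snd (x : Ham F) / star (snd (x : Ham F))) (inv h) := by
  have h0 : snd (x : Ham F) ≠ 0 := fun h0 => x.ne_zero (ext' hx h0)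
  have h1 : star (snd (x : Ham F)) ≠ 0 := by simpa using h0
  rw [conjE_apply]
  have : (x : Ham F) * h = rot (snd (x : Ham F) / star (snd (x : Ham F))) (inv h) * x := by
    apply ext'
    · simp only [rot, inv, fst_mul, hx, fst_mk, snd_mk]
      field_simp
      ring
    · simp [rot, inv, snd_mul, hx]; ring
  rw [this, Units.mul_inv_cancel_right]

lemma norm_div_star {u : Gau F} (hu : u ≠ 0) : (u / star u).norm = 1 := by
  have h1 : (star u).norm ≠ 0 := by
    intro h
    have := gau_mul_star (star u)
    rw [h, map_zero, star_star] at this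
    rcases mul_eq_zero.mp this with h | h
    · exact hu (by simpa using h)
    · exact hu h
  have h2 := congrArg QuadraticAlgebra.norm (div_mul_cancel₀ u (b := star u) (by simpa using hu))
  rw [map_mul, ← norm_star u] at h2
  exact mul_right_cancel₀ h1 (by rw [h2, one_mul])

lemma exists_div_star {v : Gau F} (hv : v.norm = 1) : ∃ u : Gau F, u ≠ 0 ∧ v = u / star u := by
  have h := mul_star_of_norm hv
  by_cases h1 : 1 + v = 0
  · refine ⟨gI F, fun h0 => one_ne_zero (congrArg QuadraticAlgebra.im h0), ?_⟩
    have : gI F ≠ 0 := fun h0 => one_ne_zero (congrArg QuadraticAlgebra.im h0)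
    rw [star_gI, div_neg, div_self this]
    linear_combination h1
  · refine ⟨1 + v, h1, ?_⟩
    rw [eq_div_iff (star_ne_zero.mpr h1), star_add, star_one]
    linear_combination h

/-- Multiplication of data by an element of `F(i)`. -/
def act (v : Gau F) (D : FId (Gau F) × Option (Gau F)) : FId (Gau F) × Option (Gau F) :=
  (FId.pr v * D.1, D.2.map (v * ·))

/-- Complex conjugation of data. -/
def cc (D : FId (Gau F) × Option (Gau F)) : FId (Gau F) × Option (Gau F) :=
  (bar D.1, D.2.map star)

lemma cc_cc (D : FId (Gau F) × Option (Gau F)) : cc (cc D) = D := by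
  obtain ⟨𝔟, _ | y⟩ := D <;> simp [cc, bar_bar]

variable {s : F}

lemma Dat.act {v : Gau F} (hv : v.norm = 1) {D : FId (Gau F) × Option (Gau F)} (h : Dat s D.1 D.2) :
    Dat s (act v D).1 (act v D).2 := by
  constructor
  · rw [Ham.act, map_mul, bar_pr, mul_mul_mul_comm, h.unit, ← FId.pr_mul, mul_star_of_norm hv,
      FId.pr_one, one_mul]
  · intro y hy
    obtain ⟨z, hz, rfl⟩ := Option.map_eq_some_iff.mp hy
    have := h.good z hz
    exact ⟨(mul_mem_pr_mul (ne_zero_of_norm hv)).mpr this.mem, by rw [map_mul, hv, one_mul]; exact this.int⟩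

lemma Dat.cc {D : FId (Gau F) × Option (Gau F)} (h : Dat s D.1 D.2) : Dat s (cc D).1 (cc D).2 := by
  constructor
  · rw [Ham.cc, bar_bar, mul_comm, h.unit]
  · intro y hy
    obtain ⟨z, hz, rfl⟩ := Option.map_eq_some_iff.mp hy
    have := h.good z hz
    exact ⟨mem_bar.mpr (by rw [star_star]; exact this.mem), by rw [norm_star]; exact this.int⟩

lemma al_rot {v : Gau F} (y : Gau F) : al s (v * y) = rot v (al s y) := by
  rw [al, rot, al, fst_mk, snd_mk, mul_div_assoc]

lemma al_inv (y : Gau F) : al s (star y) = inv (al s y) := by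
  rw [al, inv, al, fst_mk, snd_mk]
  simp [star_gau, star_div₀]

lemma rot_mem_lat {v : Gau F} (hv : v ≠ 0) {𝔟 : FId (Gau F)} {y : Gau F} {h : Ham F} :
    rot v h ∈ lat s (FId.pr v * 𝔟) (v * y) ↔ h ∈ lat s 𝔟 y := by
  rw [mem_lat, mem_lat, rot, fst_mk, snd_mk, mul_left_comm (fst h), ← mul_sub, mul_mem_pr_mul hv]

lemma inv_mem_lat {𝔟 : FId (Gau F)} {y : Gau F} {h : Ham F} :
    inv h ∈ lat s (bar 𝔟) (star y) ↔ h ∈ lat s 𝔟 y := by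
  rw [mem_lat, mem_lat, inv, fst_mk, snd_mk, mem_bar, star_sub, star_mul, star_star, star_star, star_star,
    mul_comm y]
  refine and_congr ⟨fun h1 => ?_, fun h1 => ?_⟩ Iff.rfl
  · have := isIntegral_gau_star h1
    rwa [star_mul, star_star, star_gau, mul_comm] at this
  · have := isIntegral_gau_star h1
    rwa [star_mul, star_gau, mul_comm] at this

end Ham

namespace RealQuad
variable {p : ℕ} {r s : F} (H : RealQuad F p r s)
include H

lemma rot_mem_ordX {v : Gau F} (hv : v.norm = 1) {D : FId (Gau F) × Option (Gau F)} (hD : Dat s D.1 D.2)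
    {h : Ham F} : rot v h ∈ ordX s (act v D).1 (act v D).2 ↔ h ∈ ordX s D.1 D.2 := by
  have hv0 := ne_zero_of_norm hv
  have hD' := hD.act hv
  obtain ⟨𝔟, _ | y⟩ := D
  · simp only [act, Option.map_none] at hD' ⊢
    rw [ordX_none s hD.unit.le, ordX_none s hD'.unit.le, mem_ord1, mem_ord1, rot, fst_mk, snd_mk,
      mul_mem_pr_mul hv0]
  · simp only [act, Option.map_some] at hD' ⊢
    rw [ordX_some, ordX_some, H.mem_ord2 hD.unit.le (hD.good y rfl), H.mem_ord2 hD'.unit.le (hD'.good _ rfl),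
      al_rot, ← rot_mul hv, rot_mem_lat hv0, rot_mem_lat hv0]

lemma inv_mem_ordX {D : FId (Gau F) × Option (Gau F)} (hD : Dat s D.1 D.2)
    {h : Ham F} : inv h ∈ ordX s (cc D).1 (cc D).2 ↔ h ∈ ordX s D.1 D.2 := by
  have hD' := hD.cc
  obtain ⟨𝔟, _ | y⟩ := D
  · simp only [cc, Option.map_none] at hD' ⊢
    rw [ordX_none s hD.unit.le, ordX_none s hD'.unit.le, mem_ord1, mem_ord1, inv, fst_mk, snd_mk,
      mem_bar, star_star]
    refine and_congr ⟨fun h1 => ?_, fun h1 => isIntegral_gau_star h1⟩ Iff.rfl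
    simpa using isIntegral_gau_star h1
  · simp only [cc, Option.map_some] at hD' ⊢
    rw [ordX_some, ordX_some, H.mem_ord2 hD.unit.le (hD.good y rfl), H.mem_ord2 hD'.unit.le (hD'.good _ rfl),
      al_inv, ← Ham.inv_mul, inv_mem_lat, inv_mem_lat]

end RealQuad

namespace Ham

/-- Data equivalent up to `F(i)^×`. -/
def AEq (s : F) (D D' : FId (Gau F) × Option (Gau F)) : Prop :=
  ∃ v : Gau F, v.norm = 1 ∧ D'.1 = (act v D).1 ∧ Eqv s D'.1 (act v D).2 D'.2

variable {s : F} {D D' D'' : FId (Gau F) × Option (Gau F)}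

lemma Eqv.refl (s : F) (𝔟 : FId (Gau F)) (o : Option (Gau F)) : Eqv s 𝔟 o o := by
  cases o with
  | none => trivial
  | some y => simp only [Eqv, sub_self, zero_div]; exact FId.zero_mem

lemma Eqv.symm {𝔟 : FId (Gau F)} {o o' : Option (Gau F)} (h : Eqv s 𝔟 o o') : Eqv s 𝔟 o' o := by
  rcases o with _ | y <;> rcases o' with _ | y'
  · trivial
  · exact h
  · exact h
  · simp only [Eqv] at h ⊢
    rw [← neg_sub, neg_div]; exact FId.neg_mem h

lemma Eqv.trans {𝔟 : FId (Gau F)} {o o' o'' : Option (Gau F)} (h : Eqv s 𝔟 o o') (h' : Eqv s 𝔟 o' o'') :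
    Eqv s 𝔟 o o'' := by
  rcases o with _ | y <;> rcases o' with _ | y' <;> rcases o'' with _ | y'' <;>
    first | trivial | exact h.elim | exact h'.elim | skip
  simp only [Eqv] at h h' ⊢
  have := FId.add_mem h h'
  rwa [← add_div, sub_add_sub_cancel] at this

lemma Eqv.act {𝔟 : FId (Gau F)} {o o' : Option (Gau F)} (h : Eqv s 𝔟 o o') {v : Gau F} (hv : v ≠ 0) :
    Eqv s (FId.pr v * 𝔟) (o.map (v * ·)) (o'.map (v * ·)) := by
  rcases o with _ | y <;> rcases o' with _ | y' <;> try trivial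
  simp only [Eqv, Option.map_some] at h ⊢
  rwa [← mul_sub, mul_div_assoc, mul_mem_pr_mul hv]

lemma act_act (v w : Gau F) (D : FId (Gau F) × Option (Gau F)) : act v (act w D) = act (v * w) D := by
  obtain ⟨𝔟, _ | y⟩ := D <;> simp only [act, FId.pr_mul, Option.map_none, Option.map_some, mul_assoc]

lemma act_one (D : FId (Gau F) × Option (Gau F)) : act 1 D = D := by
  obtain ⟨𝔟, _ | y⟩ := D <;> simp [act]

lemma AEq.refl (s : F) (D : FId (Gau F) × Option (Gau F)) : AEq s D D :=
  ⟨1, map_one _, by rw [act_one], by rw [act_one]; exact Eqv.refl _ _ _⟩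

lemma AEq.trans (h : AEq s D D') (h' : AEq s D' D'') : AEq s D D'' := by
  obtain ⟨v, hv, h1, h2⟩ := h
  obtain ⟨w, hw, h3, h4⟩ := h'
  refine ⟨w * v, by rw [map_mul, hv, hw, one_mul], ?_, ?_⟩
  · rw [h3, ← act_act]; simp only [act] at h1 ⊢; rw [h1]
  · refine Eqv.trans ?_ h4
    rw [← act_act, h3]
    exact h2.act (ne_zero_of_norm hw)

lemma AEq.symm (h : AEq s D D') : AEq s D' D := by
  obtain ⟨v, hv, h1, h2⟩ := h
  have hv0 := ne_zero_of_norm hv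
  have e : act v⁻¹ (act v D) = D := by rw [act_act, inv_mul_cancel₀ hv0, act_one]
  have h3 := (h2.act (inv_ne_zero hv0)).symm
  have e1 : D.1 = (act v⁻¹ D').1 := by
    conv_lhs => rw [← e]
    simp only [act] at h1 ⊢; rw [h1]
  refine ⟨v⁻¹, norm_inv_of_norm hv, e1, ?_⟩
  have e2 : ((act v D).2.map (v⁻¹ * ·)) = D.2 := congrArg Prod.snd e
  rw [e2] at h3
  rw [e1]; exact h3

end Ham

namespace RealQuad
variable {p : ℕ} {r s : F} (H : RealQuad F p r s) {D D' : FId (Gau F) × Option (Gau F)}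
include H

lemma ordX_of_aEq (h : AEq s D D') : ∃ v : Gau F, v.norm = 1 ∧
    ordX s D'.1 D'.2 = ordX s (act v D).1 (act v D).2 := by
  obtain ⟨v, hv, h1, h2⟩ := h
  refine ⟨v, hv, ?_⟩
  rw [← h1]; exact (H.ordX_congr h2).symm

/-- Conjugacy of the orders without special elements, in terms of data. -/
theorem conjRel_iff (hD : Dat s D.1 D.2) (hD' : Dat s D'.1 D'.2) (hs : ¬ Special (ordX s D'.1 D'.2)) :
    ConjRel (ordX s D.1 D.2) (ordX s D'.1 D'.2) ↔ AEq s D D' ∨ AEq s (cc D) D' := by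
  have hj0 : nr (qm 0 1 : Ham F) ≠ 0 :=
    nr_ne_zero ⟨H.exists_real.some, trivial⟩ fun h => one_ne_zero (congrArg snd h)
  have hrot : ∀ {E E' : FId (Gau F) × Option (Gau F)}, Dat s E.1 E.2 → AEq s E E' →
      ConjRel (ordX s E.1 E.2) (ordX s E'.1 E'.2) := by
    intro E E' hE h
    obtain ⟨v, hv, h1⟩ := H.ordX_of_aEq h
    obtain ⟨u, hu, huv⟩ := exists_div_star hv
    let x := unit (qm u 0) (nr_ne_zero ⟨H.exists_real.some, trivial⟩ (qm_ne_zero_left _ hu))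
    refine ⟨x, fun y => ?_⟩
    rw [← conjE_apply (F := F), conjE_of_snd rfl, h1]
    change _ ↔ rot (u / star u) y ∈ _
    rw [← huv, H.rot_mem_ordX hv hE]
  constructor
  · rintro ⟨x, hx⟩
    have hO := H.ordX_isOrder hD
    have hO' := H.ordX_isOrder hD'
    rcases H.conj_normalizes hO (H.eta_mem_ordX hD) hO' (H.eta_mem_ordX hD') hs hx with h | h
    · right
      have h0 : snd (x : Ham F) ≠ 0 := fun h0 => x.ne_zero (ext' h h0)
      have hv := norm_div_star h0
      have hle : ordX s (act (snd (x : Ham F) / star (snd (x : Ham F))) (cc D)).1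
          (act (snd (x : Ham F) / star (snd (x : Ham F))) (cc D)).2 ≤ ordX s D'.1 D'.2 := by
        intro y hy
        have h1 : y = conjE F x ((conjE F x).symm y) := by simp
        rw [h1, conjE_apply]
        refine (hx _).mp ?_
        rw [h1, conjE_of_fst h, H.rot_mem_ordX hv hD.cc, H.inv_mem_ordX hD] at hy
        exact hy
      obtain ⟨h1, h2⟩ := H.ordX_le (hD.cc.act hv) hD' hle
      exact ⟨_, hv, h1.symm, by rw [← h1]; exact h2⟩
    · left
      have h0 : fst (x : Ham F) ≠ 0 := fun h0 => x.ne_zero (ext' h0 h)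
      have hv := norm_div_star h0
      have hle : ordX s (act (fst (x : Ham F) / star (fst (x : Ham F))) D).1
          (act (fst (x : Ham F) / star (fst (x : Ham F))) D).2 ≤ ordX s D'.1 D'.2 := by
        intro y hy
        have h1 : y = conjE F x ((conjE F x).symm y) := by simp
        rw [h1, conjE_apply]
        refine (hx _).mp ?_
        rw [h1, conjE_of_snd h, H.rot_mem_ordX hv hD] at hy
        exact hy
      obtain ⟨h1, h2⟩ := H.ordX_le (hD.act hv) hD' hle
      exact ⟨_, hv, h1.symm, by rw [← h1]; exact h2⟩
  · rintro (h | h)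
    · exact hrot hD h
    · refine ConjRel.trans ⟨unit (qm 0 1) hj0, fun y => ?_⟩ (hrot hD.cc h)
      rw [← conjE_apply (F := F), conjE_of_fst rfl]
      change _ ↔ rot (1 / star 1) (inv y) ∈ _
      rw [star_one, div_one]
      have : rot 1 (inv y) = inv y := by apply ext' <;> simp [rot]
      rw [this, H.inv_mem_ordX hD]

lemma special_of_aEq (hD : Dat s D.1 D.2) (h : AEq s D D') (hs : Special (ordX s D.1 D.2)) :
    Special (ordX s D'.1 D'.2) := by
  obtain ⟨v, hv, h1⟩ := H.ordX_of_aEq h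
  obtain ⟨w, hw, hwO⟩ := hs
  refine ⟨v * w, by rw [map_mul, hv, hw, one_mul], ?_⟩
  rw [h1]
  exact (H.rot_mem_ordX hv hD).mpr hwO

lemma special_cc (hD : Dat s D.1 D.2) (hs : Special (ordX s D.1 D.2)) :
    Special (ordX s (cc D).1 (cc D).2) := by
  obtain ⟨w, hw, hwO⟩ := hs
  refine ⟨star w, by rw [Ham.norm_star, hw], ?_⟩
  have := (H.inv_mem_ordX hD).mpr hwO
  rwa [inv, fst_mk, snd_mk, star_zero] at this

omit H in
lemma dat_none : Dat s (1 : FId (Gau F)) none := ⟨by rw [map_one, one_mul], fun y hy => by cases hy⟩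

lemma dat_one : Dat s (1 : FId (Gau F)) (some 1) := by
  refine ⟨by rw [map_one, one_mul], fun y hy => ?_⟩
  cases hy
  refine ⟨FId.mem_one.mpr isIntegral_one, ?_⟩
  rw [map_one, one_add_one_eq_two]
  exact H.isIntegral_two_div

omit H in
lemma special_none : Special (ordX s (1 : FId (Gau F)) none) := by
  refine ⟨1, map_one _, ?_⟩
  rw [ordX_none s (dat_none (s := s)).unit.le, mem_ord1]
  exact ⟨isIntegral_zero, FId.mem_one.mpr isIntegral_one⟩

lemma special_one : Special (ordX s (1 : FId (Gau F)) (some 1)) := by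
  refine ⟨1, map_one _, ?_⟩
  have hd := H.dat_one
  have hS := H.algebraMap_s_ne
  rw [ordX_some, H.mem_ord2 hd.unit.le (hd.good _ rfl), mem_lat, mem_lat, fst_mul, snd_mul, al]
  simp only [fst_mk, snd_mk, mul_zero, star_one, star_zero, sub_zero, mul_one, add_zero, zero_sub]
  refine ⟨⟨isIntegral_zero, FId.mem_one.mpr isIntegral_one⟩, ?_, ?_⟩
  · have : algebraMap F (Gau F) s * -(1 / algebraMap F (Gau F) s) = -1 := by field_simp
    rw [this]; exact isIntegral_one.neg
  · have : 1 / algebraMap F (Gau F) s - -(1 / algebraMap F (Gau F) s) = algebraMap F _ (2 / s) := by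
      rw [map_div₀, map_ofNat]; ring
    rw [this]; exact FId.mem_one.mpr H.isIntegral_two_div.gau

/-- Integral `a` with `a² ≡ N a ≡ 1` modulo `s` are `≡ 1`. -/
lemma sub_one_div {a : Gau F} (ha : IsIntegral ℤ a) (h1 : IsIntegral ℤ ((a * (a - star a)) / algebraMap F _ s))
    (h2 : IsIntegral ℤ ((1 + a.norm) / s)) : IsIntegral ℤ ((a - 1) / algebraMap F _ s) := by
  have hS := H.algebraMap_s_ne
  have hs := H.s_ne
  have hN := gau_mul_star a
  have h3 : IsIntegral ℤ ((a - star a) / algebraMap F _ s) := by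
    have e : (a - star a) / algebraMap F _ s = algebraMap F _ ((1 + a.norm) / s) * (a - star a) -
        star a * ((a * (a - star a)) / algebraMap F _ s) := by
      rw [map_div₀, map_add, map_one, ← hN]; field_simp; ring
    rw [e]
    exact (h2.gau.mul (ha.sub (isIntegral_gau_star ha))).sub ((isIntegral_gau_star ha).mul h1)
  obtain ⟨u, v, hu, hv, rfl⟩ := H.exists_coords ha
  have h4 : IsIntegral ℤ (algebraMap F (Gau F) v / algebraMap F _ s) := by
    have e : algebraMap F (Gau F) v / algebraMap F _ s = -(gI F * ((algebraMap F (Gau F) u + algebraMap F (Gau F) v * H.om -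
        star (algebraMap F (Gau F) u + algebraMap F (Gau F) v * H.om)) / algebraMap F _ s)) := by
      rw [star_add, star_mul, star_gau, star_gau]
      have hom := H.om_sub_star
      have hI := gI_mul_gI (F := F)
      field_simp
      linear_combination algebraMap F (Gau F) v * gI F * hom + algebraMap F (Gau F) v * hI
    rw [e]; exact (isIntegral_gI.mul h3).neg
  have h5 : IsIntegral ℤ (algebraMap F (Gau F) v * H.om / algebraMap F _ s) := by
    rw [mul_div_right_comm]; exact h4.mul H.isIntegral_om
  rcases H.mod_s hu with h6 | h6
  · exfalso
    have h7 : IsIntegral ℤ ((algebraMap F (Gau F) u + algebraMap F (Gau F) v * H.om) / algebraMap F _ s) := by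
      rw [add_div, ← map_div₀]; exact h6.gau.add h5
    generalize algebraMap F (Gau F) u + algebraMap F (Gau F) v * H.om = a at *
    apply H.not_isIntegral_inv_s
    have e : 1 / s = (1 + a.norm) / s - a.norm / s := by ring
    rw [e]
    refine h2.sub (isIntegral_gau_algebraMap.mp ?_)
    rw [map_div₀, ← hN, mul_div_right_comm]
    exact h7.mul (isIntegral_gau_star ha)
  · have e : (algebraMap F (Gau F) u + algebraMap F (Gau F) v * H.om - 1) / algebraMap F _ s =
        algebraMap F _ ((u - 1) / s) + algebraMap F (Gau F) v * H.om / algebraMap F _ s := by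
      rw [map_div₀, map_sub, map_one]; ring
    rw [e]; exact h6.gau.add h5

/-- The orders with special elements. -/
theorem special_iff (hD : Dat s D.1 D.2) :
    Special (ordX s D.1 D.2) ↔ AEq s (1, none) D ∨ AEq s (1, some 1) D := by
  constructor
  · rintro ⟨w, hw, hwO⟩
    have hw0 := ne_zero_of_norm hw
    have hb : ∀ {𝔟 : FId (Gau F)}, 𝔟 * bar 𝔟 = 1 → w ∈ 𝔟 → 𝔟 = FId.pr w := by
      intro 𝔟 h𝔟 hwb
      refine (eq_of_le_of_unit ?_ h𝔟 ?_).symm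
      · rw [bar_pr, ← FId.pr_mul, mul_star_of_norm hw, FId.pr_one]
      · intro x hx
        obtain ⟨a, ha, rfl⟩ := FId.mem_pr.mp hx
        exact FId.mul_mem ha hwb
    obtain ⟨𝔟, _ | y⟩ := D
    · left
      rw [ordX_none s hD.unit.le, mem_ord1, snd_mk] at hwO
      refine ⟨w, hw, ?_, trivial⟩
      rw [act, mul_one]
      exact hb hD.unit hwO.2
    · right
      have hg := hD.good y rfl
      have hm := hwO
      rw [ordX_some, H.mem_ord2 hD.unit.le hg, mem_lat, snd_mk, fst_mk, zero_mul, sub_zero] at hm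
      have e𝔟 : 𝔟 = FId.pr w := hb hD.unit hm.1.2
      have hS := H.algebraMap_s_ne
      have hya : y ∈ FId.pr w := e𝔟 ▸ hg.mem
      obtain ⟨a, ha, rfl⟩ := FId.mem_pr.mp hya
      have h2 := hm.2
      rw [mem_lat, fst_mul, snd_mul, al] at h2
      simp only [fst_mk, snd_mk, star_zero, mul_zero, zero_sub] at h2
      replace h2 := h2.2
      change _ ∈ 𝔟 at h2
      rw [e𝔟, FId.mem_pr] at h2
      obtain ⟨b, hbi, hb2⟩ := h2
      have hww := mul_star_of_norm hw
      have h3 : (1 + a * a) / algebraMap F (Gau F) s = b := by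
        apply mul_right_cancel₀ hw0
        rw [← hb2]
        field_simp
        linear_combination (-a ^ 2 * w) * hww
      have hn : (a * w).norm = a.norm := by rw [map_mul, hw, mul_one]
      have hgi := hg.int
      rw [hn] at hgi
      have h4 := H.sub_one_div ha (by
        have e : a * (a - star a) / algebraMap F (Gau F) s = b - algebraMap F _ ((1 + a.norm) / s) := by
          rw [← h3, map_div₀, map_add, map_one, ← gau_mul_star]; ring
        rw [e]; exact hbi.sub hgi.gau) hgi
      refine ⟨w, hw, ?_, ?_⟩
      · rw [act, mul_one]; exact e𝔟
      · change (w * 1 - a * w) / algebraMap F (Gau F) s ∈ 𝔟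
        rw [e𝔟]
        refine FId.mem_pr.mpr ⟨_, h4.neg, ?_⟩
        ring
  · rintro (h | h)
    · exact H.special_of_aEq dat_none h special_none
    · exact H.special_of_aEq H.dat_one h H.special_one

end RealQuad
end

namespace FId
variable {E : Type*} [Field E] [NumberField E]

lemma pr_ne_zero_iff {x : E} : pr x ≠ 0 ↔ x ≠ 0 := by
  simp [pr, FractionalIdeal.spanSingleton_eq_zero_iff]

lemma pr_eq_pr {x y : E} (hx : x ≠ 0) (hy : y ≠ 0) :
    pr x = pr y ↔ IsIntegral ℤ (x / y) ∧ IsIntegral ℤ (y / x) := by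
  rw [← inv_div x y, ← pr_eq_one (div_ne_zero hx hy), pr_div hy, div_eq_one_iff_eq (pr_ne_zero hy)]

lemma exists_pr_rat (N : FId ℚ) : ∃ q : ℚ, N = pr q := by
  have : IsPrincipalIdealRing (𝓞 ℚ) :=
    IsPrincipalIdealRing.of_surjective Rat.ringOfIntegersEquiv.symm.toRingHom
      Rat.ringOfIntegersEquiv.symm.surjective
  exact (FractionalIdeal.isPrincipal_iff N).1 inferInstance

/-- The primes which are not squares of principal ideals do not divide squares. -/
lemma exists_sq_of_squarefree
    (hred : ∀ l : ℕ, l.Prime → (∃ t : E, pr t * pr t = pr (l : E)) ∨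
      ∀ x : E, IsIntegral ℤ x → IsIntegral ℤ (x ^ 2 / l) → IsIntegral ℤ (x / l))
    {I : FId E} {a : ℕ} (ha : Squarefree a) (h : I * I = pr (a : E)) : ∃ t, I = pr t := by
  have ha0 : a ≠ 0 := ha.ne_zero
  have key : ∀ l : ℕ, l.Prime → l ∣ a → ∃ t : E, pr t * pr t = pr (l : E) := by
    intro l hl hla
    refine (hred l hl).resolve_right fun h2 => ?_
    have hl0 : (l : E) ≠ 0 := by exact_mod_cast hl.ne_zero
    have hI : I ≤ pr (l : E) := by
      intro x hx
      obtain ⟨y, hy, hxy⟩ := mem_pr.1 (h ▸ FractionalIdeal.mul_mem_mul hx hx : x * x ∈ pr (a : E))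
      obtain ⟨m, rfl⟩ := hla
      refine mem_pr.2 ⟨x / l, h2 x ?_ ?_, by field_simp⟩
      · refine IsIntegral.of_pow (n := 2) (by norm_num) ?_
        rw [pow_two, hxy]
        exact hy.mul (isIntegral_nat _)
      · rw [pow_two, hxy]
        have : y * ((l * m : ℕ) : E) / l = y * (m : ℕ) := by push_cast; field_simp
        rw [this]
        exact hy.mul (isIntegral_nat _)
    have h3 : pr (a : E) ≤ pr ((l : E) * l) := by
      rw [← h, pr_mul]; exact mul_le_mul' hI hI
    obtain ⟨y, hy, hay⟩ := mem_pr.1 (h3 (mem_pr.2 ⟨1, isIntegral_one, (one_mul _).symm⟩))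
    have hy' : y = ((a / (l * l) : ℚ) : E) := by
      push_cast; rw [hay]; field_simp
    rw [hy', isIntegral_ratCast_iff] at hy
    obtain ⟨n, hn⟩ := hy
    have hlq : (l : ℚ) ≠ 0 := by exact_mod_cast hl.ne_zero
    rw [div_eq_iff (by positivity)] at hn
    have hdvd : l * l ∣ a := by
      have h4 : (a : ℚ) = ((l * l : ℕ) : ℤ) * n := by push_cast; rw [hn]; ring
      exact Int.natCast_dvd_natCast.1 ⟨n, by exact_mod_cast h4⟩
    exact hl.one_lt.ne' (Nat.isUnit_iff.1 (ha l hdvd))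
  have prod : ∀ b : ℕ, b ∣ a → ∃ t : E, pr t * pr t = pr (b : E) := by
    intro b
    induction b using induction_on_primes with
    | zero => intro h; exact absurd (zero_dvd_iff.1 h) ha0
    | one => intro _; exact ⟨1, by rw [← pr_mul]; simp⟩
    | prime_mul l b hl ih =>
      intro hb
      obtain ⟨t, ht⟩ := ih (dvd_of_mul_left_dvd hb)
      obtain ⟨u, hu⟩ := key l hl (dvd_of_mul_right_dvd hb)
      refine ⟨u * t, ?_⟩
      rw [pr_mul, Nat.cast_mul, pr_mul, ← hu, ← ht]; ring
  obtain ⟨t, ht⟩ := prod a dvd_rfl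
  refine ⟨t, eq_of_sq ?_ (h.trans ht.symm)⟩
  intro h0
  rw [h0, zero_mul] at ht
  exact pr_ne_zero (by exact_mod_cast ha0) ht.symm

/-- Triviality of the 2-torsion of the class group of a quadratic field. -/
lemma exists_pr_of_sq (σ : E →+* E) (hσ : ∀ x, σ (σ x) = x)
    (hfix : ∀ x, σ x = x → ∃ q : ℚ, (q : E) = x)
    (hneg : ∀ (x : E) (q : ℚ), x * σ x = -(q : E) ^ 2 → x = 0)
    (hred : ∀ l : ℕ, l.Prime → (∃ t : E, pr t * pr t = pr (l : E)) ∨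
      ∀ x : E, IsIntegral ℤ x → IsIntegral ℤ (x ^ 2 / l) → IsIntegral ℤ (x / l))
    {I : FId E} {g : E} (hg : g ≠ 0) (h : I * I = pr g) : ∃ t, I = pr t := by
  have hI : I ≠ 0 := by rintro rfl; exact pr_ne_zero hg (by rw [← h, zero_mul])
  obtain ⟨N, hN, hN'⟩ := exists_norm (algebraMap ℚ E) σ hσ hfix hI
  obtain ⟨q, rfl⟩ := exists_pr_rat N
  have hq : q ≠ 0 := pr_ne_zero_iff.1 hN
  have hqE : (q : E) ≠ 0 := by exact_mod_cast hq
  obtain ⟨t, ht⟩ := hfix (g * σ g) (by rw [map_mul, hσ, mul_comm])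
  obtain ⟨T, hT⟩ := hfix (g + σ g) (by rw [map_add, hσ, add_comm])
  have htq : pr (t : E) = pr ((q ^ 2 : ℚ) : E) := by
    rw [ht, pr_mul, ← map_pr σ, ← h, map_mul]
    calc I * I * (map σ I * map σ I) = (I * map σ I) * (I * map σ I) := by ring
      _ = _ := by rw [hN', map_pr, ← pr_mul]; simp [pow_two]
  have ht0 : t ≠ 0 := by
    rintro rfl
    rw [eq_comm, Rat.cast_zero, mul_eq_zero, map_eq_zero] at ht
    exact hg (or_self_iff.1 ht)
  have htq2 : t = q ^ 2 := by
    obtain ⟨h1, h2⟩ := (pr_eq_pr (by exact_mod_cast ht0) (by exact_mod_cast pow_ne_zero 2 hq)).1 htq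
    rw [← Rat.cast_div, isIntegral_ratCast_iff] at h1 h2
    obtain ⟨m, hm⟩ := h1
    obtain ⟨n, hn⟩ := h2
    have hmn : m * n = 1 := by
      have : (m : ℚ) * n = 1 := by rw [← hm, ← hn]; field_simp
      exact_mod_cast this
    rw [div_eq_iff (pow_ne_zero 2 hq)] at hm
    rcases Int.eq_one_or_neg_one_of_mul_eq_one hmn with rfl | rfl
    · simpa using hm
    · exact absurd (hneg g q (by rw [← ht, hm]; simp)) hg
  obtain ⟨n, hn, hc⟩ : ∃ n : ℚ, n ^ 2 = q ^ 2 ∧ T + 2 * n ≠ 0 := by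
    by_cases h1 : T + 2 * q = 0
    · exact ⟨-q, by ring, fun h2 => hq (by linarith)⟩
    · exact ⟨q, rfl, h1⟩
  set c : ℚ := T + 2 * n with hcdef
  have hgc : (g + n) ^ 2 = g * c := by
    have h1 : (n : E) ^ 2 = g * σ g := by rw [← ht, htq2]; exact_mod_cast hn
    have h2 : (c : E) = g + σ g + 2 * n := by rw [hcdef, ← hT]; push_cast; ring
    rw [h2]; linear_combination h1
  have hcE : (c : E) ≠ 0 := by exact_mod_cast hc
  have hgn : g + n ≠ 0 := by
    intro h0; rw [h0] at hgc
    exact mul_ne_zero hg hcE (by rw [← hgc]; ring)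
  obtain ⟨a, b, hab, ha⟩ := Nat.sq_mul_squarefree (c.num * c.den).natAbs
  have hden : (c.den : E) ≠ 0 := by exact_mod_cast c.den_ne_zero
  have hb : (b : E) ≠ 0 := by
    rintro h0
    have h1 : b = 0 := by exact_mod_cast h0
    rw [h1, zero_pow two_ne_zero, zero_mul, eq_comm, Int.natAbs_eq_zero, mul_eq_zero] at hab
    rcases hab with h | h
    · exact hc (Rat.num_eq_zero.1 h)
    · exact c.den_ne_zero (by exact_mod_cast h)
  obtain ⟨z, hz⟩ := exists_sq_of_squarefree hred ha
    (I := I * pr (c / (g + n)) * pr (c.den / b : E)) (by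
      have h1 : I * pr (c / (g + n)) * pr (c.den / b : E) * (I * pr (c / (g + n)) * pr (c.den / b : E)) =
          pr (g * (c / (g + n)) ^ 2 * (c.den / b : E) ^ 2) := by
        rw [pr_mul, pr_mul, ← h, pow_two, pow_two, pr_mul, pr_mul]; ring
      have h2 : g * (c / (g + n)) ^ 2 * (c.den / b : E) ^ 2 = c * c.den ^ 2 / b ^ 2 := by
        field_simp
        linear_combination -hgc
      have h3 : (c : E) * c.den ^ 2 / b ^ 2 = a ∨ (c : E) * c.den ^ 2 / b ^ 2 = -a := by
        have h4 : (c : E) * c.den = c.num := by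
          have := Rat.mul_den_eq_num c
          exact_mod_cast this
        rw [div_eq_iff (pow_ne_zero 2 hb), div_eq_iff (pow_ne_zero 2 hb)]
        have h5 : (c : E) * c.den ^ 2 = ((c.num * c.den : ℤ) : E) := by
          push_cast; rw [← h4]; ring
        rw [h5]
        rcases Int.natAbs_eq (c.num * c.den) with h6 | h6
        · left; rw [h6, ← hab]; push_cast; ring
        · right; rw [h6, ← hab]; push_cast; ring
      rw [h1, h2]
      rcases h3 with h3 | h3
      · rw [h3]
      · rw [h3, ← neg_one_mul, pr_mul, (pr_eq_one (by norm_num)).2, one_mul]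
        exact ⟨isIntegral_one.neg, by simpa using (isIntegral_one (R := ℤ) (B := E)).neg⟩)
  refine ⟨z / (c / (g + n) * (c.den / b)), ?_⟩
  have hne : (c / (g + n) * (c.den / b) : E) ≠ 0 := by positivity
  rw [pr_div hne, eq_div_iff (pr_ne_zero hne), ← hz, pr_mul, mul_assoc]

end FId

section
variable {E : Type*} [Field E] [NumberField E]

lemma quad_conj_inv {d : ℤ} {ρ : E} (hρ : ρ ^ 2 = (d : E)) (hgen : Algebra.adjoin ℚ {ρ} = ⊤)
    {σ : E →+* E} (hσ : ∀ a b : ℚ, σ (a + b * ρ) = a - b * ρ) :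
    (∀ x, σ (σ x) = x) ∧ ∀ x, σ x = x → ∃ q : ℚ, (q : E) = x := by
  have hρ' : ρ ^ 2 = (((d : ℚ)) : E) := by simpa using hρ
  refine ⟨fun x => ?_, fun x hx => ?_⟩
  · obtain ⟨a, b, rfl⟩ := quad_coords hρ' hgen x
    have := hσ a (-b)
    push_cast at this
    rw [hσ, sub_eq_add_neg, ← neg_mul, this]; ring
  · obtain ⟨a, b, rfl⟩ := quad_coords hρ' hgen x
    rw [hσ] at hx
    have h0 : b * ρ = 0 := by linear_combination (-1 / 2) * hx
    exact ⟨a, by rw [h0, add_zero]⟩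

/-- Triviality of the 2-torsion of the class group of a quadratic field, in coordinates. -/
lemma quad_exists_pr_of_sq {d : ℤ} {ρ : E} (hρ : ρ ^ 2 = (d : E)) (hd : ¬ IsSquare (d : ℚ))
    (hgen : Algebra.adjoin ℚ {ρ} = ⊤)
    (hneg : ∀ a b q : ℚ, a ^ 2 - d * b ^ 2 = -q ^ 2 → a = 0 ∧ b = 0)
    (hred : ∀ l : ℕ, l.Prime → (∃ t : E, FId.pr t * FId.pr t = FId.pr (l : E)) ∨
      ∀ x : E, IsIntegral ℤ x → IsIntegral ℤ (x ^ 2 / l) → IsIntegral ℤ (x / l))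
    {I : FId E} {g : E} (hg : g ≠ 0) (h : I * I = FId.pr g) : ∃ t, I = FId.pr t := by
  obtain ⟨σ, hσ⟩ := quad_conj hρ hd hgen
  obtain ⟨h1, h2⟩ := quad_conj_inv hρ hgen hσ
  refine FId.exists_pr_of_sq σ h1 h2 (fun x q hx => ?_) hred hg h
  obtain ⟨a, b, rfl⟩ := quad_coords (n := (d : ℚ)) (by simpa using hρ) hgen x
  rw [hσ] at hx
  obtain ⟨rfl, rfl⟩ := hneg a b q (by
    have : ((a ^ 2 - d * b ^ 2 : ℚ) : E) = ((-q ^ 2 : ℚ) : E) := by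
      push_cast; rw [← hx, ← hρ]; ring
    exact_mod_cast this)
  simp

end

lemma eq_zero_of_sq_add_sq_eq {p : ℕ} (hp : p.Prime) (hp4 : p % 4 = 3) {a b q : ℚ}
    (h : a ^ 2 + q ^ 2 = p * b ^ 2) : a = 0 ∧ b = 0 := by
  have hp0 : (p : ℚ) ≠ 0 := by exact_mod_cast hp.ne_zero
  by_cases hb : b = 0
  · subst hb; exact ⟨by nlinarith [sq_nonneg a, sq_nonneg q], rfl⟩
  exfalso
  set m : ℕ := a.den * q.den * b.num.natAbs with hm
  have hm0 : m ≠ 0 := by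
    simp [hm, hb]
  have h1 : p * m ^ 2 = (a.num * q.den * b.den).natAbs ^ 2 + (q.num * a.den * b.den).natAbs ^ 2 := by
    zify
    simp only [hm, sq_abs, Nat.cast_mul, Int.natCast_natAbs, mul_pow]
    have e1 := Rat.mul_den_eq_num a
    have e2 := Rat.mul_den_eq_num q
    have e3 := Rat.mul_den_eq_num b
    have : ((p * (a.den ^ 2 * q.den ^ 2 * b.num ^ 2) : ℤ) : ℚ) =
        ((a.num ^ 2 * q.den ^ 2 * b.den ^ 2 + q.num ^ 2 * a.den ^ 2 * b.den ^ 2 : ℤ) : ℚ) := by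
      push_cast
      rw [← e1, ← e2, ← e3]
      linear_combination (-(a.den * q.den * b.den : ℚ) ^ 2) * h
    exact_mod_cast this
  have h2 := Nat.eq_sq_add_sq_iff.1 ⟨_, _, h1⟩ (q := p)
    (Nat.mem_primeFactors.2 ⟨hp, dvd_mul_right _ _, mul_ne_zero hp.ne_zero (pow_ne_zero 2 hm0)⟩) hp4
  have := Fact.mk hp
  rw [padicValNat.mul hp.ne_zero (pow_ne_zero 2 hm0), padicValNat.pow, padicValNat_self] at h2
  exact Nat.not_even_iff_odd.2 ⟨padicValNat p m, by ring⟩ h2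

namespace RealQuad
variable {F : Type} [Field F] [NumberField F] {p : ℕ} {r s : F} (H : RealQuad F p r s)
include H

lemma exists_pr_of_sq {I : FId F} {g : F} (hg : g ≠ 0) (h : I * I = FId.pr g) : ∃ t, I = FId.pr t := by
  refine quad_exists_pr_of_sq (d := p) (ρ := r) (by simpa using H.sq)
    (by simpa using not_isSquare_prime H.prime) H.gen (fun a b q hab => ?_) (fun l hl => ?_) hg h
  · exact eq_zero_of_sq_add_sq_eq H.prime H.mod_four (q := q) (by push_cast at hab; linarith)
  · by_cases hlp : l = p
    · left; exact ⟨r, by rw [← FId.pr_mul, ← pow_two, H.sq, hlp]⟩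
    by_cases hl2 : l = 2
    · left
      refine ⟨s, ?_⟩
      have hs := H.s_ne
      rw [← FId.pr_mul, ← pow_two, hl2]
      exact (FId.pr_eq_pr (pow_ne_zero 2 hs) (by norm_num)).2
        ⟨by simpa using H.isIntegral_eps, by simpa using H.isIntegral_eps_inv⟩
    right
    intro x hx hx2
    have hlF : (l : F) ≠ 0 := by exact_mod_cast hl.ne_zero
    obtain ⟨a, b, rfl⟩ := H.isIntegral_iff.1 hx
    obtain ⟨c, e, hce⟩ := H.isIntegral_iff.1 hx2
    rw [div_eq_iff hlF] at hce
    obtain ⟨h1, h2⟩ := H.indep_int (a := a ^ 2 + p * b ^ 2) (b := 2 * a * b) (c := c * l) (d := e * l) (by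
      push_cast; rw [← H.sq]; linear_combination hce)
    have hl' : Prime (l : ℤ) := Nat.prime_iff_prime_int.1 hl
    have hlp' : ¬ (l : ℤ) ∣ p := fun hd =>
      hlp ((Nat.prime_dvd_prime_iff_eq hl H.prime).1 (by exact_mod_cast hd))
    have hl2' : ¬ (l : ℤ) ∣ 2 := fun hd =>
      hl2 ((Nat.prime_dvd_prime_iff_eq hl Nat.prime_two).1 (by exact_mod_cast hd))
    have hab : (l : ℤ) ∣ a ∧ (l : ℤ) ∣ b := by
      have h3 : (l : ℤ) ∣ 2 * a * b := ⟨e, by rw [h2]; ring⟩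
      rcases hl'.dvd_or_dvd h3 with h4 | h4
      · have ha := (hl'.dvd_or_dvd h4).resolve_left hl2'
        have : (l : ℤ) ∣ p * b ^ 2 := by
          rw [← Int.dvd_add_right (dvd_pow ha two_ne_zero), h1]; exact dvd_mul_left _ _
        exact ⟨ha, hl'.dvd_of_dvd_pow ((hl'.dvd_or_dvd this).resolve_left hlp')⟩
      · have : (l : ℤ) ∣ a ^ 2 := by
          rw [← Int.dvd_add_left ((dvd_pow h4 two_ne_zero).mul_left _), h1]; exact dvd_mul_left _ _
        exact ⟨hl'.dvd_of_dvd_pow this, h4⟩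
    obtain ⟨⟨a', rfl⟩, ⟨b', rfl⟩⟩ := hab
    refine H.isIntegral_iff.2 ⟨a', b', ?_⟩
    push_cast; field_simp

end RealQuad

section
variable {K : Type} [Field K] [NumberField K] {p : ℕ} {ρ : K}

lemma imquad_isIntegral_iff (hp : p.Prime) (hp4 : p % 4 = 3) (hρ : ρ ^ 2 = -(p : K))
    (hgen : Algebra.adjoin ℚ {ρ} = ⊤) {x : K} :
    IsIntegral ℤ x ↔ ∃ a b : ℤ, x = a + b * ((1 + ρ) / 2) := by
  rw [quad_isIntegral_iff (d := -p) (ρ := ρ) (by simpa using hρ) (Nat.prime_iff_prime_int.1 hp).neg hgen]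
  constructor
  · rintro ⟨m, t, h, k, hk⟩
    obtain ⟨j, hj⟩ : ∃ j, m - t = 2 * j := by
      have : Even (m - t) := by
        have h1 : Even (m ^ 2 + p * t ^ 2) := ⟨2 * k, by linarith⟩
        have h2 : ¬ Even (p : ℤ) := by
          rw [Int.even_coe_nat, Nat.even_iff]; omega
        simp only [Int.even_add, Int.even_mul, Int.even_pow, h2] at h1
        rw [Int.even_sub]; tauto
      obtain ⟨j, hj⟩ := this
      exact ⟨j, by omega⟩
    refine ⟨j, t, ?_⟩
    have : (m : K) = 2 * j + t := by
      have : m = 2 * j + t := by linarith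
      exact_mod_cast this
    rw [this] at h
    linear_combination h / 2
  · rintro ⟨a, b, rfl⟩
    refine ⟨2 * a + b, b, by push_cast; ring, ?_⟩
    obtain ⟨k, hk⟩ : ∃ k, (p : ℤ) + 1 = 4 * k := ⟨(p + 1) / 4, by omega⟩
    exact ⟨a ^ 2 + a * b + k * b ^ 2, by linear_combination b ^ 2 * hk⟩

lemma imquad_not_isSquare (hp : p.Prime) : ¬ IsSquare ((-p : ℤ) : ℚ) := by
  rintro ⟨x, hx⟩
  push_cast at hx
  have : (0 : ℚ) < p := by exact_mod_cast hp.pos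
  nlinarith [mul_self_nonneg x]

lemma imquad_exists_pr_of_sq (hp : p.Prime) (hp4 : p % 4 = 3) (hρ : ρ ^ 2 = -(p : K))
    (hgen : Algebra.adjoin ℚ {ρ} = ⊤) {I : FId K} {g : K} (hg : g ≠ 0) (h : I * I = FId.pr g) :
    ∃ t, I = FId.pr t := by
  have hp0 : (0 : ℚ) < p := by exact_mod_cast hp.pos
  refine quad_exists_pr_of_sq (d := -p) (ρ := ρ) (by simpa using hρ) (imquad_not_isSquare hp) hgen
    (fun a b q hab => ?_) (fun l hl => ?_) hg h
  · push_cast at hab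
    have hb : p * b ^ 2 = 0 := by nlinarith [sq_nonneg a, sq_nonneg q, mul_nonneg hp0.le (sq_nonneg b)]
    have hb0 : b = 0 := by simpa [hp0.ne'] using hb
    subst hb0
    exact ⟨by nlinarith [sq_nonneg a, sq_nonneg q], rfl⟩
  · have hlK : (l : K) ≠ 0 := by exact_mod_cast hl.ne_zero
    have hl' : Prime (l : ℤ) := Nat.prime_iff_prime_int.1 hl
    by_cases hlp : l = p
    · left
      refine ⟨ρ, ?_⟩
      rw [← FId.pr_mul, ← pow_two, hρ, hlp, FId.pr_eq_pr (by rw [← hlp]; exact neg_ne_zero.2 hlK) (hlp ▸ hlK),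
        neg_div, div_neg, div_self (hlp ▸ hlK)]
      exact ⟨isIntegral_one.neg, isIntegral_one.neg⟩
    right
    intro x hx hx2
    have hint := fun {x : K} => imquad_isIntegral_iff (x := x) hp hp4 hρ hgen
    obtain ⟨a, b, rfl⟩ := hint.1 hx
    obtain ⟨c, e, hce⟩ := hint.1 hx2
    rw [div_eq_iff hlK] at hce
    obtain ⟨k, hk⟩ : ∃ k, (p : ℤ) + 1 = 4 * k := ⟨(p + 1) / 4, by omega⟩
    have hkK : (p : K) = 4 * k - 1 := by
      have : (p : ℤ) = 4 * k - 1 := by linarith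
      exact_mod_cast this
    have hρ2 : ρ ^ 2 = ((-p : ℚ) : K) := by simpa using hρ
    obtain ⟨h1, h2⟩ := quad_indep' hρ2 (by simpa using imquad_not_isSquare hp)
      (a := (a ^ 2 - k * b ^ 2 + (2 * a * b + b ^ 2) / 2)) (b := (2 * a * b + b ^ 2) / 2)
      (c := (c + e / 2) * l) (d := e / 2 * l) (by
        push_cast
        rw [hkK] at hρ
        linear_combination hce - b ^ 2 / 4 * hρ)
    have h2' : b * (2 * a + b) = l * e := by
      have : (b * (2 * a + b) : ℚ) = l * e := by linear_combination 2 * h2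
      exact_mod_cast this
    have h1' : a ^ 2 - k * b ^ 2 = l * c := by
      have : (a ^ 2 - k * b ^ 2 : ℚ) = l * c := by linear_combination h1 - h2
      exact_mod_cast this
    have hlp' : ¬ (l : ℤ) ∣ p := fun hd =>
      hlp ((Nat.prime_dvd_prime_iff_eq hl hp).1 (by exact_mod_cast hd))
    have hab : (l : ℤ) ∣ a ∧ (l : ℤ) ∣ b := by
      rcases hl'.dvd_or_dvd (⟨e, h2'⟩ : (l : ℤ) ∣ b * (2 * a + b)) with h4 | h4
      · have : (l : ℤ) ∣ a ^ 2 := by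
          have := dvd_add (⟨c, h1'⟩ : (l : ℤ) ∣ a ^ 2 - k * b ^ 2) ((dvd_pow h4 two_ne_zero).mul_left k)
          rwa [sub_add_cancel] at this
        exact ⟨hl'.dvd_of_dvd_pow this, h4⟩
      · have : (l : ℤ) ∣ p * a ^ 2 := by
          obtain ⟨f, hf⟩ := h4
          refine ⟨-c - k * (b * f - 2 * a * f), ?_⟩
          linear_combination -h1' + a ^ 2 * hk - k * (b - 2 * a) * hf
        have ha := hl'.dvd_of_dvd_pow ((hl'.dvd_or_dvd this).resolve_left hlp')
        exact ⟨ha, (Int.dvd_add_right (ha.mul_left 2)).1 h4⟩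
    obtain ⟨⟨a', rfl⟩, ⟨b', rfl⟩⟩ := hab
    refine hint.2 ⟨a', b', ?_⟩
    push_cast; field_simp

end

section
variable {F : Type} [Field F] [NumberField F] [Fact (∀ x : F, x ^ 2 ≠ -1 + 0 * x)]
open Ham

lemma gau_norm_ne {x : Gau F} (hx : x ≠ 0) : x.norm ≠ 0 :=
  fun h => hx (QuadraticAlgebra.norm_eq_zero_iff_eq_zero.mp h)

lemma gau_norm_inv (x : Gau F) : x⁻¹.norm = x.norm⁻¹ := by
  by_cases hx : x = 0
  · simp [hx]
  · apply mul_right_cancel₀ (gau_norm_ne hx)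
    rw [inv_mul_cancel₀ (gau_norm_ne hx), ← map_mul, inv_mul_cancel₀ hx, map_one]

namespace RealQuad
variable {p : ℕ} {r s : F} (H : RealQuad F p r s) {D D' : FId (Gau F) × Option (Gau F)}
include H

lemma exists_eq_add_gau (y : Gau F) :
    ∃ a b : F, y = algebraMap F _ a + algebraMap F _ b * H.om ∧
      algebraMap F (Gau F) b = (y - star y) * -gI F := by
  refine ⟨y.re - y.im * r, 2 * y.im, ?_, ?_⟩
  · rw [algebraMap_gau, algebraMap_gau, om]
    ext <;> simp <;> ring
  · rw [algebraMap_gau, gI]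
    ext <;> simp <;> ring

/-- Conjugation invariant ideals of `F(i)` come from `F`. -/
lemma exists_map_eq {𝔟 : FId (Gau F)} (h : bar 𝔟 = 𝔟) :
    ∃ 𝔣 : FId F, FId.map (algebraMap F (Gau F)) 𝔣 = 𝔟 := by
  obtain ⟨d, hd, hdi, hd'⟩ := FId.exists_bound 𝔟
  obtain ⟨𝔣, h𝔣⟩ : ∃ 𝔣 : FId F, ∀ x, x ∈ 𝔣 ↔ algebraMap F (Gau F) x ∈ 𝔟 := by
    refine ⟨FId.mk' (fun a => algebraMap F (Gau F) a ∈ 𝔟) (by simpa using FId.zero_mem)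
      (fun x y hx hy => by rw [map_add]; exact FId.add_mem hx hy)
      (fun a x ha hx => by rw [map_mul]; exact FId.mul_mem ha.gau hx) d.norm
      (gau_norm_ne hd) (fun x hx => ?_), fun x => FId.mem_mk'⟩
    rw [← isIntegral_gau_algebraMap, map_mul, ← gau_mul_star, mul_right_comm, mul_comm]
    exact (isIntegral_gau_star hdi).mul (hd' _ hx)
  refine ⟨𝔣, le_antisymm (FId.map_le _ fun x hx => (h𝔣 x).1 hx) fun y hy => ?_⟩
  obtain ⟨a, b, hab, hb⟩ := H.exists_eq_add_gau y
  have hy' : star y ∈ 𝔟 := by rw [← h, mem_bar, star_star]; exact hy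
  have hbm : algebraMap F (Gau F) b ∈ 𝔟 := by
    rw [hb, mul_comm]
    exact FId.mul_mem isIntegral_gI.neg (FId.sub_mem hy hy')
  have ham : algebraMap F (Gau F) a ∈ 𝔟 := by
    have e : algebraMap F (Gau F) a = y - H.om * algebraMap F _ b := by rw [hab]; ring
    rw [e]
    exact FId.sub_mem hy (FId.mul_mem H.isIntegral_om hbm)
  have : y ∈ FId.map (algebraMap F (Gau F)) 𝔣 := by
    rw [hab, mul_comm]
    exact FId.add_mem (FId.mem_map_of_mem _ ((h𝔣 _).2 ham))
      (FId.mul_mem H.isIntegral_om (FId.mem_map_of_mem _ ((h𝔣 _).2 hbm)))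
  exact this

lemma exists_pr_norm_one {w : Gau F} (hw : w ≠ 0) (h : FId.pr w * bar (FId.pr w) = 1) :
    ∃ z : Gau F, z.norm = 1 ∧ FId.pr w = FId.pr z := by
  have hn := gau_norm_ne hw
  rw [bar_pr, ← FId.pr_mul, gau_mul_star, FId.pr_eq_one ((map_ne_zero _).2 hn), ← map_inv₀,
    isIntegral_gau_algebraMap, isIntegral_gau_algebraMap] at h
  obtain ⟨e, he, he', hne⟩ : ∃ e : Gau F, IsIntegral ℤ e ∧ IsIntegral ℤ e⁻¹ ∧ e.norm = w.norm := by
    obtain ⟨v, hv, hv', h1 | h1⟩ := H.exists_norm_eq h.1 h.2 (norm_pos hw)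
    · exact ⟨_, hv.gau, by rw [← map_inv₀]; exact hv'.gau, h1⟩
    · refine ⟨_, hv.gau.mul H.isIntegral_eta, ?_, h1⟩
      rw [mul_inv, ← map_inv₀]
      refine hv'.gau.mul ?_
      have e1 : H.eta⁻¹ = star H.eta * algebraMap F _ (2 / s ^ 2) := by
        apply mul_left_cancel₀ H.eta_ne
        rw [mul_inv_cancel₀ H.eta_ne, ← mul_assoc, gau_mul_star, H.norm_eta, ← map_mul]
        have := H.s_ne
        field_simp
        simp
      rw [e1]
      exact (isIntegral_gau_star H.isIntegral_eta).mul H.isIntegral_eps_inv.gau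
  have he0 : e ≠ 0 := by
    rintro rfl
    rw [QuadraticAlgebra.norm_zero] at hne
    exact hn hne.symm
  refine ⟨w * e⁻¹, ?_, ?_⟩
  · rw [map_mul, gau_norm_inv, hne, mul_inv_cancel₀ hn]
  · rw [FId.pr_mul, (FId.pr_eq_one (inv_ne_zero he0)).2 ⟨he', by rwa [inv_inv]⟩, mul_one]

/-- A unitary ideal with square generated by an element of norm one is itself so generated. -/
lemma exists_pr_of_unitary_sq {𝔟 : FId (Gau F)} (h : 𝔟 * bar 𝔟 = 1) {v : Gau F} (hv : v.norm = 1)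
    (h2 : 𝔟 * 𝔟 = FId.pr v) : ∃ z : Gau F, z.norm = 1 ∧ 𝔟 = FId.pr z := by
  obtain ⟨x, hx, rfl⟩ := exists_div_star hv
  have hx' : star x ≠ 0 := star_ne_zero.2 hx
  have h𝔟 : 𝔟 ≠ 0 := by rintro rfl; simp at h
  have hpx := FId.pr_ne_zero hx
  have hpx' := FId.pr_ne_zero hx'
  rw [FId.pr_div hx', eq_div_iff hpx'] at h2
  have hbar : bar (𝔟 * (FId.pr x)⁻¹) = 𝔟 * (FId.pr x)⁻¹ := by
    rw [map_mul, map_inv₀, bar_pr]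
    apply mul_right_cancel₀ (mul_ne_zero h𝔟 hpx')
    calc _ = 𝔟 * bar 𝔟 * ((FId.pr (star x))⁻¹ * FId.pr (star x)) := by ring
      _ = (𝔟 * 𝔟 * FId.pr (star x)) * (FId.pr x)⁻¹ := by
        rw [h, h2, inv_mul_cancel₀ hpx', mul_inv_cancel₀ hpx, one_mul]
      _ = _ := by ring
  obtain ⟨𝔣, h𝔣⟩ := H.exists_map_eq hbar
  obtain ⟨t, rfl⟩ := H.exists_pr_of_sq (I := 𝔣) (g := x.norm⁻¹) (inv_ne_zero (gau_norm_ne hx)) (by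
    apply FId.map_injective (algebraMap F (Gau F))
    rw [map_mul, h𝔣, FId.map_pr, map_inv₀, ← gau_mul_star, FId.pr_inv (mul_ne_zero hx hx'), FId.pr_mul]
    apply mul_right_cancel₀ (mul_ne_zero hpx hpx')
    rw [inv_mul_cancel₀ (mul_ne_zero hpx hpx')]
    calc _ = (𝔟 * 𝔟 * FId.pr (star x)) * (FId.pr x)⁻¹ * ((FId.pr x)⁻¹ * FId.pr x) := by ring
      _ = _ := by rw [h2, inv_mul_cancel₀ hpx, mul_inv_cancel₀ hpx, one_mul])
  have e : 𝔟 = FId.pr (algebraMap F _ t * x) := by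
    rw [FId.pr_mul, ← FId.map_pr, h𝔣, mul_assoc, inv_mul_cancel₀ hpx, mul_one]
  rw [e] at h ⊢
  refine H.exists_pr_norm_one ?_ h
  rw [← FId.pr_ne_zero_iff, ← e]; exact h𝔟

/-- Integral elements of norm one are congruent to `1` modulo `s`. -/
lemma norm_one_sub_one {x : Gau F} (hx : IsIntegral ℤ x) (h : x.norm = 1) :
    IsIntegral ℤ ((x - 1) / algebraMap F (Gau F) s) := by
  have h2 : IsIntegral ℤ ((2 : Gau F) / algebraMap F _ s) := by
    have := H.isIntegral_two_div.gau
    rwa [map_div₀, map_ofNat] at this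
  have hi := H.isIntegral_gI_sub_one
  rcases H.eq_of_norm_one hx h with rfl | rfl | rfl | rfl
  · simpa using isIntegral_zero
  · convert! h2.neg using 1; ring
  · exact hi
  · convert! (hi.add h2).neg using 1; ring

lemma special_of_cc (hD : Dat s D.1 D.2) (h : AEq s (cc D) D) : Special (ordX s D.1 D.2) := by
  rw [H.special_iff hD]
  obtain ⟨v, hv, h1, h2⟩ := h
  have hv0 := ne_zero_of_norm hv
  obtain ⟨𝔟, o⟩ := D
  have hu : 𝔟 * bar 𝔟 = 1 := hD.unit
  replace h1 : 𝔟 = FId.pr v * bar 𝔟 := h1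
  obtain ⟨z, hz, rfl⟩ := H.exists_pr_of_unitary_sq hu hv (by
    nth_rewrite 2 [h1]
    rw [mul_left_comm, hu, mul_one])
  have hz0 := ne_zero_of_norm hz
  have hS := H.algebraMap_s_ne
  cases o with
  | none =>
    left
    exact ⟨z, hz, by simp [act], trivial⟩
  | some y =>
    right
    have hg := hD.good y rfl
    obtain ⟨a, ha, rfl⟩ := FId.mem_pr.1 hg.mem
    have hgi := hg.int
    rw [map_mul, hz, mul_one] at hgi
    have hζ : IsIntegral ℤ (v * star z / z) := by
      have : v * star z ∈ FId.pr z := by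
        rw [h1, bar_pr, ← FId.pr_mul]
        exact FId.mem_pr.2 ⟨1, isIntegral_one, (one_mul _).symm⟩
      obtain ⟨b, hb, hb'⟩ := FId.mem_pr.1 this
      rwa [hb', mul_div_cancel_right₀ _ hz0]
    have hζ1 := H.norm_one_sub_one hζ (by
      rw [div_eq_mul_inv, map_mul, map_mul, hv, Ham.norm_star, hz, norm_inv_of_norm hz]; norm_num)
    have h3 : (v * star (a * z) - a * z) / algebraMap F (Gau F) s ∈ FId.pr z := h2
    obtain ⟨b, hb, hb'⟩ := FId.mem_pr.1 h3
    refine ⟨z, hz, by simp [act], ?_⟩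
    have h4 : (star a - a) / algebraMap F (Gau F) s =
        b - star a * ((v * star z / z - 1) / algebraMap F (Gau F) s) := by
      apply mul_right_cancel₀ hz0
      rw [sub_mul, ← hb', star_mul]
      field_simp; ring
    have h5 := H.sub_one_div ha (by
      have e : a * (a - star a) / algebraMap F (Gau F) s = -(a * ((star a - a) / algebraMap F (Gau F) s)) := by ring
      rw [e, h4]
      exact (ha.mul (hb.sub ((isIntegral_gau_star ha).mul hζ1))).neg) hgi
    change (z * 1 - a * z) / algebraMap F (Gau F) s ∈ FId.pr z
    exact FId.mem_pr.2 ⟨_, h5.neg, by ring⟩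

end RealQuad
end

attribute [local simp] QuadraticAlgebra.re_one QuadraticAlgebra.im_one

instance : Fact (∀ x : ℚ, x ^ 2 ≠ -1 + 0 * x) :=
  ⟨fun x => by nlinarith [sq_nonneg x]⟩

lemma exists_int_of_gau_rat {x : Gau ℚ} (hx : IsIntegral ℤ x) : ∃ a b : ℤ, x = ⟨a, b⟩ := by
  have h1 := isIntegral_gau_trace hx
  have h2 := isIntegral_gau_trace (hx.mul isIntegral_gI.neg)
  have h3 := isIntegral_gau_norm hx
  have e2 : 2 * (x * -gI ℚ).re = 2 * x.im := by simp [gI]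
  rw [e2] at h2
  rw [gau_norm] at h3
  have hint : ∀ {q : ℚ}, IsIntegral ℤ q → ∃ n : ℤ, q = n := fun {q} hq =>
    isIntegral_ratCast_iff (k := ℚ).1 (by simpa using hq)
  obtain ⟨m, hm⟩ := hint h1
  obtain ⟨n, hn⟩ := hint h2
  obtain ⟨k, hk⟩ := hint h3
  have h4 : m ^ 2 + n ^ 2 = 4 * k := by
    have : (m ^ 2 + n ^ 2 : ℚ) = 4 * k := by rw [← hm, ← hn, ← hk]; ring
    exact_mod_cast this
  have h5 : 2 ∣ m ∧ 2 ∣ n := by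
    have h6 : (m ^ 2 + n ^ 2) % 4 = 0 := by omega
    rcases Int.even_or_odd m with ⟨a, rfl⟩ | ⟨a, rfl⟩ <;> rcases Int.even_or_odd n with ⟨b, rfl⟩ | ⟨b, rfl⟩ <;>
      ring_nf at h6 <;> omega
  obtain ⟨⟨a, rfl⟩, ⟨b, rfl⟩⟩ := h5
  refine ⟨a, b, ?_⟩
  push_cast at hm hn
  ext
  · simp; linarith
  · simp; linarith

lemma exists_pr_gau_rat (N : FId (Gau ℚ)) : ∃ g : Gau ℚ, N = FId.pr g := by
  let i : 𝓞 (Gau ℚ) := ⟨gI ℚ, isIntegral_gI⟩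
  have hi : i * i = ((-1 : ℤ) : 𝓞 (Gau ℚ)) := by
    apply RingOfIntegers.ext
    push_cast
    exact gI_mul_gI
  have : IsPrincipalIdealRing (𝓞 (Gau ℚ)) := by
    refine IsPrincipalIdealRing.of_surjective (Zsqrtd.lift ⟨i, hi⟩ : GaussianInt →+* 𝓞 (Gau ℚ)) fun x => ?_
    obtain ⟨a, b, h⟩ := exists_int_of_gau_rat x.2
    refine ⟨⟨a, b⟩, RingOfIntegers.ext ?_⟩
    rw [Zsqrtd.lift_apply_apply]
    push_cast
    refine Eq.trans (b := (a : Gau ℚ) + b * gI ℚ) rfl (Eq.trans ?_ h.symm)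
    ext <;> simp [gI]
  exact (FractionalIdeal.isPrincipal_iff N).1 inferInstance

section
variable {F : Type} [Field F] [NumberField F] [Fact (∀ x : F, x ^ 2 ≠ -1 + 0 * x)]
open Ham

/-- The inclusion of `ℚ(i)`. -/
def gauRat : Gau ℚ →+* Gau F where
  toFun x := ⟨x.re, x.im⟩
  map_one' := by ext <;> simp
  map_mul' x y := by ext <;> simp
  map_zero' := by ext <;> simp
  map_add' x y := by ext <;> simp

/-- The extension of an automorphism of `F` to `F(i)` mapping `i` to `-i`. -/
def tau (σ : F →+* F) : Gau F →+* Gau F where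
  toFun x := ⟨σ x.re, -σ x.im⟩
  map_one' := by ext <;> simp
  map_mul' x y := by ext <;> simp <;> ring
  map_zero' := by ext <;> simp
  map_add' x y := by ext <;> simp <;> ring

lemma tau_tau {σ : F →+* F} (hσ : ∀ x, σ (σ x) = x) (x : Gau F) : tau σ (tau σ x) = x := by
  ext <;> simp [tau, hσ]

lemma star_tau (σ : F →+* F) (x : Gau F) : star (tau σ x) = ⟨σ x.re, σ x.im⟩ := by
  ext <;> simp [tau]

lemma bar_eq_inv {𝔟 : FId (Gau F)} (h : 𝔟 * bar 𝔟 = 1) : bar 𝔟 = 𝔟⁻¹ := eq_inv_of_mul_eq_one_right h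

/-- The unitary ideal attached to an ideal of a subfield. -/
def jj {K : Type} [Field K] [NumberField K] (ι : K →+* Gau F) (I : FId K) : FId (Gau F) :=
  FId.map ι I / bar (FId.map ι I)

section
variable {K : Type} [Field K] [NumberField K] (ι : K →+* Gau F)

lemma jj_mul (I J : FId K) : jj ι (I * J) = jj ι I * jj ι J := by
  simp only [jj, map_mul, mul_div_mul_comm]

lemma jj_pow (I : FId K) (n : ℕ) : jj ι (I ^ n) = jj ι I ^ n := by
  simp only [jj, map_pow, div_pow]

lemma bar_ne_zero {𝔟 : FId (Gau F)} (h : 𝔟 ≠ 0) : bar 𝔟 ≠ 0 := FId.map_ne_zero _ h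

lemma jj_unitary {I : FId K} (hI : I ≠ 0) : jj ι I * bar (jj ι I) = 1 := by
  have h1 := FId.map_ne_zero ι hI
  have h2 := bar_ne_zero h1
  rw [jj, map_div₀, bar_bar, div_mul_div_comm, mul_comm (bar _), div_self (mul_ne_zero h1 h2)]

lemma jj_pr {a : K} (ha : a ≠ 0) : ∃ u : Gau F, u.norm = 1 ∧ jj ι (FId.pr a) = FId.pr u := by
  have h : ι a ≠ 0 := (map_ne_zero _).2 ha
  exact ⟨_, norm_div_star h, by rw [jj, FId.map_pr, bar_pr, FId.pr_div (star_ne_zero.2 h)]⟩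

end

namespace RealQuad
variable {p : ℕ} {r s : F} (H : RealQuad F p r s)
include H

lemma exists_gau_embedding {K : Type} [Field K] [NumberField K] {ρ : K} (hρ : ρ ^ 2 = -(p : K))
    (hgen : Algebra.adjoin ℚ {ρ} = ⊤) : ∃ (ι : K →+* Gau F) (σ : F →+* F) (c : K →+* K),
      (∀ x, σ (σ x) = x) ∧ (∀ x, σ x = x → ∃ q : ℚ, (q : F) = x) ∧
      (∀ x, c (c x) = x) ∧ (∀ x, c x = x → ∃ q : ℚ, (q : K) = x) ∧
      (∀ x, star (ι x) = ι (c x)) ∧ (∀ x, tau σ (ι x) = ι x) ∧ ∀ x, tau σ x = x → ∃ y, ι y = x := by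
  have hsq := imquad_not_isSquare H.prime
  have hFsq : ¬ IsSquare ((p : ℤ) : ℚ) := by simpa using not_isSquare_prime H.prime
  have hρ' : ρ ^ 2 = ((-p : ℤ) : K) := by simpa using hρ
  have hr' : r ^ 2 = ((p : ℤ) : F) := by simpa using H.sq
  have hρq : ρ ^ 2 = (((-p : ℤ) : ℚ) : K) := by simpa using hρ
  have hrq : r ^ 2 = (((p : ℤ) : ℚ) : F) := by simpa using H.sq
  obtain ⟨σ, hσ⟩ := quad_conj hr' hFsq H.gen
  obtain ⟨c, hc⟩ := quad_conj hρ' hsq hgen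
  have ht : (⟨0, r⟩ : Gau F) ^ 2 = (((-p : ℤ) : ℚ) : Gau F) := by
    have e : (((-p : ℤ) : ℚ) : Gau F) = algebraMap F (Gau F) (-p) := by simp
    rw [e, algebraMap_gau, ← H.sq, pow_two]
    ext <;> simp [pow_two]
  obtain ⟨ι, hι⟩ := quad_hom hρq hsq hgen ht
  have hι' : ∀ a b : ℚ, ι (a + b * ρ) = ⟨a, b * r⟩ := fun a b => by
    have e : ∀ q : ℚ, (q : Gau F) = algebraMap F (Gau F) q := fun q => by simp
    rw [hι, e, e, algebraMap_gau, algebraMap_gau]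
    ext <;> simp
  obtain ⟨h1, h2⟩ := quad_conj_inv hr' H.gen hσ
  obtain ⟨h3, h4⟩ := quad_conj_inv hρ' hgen hc
  have hσr : σ r = -r := by simpa using hσ 0 1
  refine ⟨ι, σ, c, h1, h2, h3, h4, fun x => ?_, fun x => ?_, fun x hx => ?_⟩
  · obtain ⟨a, b, rfl⟩ := quad_coords hρq hgen x
    have e := hι' a (-b)
    rw [hc, hι']
    push_cast at e
    rw [sub_eq_add_neg, ← neg_mul, e]
    ext <;> simp
  · obtain ⟨a, b, rfl⟩ := quad_coords hρq hgen x
    rw [hι']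
    ext <;> simp [tau, hσr]
  · have hre := congrArg QuadraticAlgebra.re hx
    have him := congrArg QuadraticAlgebra.im hx
    obtain ⟨a, ha⟩ := h2 x.re hre
    obtain ⟨d, b, hb⟩ := quad_coords hrq H.gen x.im
    have him' : -σ x.im = x.im := him
    rw [hb, hσ] at him'
    have hd : (d : F) = 0 := by linear_combination (-1 / 2) * him'
    refine ⟨a + b * ρ, ?_⟩
    rw [hι']
    ext
    · exact ha
    · rw [hb, hd, zero_add]

omit H in
/-- The square of a unitary ideal comes from `K` and `ℚ(i)`. -/
lemma exists_unitary_sq {K : Type} [Field K] [NumberField K] {ι : K →+* Gau F} {σ : F →+* F}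
    (hσ : ∀ x, σ (σ x) = x) (hfix : ∀ x, σ x = x → ∃ q : ℚ, (q : F) = x)
    (hι' : ∀ x, tau σ x = x → ∃ y, ι y = x)
    {𝔟 : FId (Gau F)} (h : 𝔟 * bar 𝔟 = 1) :
    ∃ (N : FId K) (g : Gau F), N ≠ 0 ∧ g ≠ 0 ∧ 𝔟 * 𝔟 = FId.map ι N * FId.pr g := by
  have h𝔟 : 𝔟 ≠ 0 := by rintro rfl; simp at h
  obtain ⟨N, hN, hN'⟩ := FId.exists_norm ι (tau σ) (tau_tau hσ) hι' h𝔟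

  have t1 : ∀ x, (starRingEnd (Gau F)).comp (tau σ) ((starRingEnd (Gau F)).comp (tau σ) x) = x := fun x => by
    change star (tau σ (star (tau σ x))) = x
    rw [star_tau, star_tau]
    ext <;> simp [hσ]
  have t3 : ∀ x, (starRingEnd (Gau F)).comp (tau σ) x = x → ∃ y, gauRat y = x := fun x hx => by
    change star (tau σ x) = x at hx
    rw [star_tau] at hx
    obtain ⟨a, ha⟩ := hfix x.re (congrArg QuadraticAlgebra.re hx)
    obtain ⟨b, hb⟩ := hfix x.im (congrArg QuadraticAlgebra.im hx)
    exact ⟨⟨a, b⟩, QuadraticAlgebra.ext ha hb⟩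
  obtain ⟨M, hM, hM'⟩ := FId.exists_norm (E := Gau ℚ) (gauRat : Gau ℚ →+* Gau F)
    ((starRingEnd (Gau F)).comp (tau σ)) t1 t3 h𝔟
  · obtain ⟨g, rfl⟩ := exists_pr_gau_rat M
    have hg : g ≠ 0 := FId.pr_ne_zero_iff.1 hM
    refine ⟨N, gauRat g, hN, (map_ne_zero _).2 hg, ?_⟩
    have ht : FId.map (tau σ) 𝔟 ≠ 0 := FId.map_ne_zero _ h𝔟
    have h2 : FId.map ((starRingEnd (Gau F)).comp (tau σ)) 𝔟 = bar (FId.map (tau σ) 𝔟) :=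
      (FId.map_map _ _ _).symm
    have h3 : FId.map (tau σ) 𝔟 * bar (FId.map (tau σ) 𝔟) = 1 := by
      have h4 : bar (FId.map (tau σ) 𝔟) = FId.map (tau σ) (bar 𝔟) := by
        have h5 : (starRingEnd (Gau F)).comp (tau σ) = (tau σ).comp (starRingEnd (Gau F)) :=
          RingHom.ext fun x => by
            change star (tau σ x) = tau σ (star x)
            rw [star_tau]
            ext <;> simp [tau]
        rw [bar, FId.map_map, FId.map_map, h5]
      rw [h4, ← map_mul, h, map_one]
    rw [← FId.map_pr, ← hN', ← hM', h2, bar_eq_inv h3]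
    calc 𝔟 * 𝔟 = 𝔟 * 𝔟 * (FId.map (tau σ) 𝔟 * (FId.map (tau σ) 𝔟)⁻¹) := by
          rw [mul_inv_cancel₀ ht, mul_one]
      _ = _ := by ring

/-- Representatives of the unitary ideals modulo principal ones, indexed by the class group of `ℚ(√-p)`. -/
theorem exists_unitary_reps {K : Type} [Field K] [NumberField K] {ρ : K} (hρ : ρ ^ 2 = -(p : K))
    (hgen : Algebra.adjoin ℚ {ρ} = ⊤) : ∃ β : ClassGroup (𝓞 K) → FId (Gau F),
      (∀ c, β c * bar (β c) = 1) ∧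
      (∀ 𝔟, 𝔟 * bar 𝔟 = 1 → ∃ c u, u.norm = 1 ∧ 𝔟 = FId.pr u * β c) ∧
      ∀ c c' u, u ≠ 0 → FId.pr u * β c = β c' → c = c' := by
  obtain ⟨ι, σ, c, hσ, hσf, hc, hcf, hstar, hι, hι'⟩ := H.exists_gau_embedding hρ hgen
  have hsurj : Function.Surjective (ClassGroup.mk (R := 𝓞 K) K) :=
    fun x => ClassGroup.induction K (fun I => ⟨I, rfl⟩) x
  choose rep hrep using hsurj
  have hker : ∀ I : (FId K)ˣ, ClassGroup.mk K I = 1 ↔ ∃ t, (I : FId K) = FId.pr t := fun I => by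
    rw [ClassGroup.mk_eq_one_iff, FractionalIdeal.isPrincipal_iff]
  have hprne : ∀ {I : (FId K)ˣ} {t : K}, (I : FId K) = FId.pr t → t ≠ 0 := fun {I t} h =>
    FId.pr_ne_zero_iff.1 (h ▸ I.ne_zero)
  have hsq : ∀ (I : (FId K)ˣ) (t : K), (I : FId K) * I = FId.pr t → ∃ t', (I : FId K) = FId.pr t' :=
    fun I t h => imquad_exists_pr_of_sq H.prime H.mod_four hρ hgen (hprne (I := I * I) (by simpa using h)) h
  have hinj : Function.Injective (fun x : ClassGroup (𝓞 K) => x ^ 4) := by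
    refine (injective_iff_map_eq_one (powMonoidHom 4 : ClassGroup (𝓞 K) →* ClassGroup (𝓞 K))).2 fun x hx => ?_
    rw [← hrep x, powMonoidHom_apply, ← map_pow, hker] at hx
    rw [← hrep x, hker]
    obtain ⟨t, ht⟩ := hx
    obtain ⟨t', ht'⟩ := hsq (rep x * rep x) t (by rw [← ht]; push_cast; ring)
    exact hsq _ t' (by rw [← ht']; push_cast; ring)
  have hpow := Finite.injective_iff_surjective.1 hinj
  have hβ : ∀ x, jj ι (rep x : FId K) * bar (jj ι (rep x : FId K)) = 1 := fun x => jj_unitary ι (rep x).ne_zero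
  have hβ0 : ∀ x, jj ι (rep x : FId K) ≠ 0 := fun x h => by simpa [h] using hβ x
  refine ⟨fun x => jj ι (rep x), hβ, fun 𝔟 h𝔟 => ?_, fun x y u hu hxy => ?_⟩
  · obtain ⟨N, g, hN, hg, hNg⟩ := exists_unitary_sq hσ hσf hι' h𝔟
    obtain ⟨x, hx⟩ := hpow (ClassGroup.mk K (Units.mk0 N hN))
    obtain ⟨a, ha⟩ := (hker (Units.mk0 N hN * (rep x ^ 4)⁻¹)).1 (by
      rw [map_mul, map_inv, map_pow, hrep]
      exact mul_inv_eq_one.2 hx.symm)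
    have ha0 := hprne ha
    have hN2 : N = FId.pr a * (rep x : FId K) ^ 4 := by
      rw [← ha]; push_cast
      rw [inv_mul_cancel_right₀ (pow_ne_zero 4 (rep x).ne_zero), Units.val_mk0]
    obtain ⟨v, hv, hv'⟩ := jj_pr ι ha0
    have h4 : 𝔟 ^ 4 = jj ι N * FId.pr (g / star g) := by
      have h5 : 𝔟 * 𝔟 / bar (𝔟 * 𝔟) = 𝔟 ^ 4 := by
        rw [map_mul, bar_eq_inv h𝔟, ← mul_inv, div_inv_eq_mul]; ring
      rw [← h5, hNg, map_mul, mul_div_mul_comm, bar_pr, jj, FId.pr_div (star_ne_zero.2 hg)]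
    have hd : (𝔟 * (jj ι (rep x : FId K))⁻¹) ^ 4 = FId.pr (v * (g / star g)) := by
      rw [mul_pow, h4, hN2, jj_mul, hv', jj_pow, FId.pr_mul]
      have := pow_ne_zero 4 (hβ0 x)
      rw [inv_pow]
      calc _ = FId.pr v * FId.pr (g / star g) *
            (jj ι (rep x : FId K) ^ 4 * (jj ι (rep x : FId K) ^ 4)⁻¹) := by ring
        _ = _ := by rw [mul_inv_cancel₀ this, mul_one]
    set 𝔡 := 𝔟 * (jj ι (rep x : FId K))⁻¹ with h𝔡
    have hdu : 𝔡 * bar 𝔡 = 1 := by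
      rw [h𝔡, map_mul, map_inv₀, mul_mul_mul_comm, h𝔟, ← mul_inv, hβ, inv_one, one_mul]
    obtain ⟨z, hz, hz'⟩ := H.exists_pr_of_unitary_sq (𝔟 := 𝔡 * 𝔡)
      (by rw [map_mul, mul_mul_mul_comm, hdu, one_mul])
      (v := v * (g / star g)) (by rw [map_mul, hv, norm_div_star hg, one_mul]) (by rw [← hd]; ring)
    obtain ⟨w, hw, hw'⟩ := H.exists_pr_of_unitary_sq hdu hz hz'
    exact ⟨x, w, hw, by rw [← hw', h𝔡, inv_mul_cancel_right₀ (hβ0 x)]⟩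
  · obtain ⟨q, hq, hq'⟩ := FId.exists_norm (algebraMap ℚ K) c hc hcf
      (I := (rep y * (rep x)⁻¹ : (FId K)ˣ)) (Units.ne_zero _)
    obtain ⟨q, rfl⟩ := FId.exists_pr_rat q
    set 𝔞 : (FId K)ˣ := rep y * (rep x)⁻¹ with h𝔞
    have ha0 : FId.map ι (𝔞 : FId K) ≠ 0 := FId.map_ne_zero ι 𝔞.ne_zero
    have e1 : jj ι (𝔞 : FId K) = FId.pr u := by
      have h1 : jj ι (𝔞 : FId K) * jj ι (rep x : FId K) = jj ι (rep y : FId K) := by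
        rw [← jj_mul, ← Units.val_mul, h𝔞, inv_mul_cancel_right]
      exact mul_right_cancel₀ (hβ0 x) (h1.trans hxy.symm)
    have e2 : bar (FId.map ι (𝔞 : FId K)) = FId.map ι (FId.map c (𝔞 : FId K)) := by
      have h5 : (starRingEnd (Gau F)).comp ι = ι.comp c := RingHom.ext hstar
      rw [bar, FId.map_map, FId.map_map, h5]
    have e3 : FId.map ι (𝔞 : FId K) * FId.map ι (𝔞 : FId K) = FId.pr (u * ι (algebraMap ℚ K q)) := by
      rw [jj, div_eq_iff (bar_ne_zero ha0), e2] at e1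
      nth_rw 1 [e1]
      rw [mul_assoc, ← map_mul, mul_comm (FId.map c _), hq', FId.map_pr, FId.map_pr, FId.pr_mul]
    set w := u * ι (algebraMap ℚ K q)
    have e4 : FId.map ι (𝔞 : FId K) * FId.map ι (𝔞 : FId K) = FId.pr (tau σ w) := by
      have h5 : (tau σ).comp ι = ι := RingHom.ext hι
      rw [← FId.map_pr, ← e3, map_mul, FId.map_map, h5]
    obtain ⟨m, hm⟩ := hι' (w * tau σ w) (by rw [map_mul, tau_tau hσ, mul_comm])
    have e5 : ((𝔞 * 𝔞 : (FId K)ˣ) : FId K) * (𝔞 * 𝔞 : (FId K)ˣ) = FId.pr m := by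
      refine FId.map_injective ι ?_
      rw [FId.map_pr, hm, FId.pr_mul, Units.val_mul, map_mul, map_mul]
      nth_rw 1 [e3]
      rw [e4]
    obtain ⟨m', hm'⟩ := hsq _ _ e5
    have h6 := (hker 𝔞).2 (hsq 𝔞 m' hm')
    rw [h𝔞, map_mul, map_inv, hrep, hrep] at h6
    exact (mul_inv_eq_one.1 h6).symm

end RealQuad
end

section
variable {F : Type} [Field F] [NumberField F] [Fact (∀ x : F, x ^ 2 ≠ -1 + 0 * x)]
open Ham

/-- Divisibility by `s` among the integers of `F(i)`. -/
def SDvd (s : F) (x : Gau F) : Prop := IsIntegral ℤ (x / algebraMap F (Gau F) s)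

namespace SDvd
variable {s : F} {x y a : Gau F}

lemma add (hx : SDvd s x) (hy : SDvd s y) : SDvd s (x + y) := by
  rw [SDvd, add_div]; exact IsIntegral.add hx hy

lemma sub (hx : SDvd s x) (hy : SDvd s y) : SDvd s (x - y) := by
  rw [SDvd, sub_div]; exact IsIntegral.sub hx hy

lemma mul (ha : IsIntegral ℤ a) (hx : SDvd s x) : SDvd s (a * x) := by
  rw [SDvd, mul_div_assoc]; exact IsIntegral.mul ha hx

lemma mul_mem {I : FId (Gau F)} (hx : SDvd s x) (hy : y ∈ I) : x * y / algebraMap F (Gau F) s ∈ I := by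
  rw [mul_div_right_comm]; exact FId.mul_mem hx hy

lemma coe {t : F} : SDvd s (algebraMap F (Gau F) t) ↔ IsIntegral ℤ (t / s) := by
  rw [SDvd, ← map_div₀, isIntegral_gau_algebraMap]

lemma one_add_norm : SDvd s (1 + y * star y) ↔ IsIntegral ℤ ((1 + y.norm) / s) := by
  rw [gau_mul_star, ← map_one (algebraMap F (Gau F)), ← map_add, coe]

end SDvd

namespace RealQuad
variable {p : ℕ} {r s : F} (H : RealQuad F p r s)
include H

lemma sDvd_two : SDvd s (2 : Gau F) := by
  rw [← map_ofNat (algebraMap F (Gau F)) 2, SDvd.coe]; exact H.isIntegral_two_div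

lemma not_sDvd_one : ¬ SDvd s (1 : Gau F) := by
  rw [← map_one (algebraMap F (Gau F)), SDvd.coe]; exact H.not_isIntegral_inv_s

lemma sDvd_intCast {n : ℤ} : SDvd s (n : Gau F) ↔ Even n := by
  refine ⟨fun h => ?_, ?_⟩
  · by_contra hn
    obtain ⟨k, rfl⟩ := Int.not_even_iff_odd.1 hn
    refine H.not_sDvd_one ?_
    have := h.sub (SDvd.mul (isIntegral_intCast k) H.sDvd_two)
    push_cast at this
    convert this using 1
    ring
  · rintro ⟨k, rfl⟩
    have := SDvd.mul (isIntegral_intCast k) H.sDvd_two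
    rw [mul_two] at this
    exact_mod_cast this

lemma sDvd_coords {u v : F} (h : SDvd s (algebraMap F (Gau F) u + algebraMap F _ v * H.om)) :
    IsIntegral ℤ (v / s) ∧ IsIntegral ℤ (u / s) := by
  have hs : star (algebraMap F (Gau F) s) = algebraMap F _ s := star_gau s
  have h1 : SDvd s (algebraMap F (Gau F) v) := by
    have h2 : SDvd s (star (algebraMap F (Gau F) u + algebraMap F _ v * H.om)) := by
      have := isIntegral_gau_star h
      rwa [star_div₀, hs] at this
    have h3 := SDvd.mul isIntegral_gI.neg (h.sub h2)
    convert h3 using 1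
    rw [star_add, star_mul', star_gau, star_gau]
    linear_combination (algebraMap F (Gau F) v * gI F) * H.om_sub_star + algebraMap F (Gau F) v * gI_mul_gI (F := F)
  refine ⟨SDvd.coe.1 h1, SDvd.coe.1 ?_⟩
  convert h.sub (SDvd.mul H.isIntegral_om h1) using 1
  ring

lemma sDvd_one_add_om_norm : SDvd s (1 + H.om * star H.om) ↔ p % 8 = 3 := by
  have h4 := H.mod_four
  obtain ⟨m, hm⟩ : ∃ m : ℕ, p = 4 * m + 3 := ⟨p / 4, by omega⟩
  have e : 1 + H.om * star H.om = ((m + 2 : ℤ) : Gau F) := by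
    rw [gau_mul_star, H.norm_om, ← map_one (algebraMap F (Gau F)), ← map_add, hm,
      ← map_intCast (algebraMap F (Gau F))]
    congr 1
    push_cast
    ring
  rw [e, H.sDvd_intCast, Int.even_add, iff_true_right even_two, Int.even_coe_nat, Nat.even_iff]
  omega

lemma sDvd_one_add_trace : SDvd s (1 + H.om + star H.om) := by
  have e : 1 + H.om + star H.om = algebraMap F (Gau F) (1 + r) := by
    rw [add_assoc, gau_add_star, map_add, map_one]
    congr 2
    simp only [om]
    ring
  rw [e, SDvd.coe]
  have hs := H.s_ne
  have e2 : (1 + r) / s = (r - 1) * s / 2 * (2 / s ^ 2) + 2 / s := by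
    field_simp
    ring
  rw [e2]
  exact (H.isIntegral_r_sub_one_mul.mul H.isIntegral_eps_inv).add H.isIntegral_two_div

lemma sDvd_one_add_one_add_om_norm : SDvd s (1 + (1 + H.om) * star (1 + H.om)) ↔ p % 8 = 3 := by
  rw [← H.sDvd_one_add_om_norm]
  have h := H.sDvd_one_add_trace
  constructor
  · intro h'
    convert h'.sub h using 1
    rw [star_add, star_one]; ring
  · intro h'
    convert h'.add h using 1
    rw [star_add, star_one]; ring

/-- Residues modulo `s` of norm congruent to `1`. -/
lemma exists_residues : ∃ (k : ℕ) (l : Fin k → Gau F), (k : ℤ) = 2 - @legendreSym p ⟨H.prime⟩ 2 ∧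
    (∀ i, IsIntegral ℤ (l i) ∧ SDvd s (1 + l i * star (l i))) ∧
    (∀ x, IsIntegral ℤ x → SDvd s (1 + x * star x) → ∃ i, SDvd s (x - l i)) ∧
    ∀ i j, SDvd s (l i - l j) → i = j := by
  have : Fact p.Prime := ⟨H.prime⟩
  have hp2 : p ≠ 2 := by have := H.five_lt; omega
  have h4 := H.mod_four
  have hleg : legendreSym p 2 = if p % 8 = 3 then -1 else 1 := by
    rw [legendreSym.at_two hp2, ZMod.χ₈_nat_eq_if_mod_eight, if_neg (by omega)]
    split_ifs <;> first | rfl | omega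
  have h1 : SDvd s (1 + 1 * star (1 : Gau F)) := by
    rw [star_one, one_mul, one_add_one_eq_two]; exact H.sDvd_two
  have hcase : ∀ x, IsIntegral ℤ x → SDvd s x ∨ SDvd s (x - 1) ∨ SDvd s (x - H.om) ∨ SDvd s (x - (1 + H.om)) := by
    intro x hx
    obtain ⟨u, v, hu, hv, rfl⟩ := H.exists_coords hx
    have key : ∀ {t : F}, IsIntegral ℤ ((t - 1) / s) → SDvd s (algebraMap F (Gau F) t - 1) := fun {t} ht => by
      rw [← map_one (algebraMap F (Gau F)), ← map_sub]; exact SDvd.coe.2 ht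
    rcases H.mod_s hu with hu | hu <;> rcases H.mod_s hv with hv | hv
    · exact Or.inl ((SDvd.coe.2 hu).add (by rw [mul_comm]; exact SDvd.mul H.isIntegral_om (SDvd.coe.2 hv)))
    · refine Or.inr (Or.inr (Or.inl ?_))
      convert (SDvd.coe.2 hu).add (SDvd.mul H.isIntegral_om (key hv)) using 1
      ring
    · refine Or.inr (Or.inl ?_)
      convert (key hu).add (SDvd.mul H.isIntegral_om (SDvd.coe.2 hv)) using 1
      ring
    · refine Or.inr (Or.inr (Or.inr ?_))
      convert (key hu).add (SDvd.mul H.isIntegral_om (key hv)) using 1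
      ring
  have hcongr : ∀ {x y : Gau F}, IsIntegral ℤ x → IsIntegral ℤ y → SDvd s (x - y) → SDvd s (1 + x * star x) →
      SDvd s (1 + y * star y) := fun {x y} hx hy h hN => by
    have h' : SDvd s (star (x - y)) := by
      have := isIntegral_gau_star h
      rwa [star_div₀, star_gau] at this
    rw [star_sub] at h'
    convert (hN.sub (SDvd.mul (isIntegral_gau_star hx) h)).sub (SDvd.mul hy h') using 1
    ring
  have h0 : ∀ {x : Gau F}, IsIntegral ℤ x → SDvd s x → ¬ SDvd s (1 + x * star x) := fun {x} hx h hN => by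
    have := hcongr hx isIntegral_zero (by rwa [sub_zero]) hN
    rw [zero_mul, add_zero] at this
    exact H.not_sDvd_one this
  by_cases h8 : p % 8 = 3
  · refine ⟨3, fun i => (![1, 0, 1] i : ℤ) + (![0, 1, 1] i : ℤ) * H.om,
      by rw [hleg, if_pos h8]; norm_num, fun i => ?_, fun x hx hN => ?_, fun i j h => ?_⟩
    · fin_cases i
      · simpa only [Fin.zero_eta, Matrix.cons_val, Int.cast_one, Int.cast_zero, zero_mul, add_zero] using
          ⟨isIntegral_one, h1⟩
      · simpa using ⟨H.isIntegral_om, H.sDvd_one_add_om_norm.2 h8⟩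
      · simpa only [Fin.reduceFinMk, Matrix.cons_val, Int.cast_one, one_mul] using
          ⟨isIntegral_one.add H.isIntegral_om, H.sDvd_one_add_one_add_om_norm.2 h8⟩
    · rcases hcase x hx with h | h | h | h
      · exact absurd hN (h0 hx h)
      · exact ⟨0, by simpa using h⟩
      · exact ⟨1, by simpa using h⟩
      · exact ⟨2, by simpa using h⟩
    · have key : ∀ u v : ℤ, SDvd s (u + v * H.om : Gau F) → Even v ∧ Even u := fun u v h => by
        have := H.sDvd_coords (u := u) (v := v) (by simpa using h)
        rwa [← SDvd.coe, ← SDvd.coe, map_intCast, map_intCast, H.sDvd_intCast, H.sDvd_intCast] at this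
      have h' := key (![1, 0, 1] i - ![1, 0, 1] j) (![0, 1, 1] i - ![0, 1, 1] j) (by
        convert h using 1
        push_cast
        ring)
      clear h
      revert i j
      decide
  · refine ⟨1, ![1], by rw [hleg, if_neg h8]; norm_num, fun i => ?_, fun x hx hN => ⟨0, ?_⟩,
      fun i j _ => Subsingleton.elim i j⟩
    · rw [Subsingleton.elim i 0]
      exact ⟨isIntegral_one, h1⟩
    · rcases hcase x hx with h | h | h | h
      · exact absurd hN (h0 hx h)
      · exact h
      · exact absurd (H.sDvd_one_add_om_norm.1 (hcongr hx H.isIntegral_om h hN)) h8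
      · exact absurd (H.sDvd_one_add_one_add_om_norm.1
          (hcongr hx (isIntegral_one.add H.isIntegral_om) h hN)) h8

/-- Every unitary ideal contains an element of norm congruent to `1` modulo `s`. -/
lemma exists_good_mem {𝔟 : FId (Gau F)} (h : 𝔟 * bar 𝔟 = 1) : ∃ y, Good s 𝔟 y := by
  have hint : ∀ x ∈ 𝔟, ∀ y ∈ 𝔟, IsIntegral ℤ (x * star y) := mul_bar_le_one_iff.1 h.le
  by_contra! hne
  have hN : ∀ x ∈ 𝔟, SDvd s (x * star x) := fun x hx => by
    have hx' := hint x hx x hx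
    rw [gau_mul_star, isIntegral_gau_algebraMap] at hx'
    rcases H.mod_s hx' with h1 | h1
    · rw [gau_mul_star]; exact SDvd.coe.2 h1
    · refine absurd ⟨hx, ?_⟩ (hne x)
      have e : (1 + x.norm) / s = (x.norm - 1) / s + 2 / s := by ring
      rw [e]
      exact h1.add H.isIntegral_two_div
  have htr : ∀ z ∈ 𝔟 * bar 𝔟, SDvd s (z + star z) := fun z hz => by
    refine FractionalIdeal.mul_induction_on hz (fun x hx y hy => ?_) fun x y hx hy => ?_
    · rw [mem_bar] at hy
      have := ((hN _ (FId.add_mem hx hy)).sub (hN _ hx)).sub (hN _ hy)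
      rw [star_add, star_star] at this
      rw [star_mul']
      convert this using 1
      ring
    · convert hx.add hy using 1
      rw [star_add]; ring
  have h1 := htr H.om (h ▸ FId.mem_one.2 H.isIntegral_om)
  refine H.not_sDvd_one ?_
  convert H.sDvd_one_add_trace.sub h1 using 1
  ring

/-- Representatives of the equivalence classes of data. -/
theorem exists_data_reps {K : Type} [Field K] [NumberField K] {ρ : K} (hρ : ρ ^ 2 = -(p : K))
    (hgen : Algebra.adjoin ℚ {ρ} = ⊤) :
    ∃ (S : Type) (_ : Fintype S) (D : S → FId (Gau F) × Option (Gau F)),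
      (Fintype.card S : ℤ) = (3 - @legendreSym p ⟨H.prime⟩ 2) * classNumber K ∧
      (∀ i, Dat s (D i).1 (D i).2) ∧ (∀ E : FId (Gau F) × Option (Gau F), Dat s E.1 E.2 → ∃ i, AEq s (D i) E) ∧
      ∀ i j, AEq s (D i) (D j) → i = j := by
  obtain ⟨β, hβ, hβs, hβi⟩ := H.exists_unitary_reps hρ hgen
  obtain ⟨k, l, hk, hl, hls, hli⟩ := H.exists_residues
  choose y hy using fun c => H.exists_good_mem (hβ c)
  have hyN : ∀ c, SDvd s (1 + y c * star (y c)) := fun c => SDvd.one_add_norm.2 (hy c).int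
  have hint : ∀ c, ∀ z ∈ β c, IsIntegral ℤ (z * star (y c)) := fun c z hz =>
    mul_bar_le_one_iff.1 (hβ c).le z hz _ (hy c).mem
  refine ⟨ClassGroup (𝓞 K) × Option (Fin k), inferInstance, fun i => (β i.1, i.2.map fun j => l j * y i.1),
    ?_, fun i => ⟨hβ _, ?_⟩, ?_, ?_⟩
  · rw [Fintype.card_prod, Fintype.card_option, Fintype.card_fin]
    push_cast
    rw [hk, classNumber]
    ring
  · rintro z hz
    obtain ⟨j, -, rfl⟩ := Option.map_eq_some_iff.1 hz
    refine ⟨FId.mul_mem (hl j).1 (hy _).mem, SDvd.one_add_norm.1 ?_⟩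
    have h1 := SDvd.mul ((hl j).1.mul (isIntegral_gau_star (hl j).1)) (hyN i.1)
    convert (H.sDvd_two.add h1).sub (hl j).2 using 1
    rw [star_mul']
    ring
  · rintro ⟨𝔟, o⟩ hE
    obtain ⟨c, u, hu, rfl⟩ := hβs 𝔟 hE.unit
    have hu0 := ne_zero_of_norm hu
    rcases o with _ | x
    · exact ⟨(c, none), u, hu, rfl, trivial⟩
    · have hx := hE.good x rfl
      obtain ⟨z, hz, rfl⟩ := FId.mem_pr_mul.1 hx.mem
      have hzN : SDvd s (1 + z * star z) := SDvd.one_add_norm.2 (by simpa [hu] using hx.int)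
      obtain ⟨i, hi⟩ := hls (z * star (y c)) (hint c z hz) (by
        have h1 := SDvd.mul (mul_bar_le_one_iff.1 (hβ c).le z hz z hz) (hyN c)
        convert (H.sDvd_two.add h1).sub hzN using 1
        rw [star_mul', star_star]
        ring)
      refine ⟨(c, some i), u, hu, rfl, ?_⟩
      change (u * (l i * y c) - u * z) / algebraMap F (Gau F) s ∈ FId.pr u * β c
      have h1 := FId.neg_mem (hi.mul_mem (hy c).mem)
      have h2 := FId.sub_mem ((hyN c).mul_mem hz) (H.sDvd_two.mul_mem hz)
      have h3 := (mul_mem_pr_mul hu0).2 (FId.add_mem h1 h2)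
      convert h3 using 1
      ring
  · rintro ⟨c, o⟩ ⟨c', o'⟩ ⟨v, hv, h1, h2⟩
    have hv0 := ne_zero_of_norm hv
    obtain rfl := hβi c c' v hv0 h1.symm
    refine Prod.ext rfl ?_
    rcases o with _ | i <;> rcases o' with _ | j
    · rfl
    · exact h2.elim
    · exact h2.elim
    · have h3 : FId.pr v = 1 := mul_right_cancel₀ (unit_ne_zero (hβ c)) (h1.symm.trans (one_mul _).symm)
      have hvi := ((FId.pr_eq_one hv0).1 h3).1
      have hv1 : SDvd s (v - 1) := H.norm_one_sub_one hvi hv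
      have h4 : (v * (l i * y c) - l j * y c) / algebraMap F (Gau F) s ∈ β c := h2
      have h5 : SDvd s ((v * l i - l j) * (y c * star (y c))) := by
        have := hint c _ h4
        rw [SDvd]
        convert this using 1
        ring
      refine congrArg some (hli i j ?_)
      have h6 := SDvd.mul ((hvi.mul (hl i).1).sub (hl j).1) (hyN c)
      convert (h6.sub h5).sub (SDvd.mul (hl i).1 hv1) using 1
      ring

end RealQuad
end

lemma card_eq_two_mul_card {N Q : Type*} [Finite N] {f : N → Q} (hf : Function.Surjective f) (c : N → N)
    (hc : ∀ i, c i ≠ i) (h : ∀ i j, f i = f j ↔ i = j ∨ c i = j) : Nat.card N = 2 * Nat.card Q := by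
  classical
  have := Fintype.ofFinite N
  have := Finite.of_surjective f hf
  have := Fintype.ofFinite Q
  rw [Nat.card_eq_fintype_card, Nat.card_eq_fintype_card, ← Finset.card_univ,
    Finset.card_eq_sum_card_fiberwise (f := f) (t := Finset.univ) (fun _ _ => by simp), ← Finset.card_univ, mul_comm]
  refine Finset.sum_const_nat fun q _ => ?_
  obtain ⟨i, rfl⟩ := hf q
  rw [Finset.card_eq_two]
  refine ⟨i, c i, (hc i).symm, ?_⟩
  ext j
  simp only [Finset.mem_filter, Finset.mem_univ, true_and, Finset.mem_insert, Finset.mem_singleton]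
  rw [eq_comm, h, eq_comm (a := i), eq_comm (a := c i)]

section
variable {F : Type} [Field F] [NumberField F] [Fact (∀ x : F, x ^ 2 ≠ -1 + 0 * x)]
open Ham

namespace RealQuad
variable {p : ℕ} {r s : F} (H : RealQuad F p r s)
include H

lemma not_aEq_none_one : ¬ AEq s ((1 : FId (Gau F)), none) (1, some 1) := fun ⟨_, _, _, h⟩ => h

theorem two_mul_typeNum {K : Type} [Field K] [NumberField K] {ρ : K} (hρ : ρ ^ 2 = -(p : K))
    (hgen : Algebra.adjoin ℚ {ρ} = ⊤) :
    2 * (typeNum F (Ham F) (Multiplicative (ZMod 4)) : ℤ) =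
      (3 - @legendreSym p ⟨H.prime⟩ 2) * (classNumber K : ℤ) - 2 := by
  classical
  obtain ⟨S, _, D, hcard, hD, hsurj, hinj⟩ := H.exists_data_reps hρ hgen
  have huniq : ∀ {E : FId (Gau F) × Option (Gau F)} {i j}, AEq s (D i) E → AEq s (D j) E → i = j :=
    fun h h' => hinj _ _ (h.trans h'.symm)
  let P : S → Prop := fun i => Special (ordX s (D i).1 (D i).2)
  obtain ⟨i₀, hi₀⟩ := hsurj (1, none) dat_none
  obtain ⟨i₁, hi₁⟩ := hsurj (1, some 1) H.dat_one
  have hP : ∀ i, P i ↔ i = i₀ ∨ i = i₁ := fun i => by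
    refine (H.special_iff (hD i)).trans (or_congr ⟨fun h => ?_, ?_⟩ ⟨fun h => ?_, ?_⟩)
    · exact huniq h.symm hi₀
    · rintro rfl; exact hi₀.symm
    · exact huniq h.symm hi₁
    · rintro rfl; exact hi₁.symm
  have hne : i₀ ≠ i₁ := by
    rintro rfl
    exact H.not_aEq_none_one (hi₀.symm.trans hi₁)
  have hN : Nat.card {i // ¬ P i} + 2 = Fintype.card S := by
    have h2 : Fintype.card {i // P i} = 2 := by
      rw [Fintype.card_subtype, ← Finset.card_pair hne]
      congr 1
      ext i
      simp [hP]
    have := Fintype.card_subtype_le P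
    rw [Nat.card_eq_fintype_card, Fintype.card_subtype_compl]
    omega
  choose conj hconj using fun i => hsurj (cc (D i)) (hD i).cc
  have hconjP : ∀ i, ¬ P i → ¬ P (conj i) := fun i hi h => hi <| by
    have := H.special_cc (hD i).cc (H.special_of_aEq (hD _) (hconj i) h)
    rwa [cc_cc] at this
  have hη : ∀ i, qm H.eta 0 ∈ ordX s (D i).1 (D i).2 := fun i => H.eta_mem_ordX (hD i)
  have hmax := fun i => H.ordX_isMaximalOrder (hD i)
  let C := {O : Subring (Ham F) // IsMaximalOrder F O ∧ RedUnitIso F O (Multiplicative (ZMod 4))}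
  let R : C → C → Prop := fun O O' => ConjRel O.1 O'.1
  have hR : Equivalence R := ⟨fun O => ConjRel.refl _, ConjRel.symm, ConjRel.trans⟩
  let f : {i // ¬ P i} → Quot R := fun i => Quot.mk R
    ⟨ordX s (D i).1 (D i).2, hmax i, H.redUnitIso_of_not_special (hmax i).1 (hη i) i.2⟩
  have hf : ∀ i j, f i = f j ↔ i = j ∨ (⟨conj i, hconjP i i.2⟩ : {i // ¬ P i}) = j := fun i j => by
    have h1 : f i = f j ↔ ConjRel (ordX s (D i).1 (D i).2) (ordX s (D j).1 (D j).2) :=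
      ⟨fun h => (hR.eqvGen_iff).1 (Quot.eqvGen_exact h), fun h => Quot.sound h⟩
    rw [h1, H.conjRel_iff (hD i) (hD j) j.2, Subtype.ext_iff, Subtype.ext_iff]
    refine or_congr ⟨hinj _ _, fun h => h ▸ AEq.refl _ _⟩ ⟨fun h => hinj _ _ ((hconj i).trans h), fun h => ?_⟩
    rw [← show conj i = j from h]
    exact (hconj i).symm
  have hfs : Function.Surjective f := by
    rintro ⟨O, hO, hO4⟩
    obtain ⟨x, hx⟩ := H.exists_conj_eta hO.1 hO4
    have hO' := isMaximalOrder_mapO (conjE F x) hO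
    obtain ⟨𝔟, o, hE, he⟩ := H.exists_eq_ordX hO' hx
    have hs : ¬ Special (ordX s 𝔟 o) := fun h =>
      H.not_redUnitIso_of_special hO'.1 hx (he ▸ h) (redUnitIso_mapO _ hO4)
    obtain ⟨i, hi⟩ := hsurj (𝔟, o) hE
    refine ⟨⟨i, fun h => hs (H.special_of_aEq (hD i) hi h)⟩, Quot.sound ?_⟩
    have h1 : ConjRel (ordX s (D i).1 (D i).2) (ordX s 𝔟 o) := (H.conjRel_iff (hD i) hE hs).2 (Or.inl hi)
    exact h1.trans (he ▸ ConjRel.symm ⟨x, isConjugate_conjE F x O⟩)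
  have h2 := card_eq_two_mul_card hfs (fun i => ⟨conj i, hconjP i i.2⟩)
    (fun i h => i.2 (H.special_of_cc (hD i) (by
      have h3 := (hconj i).symm
      rwa [show conj i = i from congrArg Subtype.val h] at h3))) hf
  have h3 : typeNum F (Ham F) (Multiplicative (ZMod 4)) = Nat.card (Quot R) := rfl
  rw [h3, ← hcard, ← hN, h2]
  push_cast
  ring

end RealQuad
end

variable (F : Type) [Field F] [NumberField F]

/-- **`t(C₄)` for `F = ℚ(√p)`, `p ≡ 3 (mod 4)`, `p > 5`, `H = H_{∞₁,∞₂}`.** -/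
theorem typeNum_C4_p3mod4
    (p : ℕ) (hp : p.Prime) (hp5 : 5 < p) (hp4 : p % 4 = 3)
    (sqrtp : F) (hsqrtp : sqrtp ^ 2 = (p : F))
    (hgen : Algebra.adjoin ℚ {sqrtp} = ⊤)
    -- `H = ℍ[F, A, B]` is a totally definite quaternion `F`-algebra (every totally
    -- definite quaternion algebra admits such a presentation) ...
    (A B : F) (hdef : ∀ σ : F →+* ℝ, σ A < 0 ∧ σ B < 0)
    -- ... unramified at every finite place of `F`
    (hunram : ∀ v : IsDedekindDomain.HeightOneSpectrum (𝓞 F),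
      Nonempty
        (ℍ[v.adicCompletion F, algebraMap F (v.adicCompletion F) A,
            algebraMap F (v.adicCompletion F) B] ≃ₐ[v.adicCompletion F]
          Matrix (Fin 2) (Fin 2) (v.adicCompletion F)))
    -- `K = ℚ(√−p)`
    (K : Type) [Field K] [NumberField K]
    (sqrtmp : K) (hsqrtmp : sqrtmp ^ 2 = -(p : K))
    (hgenK : Algebra.adjoin ℚ {sqrtmp} = ⊤) :
    -- `t(C₄) = (3 − (2/p))·h(−p)/2 − 1`
    2 * (typeNum F ℍ[F, A, B] (Multiplicative (ZMod 4)) : ℤ) =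
      (3 - @legendreSym p ⟨hp⟩ 2) * (classNumber K : ℤ) - 2 := by
  obtain ⟨f⟩ := sim_hamilton hp hp4 hsqrtp hgen hdef hunram
  obtain ⟨a, b, hab⟩ := exists_pell_two hp hp4
  have H : RealQuad F p sqrtp (a + b * sqrtp) := ⟨hp, hp4, hp5, hsqrtp, hgen, a, b, rfl, hab⟩
  have := H.fact
  rw [← typeNum_congr f]
  exact H.two_mul_typeNum hsqrtmp hgenK

end QuatPaper
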